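/- Assume μ_X is a Borel probability measure on X invariant under left translation by every element of G. Then the following are equivalent: (1) the averages A_T get equidistributed in X as T → ∞, i.e. ∫ f dA_T → ∫ f dμ_X for every continuous compactly supported f : X → ℝ; (2) the family {A_T}_{T>0} has no escape of mass, i.e. for every ε > 0 there is a compact set K ⊆ X with A_T(K) > 1−ε for all T > 0; (3) (a,b) ∉ W₂′. -/

import Mathlib

open MeasureTheory Matrix Filter Topology ENNReal

noncomputable section

/-- `G = SL(3,ℝ)`. -/
abbrev G : Type := Matrix.SpecialLinearGroup (Fin 3) ℝ

instance : TopologicalSpace G :=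
  TopologicalSpace.induced (fun g : G => (g : Matrix (Fin 3) (Fin 3) ℝ)) inferInstance

/-- `Γ = SL(3,ℤ)`, viewed as a (discrete) subgroup of `G`. -/
def Gamma : Subgroup G := (Matrix.SpecialLinearGroup.map (n := Fin 3) (Int.castRingHom ℝ)).range

/-- `X = G/Γ` with the quotient topology. -/
abbrev X : Type := G ⧸ Gamma

instance : MeasurableSpace X := borel X

/-- `x₀ = eΓ ∈ X`. -/
def x₀ : X := ↑(1 : G)

/-- `g_t = diag(e^{2t}, e^{-t}, e^{-t})`. -/
def gSL (t : ℝ) : G :=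
  ⟨Matrix.diagonal ![Real.exp (2*t), Real.exp (-t), Real.exp (-t)], by
    rw [Matrix.det_diagonal, Fin.prod_univ_three]
    simp [← Real.exp_add]
    ring_nf⟩

/-- `φ_{a,b}(s)`, the unipotent matrix with first row `(1, s, as+b)`. -/
def phiSL (a b s : ℝ) : G :=
  ⟨!![1, s, a*s+b; 0, 1, 0; 0, 0, 1], by
    simp [Matrix.det_fin_three, Matrix.vecHead, Matrix.vecTail]⟩

/-- `λ_{a,b}` : the push-forward of the normalized Lebesgue measure on `I = [s₁,s₂]`
under `s ↦ φ_{a,b}(s)·x₀`. -/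
def lambdaAB (a b s₁ s₂ : ℝ) : Measure X :=
  Measure.map (fun s => phiSL a b s • x₀)
    ((volume (Set.Icc s₁ s₂))⁻¹ • volume.restrict (Set.Icc s₁ s₂))

/-- `g_t λ_{a,b}` : the translate of `λ_{a,b}` by `g_t`. -/
def gtLambda (a b s₁ s₂ t : ℝ) : Measure X :=
  Measure.map (fun x => gSL t • x) (lambdaAB a b s₁ s₂)

/-- `A_T` : the average `(1/T)∫₀ᵀ (g_t λ_{a,b}) dt` of the translates, as a Borel
measure on `X` (so `A_T(E) = (1/T)∫₀ᵀ (g_t λ_{a,b})(E) dt`). -/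
def avgMeasure (a b s₁ s₂ T : ℝ) : Measure X :=
  ((ENNReal.ofReal T)⁻¹ • volume.restrict (Set.Ioc (0:ℝ) T)).bind
    (fun t => gtLambda a b s₁ s₂ t)

/-- `(a,b) ∈ W₂′` : there exists `ε > 0` such that the system
`|qb+p₁| ≤ q^{-(2+ε)}`, `|qa+p₂| ≤ q^{-(2+ε)}` has infinitely many solutions
`(p₁,p₂,q) ∈ ℤ × ℤ × ℤ₊`. -/
def W2' (a b : ℝ) : Prop :=
  ∃ ε > (0:ℝ), {x : ℤ × ℤ × ℤ | 0 < x.2.2 ∧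
    |(x.2.2 : ℝ) * b + (x.1 : ℝ)| ≤ (x.2.2 : ℝ) ^ (-(2 + ε) : ℝ) ∧
    |(x.2.2 : ℝ) * a + (x.2.1 : ℝ)| ≤ (x.2.2 : ℝ) ^ (-(2 + ε) : ℝ)}.Infinite

open Set (Icc Ioc mem_iUnion indicator_of_mem indicator_of_notMem mem_ofPred_eq finite_Icc mem_iInter inter_subset_left)
open Real (exp exp_pos exp_add exp_le_exp exp_log exp_neg norm_eq_abs norm_of_nonneg exp_lt_exp exp_nat_mul volume_Icc)
local notation "M₃" => Matrix (Fin 3) (Fin 3) ℝ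
local notation "ofR" => ENNReal.ofReal
local notation "𝕀" => Icc (0 : ℝ) 1
variable {ν : Measure X} [IsProbabilityMeasure ν]

/-! ### The topological group `SL(3,ℝ)` and its quotient by `SL(3,ℤ)` -/

instance : IsTopologicalGroup G where
  continuous_inv := continuous_induced_rng.mpr continuous_induced_dom.matrix_adjugate
  continuous_mul := continuous_induced_rng.mpr <|
    (continuous_induced_dom.comp continuous_fst).mul (continuous_induced_dom.comp continuous_snd)

lemma isClosedEmbedding_coe : IsClosedEmbedding (fun g : G => (g : M₃)) :=
  Matrix.SpecialLinearGroup.isClosedEmbedding_val (n := Fin 3) (R := ℝ)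

instance : T2Space G := isClosedEmbedding_coe.isEmbedding.t2Space

instance : LocallyCompactSpace M₃ :=
  inferInstanceAs (LocallyCompactSpace (Fin 3 → Fin 3 → ℝ))

instance : SecondCountableTopology M₃ :=
  inferInstanceAs (SecondCountableTopology (Fin 3 → Fin 3 → ℝ))

instance : LocallyCompactSpace G := isClosedEmbedding_coe.locallyCompactSpace

instance : SecondCountableTopology G := isClosedEmbedding_coe.isEmbedding.secondCountableTopology

lemma continuous_entry (i j : Fin 3) : Continuous (fun g : G => g i j) :=
  (continuous_apply_apply i j).comp isClosedEmbedding_coe.continuous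

lemma continuous_of_entries {α : Type*} [TopologicalSpace α] {F : α → G}
    (h : ∀ i j, Continuous fun a => F a i j) : Continuous F :=
  isClosedEmbedding_coe.isInducing.continuous_iff.2 (continuous_matrix h)

lemma tendsto_of_entries {α : Type*} {l : Filter α} {F : α → G} {g : G} (h : ∀ i j, Tendsto (fun a => F a i j) l
      (𝓝 (g i j))) : Tendsto F l (𝓝 g) := by
  rw [isClosedEmbedding_coe.isInducing.tendsto_nhds_iff]
  exact tendsto_pi_nhds.2 fun i => tendsto_pi_nhds.2 fun j => h i j

instance : MeasurableSpace G := borel G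

instance : BorelSpace G := ⟨rfl⟩

instance : BorelSpace X := ⟨rfl⟩

lemma isClosedEmbedding_map : IsClosedEmbedding (Matrix.SpecialLinearGroup.map (n := Fin 3) (Int.castRingHom ℝ)) :=
  .specialLinearGroup_map Int.isClosedEmbedding_coe_real

lemma isClosed_Gamma : IsClosed (Gamma : Set G) := isClosedEmbedding_map.isClosed_range

/-- A compact subset of `SL(3,ℝ)` contains only finitely many elements of `SL(3,ℤ)`. -/
lemma finite_inter_Gamma {C : Set G} (hC : IsCompact C) : (C ∩ (Gamma : Set G)).Finite := by
  refine ((isClosedEmbedding_map.isCompact_preimage hC).finite_of_discrete.image (Matrix.SpecialLinearGroup.map (Int.castRingHom ℝ))).subset ?_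
  rintro _ ⟨hx, y, rfl⟩
  exact ⟨y, hx, rfl⟩

instance : T2Space X := by
  rw [t2Space_iff_of_isOpenQuotientMap (QuotientGroup.isOpenQuotientMap_mk (N := Gamma))]
  have : {q : G × G | (QuotientGroup.mk q.1 : X) = QuotientGroup.mk q.2} =
      (fun q : G × G => q.1⁻¹ * q.2) ⁻¹' (Gamma : Set G) := by
    ext q; simp [QuotientGroup.eq]
  rw [this]; exact isClosed_Gamma.preimage (by fun_prop)

instance : TopologicalSpace.MetrizableSpace X :=
  TopologicalSpace.metrizableSpace_of_t3_secondCountable X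

lemma continuous_mkX : Continuous (fun g : G => (g : X)) := QuotientGroup.continuous_mk

lemma smul_mk (g h : G) : g • (h : X) = ((g * h : G) : X) := rfl

lemma exists_rep (x : X) : ∃ g : G, (g : X) = x := QuotientGroup.mk_surjective x

lemma mk_eq_mk {g h : G} : (g : X) = (h : X) ↔ g⁻¹ * h ∈ Gamma := QuotientGroup.eq

/-- Compact subsets of the quotient lift to compact subsets of the group. -/
lemma exists_compact_lift {K : Set X} (hK : IsCompact K) :
    ∃ C : Set G, IsCompact C ∧ K ⊆ (fun g : G => (g : X)) '' C := by
  choose g hg using fun x : X => exists_rep x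
  choose C hC hCn using fun x : X => exists_compact_mem_nhds (g x)
  obtain ⟨t, -, ht⟩ := hK.elim_nhds_subcover (fun x => (fun g : G => (g : X)) '' (C x)) (fun x _ => by
    have := QuotientGroup.isOpenMap_coe (N := Gamma) |>.image_mem_nhds (hCn x)
    rwa [hg] at this)
  refine ⟨⋃ x ∈ t, C x, t.isCompact_biUnion fun x _ => hC x, ht.trans ?_⟩; intro y hy; simp only [mem_iUnion] at hy
  obtain ⟨x, hx, c, hc, rfl⟩ := hy; exact ⟨c, by simp only [mem_iUnion]; exact ⟨x, hx, hc⟩, rfl⟩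

/-- The image of a closed subset of the group is Borel in the quotient. -/
lemma measurableSet_image_mk {C : Set G} (hC : IsClosed C) : MeasurableSet ((fun g : G => (g : X)) '' C) := by
  have h : (fun g : G => (g : X)) '' C = ⋃ n, (fun g : G => (g : X)) '' (C ∩ compactCovering G n) := by
    rw [← Set.image_iUnion, ← Set.inter_iUnion, iUnion_compactCovering, Set.inter_univ]
  rw [h]; refine MeasurableSet.iUnion fun n => ?_
  exact (((isCompact_compactCovering G n).inter_left hC).image continuous_mkX).isClosed.measurableSet

lemma StandardBorelSpace.of_measurableEquiv {α β : Type*} [MeasurableSpace α] [MeasurableSpace β]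
    [hβ : StandardBorelSpace β] (e : α ≃ᵐ β) : StandardBorelSpace α := by
  obtain ⟨τ, hB, hP⟩ := hβ.polish
  let _ : TopologicalSpace α := τ.induced e
  have hind : IsInducing e := ⟨rfl⟩; refine ⟨⟨inferInstance, ⟨?_⟩, ?_⟩⟩
  · rw [borel_comap, ← hB.measurable_eq]; exact e.measurableEmbedding.comap_eq.symm
  · exact (e.toEquiv.toHomeomorphOfIsInducing hind).isClosedEmbedding.polishSpace

instance : StandardBorelSpace X := by
  let _ := TopologicalSpace.metrizableSpaceMetric X
  let _ : MeasurableSpace (UniformSpace.Completion X) := borel _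
  have _ : BorelSpace (UniformSpace.Completion X) := ⟨rfl⟩
  have hemb : IsEmbedding (fun x : X => (x : UniformSpace.Completion X)) :=
    UniformSpace.Completion.isUniformEmbedding_coe X |>.isEmbedding
  have hr : MeasurableSet (Set.range (fun x : X => (x : UniformSpace.Completion X))) := by
    rw [← Set.image_univ, ← iUnion_compactCovering X, Set.image_iUnion]
    exact MeasurableSet.iUnion fun n =>
      ((isCompact_compactCovering X n).image hemb.continuous).isClosed.measurableSet
  have := hr.standardBorel; exact StandardBorelSpace.of_measurableEquiv (hemb.measurableEmbedding hr).equivRange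

/-! ### Neighbourhoods of the identity -/

/-- The elements of `SL(3,ℝ)` whose entries are within `θ` of those of the identity. -/
def nearOne (θ : ℝ) : Set G := {h | ∀ i j, |h i j - (1 : M₃) i j| ≤ θ}

lemma nearOne_mono {θ θ' : ℝ} (h : θ ≤ θ') : nearOne θ ⊆ nearOne θ' := fun _ hg i j => (hg i j).trans h

lemma one_mem_nearOne {θ : ℝ} (h : 0 ≤ θ) : (1 : G) ∈ nearOne θ := fun i j => by simpa using h

lemma nearOne_mem_nhds {θ : ℝ} (hθ : 0 < θ) : nearOne θ ∈ 𝓝 (1 : G) := by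
  refine eventually_all.2 fun i => eventually_all.2 fun j => ?_
  exact (((continuous_entry i j).sub continuous_const).abs.continuousAt.eventually_lt continuousAt_const
    (by simpa using hθ)).mono fun _ => le_of_lt

lemma exists_nearOne_subset {s : Set G} (hs : s ∈ 𝓝 (1 : G)) : ∃ θ > 0, nearOne θ ⊆ s := by
  by_contra hcon; push Not at hcon
  choose! f hf using fun n : ℕ => Set.not_subset.1 (hcon (1 / ((n : ℝ) + 1)) (by positivity))
  have : Tendsto f atTop (𝓝 1) := by
    refine tendsto_of_entries fun i j => ?_; rw [tendsto_iff_dist_tendsto_zero]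
    exact squeeze_zero (fun _ => dist_nonneg) (fun n => (hf n).1 i j) tendsto_one_div_add_atTop_nhds_zero_nat
  obtain ⟨n, hn⟩ := (this.eventually hs).exists; exact (hf n).2 hn

lemma isClosed_nearOne (θ : ℝ) : IsClosed (nearOne θ) := by
  simp only [nearOne, Set.ofPred_forall]
  exact isClosed_iInter fun i => isClosed_iInter fun j =>
    isClosed_le (((continuous_entry i j).sub continuous_const).abs) continuous_const

/-- Sets of matrices with bounded entries are compact. -/
lemma isCompact_bounded (R : ℝ) : IsCompact {g : G | ∀ i j, |g i j| ≤ R} := by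
  have h : IsCompact (Set.univ.pi fun _ : Fin 3 => Set.univ.pi fun _ : Fin 3 => Icc (-R) R) :=
    isCompact_univ_pi fun _ => isCompact_univ_pi fun _ => isCompact_Icc
  have h2 := isClosedEmbedding_coe.isCompact_preimage h
  refine h2.of_isClosed_subset ?_ fun g hg i _ j _ => abs_le.1 (hg i j); simp only [Set.ofPred_forall]
  exact isClosed_iInter fun i => isClosed_iInter fun j =>
    isClosed_le (continuous_entry i j).abs continuous_const

lemma isCompact_nearOne (θ : ℝ) : IsCompact (nearOne θ) := by
  refine (isCompact_bounded (θ + 1)).of_isClosed_subset (isClosed_nearOne θ) fun g hg i j => ?_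
  have h2 : |(1 : M₃) i j| ≤ 1 := by rw [Matrix.one_apply]; split_ifs <;> simp
  linarith [hg i j, abs_sub_abs_le_abs_sub (g i j) ((1 : M₃) i j)]

/-! ### Uniformly continuous functions on the quotient -/

/-- Functions on `X` that vary little under elements close to the identity. -/
def UnifCont (F : X → ℝ) : Prop := ∀ ε > 0, ∃ θ > 0, ∀ h ∈ nearOne θ, ∀ x, |F (h • x) - F x| ≤ ε

lemma UnifCont.of_compactSupport {f : X → ℝ} (hf : Continuous f) (hc : HasCompactSupport f) : UnifCont f := by
  intro ε hε; obtain ⟨C, hC, hC1⟩ := exists_compact_mem_nhds (1 : G)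
  set K : Set X := (fun p : G × X => p.1 • p.2) '' ((C⁻¹ : Set G) ×ˢ tsupport f)
  have hK : IsCompact K := (hC.inv.prod hc.isCompact).image (by fun_prop)
  have hK' : IsCompact (K ∪ tsupport f) := hK.union hc.isCompact
  have hev : ∀ᶠ h : G in 𝓝 1, ∀ x ∈ K ∪ tsupport f, |f (h • x) - f x| < ε := by
    refine hK'.eventually_forall_of_forall_eventually fun x _ => ?_
    exact (by fun_prop : Continuous fun p : G × X => |f (p.1 • p.2) - f p.2|).continuousAt.eventually_lt continuousAt_const (by simpa using hε)
  obtain ⟨θ, hθ, hsub⟩ := exists_nearOne_subset (Filter.inter_mem hev hC1); refine ⟨θ, hθ, fun h hh x => ?_⟩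
  obtain ⟨h1, h2⟩ := hsub hh
  by_cases hx : x ∈ K ∪ tsupport f
  · exact (h1 x hx).le
  · rw [Set.mem_union, not_or] at hx; have e1 : f x = 0 := image_eq_zero_of_notMem_tsupport hx.2
    have e2 : f (h • x) = 0 := by
      by_contra hne; exact hx.1 ⟨(h⁻¹, h • x), ⟨Set.inv_mem_inv.2 h2, subset_tsupport _ hne⟩, by simp⟩
    rw [e1, e2]; simpa using hε.le

lemma exists_conj_nearOne (g : G) {θ : ℝ} (hθ : 0 < θ) : ∃ θ' > 0, ∀ h ∈ nearOne θ', g * h * g⁻¹ ∈ nearOne θ := by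
  have h1 : Continuous fun h : G => g * h * g⁻¹ := by fun_prop
  exact exists_nearOne_subset (h1.continuousAt (x := 1) (by simpa using nearOne_mem_nhds hθ))

lemma UnifCont.comp_smul {F : X → ℝ} (hF : UnifCont F) (g : G) : UnifCont fun x => F (g • x) := by
  intro ε hε; obtain ⟨θ, hθ, h⟩ := hF ε hε; obtain ⟨θ', hθ', h'⟩ := exists_conj_nearOne g hθ
  refine ⟨θ', hθ', fun k hk x => ?_⟩; simpa [smul_smul, mul_assoc] using h _ (h' k hk) (g • x)

lemma UnifCont.sub {F F' : X → ℝ} (hF : UnifCont F) (hF' : UnifCont F') : UnifCont fun x => F x - F' x := by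
  intro ε hε; obtain ⟨θ, hθ, h⟩ := hF (ε / 2) (by positivity); obtain ⟨θ', hθ', h'⟩ := hF' (ε / 2) (by positivity)
  refine ⟨min θ θ', lt_min hθ hθ', fun k hk x => ?_⟩; have h1 := abs_le.1 (h k (nearOne_mono (min_le_left _ _) hk) x)
  have h2 := abs_le.1 (h' k (nearOne_mono (min_le_right _ _) hk) x)
  exact abs_le.2 ⟨by linarith [h1.1, h2.2], by linarith [h1.2, h2.1]⟩

lemma HasCompactSupport.comp_smulX {f : X → ℝ} (hc : HasCompactSupport f) (g : G) :
    HasCompactSupport fun x => f (g • x) :=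
  hc.comp_homeomorph (Homeomorph.smul g)

lemma exists_bound {f : X → ℝ} (hf : Continuous f) (hc : HasCompactSupport f) : ∃ M > 0, ∀ x, |f x| ≤ M := by
  obtain ⟨M, hM⟩ := hc.exists_bound_of_continuous hf
  exact ⟨max M 1, by positivity, fun x => (hM x).trans (le_max_left _ _)⟩

lemma integrable_cc {ν : Measure X} [IsFiniteMeasure ν] {f : X → ℝ} (hf : Continuous f)
    (hc : HasCompactSupport f) : Integrable f ν :=
  hf.integrable_of_hasCompactSupport hc

/-- A countable family of compactly supported functions that is dense for the sup norm. -/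
lemma exists_dense_cc : ∃ S : ℕ → X → ℝ, (∀ i, Continuous (S i) ∧ HasCompactSupport (S i)) ∧
    ∀ f : X → ℝ, Continuous f → HasCompactSupport f → ∀ ε > 0, ∃ i, ∀ x, |f x - S i x| ≤ ε := by
  have key : ∀ n : ℕ, ∃ S : ℕ → X → ℝ, (∀ i, Continuous (S i) ∧ HasCompactSupport (S i)) ∧
      ∀ f : X → ℝ, Continuous f → tsupport f ⊆ CompactExhaustion.choice X n → ∀ ε > 0, ∃ i, ∀ x, |f x - S i x| ≤ ε := by
    intro n; set P : Set C(X, ℝ) := {f | tsupport f ⊆ CompactExhaustion.choice X n}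
    have hne : Nonempty P := ⟨⟨0, by simp [P]⟩⟩; obtain ⟨d, hd⟩ := TopologicalSpace.exists_dense_seq P
    refine ⟨fun i => (d i : C(X, ℝ)), fun i => ⟨(d i : C(X, ℝ)).continuous, ?_⟩, ?_⟩
    · exact ((CompactExhaustion.choice X).isCompact n).of_isClosed_subset (isClosed_tsupport _) (d i).2
    · intro f hf hsupp ε hε; have := hd ⟨⟨f, hf⟩, hsupp⟩; rw [mem_closure_iff_nhds] at this
      have h1 : ∀ᶠ g : C(X, ℝ) in 𝓝 ⟨f, hf⟩, ∀ x ∈ CompactExhaustion.choice X n, dist (f x) (g x) < ε :=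
        (Metric.tendstoUniformlyOn_iff.1 (ContinuousMap.tendsto_iff_forall_isCompact_tendstoUniformlyOn.1
          tendsto_id _ ((CompactExhaustion.choice X).isCompact n))) ε hε
      obtain ⟨_, hg, i, rfl⟩ := this _ ((continuous_subtype_val (p := (· ∈ P))).continuousAt.eventually h1)
      refine ⟨i, fun x => ?_⟩
      by_cases hx : x ∈ CompactExhaustion.choice X n
      · exact (hg x hx).le
      · have e1 : f x = 0 := image_eq_zero_of_notMem_tsupport fun h => hx (hsupp h)
        have e2 : (d i : C(X, ℝ)) x = 0 := image_eq_zero_of_notMem_tsupport fun h => hx ((d i).2 h)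
        change |f x - (d i : C(X, ℝ)) x| ≤ ε; rw [e1, e2]; simpa using hε.le
  choose S hS hd using key
  refine ⟨fun m => S (Nat.unpair m).1 (Nat.unpair m).2, fun i => hS _ _, fun f hf hc ε hε => ?_⟩
  obtain ⟨n, hn⟩ : ∃ n, tsupport f ⊆ CompactExhaustion.choice X n :=
    (CompactExhaustion.choice X).exists_superset_of_isCompact hc.isCompact
  obtain ⟨i, hi⟩ := hd n f hf hn ε hε; exact ⟨Nat.pair n i, by simpa using hi⟩

/-! ### Stabilizers of measures -/

lemma measurable_smulX (g : G) : Measurable fun x : X => g • x := (continuous_const_smul g).measurable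

lemma map_smul_map_smul (a b : G) (ν : Measure X) :
    (ν.map fun x => b • x).map (fun x => a • x) = ν.map fun x => (a * b) • x := by
  rw [Measure.map_map (measurable_smulX a) (measurable_smulX b)]; simp only [mul_smul]; rfl

/-- The subgroup of elements preserving a measure on `X`. -/
def stab (ν : Measure X) : Subgroup G where
  carrier := {g | Measure.map (fun x => g • x) ν = ν}
  one_mem' := by simp
  mul_mem' := fun {a b} (ha : _ = _) (hb : _ = _) => by rw [mem_ofPred_eq, ← map_smul_map_smul, hb, ha]
  inv_mem' := fun {a} (ha : _ = _) => by
    change Measure.map (fun x => a⁻¹ • x) ν = ν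
    conv_lhs => rw [← ha, map_smul_map_smul]
    simp

lemma mem_stab {ν : Measure X} {g : G} : g ∈ stab ν ↔ Measure.map (fun x => g • x) ν = ν := Iff.rfl

lemma measurePreserving_of_mem_stab {ν : Measure X} {g : G} (h : g ∈ stab ν) :
    MeasurePreserving (fun x : X => g • x) ν ν := ⟨measurable_smulX g, h⟩

lemma integral_smul_of_mem_stab {ν : Measure X} {g : G} (h : g ∈ stab ν) (f : X → ℝ) :
    ∫ x, f (g • x) ∂ν = ∫ x, f x ∂ν :=
  (measurePreserving_of_mem_stab h).integral_comp (measurableEmbedding_const_smul g) f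

lemma measure_ext_cc {μ ν : Measure X} [IsFiniteMeasure μ] [IsFiniteMeasure ν]
    (h : ∀ f : X → ℝ, Continuous f → HasCompactSupport f → ∫ x, f x ∂μ = ∫ x, f x ∂ν) : μ = ν :=
  Measure.ext_of_integral_eq_on_compactlySupported fun f => h f f.continuous f.hasCompactSupport

lemma mem_stab_of_integral {ν : Measure X} [IsFiniteMeasure ν] {g : G}
    (h : ∀ f : X → ℝ, Continuous f → HasCompactSupport f → ∫ x, f (g • x) ∂ν = ∫ x, f x ∂ν) :
    g ∈ stab ν := by
  refine measure_ext_cc fun f hf hc => ?_; rw [integral_map (measurable_smulX g).aemeasurable hf.aestronglyMeasurable]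
  exact h f hf hc

lemma stab_map {ν : Measure X} {g h : G} (hg : g ∈ stab ν) :
    h * g * h⁻¹ ∈ stab (Measure.map (fun x : X => h • x) ν) := by
  rw [mem_stab, map_smul_map_smul, inv_mul_cancel_right, ← map_smul_map_smul, mem_stab.1 hg]

/-! ### One-parameter subgroups -/

/-- The unipotent element `1 + r E₁₂`. -/
def uu (r : ℝ) : G := ⟨!![1, r, 0; 0, 1, 0; 0, 0, 1], by simp [det_fin_three]⟩

/-- The unipotent element `1 + x E₂₁`. -/
def ll (x : ℝ) : G := ⟨!![1, 0, 0; x, 1, 0; 0, 0, 1], by simp [det_fin_three]⟩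

/-- The unipotent element `1 + p E₁₃ + w E₃₂`. -/
def nn (p w : ℝ) : G := ⟨!![1, 0, p; 0, 1, 0; 0, w, 1], by simp [det_fin_three]⟩

/-- The diagonal element `diag(a, a⁻¹, 1)`. -/
def dd (a : ℝ) (ha : a ≠ 0) : G := ⟨!![a, 0, 0; 0, a⁻¹, 0; 0, 0, 1], by simp [det_fin_three, ha]⟩

@[simp] lemma coe_uu (r : ℝ) : (uu r : M₃) = !![1, r, 0; 0, 1, 0; 0, 0, 1] := rfl

@[simp] lemma coe_ll (x : ℝ) : (ll x : M₃) = !![1, 0, 0; x, 1, 0; 0, 0, 1] := rfl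

@[simp] lemma coe_nn (p w : ℝ) :
    (nn p w : M₃) = !![1, 0, p; 0, 1, 0; 0, w, 1] := rfl

@[simp] lemma coe_dd (a : ℝ) (ha : a ≠ 0) :
    (dd a ha : M₃) = !![a, 0, 0; 0, a⁻¹, 0; 0, 0, 1] := rfl

lemma G_ext {g h : G} (H : ∀ i j, g i j = h i j) : g = h := Matrix.SpecialLinearGroup.ext _ _ H

lemma G_ext_fin {g h : G} (h00 : g 0 0 = h 0 0) (h01 : g 0 1 = h 0 1) (h02 : g 0 2 = h 0 2)
    (h10 : g 1 0 = h 1 0) (h11 : g 1 1 = h 1 1) (h12 : g 1 2 = h 1 2)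
    (h20 : g 2 0 = h 2 0) (h21 : g 2 1 = h 2 1) (h22 : g 2 2 = h 2 2) : g = h :=
  G_ext fun i j => by fin_cases i <;> fin_cases j <;> assumption

lemma mul₃ (A B : M₃) (i j : Fin 3) : (A * B) i j = A i 0 * B 0 j + A i 1 * B 1 j + A i 2 * B 2 j := by
  rw [Matrix.mul_apply, Fin.sum_univ_three]

lemma mul_entry (g h : G) (i j : Fin 3) : (g * h : G) i j = g i 0 * h 0 j + g i 1 * h 1 j + g i 2 * h 2 j :=
  mul₃ g h i j

lemma nearOne.entries {h : G} {θ : ℝ} (hh : h ∈ nearOne θ) :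
    (|h 0 0 - 1| ≤ θ ∧ |h 0 1| ≤ θ ∧ |h 0 2| ≤ θ) ∧ (|h 1 0| ≤ θ ∧ |h 1 1 - 1| ≤ θ ∧ |h 1 2| ≤ θ) ∧
      |h 2 0| ≤ θ ∧ |h 2 1| ≤ θ ∧ |h 2 2 - 1| ≤ θ := by
  simpa [nearOne, Fin.forall_fin_succ] using hh

lemma uu_add (r s : ℝ) : uu (r + s) = uu r * uu s := by apply G_ext_fin <;> simp [mul₃, add_comm]

lemma ll_add (r s : ℝ) : ll (r + s) = ll r * ll s := by apply G_ext_fin <;> simp [mul₃]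

lemma uu_zero : uu 0 = 1 := by apply G_ext_fin <;> simp

lemma ll_zero : ll 0 = 1 := by apply G_ext_fin <;> simp

lemma nn_zero : nn 0 0 = 1 := by apply G_ext_fin <;> simp

lemma uu_neg (r : ℝ) : uu (-r) = (uu r)⁻¹ := by rw [eq_inv_iff_mul_eq_one, ← uu_add]; simp [uu_zero]

lemma ll_neg (r : ℝ) : ll (-r) = (ll r)⁻¹ := by rw [eq_inv_iff_mul_eq_one, ← ll_add]; simp [ll_zero]

lemma continuous_uu : Continuous uu := by
  refine continuous_of_entries fun i j => ?_
  fin_cases i <;> fin_cases j <;> simp <;> fun_prop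

lemma continuous_ll : Continuous ll := by
  refine continuous_of_entries fun i j => ?_
  fin_cases i <;> fin_cases j <;> simp <;> fun_prop

lemma uu_nat (n : ℕ) : uu (n : ℝ) = (uu 1) ^ n := by
  induction n with
  | zero => simp [uu_zero]
  | succ k ih => rw [Nat.cast_succ, uu_add, ih, pow_succ]

lemma ll_nat (n : ℕ) : ll (n : ℝ) = (ll 1) ^ n := by
  induction n with
  | zero => simp [ll_zero]
  | succ k ih => rw [Nat.cast_succ, ll_add, ih, pow_succ]

/-! ### Uniformly generic sets and polynomial divergence -/

/-- Averages of compactly supported functions along the orbits of `uu` converge to the integral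
against `ν`, uniformly over starting points in `K`. -/
def UnifGeneric (ν : Measure X) (K : Set X) : Prop :=
  ∀ f : X → ℝ, Continuous f → HasCompactSupport f → ∀ ε > 0, ∃ R₀ > 0, ∀ R ≥ R₀, ∀ x ∈ K,
    |(∫ r in (0 : ℝ)..R, f (uu r • x)) - R * ∫ x, f x ∂ν| ≤ ε * R

lemma continuous_orbit {f : X → ℝ} (hf : Continuous f) (x : X) : Continuous fun r => f (uu r • x) :=
  hf.comp (continuous_uu.smul continuous_const)

lemma UnifGeneric.interval {ν : Measure X} {K : Set X} (hK : UnifGeneric ν K) {f : X → ℝ}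
    (hf : Continuous f) (hc : HasCompactSupport f) {ε : ℝ} (hε : 0 < ε) :
    ∃ R₀ > 0, ∀ a ≥ R₀, ∀ b ≥ R₀, ∀ x ∈ K,
      |(∫ r in a..b, f (uu r • x)) - (b - a) * ∫ x, f x ∂ν| ≤ ε * (a + b) := by
  obtain ⟨R₀, h0, h⟩ := hK f hf hc ε hε; refine ⟨R₀, h0, fun a ha b hb x hx => ?_⟩; have h1 := h a ha x hx
  have h2 := h b hb x hx
  have h3 := intervalIntegral.integral_add_adjacent_intervals (μ := volume) (a := 0) (b := a) (c := b)
    ((continuous_orbit hf x).intervalIntegrable _ _) ((continuous_orbit hf x).intervalIntegrable _ _)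
  rw [abs_le] at *
  constructor <;> nlinarith [h1.1, h1.2, h2.1, h2.2]

/-- The element of the normalizer of `uu` in which two nearby orbits of `uu` diverge. -/
def driftElt (α β γ τ : ℝ) (h : 1 + τ * α ≠ 0) : G :=
  ⟨!![1 + τ * α, 0, τ * β; 0, (1 + τ * α)⁻¹, 0; 0, -(τ * γ) / (1 + τ * α), 1], by simp [det_fin_three, h]⟩

section drift
variable {h : ℕ → G} {r : ℕ → ℝ} {α β γ τ : ℝ}

/-- The reparametrization of time making the divergence of `uu r * h` transverse to `uu`. -/
def reparam (h : G) (r : ℝ) : ℝ := (h 0 1 + r * h 1 1) / (h 0 0 + r * h 1 0)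

/-- The derivative of `reparam`. -/
def reparamDeriv (h : G) (r : ℝ) : ℝ := 1 / (h 0 0 + r * h 1 0) ^ 2 * (h 0 0 * h 1 1 - h 0 1 * h 1 0)

lemma tendsto_entry_of_tendsto_one (hh : Tendsto h atTop (𝓝 1)) (i j : Fin 3) : Tendsto (fun n => h n i j) atTop
      (𝓝 ((1 : M₃) i j)) :=
  ((continuous_entry i j).tendsto 1).comp hh

lemma tendsto_drift (hh : Tendsto h atTop (𝓝 1)) (hα : Tendsto (fun n => r n * h n 1 0) atTop (𝓝 α))
    (hβ : Tendsto (fun n => r n * h n 1 2) atTop (𝓝 β))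
    (hγ : Tendsto (fun n => r n * h n 2 0) atTop (𝓝 γ))
    (hne : 1 + τ * α ≠ 0) :
    Tendsto (fun p : ℕ × ℝ => uu (p.2 * r p.1) * h p.1 * (uu (reparam (h p.1) (p.2 * r p.1)))⁻¹)
      (atTop ×ˢ 𝓝 τ) (𝓝 (driftElt α β γ τ hne)) ∧
    Tendsto (fun p : ℕ × ℝ => reparamDeriv (h p.1) (p.2 * r p.1)) (atTop ×ˢ 𝓝 τ) (𝓝 (1 / (1 + τ * α) ^ 2)) ∧
    Tendsto (fun p : ℕ × ℝ => h p.1 0 0 + (p.2 * r p.1) * h p.1 1 0) (atTop ×ˢ 𝓝 τ) (𝓝 (1 + τ * α)) := by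
  have hE : ∀ i j : Fin 3, Tendsto (fun p : ℕ × ℝ => h p.1 i j) (atTop ×ˢ 𝓝 τ) (𝓝 ((1 : M₃) i j)) :=
    fun i j => (tendsto_entry_of_tendsto_one hh i j).comp tendsto_fst
  obtain ⟨⟨h00, h01, h02⟩, ⟨h10, h11, h12⟩, h20, h21, h22⟩ : (_ ∧ _ ∧ _) ∧ (_ ∧ _ ∧ _) ∧ _ ∧ _ ∧ _ := by
    simpa [Fin.forall_fin_succ] using hE
  have hs : Tendsto (fun p : ℕ × ℝ => p.2) (atTop ×ˢ 𝓝 τ) (𝓝 τ) := tendsto_snd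
  have hm : ∀ {i j : Fin 3} {c}, Tendsto (fun n => r n * h n i j) atTop (𝓝 c) →
      Tendsto (fun p : ℕ × ℝ => p.2 * r p.1 * h p.1 i j) (atTop ×ˢ 𝓝 τ) (𝓝 (τ * c)) := fun h => by
    simpa only [mul_assoc, Function.comp_def] using hs.mul (h.comp tendsto_fst)
  have ha := hm hα; have hb := hm hβ; have hc := hm hγ; have hden := h00.add ha
  have hev : ∀ᶠ p : ℕ × ℝ in atTop ×ˢ 𝓝 τ, h p.1 0 0 + p.2 * r p.1 * h p.1 1 0 ≠ 0 := hden.eventually_ne hne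
  have hρ : ∀ {i : Fin 3} {c}, Tendsto (fun p : ℕ × ℝ => h p.1 i 0) (atTop ×ˢ 𝓝 τ) (𝓝 0) →
      Tendsto (fun n => r n * h n i 0) atTop (𝓝 c) → Tendsto (fun p : ℕ × ℝ =>
        reparam (h p.1) (p.2 * r p.1) * h p.1 i 0) (atTop ×ˢ 𝓝 τ) (𝓝 (τ * c / (1 + τ * α))) := fun hi hc => by
    have := ((h01.mul hi).add ((hm hc).mul h11)).div hden hne; simp only [mul_zero, zero_add, mul_one] at this
    refine this.congr fun p => ?_; simp only [reparam, Pi.div_apply]; ring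
  have hρa := hρ h10 hα; have hρc := hρ h20 hγ; refine ⟨?_, ?_, hden⟩
  · refine tendsto_of_entries fun i j => ?_; simp only [mul_entry, ← uu_neg]
    fin_cases i <;> fin_cases j <;> simp [driftElt]
    · exact hden
    · refine tendsto_const_nhds.congr' ?_
      filter_upwards [hev] with p hp
      simp only [reparam]; field_simp; ring
    · simpa using h02.add hb
    · exact h10
    · have := (hρa.neg.add h11).congr fun p => by rw [mul_comm (reparam _ _)]
      rwa [show -(τ * α / (1 + τ * α)) + 1 = (1 + τ * α)⁻¹ by
        rw [inv_eq_one_div, eq_div_iff hne, add_mul, neg_mul, div_mul_cancel₀ _ hne]; ring] at this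
    · exact h12
    · exact h20
    · have := (hρc.neg.add h21).congr fun p => by rw [mul_comm (reparam _ _)]
      rwa [show -(τ * γ / (1 + τ * α)) + 0 = -(τ * γ) / (1 + τ * α) by rw [add_zero, neg_div]] at this
    · exact h22
  · simpa [reparamDeriv] using (tendsto_const_nhds (x := (1 : ℝ))).div (hden.pow 2) (pow_ne_zero 2 hne) |>.mul
      ((h00.mul h11).sub (h01.mul h10))

lemma tendsto_reparam_div (hh : Tendsto h atTop (𝓝 1)) (hr : Tendsto r atTop atTop)
    (hα : Tendsto (fun n => r n * h n 1 0) atTop (𝓝 α))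
    (hne : 1 + τ * α ≠ 0) :
    Tendsto (fun p : ℕ × ℝ => reparam (h p.1) (p.2 * r p.1) / r p.1) (atTop ×ˢ 𝓝 τ) (𝓝 (τ / (1 + τ * α))) := by
  have h00 := (tendsto_entry_of_tendsto_one hh 0 0).comp (tendsto_fst (g := 𝓝 τ))
  have h01 := (tendsto_entry_of_tendsto_one hh 0 1).comp (tendsto_fst (g := 𝓝 τ))
  have h11 := (tendsto_entry_of_tendsto_one hh 1 1).comp (tendsto_fst (g := 𝓝 τ))
  have hr' := (tendsto_inv_atTop_zero.comp hr).comp (tendsto_fst (g := 𝓝 τ))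
  have hs : Tendsto (fun p : ℕ × ℝ => p.2) (atTop ×ˢ 𝓝 τ) (𝓝 τ) := tendsto_snd
  have ha := hs.mul (hα.comp (tendsto_fst (g := 𝓝 τ))); simp [-tendsto_fst] at h00 h01 h11
  have := ((h01.mul hr').add (hs.mul h11)).div (h00.add ha) hne; simp only [mul_zero, zero_add, mul_one] at this
  refine this.congr' ?_
  filter_upwards [(tendsto_fst (f := atTop) (g := 𝓝 τ)).eventually (hr.eventually_gt_atTop 0)] with p hp
  simp only [reparam, Pi.div_apply, Function.comp_apply]; field_simp

lemma hasDerivAt_reparam (h : G) {r : ℝ} (hr : h 0 0 + r * h 1 0 ≠ 0) :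
    HasDerivAt (reparam h) (reparamDeriv h r) r := by
  have h1 : ∀ a b : ℝ, HasDerivAt (fun r : ℝ => a + r * b) b r := fun a b => by
    simpa using ((hasDerivAt_id r).mul_const b).const_add a
  refine ((h1 _ _).div (h1 _ _) hr).congr_deriv ?_; rw [reparamDeriv, one_div, inv_mul_eq_div]; congr 1; ring

/-- Two sequences of nearby points in a uniformly generic set force the limit of their transverse
divergence to preserve the measure. -/
theorem driftElt_mem_stab {K : Set X} (hK : UnifGeneric ν K) {x : ℕ → X} (hx : ∀ n, x n ∈ K) (hy : ∀ n, h n • x n ∈ K)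
    (hh : Tendsto h atTop (𝓝 1)) (hr : Tendsto r atTop atTop)
    (hα : Tendsto (fun n => r n * h n 1 0) atTop (𝓝 α))
    (hβ : Tendsto (fun n => r n * h n 1 2) atTop (𝓝 β))
    (hγ : Tendsto (fun n => r n * h n 2 0) atTop (𝓝 γ))
    (hτ : 0 < τ) (hpos : 0 < 1 + τ * α) : driftElt α β γ τ hpos.ne' ∈ stab ν := by
  refine mem_stab_of_integral fun f hf hc => ?_; set N := driftElt α β γ τ hpos.ne' with hN
  set J : ℝ := 1 / (1 + τ * α) ^ 2; have hJ0 : 0 < J := by positivity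
  set κ : ℝ := τ / (1 + τ * α); have hκ0 : 0 < κ := by positivity
  set fN : X → ℝ := fun x => f (N • x); have hfNc : Continuous fN := hf.comp (continuous_const_smul N)
  have hcN : HasCompactSupport fN := hc.comp_smulX N; obtain ⟨M, hM0, hM⟩ := exists_bound hf hc; replace hM0 := hM0.le
  set c := ∫ x, f x ∂ν; set c' := ∫ x, fN x ∂ν
  have hc'M : |c'| ≤ M := by
    simpa using norm_integral_le_of_norm_le_const (μ := ν) (f := fN) (C := M) (.of_forall fun x => hM _)
  have key : ∀ ε > 0, J * |c - c'| ≤ ε * (2 * J + 2 * M + 1) := by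
    intro ε hε; obtain ⟨θ, hθ, hu⟩ := UnifCont.of_compactSupport hf hc ε hε
    obtain ⟨T1, T2, T3⟩ := tendsto_drift hh hα hβ hγ hpos.ne'; have T4 := tendsto_reparam_div hh hr hα hpos.ne'
    have e1 : ∀ᶠ p : ℕ × ℝ in atTop ×ˢ 𝓝 τ, uu (p.2 * r p.1) * h p.1 *
        (uu (reparam (h p.1) (p.2 * r p.1)))⁻¹ * N⁻¹ ∈ nearOne θ := by
      have : Tendsto (fun g : G => g * N⁻¹) (𝓝 N) (𝓝 1) := by
        have := (continuous_mul_const N⁻¹).tendsto N; rwa [mul_inv_cancel] at this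
      exact (this.comp T1).eventually (nearOne_mem_nhds hθ)
    have e2 := T2.eventually (Metric.closedBall_mem_nhds _ hε); have e3 := T3.eventually (lt_mem_nhds hpos)
    have e4 := T4.eventually (Icc_mem_nhds (show κ / 2 < κ by linarith) (show κ < 2 * κ by linarith))
    obtain ⟨pa, hpa, pb, hpb, hp⟩ := eventually_prod_iff.1 (e1.and (e2.and (e3.and e4)))
    obtain ⟨δ, hδ, hpb⟩ := Metric.nhds_basis_closedBall.eventually_iff.1 hpb
    obtain ⟨R₁, hR₁, H1⟩ := hK.interval hf hc (ε := ε * δ / (2 * τ + δ)) (by positivity)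
    obtain ⟨R₂, hR₂, H2⟩ := hK.interval hfNc hcN (ε := ε * δ / (4 * κ)) (by positivity)
    obtain ⟨n, hn1, hn2⟩ := (hpa.and (hr.eventually_ge_atTop (R₁ / τ + R₂ / (κ / 2)))).exists; set R := r n
    have hRpos : 0 < R := lt_of_lt_of_le (by positivity) hn2
    have hRa : R₁ ≤ τ * R := by have : R₁ / τ ≤ R := le_trans (by simp; positivity) hn2; rwa [div_le_iff₀' hτ] at this
    have hRb : R₂ ≤ κ / 2 * R := by
      have : R₂ / (κ / 2) ≤ R := le_trans (by simp; positivity) hn2; rwa [div_le_iff₀' (by positivity)] at this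
    have good : ∀ s ∈ Icc τ (τ + δ), _ := fun s hs => hp hn1 (hpb (x := s) (by
      rw [Metric.mem_closedBall, Real.dist_eq, abs_le]; constructor <;> linarith [hs.1, hs.2]))
    set a := τ * R with ha; set b := (τ + δ) * R with hb; have hab : a ≤ b := by rw [ha, hb]; nlinarith
    have hba : b - a = δ * R := by rw [ha, hb]; ring
    have goodr : ∀ t ∈ Icc a b, t / R ∈ Icc τ (τ + δ) := fun t ht => by
      rw [Set.mem_Icc, le_div_iff₀ hRpos, div_le_iff₀ hRpos]; exact ht
    set ρ := reparam (h n) with hρ; set ρ' := reparamDeriv (h n)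
    have hmulR : ∀ t, t / R * r n = t := fun t => div_mul_cancel₀ t hRpos.ne'
    have hden : ∀ t ∈ Icc a b, 0 < h n 0 0 + t * h n 1 0 := fun t ht => by
      simpa only [hmulR] using (good _ (goodr t ht)).2.2.1
    have hder : ∀ t ∈ Icc a b, |ρ' t - J| ≤ ε := fun t ht => by
      have := (good _ (goodr t ht)).2.1; simp only [hmulR] at this; exact this
    have hρR : ∀ t ∈ Icc a b, κ / 2 * R ≤ ρ t ∧ ρ t ≤ 2 * κ * R := fun t ht => by
      have := (good _ (goodr t ht)).2.2.2; simp only [hmulR] at this; rwa [le_div_iff₀ hRpos, div_le_iff₀ hRpos] at this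
    have hclose : ∀ t ∈ Icc a b, |f (uu t • (h n • x n)) - fN (uu (ρ t) • x n)| ≤ ε := fun t ht => by
      have h1 := (good _ (goodr t ht)).1; simp only [hmulR] at h1; have := hu _ h1 (N • (uu (ρ t) • x n))
      convert this using 4; simp only [smul_smul]; congr 1; simp [hρ]
    have cont1 : Continuous fun t => f (uu t • (h n • x n)) := continuous_orbit hf _
    have cρ : ContinuousOn ρ (Set.uIcc a b) := fun t ht => by
      rw [Set.uIcc_of_le hab] at ht; exact (hasDerivAt_reparam (h n) (hden t ht).ne').continuousAt.continuousWithinAt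
    have cρ' : ContinuousOn ρ' (Set.uIcc a b) := by
      rw [Set.uIcc_of_le hab]
      refine (continuousOn_const.div (by fun_prop) fun t ht => pow_ne_zero 2 (hden t ht).ne').mul continuousOn_const
    have bnd : ∀ {F : ℝ → ℝ} {C : ℝ}, (∀ t ∈ Icc a b, |F t| ≤ C) → |∫ t in a..b, F t| ≤ C * (δ * R) :=
      fun {F C} hF => by
        have := intervalIntegral.norm_integral_le_of_norm_le_const (a := a) (b := b) (C := C) (f := F)
          fun t ht => by rw [Set.uIoc_of_le hab] at ht; exact hF t ⟨ht.1.le, ht.2⟩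
        rwa [abs_of_nonneg (by linarith : 0 ≤ b - a), hba] at this
    have contN : ContinuousOn (fun t => fN (uu (ρ t) • x n)) (Set.uIcc a b) :=
      (continuous_orbit hfNc (x n)).comp_continuousOn cρ
    have hint1 : IntervalIntegrable (fun t => f (uu t • (h n • x n))) volume a b := cont1.intervalIntegrable _ _
    have hint2 : IntervalIntegrable (fun t => fN (uu (ρ t) • x n)) volume a b := contN.intervalIntegrable
    have hint3 : IntervalIntegrable (fun t => fN (uu (ρ t) • x n) * ρ' t) volume a b :=
      (contN.mul cρ').intervalIntegrable
    have amem : a ∈ Icc a b := Set.left_mem_Icc.2 hab; have bmem : b ∈ Icc a b := Set.right_mem_Icc.2 hab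
    -- the five comparisons
    have c1 : |(∫ t in a..b, f (uu t • (h n • x n))) - δ * R * c| ≤ ε * (δ * R) := by
      have := H1 a hRa b (hRa.trans hab) _ (hy n); rw [hba] at this; refine this.trans (le_of_eq ?_)
      rw [ha, hb]; field_simp; ring
    have c2 : |(∫ t in a..b, f (uu t • (h n • x n))) - ∫ t in a..b, fN (uu (ρ t) • x n)| ≤ ε * (δ * R) := by
      rw [← intervalIntegral.integral_sub hint1 hint2]; exact bnd hclose
    have c3 : |J * (∫ t in a..b, fN (uu (ρ t) • x n)) - ∫ t in a..b, fN (uu (ρ t) • x n) * ρ' t| ≤ M * ε * (δ * R) := by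
      rw [← intervalIntegral.integral_const_mul, ← intervalIntegral.integral_sub (hint2.const_mul _) hint3]
      refine bnd fun t ht => ?_; rw [mul_comm J, ← mul_sub, abs_mul, abs_sub_comm]
      exact mul_le_mul (hM _) (hder t ht) (abs_nonneg _) hM0
    have c4 : |(∫ t in a..b, fN (uu (ρ t) • x n) * ρ' t) - (ρ b - ρ a) * c'| ≤ ε * (δ * R) := by
      have e := intervalIntegral.integral_comp_mul_deriv (a := a) (b := b) (f := ρ) (f' := ρ')
        (g := fun s => fN (uu s • x n)) (fun t ht => by
          rw [Set.uIcc_of_le hab] at ht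
          exact hasDerivAt_reparam (h n) (hden t ht).ne') cρ' (continuous_orbit hfNc _)
      simp only [Function.comp_def] at e; rw [e]; have b1 := hρR a amem; have b2 := hρR b bmem
      refine (H2 _ (hRb.trans b1.1) _ (hRb.trans b2.1) _ (hx n)).trans ?_
      calc ε * δ / (4 * κ) * (ρ a + ρ b) ≤ ε * δ / (4 * κ) * (4 * κ * R) := by
            gcongr; linarith [b1.2, b2.2]
        _ = ε * (δ * R) := by field_simp
    have c5 : |(ρ b - ρ a) - J * (δ * R)| ≤ ε * (δ * R) := by
      have e := intervalIntegral.integral_eq_sub_of_hasDerivAt (a := a) (b := b) (f := ρ) (f' := ρ') (fun t ht => by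
          rw [Set.uIcc_of_le hab] at ht
          exact hasDerivAt_reparam (h n) (hden t ht).ne') cρ'.intervalIntegrable
      have e' : J * (δ * R) = ∫ t in a..b, J := by rw [intervalIntegral.integral_const, hba, smul_eq_mul, mul_comm]
      rw [← e, e', ← intervalIntegral.integral_sub cρ'.intervalIntegrable intervalIntegrable_const]; exact bnd hder
    have hδR : 0 < δ * R := by positivity
    set I1 := ∫ t in a..b, f (uu t • (h n • x n)); set I2 := ∫ t in a..b, fN (uu (ρ t) • x n)
    set I3 := ∫ t in a..b, fN (uu (ρ t) • x n) * ρ' t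
    have tot : δ * R * (J * |c - c'|) ≤ δ * R * (ε * (2 * J + 2 * M + 1)) := by
      have : δ * R * (J * |c - c'|) = |δ * R * (J * (c - c'))| := by
        rw [abs_mul (δ * R), abs_mul J, abs_of_pos hδR, abs_of_pos hJ0]
      rw [this]
      have id : δ * R * (J * (c - c')) = -(J * (I1 - δ * R * c)) + J * (I1 - I2) + (J * I2 - I3) +
          (I3 - (ρ b - ρ a) * c') + ((ρ b - ρ a) - J * (δ * R)) * c' := by ring
      rw [id]; refine (abs_add_le _ _).trans ?_
      have t5 : |((ρ b - ρ a) - J * (δ * R)) * c'| ≤ ε * (δ * R) * M := by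
        rw [abs_mul]; exact mul_le_mul c5 hc'M (abs_nonneg _) (by positivity)
      have t1 : |-(J * (I1 - δ * R * c))| ≤ J * (ε * (δ * R)) := by rw [abs_neg, abs_mul, abs_of_pos hJ0]; gcongr
      have t2 : |J * (I1 - I2)| ≤ J * (ε * (δ * R)) := by rw [abs_mul, abs_of_pos hJ0]; gcongr
      have q1 := abs_add_le (-(J * (I1 - δ * R * c)) + J * (I1 - I2) + (J * I2 - I3)) (I3 - (ρ b - ρ a) * c')
      have q2 := abs_add_le (-(J * (I1 - δ * R * c)) + J * (I1 - I2)) (J * I2 - I3)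
      have q3 := abs_add_le (-(J * (I1 - δ * R * c))) (J * (I1 - I2)); nlinarith
    exact le_of_mul_le_mul_left tot hδR
  have : J * |c - c'| ≤ 0 := by
    refine le_of_forall_pos_le_add fun ε hε => ?_; have := key (ε / (2 * J + 2 * M + 1)) (by positivity)
    rw [div_mul_cancel₀ _ (by positivity)] at this; linarith
  have h0 : |c - c'| ≤ 0 := by by_contra! hcon; nlinarith [mul_pos hJ0 hcon]
  have := abs_nonpos_iff.1 h0; linarith

end drift

/-! ### Generic points -/

/-- The averages of `f` along the orbit of `x` under `uu`. -/
def orbitAvg (f : X → ℝ) (N : ℕ) (x : X) : ℝ := (N : ℝ)⁻¹ * ∫ r in (0 : ℝ)..N, f (uu r • x)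

/-- The orbit of `x` under `uu` equidistributes with respect to `ν`. -/
def Generic (ν : Measure X) (x : X) : Prop := ∀ f : X → ℝ, Continuous f → HasCompactSupport f →
    Tendsto (fun N => orbitAvg f N x) atTop (𝓝 (∫ x, f x ∂ν))

lemma continuous_orbitAvg {f : X → ℝ} (hf : Continuous f) (N : ℕ) : Continuous (orbitAvg f N) := by
  refine continuous_const.mul ?_
  refine intervalIntegral.continuous_parametric_intervalIntegral_of_continuous' (μ := volume)
    (f := fun (x : X) (r : ℝ) => f (uu r • x)) ?_ _ _
  exact hf.comp ((continuous_uu.comp continuous_snd).smul continuous_fst)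

lemma abs_orbitAvg_sub_le {f g : X → ℝ} (hf : Continuous f) (hg : Continuous g) {ε : ℝ} (hε : 0 ≤ ε)
    (h : ∀ x, |f x - g x| ≤ ε) (N : ℕ) (x : X) : |orbitAvg f N x - orbitAvg g N x| ≤ ε := by
  rcases Nat.eq_zero_or_pos N with rfl | hN
  · simpa [orbitAvg] using hε
  have hN' : (0 : ℝ) < N := by exact_mod_cast hN
  rw [orbitAvg, orbitAvg, ← mul_sub, ← intervalIntegral.integral_sub
    ((continuous_orbit hf x).intervalIntegrable _ _) ((continuous_orbit hg x).intervalIntegrable _ _),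
    abs_mul, abs_inv, abs_of_pos hN', inv_mul_le_iff₀ hN']
  simpa [mul_comm] using intervalIntegral.norm_integral_le_of_norm_le_const (a := 0) (b := (N : ℝ)) (C := ε)
    (f := fun r => f (uu r • x) - g (uu r • x)) (fun t _ => h _)

lemma abs_integral_sub_le {f g : X → ℝ} (hf : Integrable f ν) (hg : Integrable g ν) {ε : ℝ}
    (h : ∀ x, |f x - g x| ≤ ε) : |∫ x, f x ∂ν - ∫ x, g x ∂ν| ≤ ε := by
  rw [← integral_sub hf hg]
  simpa using norm_integral_le_of_norm_le_const (μ := ν) (f := fun x => f x - g x) (C := ε) (.of_forall h)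

/-- A set on which the averages of a dense family converge uniformly is uniformly generic. -/
lemma UnifGeneric.of_dense {K : Set X} {S : ℕ → X → ℝ} (hS : ∀ i, Continuous (S i) ∧ HasCompactSupport (S i))
    (hd : ∀ f : X → ℝ, Continuous f → HasCompactSupport f → ∀ ε > 0, ∃ i, ∀ x, |f x - S i x| ≤ ε)
    (hK : ∀ i, TendstoUniformlyOn (fun N => orbitAvg (S i) N) (fun _ => ∫ x, S i x ∂ν) atTop K) :
    UnifGeneric ν K := by
  intro f hf hc ε hε; obtain ⟨M, hM0, hM⟩ := exists_bound hf hc; obtain ⟨i, hi⟩ := hd f hf hc (ε / 4) (by positivity)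
  have h1 := Metric.tendstoUniformlyOn_iff.1 (hK i) (ε / 4) (by positivity); obtain ⟨N₀, hN₀⟩ := eventually_atTop.1 h1
  refine ⟨N₀ + 1 + 8 * M / ε, by positivity, fun R hR x hx => ?_⟩; have hMε : 0 < 8 * M / ε := by positivity
  have hR0 : (0 : ℝ) ≤ R := by linarith [(Nat.cast_nonneg N₀ : (0:ℝ) ≤ N₀)]
  set N := ⌊R⌋₊; have hNR : (N : ℝ) ≤ R := Nat.floor_le hR0; have hRN : R < N + 1 := Nat.lt_floor_add_one R
  have hN₀N : N₀ ≤ N := Nat.le_floor (by linarith)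
  have hNpos : (0 : ℝ) < N := by linarith [(Nat.cast_nonneg N₀ : (0:ℝ) ≤ N₀)]
  have h2 := hN₀ N hN₀N x hx; rw [Real.dist_eq, abs_sub_comm] at h2
  have h3 := abs_orbitAvg_sub_le hf (hS i).1 (by positivity) hi N x
  have h4 := abs_integral_sub_le (ν := ν) (integrable_cc hf hc) (integrable_cc (hS i).1 (hS i).2) hi
  have h5 : |orbitAvg f N x - ∫ x, f x ∂ν| ≤ 3 * ε / 4 := by
    rw [abs_le] at *; rw [abs_lt] at h2; constructor <;> linarith [h2.1, h2.2, h3.1, h3.2, h4.1, h4.2]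
  have h6 : (∫ r in (0 : ℝ)..N, f (uu r • x)) = N * orbitAvg f N x := by rw [orbitAvg, mul_inv_cancel_left₀ hNpos.ne']
  have h7 := intervalIntegral.integral_add_adjacent_intervals (μ := volume) (a := 0) (b := (N : ℝ)) (c := R)
    ((continuous_orbit hf x).intervalIntegrable _ _) ((continuous_orbit hf x).intervalIntegrable _ _)
  have h8 : |∫ r in (N : ℝ)..R, f (uu r • x)| ≤ M * 1 := by
    have := intervalIntegral.norm_integral_le_of_norm_le_const (a := (N : ℝ)) (b := R) (C := M)
      (f := fun r => f (uu r • x)) (fun t _ => hM _)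
    refine this.trans ?_; gcongr; rw [abs_of_nonneg (by linarith)]; linarith
  have h9 : |∫ x, f x ∂ν| ≤ M := by
    simpa using norm_integral_le_of_norm_le_const (μ := ν) (f := f) (C := M) (.of_forall hM)
  rw [← h7, h6]
  have h10 : 8 * M ≤ ε * R := by
    have : 8 * M / ε ≤ R := by linarith [(Nat.cast_nonneg N₀ : (0:ℝ) ≤ N₀)]
    rw [div_le_iff₀ hε] at this; linarith
  have id : N * orbitAvg f N x + (∫ r in (N : ℝ)..R, f (uu r • x)) - R * ∫ x, f x ∂ν =
    N * (orbitAvg f N x - ∫ x, f x ∂ν) + (∫ r in (N : ℝ)..R, f (uu r • x)) - (R - N) * ∫ x, f x ∂ν := by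
    ring
  rw [id]; have q1 : |N * (orbitAvg f N x - ∫ x, f x ∂ν)| ≤ R * (3 * ε / 4) := by rw [abs_mul, abs_of_pos hNpos]; gcongr
  have q2 : |(R - N) * ∫ x, f x ∂ν| ≤ 1 * M := by
    rw [abs_mul]; refine mul_le_mul ?_ h9 (abs_nonneg _) zero_le_one; rw [abs_of_nonneg (by linarith)]; linarith
  have q3 := abs_sub (N * (orbitAvg f N x - ∫ x, f x ∂ν) + (∫ r in (N : ℝ)..R, f (uu r • x))) ((R - N) * ∫ x, f x ∂ν)
  have q4 := abs_add_le (N * (orbitAvg f N x - ∫ x, f x ∂ν)) (∫ r in (N : ℝ)..R, f (uu r • x)); linarith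

lemma UnifGeneric.generic {ν : Measure X} {K : Set X} (h : UnifGeneric ν K) {x : X} (hx : x ∈ K) : Generic ν x := by
  intro f hf hc; rw [Metric.tendsto_atTop]; intro ε hε; obtain ⟨R₀, h0, h1⟩ := h f hf hc (ε / 2) (by positivity)
  refine ⟨⌈R₀⌉₊, fun N hN => ?_⟩; have hNR : R₀ ≤ N := (Nat.le_ceil R₀).trans (by exact_mod_cast hN)
  have hNpos : (0 : ℝ) < N := by linarith
  have := h1 N hNR x hx; rw [Real.dist_eq, orbitAvg]
  have e : (N : ℝ)⁻¹ * (∫ r in (0 : ℝ)..N, f (uu r • x)) - ∫ x, f x ∂ν =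
      (N : ℝ)⁻¹ * ((∫ r in (0 : ℝ)..N, f (uu r • x)) - N * ∫ x, f x ∂ν) := by
    field_simp
  rw [e, abs_mul, abs_inv, abs_of_pos hNpos, inv_mul_lt_iff₀ hNpos]; nlinarith

lemma exists_compact_unifGeneric (hgen : ∀ᵐ x ∂ν, Generic ν x) {P : X → Prop} (hP : ∀ᵐ x ∂ν, P x) {ε : ℝ} (hε : 0 < ε) :
    ∃ K : Set X, IsCompact K ∧ UnifGeneric ν K ∧ (∀ x ∈ K, P x) ∧ ν Kᶜ ≤ ofR ε := by
  obtain ⟨S, hS, hd⟩ := exists_dense_cc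
  have hE : ∀ i : ℕ, ∃ t : Set X, MeasurableSet t ∧ ν t ≤ ofR (ε / 4 * (1 / 2) ^ i) ∧
      TendstoUniformlyOn (fun N => orbitAvg (S i) N) (fun _ => ∫ x, S i x ∂ν) atTop tᶜ := fun i =>
    tendstoUniformlyOn_of_ae_tendsto' (fun N => (continuous_orbitAvg (hS i).1 N).stronglyMeasurable)
      stronglyMeasurable_const
      (by filter_upwards [hgen] with x hx using hx _ (hS i).1 (hS i).2) (by positivity)
  choose t ht hνt hut using hE
  obtain ⟨t', ht's, ht'm, ht'0⟩ := exists_measurable_superset_of_null (ae_iff.1 hP)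
  set A : Set X := ((⋃ i, t i) ∪ t')ᶜ with hA
  have hAm : MeasurableSet A := ((MeasurableSet.iUnion ht).union ht'm).compl
  obtain ⟨K, hKA, hK, hKν⟩ := hAm.exists_isCompact_sdiff_lt (μ := ν) (measure_ne_top _ _)
    (ε := ofR (ε / 2)) (by simpa using hε)
  refine ⟨K, hK, UnifGeneric.of_dense hS hd fun i => (hut i).mono fun x hx => ?_, fun x hx => ?_, ?_⟩
  · have := hKA hx; simp only [hA, Set.compl_union, Set.compl_iUnion, Set.mem_inter_iff, mem_iInter] at this
    exact this.1 i
  · by_contra hc; have := hKA hx; simp only [hA, Set.compl_union, Set.mem_inter_iff] at this; exact this.2 (ht's hc)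
  · have h1 : Kᶜ ⊆ ((⋃ i, t i) ∪ t') ∪ A \ K := by
      intro x hx
      by_cases hxA : x ∈ A
      · exact Or.inr ⟨hxA, hx⟩
      · exact Or.inl (not_not.1 hxA)
    have h2 : ∑' i, ν (t i) ≤ ofR (ε / 2) := by
      refine (ENNReal.tsum_le_tsum hνt).trans ?_
      rw [← ofReal_tsum_of_nonneg (fun i => by positivity)
        (summable_geometric_two.mul_left _), tsum_mul_left, tsum_geometric_two]
      exact ofReal_le_ofReal (by linarith)
    calc ν Kᶜ ≤ ν (((⋃ i, t i) ∪ t') ∪ A \ K) := measure_mono h1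
      _ ≤ (ν (⋃ i, t i) + ν t') + ν (A \ K) := (measure_union_le _ _).trans (by gcongr; exact measure_union_le _ _)
      _ ≤ (ofR (ε / 2) + 0) + ofR (ε / 2) := by
          gcongr
          · exact (measure_iUnion_le t).trans h2
          · exact ht'0.le
      _ = ofR ε := by rw [add_zero, ← ofReal_add (by positivity) (by positivity)]; congr 1; ring

/-! ### Recurrence -/

lemma isOpenMap_orbit (x : X) : IsOpenMap fun g : G => g • x := by
  obtain ⟨g₀, rfl⟩ := exists_rep x; have : (fun g : G => g • (g₀ : X)) = (fun g : G => (g : X)) ∘ fun g => g * g₀ := rfl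
  rw [this]; exact (QuotientGroup.isOpenMap_coe).comp (isOpenMap_mul_right g₀)

lemma continuous_orbitG (x : X) : Continuous fun g : G => g • x := continuous_id.smul continuous_const

/-- A compact set of positive measure contains a small piece of positive measure. -/
lemma exists_small_piece {ν : Measure X} {K : Set X} (hK : IsCompact K) (hν : ν K ≠ 0) {θ : ℝ}
    (hθ : 0 < θ) : ∃ B ⊆ K, IsCompact B ∧ ν B ≠ 0 ∧ ∀ x ∈ B, ∀ y ∈ B, ∃ h ∈ nearOne θ, y = h • x := by
  obtain ⟨V, hV, hVV⟩ : ∃ V ∈ 𝓝 (1 : G), ∀ v ∈ V, ∀ w ∈ V, v * w⁻¹ ∈ nearOne θ := by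
    have : Tendsto (fun p : G × G => p.1 * p.2⁻¹) (𝓝 (1 : G) ×ˢ 𝓝 1) (𝓝 1) := by
      have := (continuous_fst.mul continuous_snd.inv : Continuous fun p : G × G => p.1 * p.2⁻¹).tendsto (1, 1)
      rw [nhds_prod_eq] at this; simp only [Pi.mul_apply, inv_one, mul_one] at this; exact this
    obtain ⟨V, hV, h⟩ := mem_prod_same_iff.1 (this (nearOne_mem_nhds hθ))
    exact ⟨V, hV, fun v hv w hw => h (Set.mk_mem_prod hv hw)⟩
  obtain ⟨θ', hθ', hsub⟩ := exists_nearOne_subset hV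
  have hnhds : ∀ x : X, (fun g : G => g • x) '' nearOne θ' ∈ 𝓝 x := fun x => by
    simpa using (isOpenMap_orbit x).image_mem_nhds (nearOne_mem_nhds hθ')
  obtain ⟨t, htK, ht⟩ := hK.elim_nhds_subcover _ fun x _ => hnhds x
  have : ∃ x ∈ t, ν (K ∩ (fun g : G => g • x) '' nearOne θ') ≠ 0 := by
    by_contra! hcon; refine hν (measure_mono_null (t := ⋃ x ∈ t, K ∩ (fun g : G => g • x) '' nearOne θ') ?_ ?_)
    · intro y hy; have := ht hy; simp only [mem_iUnion] at this ⊢; obtain ⟨x, hx, hyx⟩ := this; exact ⟨x, hx, hy, hyx⟩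
    · exact (measure_biUnion_null_iff t.countable_toSet).2 hcon
  obtain ⟨x, -, hx⟩ := this
  refine ⟨_, inter_subset_left, hK.inter ((isCompact_nearOne θ').image (continuous_orbitG x)), hx, ?_⟩
  rintro - ⟨-, v, hv, rfl⟩ - ⟨-, w, hw, rfl⟩
  exact ⟨w * v⁻¹, hVV _ (hsub hw) _ (hsub hv), by simp [smul_smul]⟩

/-- No nonzero lattice vector of `x` lies in `⟨e₁,e₃⟩`, and no nonzero dual vector in `⟨e₂,e₃⟩`. -/
def IrrationalPt (x : X) : Prop := ∀ g : G, (g : X) = x → (∀ v : Fin 3 → ℤ, v ≠ 0 → ∑ j, g 1 j * v j ≠ 0) ∧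
  ∀ v : Fin 3 → ℤ, v ≠ 0 → ∑ j, (g⁻¹ : G) j 0 * v j ≠ 0

/-- Poincaré recurrence in group form. -/
lemma exists_return {u : G} (hu : u ∈ stab ν) {K : Set X} (hK : IsCompact K) (hν : ν K ≠ 0) {θ : ℝ} (hθ : 0 < θ) :
    ∃ x ∈ K, ∃ n ≠ 0, u ^ n • x ∈ K ∧ ∃ h ∈ nearOne θ, u ^ n • x = h • x := by
  obtain ⟨B, hBK, hB, hνB, h⟩ := exists_small_piece hK hν hθ
  obtain ⟨x, hx, n, hn, hnx⟩ := (measurePreserving_of_mem_stab hu).exists_mem_iterate_mem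
    hB.measurableSet.nullMeasurableSet hνB
  rw [smul_iterate_apply] at hnx; exact ⟨x, hBK hx, n, hn, hBK hnx, h x hx _ hnx⟩

lemma exists_int_matrix {γ : G} (hγ : γ ∈ Gamma) : ∃ m : Matrix (Fin 3) (Fin 3) ℤ, ∀ i j, γ i j = m i j := by
  obtain ⟨m, rfl⟩ := hγ; exact ⟨m, fun i j => rfl⟩

/-- If `h • x = h' • x`, the element `h⁻¹ h'` is conjugate by a representative to an integer matrix. -/
lemma exists_gamma {g h h' : G} (e : h' • (g : X) = h • (g : X)) : ∃ γ ∈ Gamma, h⁻¹ * h' = g * γ * g⁻¹ := by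
  rw [smul_mk, smul_mk] at e; refine ⟨g⁻¹ * (h⁻¹ * h') * g, ?_, by group⟩; have := mk_eq_mk.1 e.symm
  convert this using 1; group

/-! ### Transverse pairs from recurrence -/

lemma coe_conj_apply (g γ : G) (i j : Fin 3) : (g * γ : G) i j = ∑ l, g i l * γ l j := Matrix.mul_apply

/-- A nontrivial element of the stabilizer of a point fixing the second coordinate functional
produces a lattice vector in `⟨e₁,e₃⟩`. -/
lemma not_irrationalPt_of_row {g γ l : G} (hγ : γ ∈ Gamma) (hl : l = g * γ * g⁻¹) (h1 : l ≠ 1)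
    (hrow : ∀ j, l 1 j = (1 : M₃) 1 j) :
    ¬ IrrationalPt (g : X) := by
  intro hirr; have hγ1 : γ ≠ 1 := by rintro rfl; exact h1 (by simp [hl])
  obtain ⟨m, hm⟩ := exists_int_matrix hγ
  obtain ⟨j, hj⟩ : ∃ j, (fun i => m i j - (1 : Matrix (Fin 3) (Fin 3) ℤ) i j) ≠ 0 := by
    by_contra! hcon; refine hγ1 (G_ext fun i j => ?_); have := congrFun (hcon j) i
    simp only [Pi.zero_apply, sub_eq_zero] at this
    rw [hm, this, Matrix.SpecialLinearGroup.coe_one, Matrix.one_apply, Matrix.one_apply]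
    split_ifs <;> simp
  refine (hirr g rfl).1 _ hj ?_; have e : l * g = g * γ := by rw [hl]; group
  have e1 := congrArg (fun q : G => q 1 j) e; simp only [coe_conj_apply, hrow] at e1
  have e2 : ∑ k, (1 : M₃) 1 k * g k j = ∑ k, g 1 k * (1 : M₃) k j := by
    rw [← Matrix.mul_apply, ← Matrix.mul_apply, one_mul, mul_one]
  have e3 : ∀ k, ((m k j - (1 : Matrix (Fin 3) (Fin 3) ℤ) k j : ℤ) : ℝ) = γ k j - (1 : M₃) k j := fun k => by
    rw [hm, Int.cast_sub, Matrix.one_apply, Matrix.one_apply]; split_ifs <;> simp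
  simp only [e3, mul_sub, Finset.sum_sub_distrib]; rw [← e1, e2, sub_self]

lemma trace_conj_int {g γ l : G} (hγ : γ ∈ Gamma) (hl : l = g * γ * g⁻¹) : ∃ n : ℤ, (l : M₃).trace = n := by
  obtain ⟨m, hm⟩ := exists_int_matrix hγ; refine ⟨m.trace, ?_⟩
  have : (l : M₃).trace = (γ : M₃).trace := by
    rw [hl, Matrix.SpecialLinearGroup.coe_mul, Matrix.trace_mul_comm, ← Matrix.SpecialLinearGroup.coe_mul]
    rw [inv_mul_cancel_left]
  rw [this, trace, trace]; simp [hm]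

lemma trace_inv (l : G) : ((l⁻¹ : G) : M₃).trace =
    (l 1 1 * l 2 2 - l 1 2 * l 2 1) + (l 0 0 * l 2 2 - l 0 2 * l 2 0) + (l 0 0 * l 1 1 - l 0 1 * l 1 0) := by
  rw [Matrix.SpecialLinearGroup.coe_inv, adjugate_fin_three, trace, Fin.sum_univ_three]; simp

/-- A recurrent positive measure set of irrational points contains pairs of points that are close
but differ transversally to the normalizer of `uu`. -/
lemma exists_transverse_pair (hU : ∀ r, uu r ∈ stab ν)
    {K : Set X} (hK : IsCompact K) (hν : ν K ≠ 0) (hirr : ∀ x ∈ K, IrrationalPt x) {θ : ℝ} (hθ : 0 < θ) :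
    ∃ x ∈ K, ∃ h ∈ nearOne θ, h • x ∈ K ∧ (h 1 0 ≠ 0 ∨ h 1 2 ≠ 0 ∨ h 2 0 ≠ 0) := by
  obtain ⟨x, hx, n, hn, hnx, h, hh, he⟩ := exists_return (hU 1) hK hν (θ := min θ (1 / 8)) (by positivity)
  refine ⟨x, hx, h, nearOne_mono (min_le_left _ _) hh, he ▸ hnx, ?_⟩; by_contra! hcon; obtain ⟨h10, h12, h20⟩ := hcon
  replace hh := nearOne_mono (min_le_right _ _) hh; obtain ⟨g, rfl⟩ := exists_rep x
  obtain ⟨γ, hγ, hl⟩ := exists_gamma he.symm; rw [← uu_nat, ← uu_neg] at hl; set l := uu (-(n : ℝ)) * h with hldef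
  have l00 : l 0 0 = h 0 0 := by simp [hldef, mul₃, h10]
  have l01 : l 0 1 = h 0 1 - n * h 1 1 := by simp [hldef, mul₃]; ring
  have l02 : l 0 2 = h 0 2 := by simp [hldef, mul₃, h12]
  have l10 : l 1 0 = 0 := by simp [hldef, mul₃, h10]
  have l11 : l 1 1 = h 1 1 := by simp [hldef, mul₃]
  have l12 : l 1 2 = 0 := by simp [hldef, mul₃, h12]
  have l20 : l 2 0 = 0 := by simp [hldef, mul₃, h20]
  have l21 : l 2 1 = h 2 1 := by simp [hldef, mul₃]
  have l22 : l 2 2 = h 2 2 := by simp [hldef, mul₃]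
  obtain ⟨⟨a0, a3, -⟩, ⟨-, a1, -⟩, -, -, a2⟩ := nearOne.entries hh; rw [abs_le] at a0 a1 a2 a3
  obtain ⟨k1, hk1⟩ := trace_conj_int hγ hl; have hl' : l⁻¹ = g * γ⁻¹ * g⁻¹ := by rw [hl]; group
  obtain ⟨k2, hk2⟩ := trace_conj_int (inv_mem hγ) hl'; rw [trace_inv] at hk2; rw [trace, Fin.sum_univ_three] at hk1
  change l 0 0 + l 1 1 + l 2 2 = _ at hk1; rw [l00, l11, l22] at hk1; rw [l00, l11, l22, l10, l12, l20] at hk2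
  set p := h 0 0; set q := h 1 1; set s := h 2 2
  have three : ∀ {k : ℤ}, (2 : ℝ) < k → (k : ℝ) < 4 → k = 3 := fun h1 h2 => by norm_cast at h1 h2; omega
  rw [three (k := k1) (by linarith) (by linarith)] at hk1; rw [three (k := k2) (by nlinarith) (by nlinarith)] at hk2
  push_cast at hk1 hk2; have hq : q = 1 := by nlinarith [sq_nonneg (p - 1), sq_nonneg (q - 1), sq_nonneg (s - 1)]
  refine not_irrationalPt_of_row hγ hl ?_ ?_ (hirr _ hx)
  · intro h1; have : l 0 1 = 0 := by rw [h1]; simp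
    rw [l01] at this; have hn1 : (1 : ℝ) ≤ n := by exact_mod_cast Nat.one_le_iff_ne_zero.2 hn
    rw [hq] at this; linarith
  · intro j
    fin_cases j
    · simpa using l10
    · exact l11.trans hq
    · simpa using l12

/-! ### Limits of drifts -/

lemma exists_drift {K : Set X} (hK : UnifGeneric ν K) {κ : ℝ}
    (H : ∀ θ > 0, ∃ x ∈ K, ∃ h ∈ nearOne θ, h • x ∈ K ∧ (h 1 0 ≠ 0 ∨ h 1 2 ≠ 0 ∨ h 2 0 ≠ 0) ∧
      κ * |h 1 0| ≤ max |h 1 2| |h 2 0|) :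
    ∃ α β γ : ℝ, |α| ≤ 1 / 2 ∧ (α ≠ 0 ∨ β ≠ 0 ∨ γ ≠ 0) ∧ κ * |α| ≤ max |β| |γ| ∧
      ∀ τ : ℝ, 0 < τ → τ ≤ 1 → ∀ hne, driftElt α β γ τ hne ∈ stab ν := by
  choose x hx h hh hy h0 hκ using fun n : ℕ => H (1 / (n + 1)) (by positivity)
  set m : ℕ → ℝ := fun n => max |h n 1 0| (max |h n 1 2| |h n 2 0|) with hm
  have hm0 : ∀ n, 0 < m n := fun n => by simp only [hm, lt_max_iff, abs_pos]; exact h0 n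
  have hm1 : ∀ n, m n ≤ 1 / (n + 1) := fun n => by
    have b : ∀ i j : Fin 3, i ≠ j → |h n i j| ≤ 1 / (n + 1) := fun i j hij => by
      have := hh n i j; rwa [one_apply_ne hij, sub_zero] at this
    simp only [hm, max_le_iff]; exact ⟨b 1 0 (by decide), b 1 2 (by decide), b 2 0 (by decide)⟩
  set r : ℕ → ℝ := fun n => 1 / (2 * m n) with hr
  have hr0 : ∀ n, 0 < r n := fun n => by have := hm0 n; simp only [hr]; positivity
  have hrm : ∀ n, r n * m n = 1 / 2 := fun n => by have := (hm0 n).ne'; simp only [hr]; field_simp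
  have hrt : Tendsto r atTop atTop := by
    refine tendsto_atTop_mono (f := fun n : ℕ => (n : ℝ) / 2) (fun n => ?_)
      (tendsto_natCast_atTop_atTop.atTop_div_const (by norm_num))
    simp only [hr]; rw [div_le_div_iff₀ (by norm_num) (by have := hm0 n; positivity)]; have h1 := hm1 n
    rw [le_div_iff₀ (by positivity)] at h1; have := hm0 n; nlinarith
  have hh1 : Tendsto h atTop (𝓝 1) := by
    refine tendsto_of_entries fun i j => ?_; rw [tendsto_iff_norm_sub_tendsto_zero]
    exact squeeze_zero (fun n => norm_nonneg _) (fun n => hh n i j) tendsto_one_div_add_atTop_nhds_zero_nat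
  set V : ℕ → ℝ × ℝ × ℝ := fun n => (r n * h n 1 0, r n * h n 1 2, r n * h n 2 0)
  have habs : ∀ n, ∀ t : ℝ, |t| ≤ m n → |r n * t| ≤ 1 / 2 := fun n t ht => by
    rw [abs_mul, abs_of_pos (hr0 n), ← hrm n]; exact mul_le_mul_of_nonneg_left ht (hr0 n).le
  have hVb : ∀ n, V n ∈ Metric.closedBall (0 : ℝ × ℝ × ℝ) (1 / 2) := fun n => by
    rw [mem_closedBall_zero_iff, Prod.norm_def, Prod.norm_def]; refine max_le ?_ (max_le ?_ ?_)
    · exact habs n _ (le_max_left _ _)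
    · exact habs n _ ((le_max_left _ _).trans (le_max_right _ _))
    · exact habs n _ ((le_max_right _ _).trans (le_max_right _ _))
  obtain ⟨⟨α, β, γ⟩, -, φ, hφ, hlim⟩ := (isCompact_closedBall (0 : ℝ × ℝ × ℝ) (1 / 2)).tendsto_subseq hVb
  have hφt := hφ.tendsto_atTop
  have lα : Tendsto (fun n => r (φ n) * h (φ n) 1 0) atTop (𝓝 α) := (continuous_fst.tendsto _).comp hlim
  have lβ : Tendsto (fun n => r (φ n) * h (φ n) 1 2) atTop (𝓝 β) :=
    ((continuous_fst.comp continuous_snd).tendsto _).comp hlim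
  have lγ : Tendsto (fun n => r (φ n) * h (φ n) 2 0) atTop (𝓝 γ) :=
    ((continuous_snd.comp continuous_snd).tendsto _).comp hlim
  have hmax : max |α| (max |β| |γ|) = 1 / 2 := by
    refine tendsto_nhds_unique (lα.abs.max (lβ.abs.max lγ.abs)) ?_; refine tendsto_const_nhds.congr fun n => ?_
    rw [← hrm (φ n), hm]; simp only [abs_mul, abs_of_pos (hr0 (φ n)), mul_max_of_nonneg _ _ (hr0 (φ n)).le]
  have hαle : |α| ≤ 1 / 2 := hmax ▸ le_max_left _ _; refine ⟨α, β, γ, hαle, ?_, ?_, fun τ h0 h1 hne => ?_⟩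
  · by_contra! hcon; obtain ⟨rfl, rfl, rfl⟩ := hcon; norm_num at hmax
  · refine le_of_tendsto_of_tendsto (lα.abs.const_mul κ) (lβ.abs.max lγ.abs) ?_; refine .of_forall fun n => ?_
    simp only [abs_mul, abs_of_pos (hr0 (φ n))]; rw [← mul_max_of_nonneg _ _ (hr0 (φ n)).le, mul_left_comm]
    exact mul_le_mul_of_nonneg_left (hκ _) (hr0 _).le
  · have hpos : 0 < 1 + τ * α := by nlinarith [abs_le.1 hαle]
    exact driftElt_mem_stab (h := h ∘ φ) (r := r ∘ φ) hK (fun n => hx (φ n)) (fun n => hy (φ n))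
      (hh1.comp hφt) (hrt.comp hφt) lα lβ lγ h0 hpos

/-! ### Relations between the subgroups -/

lemma nn_mul (p w p' w' : ℝ) : nn p w * nn p' w' = nn (p + p') (w + w') * uu (p * w') := by
  apply G_ext_fin <;> simp [mul₃, add_comm]

lemma nn_uu (p w r : ℝ) : nn p w * uu r = uu r * nn p w := by apply G_ext_fin <;> simp [mul₃]

lemma dd_nn (a : ℝ) (ha : a ≠ 0) (p w : ℝ) : dd a ha * nn p w * (dd a ha)⁻¹ = nn (a * p) (a * w) := by
  rw [mul_inv_eq_iff_eq_mul]; apply G_ext_fin <;> simp [mul₃]; field_simp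

lemma dd_mul (a b : ℝ) (ha : a ≠ 0) (hb : b ≠ 0) : dd a ha * dd b hb = dd (a * b) (mul_ne_zero ha hb) := by
  apply G_ext_fin <;> simp [mul₃]; ring

lemma driftElt_eq (α β γ τ : ℝ) (h : 1 + τ * α ≠ 0) :
    driftElt α β γ τ h = nn (τ * β) (-(τ * γ)) * dd (1 + τ * α) h := by
  apply G_ext_fin <;> simp [mul₃, driftElt]; ring

lemma driftElt_eq_conj (α β γ τ : ℝ) (hα : α ≠ 0) (h : 1 + τ * α ≠ 0) :
    nn (β / α) (-(γ / α)) * (uu (β / α * (γ / α) * (τ * α)) * driftElt α β γ τ h) *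
      (nn (β / α) (-(γ / α)))⁻¹ = dd (1 + τ * α) h := by
  obtain ⟨c, rfl⟩ : ∃ c, γ = c * α := ⟨γ / α, by field_simp⟩; obtain ⟨b, rfl⟩ : ∃ b, β = b * α := ⟨β / α, by field_simp⟩
  rw [mul_inv_eq_iff_eq_mul, mul_div_cancel_right₀ _ hα, mul_div_cancel_right₀ _ hα]; have h1 := mul_inv_cancel₀ h
  apply G_ext_fin <;> simp only [mul_entry] <;> simp [driftElt, div_eq_mul_inv]
  · ring
  · ring
  · linear_combination (-c) * h1

lemma addSubgroup_eq_top (T : AddSubgroup ℝ) {c : ℝ} (hc : 0 < c) (h : ∀ t, 0 < t → t ≤ c → t ∈ T) (s : ℝ) : s ∈ T := by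
  have pos : ∀ s, 0 < s → s ∈ T := by
    intro s hs; obtain ⟨n, hn⟩ := exists_nat_ge (s / c); have hn0 : (0 : ℝ) < n := lt_of_lt_of_le (by positivity) hn
    have : s = n • (s / n) := by rw [nsmul_eq_mul]; field_simp
    rw [this]; refine T.nsmul_mem (h _ (by positivity) ?_) n; rw [div_le_iff₀ hc] at hn; rw [div_le_iff₀ hn0]; linarith
  rcases lt_trichotomy s 0 with hs | rfl | hs
  · have := T.neg_mem (pos (-s) (by linarith)); simpa using this
  · exact T.zero_mem
  · exact pos s hs

/-- The times at which a one-parameter family, additive modulo `uu`, preserves a measure. -/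
lemma nn_line_mem_stab {ν : Measure X} (hU : ∀ r, uu r ∈ stab ν) {p w c : ℝ} (hc : 0 < c)
    (h : ∀ s, 0 < s → s ≤ c → nn (s * p) (s * w) ∈ stab ν) (s : ℝ) : nn (s * p) (s * w) ∈ stab ν := by
  let T : AddSubgroup ℝ := {
      carrier := {s | nn (s * p) (s * w) ∈ stab ν}
      zero_mem' := by simp [nn_zero]
      add_mem' := by
        intro a b ha hb; have := mul_mem (mul_mem ha hb) (hU (-(a * p * (b * w))))
        rw [nn_mul, mul_assoc, ← uu_add, add_neg_cancel, uu_zero, mul_one] at this; simpa [add_mul] using this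
      neg_mem' := by
        intro a ha
        have h1 : nn (-a * p) (-a * w) = (nn (a * p) (a * w))⁻¹ * uu (-(a * p * (a * w))) := by
          rw [eq_inv_mul_iff_mul_eq, nn_mul]; simp [nn_zero]
        change nn (-a * p) (-a * w) ∈ stab ν; rw [h1]
        exact mul_mem (inv_mem ha) (hU _) }
  exact addSubgroup_eq_top T hc h s

lemma dd_mem_stab {ν : Measure X} {c : ℝ} (hc : c ≠ 0)
    (h : ∀ τ, 0 < τ → τ ≤ 1 → dd (exp (τ * c)) (exp_pos _).ne' ∈ stab ν) (a : ℝ) (ha : 0 < a) :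
    dd a ha.ne' ∈ stab ν := by
  let T : AddSubgroup ℝ := {
      carrier := {s | dd (exp (s * c)) (exp_pos _).ne' ∈ stab ν}
      zero_mem' := by
        have : dd (exp (0 * c)) (exp_pos _).ne' = 1 := by apply G_ext_fin <;> simp
        change dd (exp (0 * c)) _ ∈ stab ν; exact this ▸ one_mem _
      add_mem' := by
        intro a b ha hb; have := (stab ν).mul_mem ha hb; rw [dd_mul] at this
        simpa only [mem_ofPred_eq, add_mul, exp_add] using this
      neg_mem' := by
        intro a ha
        have h1 : dd (exp (-a * c)) (exp_pos _).ne' = (dd (exp (a * c)) (exp_pos _).ne')⁻¹ := by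
          rw [eq_inv_iff_mul_eq_one, dd_mul]; apply G_ext_fin <;> simp [← exp_add]
        change dd (exp (-a * c)) (exp_pos _).ne' ∈ stab ν; rw [h1]
        exact inv_mem ha }
  have := addSubgroup_eq_top T one_pos h (Real.log a / c); change dd (exp (Real.log a / c * c)) _ ∈ stab ν at this
  simpa only [div_mul_cancel₀ _ hc, exp_log ha] using this

/-! ### Conjugation by the centralizer of `uu` -/

lemma orbitAvg_smul {c : G} (hc : ∀ r, c * uu r = uu r * c) (f : X → ℝ) (N : ℕ) (x : X) :
    orbitAvg f N (c • x) = orbitAvg (fun y => f (c • y)) N x := by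
  simp only [orbitAvg, smul_smul, hc]

lemma Generic.smul {ν : Measure X} {c : G} (hc : ∀ r, c * uu r = uu r * c) {x : X} (hx : Generic ν x) :
    Generic (Measure.map (fun x => c • x) ν) (c • x) := by
  intro f hf hcs; rw [integral_map (measurable_smulX c).aemeasurable hf.aestronglyMeasurable]
  simp only [orbitAvg_smul hc]; exact hx _ (hf.comp (continuous_const_smul c)) (hcs.comp_smulX c)

/-- Two generic points on a common orbit of the centralizer of `uu` differ by the stabilizer. -/
lemma mem_stab_of_generic {c : G}
    (hc : ∀ r, c * uu r = uu r * c) {x : X} (hx : Generic ν x) (hcx : Generic ν (c • x)) : c ∈ stab ν := by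
  refine mem_stab_of_integral fun f hf hcs => ?_; refine tendsto_nhds_unique ?_ (hcx f hf hcs)
  simp only [orbitAvg_smul hc]; exact hx _ (hf.comp (continuous_const_smul c)) (hcs.comp_smulX c)

lemma IrrationalPt.nn_smul {x : X} (hx : IrrationalPt x) (p w : ℝ) : IrrationalPt (nn p w • x) := by
  intro g hg; have h1 : (((nn p w)⁻¹ * g : G) : X) = x := by rw [← smul_mk, hg, inv_smul_smul]
  have e : g = nn p w * ((nn p w)⁻¹ * g) := by group
  have e' : g⁻¹ * nn p w = ((nn p w)⁻¹ * g)⁻¹ := by group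
  obtain ⟨ha, hb⟩ := hx _ h1; refine ⟨fun v hv h0 => ha v hv ?_, fun v hv h0 => hb v hv ?_⟩
  · rw [← h0]; refine Finset.sum_congr rfl fun j _ => ?_
    conv_rhs => rw [e, mul_entry (nn p w)]
    simp
  · rw [← h0, ← e']; refine Finset.sum_congr rfl fun j _ => ?_; rw [mul_entry]; simp

/-! ### Pairs of nearby points when no transverse unipotent is available -/


lemma exists_tilt (hD : ∀ a (ha : 0 < a), dd a ha.ne' ∈ stab ν)
    (hH : ∀ p w, nn p w ∈ stab ν → p = 0 ∧ w = 0) {K : Set X} (hK : UnifGeneric ν K) {κ : ℝ}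
    (hκ : 0 < κ) : ∃ θ > 0, ∀ x ∈ K, ∀ h ∈ nearOne θ, h • x ∈ K →
      |h 1 2| ≤ κ * |h 1 0| ∧ |h 2 0| ≤ κ * |h 1 0| := by
  by_contra! hcon
  obtain ⟨α, β, γ, hα, hne, hmax, hst⟩ := exists_drift (κ := κ) hK (fun θ hθ => by
    obtain ⟨x, hx, h, hh, hy, hbad⟩ := hcon θ hθ
    have hlt : κ * |h 1 0| < max |h 1 2| |h 2 0| := by
      by_cases h1 : |h 1 2| ≤ κ * |h 1 0|
      · exact lt_max_of_lt_right (hbad h1)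
      · exact lt_max_of_lt_left (not_le.1 h1)
    refine ⟨x, hx, h, hh, hy, ?_, hlt.le⟩; by_contra! h0; rw [h0.1, h0.2.1, h0.2.2] at hlt
    simp at hlt)
  have hpos : (0 : ℝ) < 1 + 1 * α := by linarith [(abs_le.1 hα).1]
  have h1 := hst 1 one_pos le_rfl hpos.ne'; rw [driftElt_eq] at h1
  have h2 := hH _ _ ((Subgroup.mul_mem_cancel_right _ (hD _ hpos)).1 h1); simp only [one_mul, neg_eq_zero] at h2
  rw [h2.1, h2.2] at hmax
  have : α = 0 := by by_contra h0; have := mul_pos hκ (abs_pos.2 h0); simp at hmax; linarith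
  simp [this, h2] at hne

lemma exists_shear (hU : ∀ r, uu r ∈ stab ν) (hH : ∀ p w, nn p w ∈ stab ν → p = 0 ∧ w = 0) {K : Set X}
    (hK : UnifGeneric ν K) (hKc : IsCompact K) {η : ℝ} (hη : 0 < η) :
    ∃ θ > 0, ∀ x ∈ K, ∀ h : G, h • x ∈ K → |h 1 0| ≤ θ → |h 2 0| ≤ θ → |h 1 2| ≤ θ →
      (∀ i, |h i i - 1| ≤ θ) → |h 0 1| ≤ 1 → |h 0 2| ≤ 1 → |h 2 1| ≤ 1 →
      |h 0 2| ≤ η ∧ |h 2 1| ≤ η := by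
  by_contra! hcon
  choose x hx h hy h10 h20 h12 hd h01 h02 h21 hbad using fun n : ℕ => hcon (1 / (n + 1)) (by positivity)
  have hle1 : ∀ n : ℕ, (1 : ℝ) / (n + 1) ≤ 1 := fun n => by
    rw [div_le_one (by positivity)]; linarith [(Nat.cast_nonneg n : (0 : ℝ) ≤ n)]
  have hb : ∀ n, (h n, x n) ∈ {g : G | ∀ i j, |g i j| ≤ 2} ×ˢ K := fun n => by
    have e := hle1 n
    have hd' : ∀ i, |h n i i| ≤ 2 := fun i => by have := abs_le.1 (hd n i); rw [abs_le]; constructor <;> linarith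
    have a1 := h10 n; have a2 := h20 n; have a3 := h12 n; have a4 := h01 n; have a5 := h02 n; have a6 := h21 n
    refine ⟨fun i j => ?_, hx n⟩
    fin_cases i <;> fin_cases j <;> first | exact hd' _ | (simp; linarith)
  obtain ⟨⟨g, y⟩, ⟨-, hyK⟩, φ, hφ, hlim⟩ := ((isCompact_bounded 2).prod hKc).tendsto_subseq hb
  have lg : Tendsto (fun n => h (φ n)) atTop (𝓝 g) := (continuous_fst.tendsto _).comp hlim
  have ly : Tendsto (fun n => x (φ n)) atTop (𝓝 y) := (continuous_snd.tendsto _).comp hlim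
  have le : ∀ i j, Tendsto (fun n => h (φ n) i j) atTop (𝓝 (g i j)) := fun i j =>
    ((continuous_entry i j).tendsto g).comp lg
  have l0 : Tendsto (fun n : ℕ => (1 : ℝ) / ((φ n : ℕ) + 1)) atTop (𝓝 0) :=
    tendsto_one_div_add_atTop_nhds_zero_nat.comp hφ.tendsto_atTop
  have z : ∀ (c : ℕ → ℝ) (d : ℝ), Tendsto (fun n => c (φ n)) atTop (𝓝 d) →
      (∀ n : ℕ, |c n| ≤ 1 / (n + 1)) → d = 0 := fun c d hc hcn => by
    refine tendsto_nhds_unique hc (squeeze_zero_norm (fun n => hcn (φ n)) l0)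
  have g10 : g 1 0 = 0 := z _ _ (le 1 0) h10; have g20 : g 2 0 = 0 := z _ _ (le 2 0) h20
  have g12 : g 1 2 = 0 := z _ _ (le 1 2) h12
  have gd : ∀ i, g i i = 1 := fun i => by
    have := z (fun n => h n i i - 1) _ ((le i i).sub_const 1) (fun n => hd n i); linarith
  have hgy : g • y ∈ K := hKc.isClosed.mem_of_tendsto (lg.smul ly) (.of_forall fun n => hy (φ n))
  have eg : g = nn (g 0 2) (g 2 1) * uu (g 0 1) := by apply G_ext_fin <;> simp [mul₃, g10, g20, g12, gd]
  have hcomm : ∀ r, g * uu r = uu r * g := fun r => by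
    rw [eg, mul_assoc, ← uu_add, add_comm, uu_add, ← mul_assoc, nn_uu, mul_assoc]
  have hst := mem_stab_of_generic hcomm (hK.generic hyK) (hK.generic hgy); rw [eg] at hst
  have h0 := hH _ _ ((Subgroup.mul_mem_cancel_right _ (hU _)).1 hst)
  have ev : ∀ {i j}, g i j = 0 → ∀ᶠ n in atTop, |h (φ n) i j| < η := fun h0 =>
    (le _ _).abs.eventually_lt_const (by simpa [h0] using hη)
  obtain ⟨n, hn1, hn2⟩ := ((ev h0.1).and (ev h0.2)).exists; exact absurd (hbad (φ n) hn1.le) (not_lt.2 hn2.le)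

/-! ### Fibrewise density -/

lemma measurableSet_orbit {p : ℝ → G} (hp : Continuous p) {A : Set X} (hA : MeasurableSet A) :
    MeasurableSet {q : X × ℝ | p q.2 • q.1 ∈ A} := by
  have : Measurable fun q : X × ℝ => p q.2 • q.1 := ((hp.comp continuous_snd).smul continuous_fst).measurable
  exact this hA

lemma measurable_fibre {p : ℝ → G} (hp : Continuous p) {A : Set X} (hA : MeasurableSet A) (I : Set ℝ) :
    Measurable fun x : X => (volume.restrict I) {ζ | p ζ • x ∈ A} :=
  measurable_measure_prodMk_left (measurableSet_orbit hp hA)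

lemma lintegral_fibre {p : ℝ → G} (hp : Continuous p) (hst : ∀ ζ, p ζ ∈ stab ν) {A : Set X} (hA : MeasurableSet A) :
    ∫⁻ x, (volume.restrict 𝕀) {ζ | p ζ • x ∈ A} ∂ν = ν A := by
  have h1 := Measure.prod_apply (μ := ν) (ν := volume.restrict 𝕀) (measurableSet_orbit hp hA)
  have h2 := Measure.prod_apply_symm (μ := ν) (ν := volume.restrict 𝕀) (measurableSet_orbit hp hA)
  have h3 : ∀ ζ, ν ((fun x => (x, ζ)) ⁻¹' {q : X × ℝ | p q.2 • q.1 ∈ A}) = ν A := fun ζ =>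
    (measurePreserving_of_mem_stab (hst ζ)).measure_preimage hA.nullMeasurableSet
  simp only [h3] at h2; rw [h1] at h2; simpa using h2

/-- The points whose orbit segment spends a large proportion of time in `A` are rare. -/
lemma measure_bad_le {p : ℝ → G} (hp : Continuous p)
    (hst : ∀ ζ, p ζ ∈ stab ν) {A : Set X} (hA : MeasurableSet A) (c : ℝ≥0∞) :
    c * ν {x | c ≤ (volume.restrict 𝕀) {ζ | p ζ • x ∈ A}} ≤ ν A := by
  rw [← lintegral_fibre hp hst hA]; exact mul_meas_ge_le_lintegral (measurable_fibre hp hA _) c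

lemma exists_compact_subset_ne_zero {A : Set X} (hA : MeasurableSet A)
    (h0 : ν A ≠ 0) : ∃ K ⊆ A, IsCompact K ∧ ν K ≠ 0 := by
  obtain ⟨K, hKA, hK, h⟩ := hA.exists_lt_isCompact (μ := ν) (pos_iff_ne_zero.2 h0); exact ⟨K, hKA, hK, pos_iff_ne_zero.1 h⟩

/-! ### Measures invariant under the block copy of `SL(2)` -/

/-- The parameter correcting the lower-left entry. -/
lemma exists_correction {h : G} {θ : ℝ} (hθ : θ ≤ 1 / 16) (hh : h ∈ nearOne θ) {a : ℝ}
    (ha : a ∈ 𝕀) {ζ : ℝ} (hζ : ζ = (h 1 0 + a * h 0 0) / (h 1 1 + a * h 0 1))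
    (hζ1 : ζ ∈ 𝕀) :
    ll a * h * (ll ζ)⁻¹ ∈ nearOne (2 * θ) ∧ (ll a * h * (ll ζ)⁻¹) 1 0 = 0 ∧
      (ll a * h * (ll ζ)⁻¹) 1 2 = h 1 2 + a * h 0 2 ∧
      (ll a * h * (ll ζ)⁻¹) 2 0 = h 2 0 - ζ * h 2 1 := by
  obtain ⟨⟨e00, e01, e02⟩, ⟨e10, e11, e12⟩, e20, e21, e22⟩ := nearOne.entries hh
  have mulb : ∀ c t : ℝ, c ∈ 𝕀 → |t| ≤ θ → |c * t| ≤ θ := fun c t hc ht => by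
    rw [abs_mul, abs_of_nonneg hc.1]; nlinarith [hc.1, hc.2, abs_nonneg t]
  have hθ0 : 0 ≤ θ := (abs_nonneg _).trans e01
  have hden : h 1 1 + a * h 0 1 ≠ 0 := by have := abs_le.1 (mulb a _ ha e01); have := abs_le.1 e11; intro h0; linarith
  set q := ll a * h * (ll ζ)⁻¹ with hq
  have hζe : ζ * (h 1 1 + a * h 0 1) = h 1 0 + a * h 0 0 := by rw [hζ, div_mul_cancel₀ _ hden]
  rw [← ll_neg] at hq; have q00 : q 0 0 = h 0 0 - ζ * h 0 1 := by rw [hq]; simp only [mul_entry]; simp; ring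
  have q01 : q 0 1 = h 0 1 := by rw [hq]; simp only [mul_entry]; simp
  have q02 : q 0 2 = h 0 2 := by rw [hq]; simp only [mul_entry]; simp
  have q10 : q 1 0 = 0 := by rw [hq]; simp only [mul_entry]; simp; linear_combination -hζe
  have q11 : q 1 1 = h 1 1 + a * h 0 1 := by rw [hq]; simp only [mul_entry]; simp; ring
  have q12 : q 1 2 = h 1 2 + a * h 0 2 := by rw [hq]; simp only [mul_entry]; simp; ring
  have q20 : q 2 0 = h 2 0 - ζ * h 2 1 := by rw [hq]; simp only [mul_entry]; simp; ring
  have q21 : q 2 1 = h 2 1 := by rw [hq]; simp only [mul_entry]; simp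
  have q22 : q 2 2 = h 2 2 := by rw [hq]; simp only [mul_entry]; simp
  refine ⟨fun i j => ?_, q10, q12, q20⟩; have m1 := abs_le.1 (mulb ζ _ hζ1 e01); have m2 := abs_le.1 (mulb a _ ha e01)
  have m3 := abs_le.1 (mulb a _ ha e02); have m4 := abs_le.1 (mulb ζ _ hζ1 e21)
  rw [abs_le] at *
  fin_cases i <;> fin_cases j <;> simp [q00, q01, q02, q10, q11, q12, q20, q21, q22] <;>
    first | linarith | (constructor <;> linarith)


/-- Nearby points in a suitable set of positive measure differ by a block matrix. -/
lemma exists_block_set (hL : ∀ r, ll r ∈ stab ν) (hD : ∀ a (ha : 0 < a), dd a ha.ne' ∈ stab ν)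
    (hgen : ∀ᵐ x ∂ν, Generic ν x) (hirr : ∀ᵐ x ∂ν, IrrationalPt x)
    (hH : ∀ p w, nn p w ∈ stab ν → p = 0 ∧ w = 0) :
    ∃ K : Set X, IsCompact K ∧ ν K ≠ 0 ∧ (∀ x ∈ K, IrrationalPt x) ∧ ∃ θ > 0, ∀ x ∈ K, ∀ h ∈ nearOne θ,
      h • x ∈ K → h 0 2 = 0 ∧ h 1 2 = 0 ∧ h 2 0 = 0 ∧ h 2 1 = 0 := by
  obtain ⟨K, hK, hKg, hKi, hKν⟩ := exists_compact_unifGeneric hgen hirr (ε := 1 / 64) (by norm_num)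
  set bad : X → Set ℝ := fun x => {ζ | ll ζ • x ∈ Kᶜ} with hbad
  set B : Set X := {x | ofR (1 / 16) ≤ (volume.restrict 𝕀) (bad x)} with hB
  have hBν : ν B ≤ ofR (1 / 4) := by
    have h1 := (measure_bad_le continuous_ll hL hK.measurableSet.compl (ofR (1 / 16))).trans hKν; by_contra! hcon
    have h2 : ofR (1 / 16) * ofR (1 / 4) < ofR (1 / 16) * ν B :=
      ENNReal.mul_lt_mul_right (by norm_num) ofReal_ne_top hcon
    rw [← ofReal_mul (by norm_num), show (1 / 16 * (1 / 4) : ℝ) = 1 / 64 by norm_num] at h2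
    exact (h2.trans_le h1).false
  have hBm : MeasurableSet B := measurableSet_le measurable_const
    (measurable_fibre continuous_ll hK.measurableSet.compl _)
  have hpos : ν (K \ B) ≠ 0 := by
    intro h0
    have h1 : (Set.univ : Set X) ⊆ (Kᶜ ∪ B) ∪ K \ B := fun x _ => by
      by_cases hx : x ∈ K <;> by_cases hx' : x ∈ B <;> simp [hx, hx']
    have h2 := (measure_mono (μ := ν) h1).trans ((measure_union_le _ _).trans
      (add_le_add_left (measure_union_le _ _) _))
    rw [h0, add_zero, measure_univ] at h2; have h3 := h2.trans (add_le_add hKν hBν)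
    rw [← ofReal_add (by norm_num) (by norm_num), ← ofReal_one, ofReal_le_ofReal_iff (by norm_num)] at h3
    norm_num at h3
  obtain ⟨K', hK's, hK', hK'0⟩ := exists_compact_subset_ne_zero (hK.measurableSet.diff hBm) hpos
  obtain ⟨θ₁, hθ₁, htilt⟩ := exists_tilt hD hH hKg (κ := 1) one_pos
  refine ⟨K', hK', hK'0, fun x hx => hKi x (hK's hx).1, min (1 / 16) (θ₁ / 2), by positivity, ?_⟩; intro x hx h hh hy
  set θ := min (1 / 16) (θ₁ / 2); have hθ : θ ≤ 1 / 16 := min_le_left _ _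
  have hθ2 : 2 * θ ≤ θ₁ := by have : θ ≤ θ₁ / 2 := min_le_right _ _; linarith
  obtain ⟨⟨e00, e01, -⟩, ⟨e10, e11, -⟩, -⟩ := nearOne.entries (nearOne_mono hθ hh); rw [abs_le] at e00 e01 e10 e11
  set ψ : ℝ → ℝ := fun a => (h 1 0 + a * h 0 0) / (h 1 1 + a * h 0 1) with hψ
  set φ : ℝ → ℝ := fun z => (z * h 1 1 - h 1 0) / (h 0 0 - z * h 0 1) with hφ
  have hdenψ : ∀ a ∈ 𝕀, 7 / 8 ≤ h 1 1 + a * h 0 1 := fun a ha => by nlinarith [ha.1, ha.2]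
  have hdenφ : ∀ a ∈ 𝕀, 7 / 8 ≤ h 0 0 - a * h 0 1 := fun a ha => by nlinarith [ha.1, ha.2]
  have hdet1 : h 0 0 * h 1 1 - h 0 1 * h 1 0 ≤ 3 / 2 := by nlinarith
  have hdet2 : 1 / 2 ≤ h 0 0 * h 1 1 - h 0 1 * h 1 0 := by nlinarith
  have hLip : LipschitzOnWith 2 ψ (Icc 0 1) := by
    refine LipschitzOnWith.of_dist_le_mul fun a ha b hb => ?_; have d1 := hdenψ a ha; have d2 := hdenψ b hb
    have : ψ a - ψ b = (a - b) * ((h 0 0 * h 1 1 - h 0 1 * h 1 0) / ((h 1 1 + a * h 0 1) * (h 1 1 + b * h 0 1))) := by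
      simp only [hψ]; rw [div_sub_div _ _ (by linarith) (by linarith), ← mul_div_assoc]; congr 1; ring
    rw [Real.dist_eq, Real.dist_eq, this, abs_mul, mul_comm]; refine mul_le_mul_of_nonneg_right ?_ (abs_nonneg _)
    have hp : (49 / 64 : ℝ) ≤ (h 1 1 + a * h 0 1) * (h 1 1 + b * h 0 1) := by nlinarith
    rw [abs_of_nonneg (by positivity), div_le_iff₀ (by linarith)]; push_cast; linarith
  have hφI : ∀ z ∈ Icc (1 / 4 : ℝ) (3 / 4), φ z ∈ 𝕀 ∧ ψ (φ z) = z := fun z hz => by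
    have d := hdenφ z ⟨by linarith [hz.1], by linarith [hz.2]⟩
    have h1 : φ z ∈ 𝕀 := by
      simp only [hφ, Set.mem_Icc]; rw [le_div_iff₀ (by linarith), div_le_iff₀ (by linarith)]
      constructor <;> nlinarith [hz.1, hz.2]
    refine ⟨h1, ?_⟩; have d' := hdenψ _ h1; simp only [hψ]; rw [div_eq_iff (by linarith)]
    have : φ z * (h 0 0 - z * h 0 1) = z * h 1 1 - h 1 0 := by simp only [hφ]; rw [div_mul_cancel₀ _ (by linarith)]
    linear_combination this
  -- good parameters
  set Ex : Set ℝ := 𝕀 ∩ bad x; set Ey : Set ℝ := 𝕀 ∩ bad (h • x)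
  have hvol : ∀ z ∈ K', volume (𝕀 ∩ bad z) ≤ ofR (1 / 16) := fun z hz => by
    have := (hK's hz).2; simp only [hB, mem_ofPred_eq, not_le] at this
    rw [Measure.restrict_apply' measurableSet_Icc, Set.inter_comm] at this; exact this.le
  have hψE : volume (ψ '' Ey) ≤ ofR (1 / 8) := by
    have := (hLip.mono (inter_subset_left : Ey ⊆ _)).hausdorffMeasure_image_le (d := 1) zero_le_one
    rw [hausdorffMeasure_real] at this; refine this.trans ?_; rw [ENNReal.rpow_one]
    refine (mul_le_mul_right (hvol _ hy) _).trans ?_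
    rw [show ((2 : NNReal) : ℝ≥0∞) = ofR 2 by norm_num, ← ofReal_mul (by norm_num)]; norm_num
  have hgood : ∀ z ∈ Icc (1 / 4 : ℝ) (3 / 4) \ (Ex ∪ ψ '' Ey), h 1 2 + φ z * h 0 2 = 0 ∧ h 2 0 - z * h 2 1 = 0 := by
    rintro z ⟨hz, hzE⟩
    have hz1 : z ∈ 𝕀 := ⟨by linarith [hz.1], by linarith [hz.2]⟩; obtain ⟨hφ1, hψφ⟩ := hφI z hz
    simp only [Set.mem_union, not_or] at hzE; have k1 : ll z • x ∈ K := not_not.1 fun hc => hzE.1 ⟨hz1, hc⟩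
    have k2 : ll (φ z) • h • x ∈ K := not_not.1 fun hc => hzE.2 ⟨φ z, ⟨hφ1, hc⟩, hψφ⟩
    obtain ⟨c1, c2, c3, c4⟩ := exists_correction hθ hh hφ1 (ζ := z) hψφ.symm hz1
    have := htilt _ k1 _ (nearOne_mono hθ2 c1) (by simpa [smul_smul] using k2); rw [c2] at this
    simp only [abs_zero, mul_zero, abs_nonpos_iff] at this; exact ⟨c3 ▸ this.1, c4 ▸ this.2⟩
  have hnt : (Icc (1 / 4 : ℝ) (3 / 4) \ (Ex ∪ ψ '' Ey)).Nontrivial := by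
    by_contra hns; rw [Set.not_nontrivial_iff] at hns
    have h0 : volume (Icc (1 / 4 : ℝ) (3 / 4) \ (Ex ∪ ψ '' Ey)) = 0 := hns.measure_zero volume
    have h2 := (measure_mono (μ := volume) (by rw [Set.union_diff_self]; exact Set.subset_union_right :
      Icc (1 / 4 : ℝ) (3 / 4) ⊆ (Ex ∪ ψ '' Ey) ∪ Icc (1 / 4) (3 / 4) \ (Ex ∪ ψ '' Ey))).trans ((measure_union_le _ _).trans
      (add_le_add_left (measure_union_le _ _) _))
    rw [h0, add_zero, volume_Icc] at h2; have h3 := h2.trans (add_le_add (hvol x hx) hψE)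
    rw [← ofReal_add (by norm_num) (by norm_num), ofReal_le_ofReal_iff (by norm_num)] at h3; norm_num at h3
  obtain ⟨z, hz, z', hz', hne⟩ := hnt; obtain ⟨a1, a2⟩ := hgood z hz; obtain ⟨b1, b2⟩ := hgood z' hz'
  have h21 : h 2 1 = 0 := by
    have : (z - z') * h 2 1 = 0 := by linear_combination b2 - a2
    exact (mul_eq_zero.1 this).resolve_left (sub_ne_zero.2 hne)
  have hφne : φ z ≠ φ z' := fun he => hne (by rw [← (hφI z hz.1).2, ← (hφI z' hz'.1).2, he])
  have h02 : h 0 2 = 0 := by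
    have : (φ z - φ z') * h 0 2 = 0 := by linear_combination a1 - b1
    exact (mul_eq_zero.1 this).resolve_left (sub_ne_zero.2 hφne)
  refine ⟨h02, ?_, ?_, h21⟩
  · rw [h02] at a1; simpa using a1
  · rw [h21] at a2; simpa using a2

lemma commutator_block_bound {k m : ℝ} (hk : 1 ≤ k) (hm : 1 ≤ m) {a b c d e f g h : ℝ}
    (ha : |a - 1| ≤ 1 / 100) (hb : |b| ≤ 1 / 100) (hc : |c| ≤ 1 / 100) (hd : |d - 1| ≤ 1 / 100)
    (he : |e - 1| ≤ 1 / 100) (hf : |f| ≤ 1 / 100) (hg : |g| ≤ 1 / 100) (hh : |h - 1| ≤ 1 / 100) :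
    ((b - k * d) * (g - m * e) - c * f) ^ 2 + (f * ((a - k * c) - d) + (b - k * d) * ((h - m * f) - e)) *
      (c * (e - (h - m * f)) + (g - m * e) * (d - (a - k * c))) ≠ 0 := by
  have lin : ∀ {n t : ℝ}, 1 ≤ n → |t| ≤ 1 / 100 → -(n / 100) ≤ n * t ∧ n * t ≤ n / 100 := fun {n t} hn ht => by
    rw [abs_le] at ht; constructor <;> nlinarith [ht.1, ht.2]
  have hkd := lin hk hd; have hme := lin hm he; have hkc := lin hk hc; have hmf := lin hm hf
  have hfa := hf; have hca := hc; rw [abs_le] at ha hb hc hd he hf hg hh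
  have h1 : 9 / 10 * k ≤ k * d - b ∧ k * d - b ≤ 11 / 10 * k := by constructor <;> linarith
  have h2 : 9 / 10 * m ≤ m * e - g ∧ m * e - g ≤ 11 / 10 * m := by constructor <;> linarith
  have mulb : ∀ {s t S T : ℝ}, |s| ≤ S → |t| ≤ T → |s * t| ≤ S * T := fun hs ht => by
    rw [abs_mul]; exact mul_le_mul hs ht (abs_nonneg _) ((abs_nonneg _).trans hs)
  have h6 : |(a - k * c) - d| ≤ 3 / 100 * k := by rw [abs_le]; constructor <;> linarith
  have h3 := mulb hfa h6; have h4 : |(h - m * f) - e| ≤ 3 / 100 * m := by rw [abs_le]; constructor <;> linarith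
  have h5 := mulb (s := b - k * d) (S := 11 / 10 * k) (by rw [abs_le]; constructor <;> linarith) h4
  have h7 := mulb hca (abs_sub_comm _ e ▸ h4)
  have h8 := mulb (s := g - m * e) (S := 11 / 10 * m) (by rw [abs_le]; constructor <;> linarith) (abs_sub_comm _ d ▸ h6)
  have hk' : k ≤ k * m := le_mul_of_one_le_right (by linarith) hm
  have hm' : m ≤ k * m := le_mul_of_one_le_left (by linarith) hk
  have b1 : |f * ((a - k * c) - d) + (b - k * d) * ((h - m * f) - e)| ≤ 1 / 10 * (k * m) :=
    (abs_add_le _ _).trans (by linarith)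
  have b2 : |c * (e - (h - m * f)) + (g - m * e) * (d - (a - k * c))| ≤ 1 / 10 * (k * m) :=
    (abs_add_le _ _).trans (by linarith)
  have b3 : 1 / 2 * (k * m) ≤ (b - k * d) * (g - m * e) - c * f := by
    have h9 := mul_le_mul h1.1 h2.1 (by positivity) (by linarith); have := (abs_le.1 (mulb hca hfa)).2; linarith
  have b5 := (abs_le.1 (mulb b1 b2)).1
  have b6 := mul_le_mul b3 b3 (by positivity) (by linarith [show 0 ≤ k * m by positivity])
  have b7 : 0 < (k * m) * (k * m) := by positivity
  intro h0; rw [sq] at h0; linarith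

/-- A probability measure invariant under the block copy of `SL(2)` and supported on irrational
points has a transverse unipotent in its stabilizer. -/
theorem exists_nn_of_SL2 (hU : ∀ r, uu r ∈ stab ν) (hL : ∀ r, ll r ∈ stab ν)
    (hD : ∀ a (ha : 0 < a), dd a ha.ne' ∈ stab ν)
    (hgen : ∀ᵐ x ∂ν, Generic ν x) (hirr : ∀ᵐ x ∂ν, IrrationalPt x)
    (hH : ∀ p w, nn p w ∈ stab ν → p = 0 ∧ w = 0) : False := by
  obtain ⟨K, hK, hK0, hKi, θ, hθ, hblock⟩ := exists_block_set hL hD hgen hirr hH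
  obtain ⟨B, hBK, hB, hB0, hBp⟩ := exists_small_piece hK hK0 (θ := min θ (1 / 100)) (by positivity)
  have r1 := (measurePreserving_of_mem_stab (hU 1)).conservative.ae_mem_imp_frequently_image_mem
    hB.measurableSet.nullMeasurableSet
  have r2 := (measurePreserving_of_mem_stab (hL 1)).conservative.ae_mem_imp_frequently_image_mem
    hB.measurableSet.nullMeasurableSet
  obtain ⟨x, hx, hx1, hx2⟩ : ∃ x ∈ B, (∃ᶠ n in atTop, (fun y => uu 1 • y)^[n] x ∈ B) ∧
      ∃ᶠ n in atTop, (fun y => ll 1 • y)^[n] x ∈ B := by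
    by_contra hcon
    refine hB0 (measure_mono_null (t := {x | ¬ ((x ∈ B → ∃ᶠ n in atTop, (fun y => uu 1 • y)^[n] x ∈ B) ∧
      (x ∈ B → ∃ᶠ n in atTop, (fun y => ll 1 • y)^[n] x ∈ B))}) ?_ (ae_iff.1 (r1.and r2)))
    intro x hx hc; exact hcon ⟨x, hx, hc.1 hx, hc.2 hx⟩
  obtain ⟨k, hk1, hkx⟩ := (hx1.and_eventually (eventually_ge_atTop 1)).exists.imp fun _ h => h.symm
  obtain ⟨m, hm1, hmx⟩ := (hx2.and_eventually (eventually_ge_atTop 1)).exists.imp fun _ h => h.symm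
  rw [smul_iterate_apply, ← uu_nat] at hkx; rw [smul_iterate_apply, ← ll_nat] at hmx
  obtain ⟨p, hp, hpe⟩ := hBp x hx _ hkx; obtain ⟨q, hq, hqe⟩ := hBp x hx _ hmx
  obtain ⟨p02, p12, p20, p21⟩ := hblock x (hBK hx) p (nearOne_mono (min_le_left _ _) hp) (hpe ▸ hBK hkx)
  obtain ⟨q02, q12, q20, q21⟩ := hblock x (hBK hx) q (nearOne_mono (min_le_left _ _) hq) (hqe ▸ hBK hmx)
  replace hp := nearOne_mono (min_le_right _ _) hp; replace hq := nearOne_mono (min_le_right _ _) hq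
  obtain ⟨g, rfl⟩ := exists_rep x; obtain ⟨γ, hγ, hl⟩ := exists_gamma hpe.symm
  obtain ⟨δ, hδ, hl'⟩ := exists_gamma hqe.symm; rw [← uu_neg] at hl; rw [← ll_neg] at hl'
  obtain ⟨c, hc⟩ := exists_int_matrix hγ; obtain ⟨d, hd⟩ := exists_int_matrix hδ; set A := uu (-(k : ℝ)) * p with hA
  set E := ll (-(m : ℝ)) * q with hE; have A00 : A 0 0 = p 0 0 - k * p 1 0 := by simp [hA, mul₃]; ring
  have A01 : A 0 1 = p 0 1 - k * p 1 1 := by simp [hA, mul₃]; ring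
  have A02 : A 0 2 = 0 := by simp [hA, mul₃, p02, p12]
  have A10 : A 1 0 = p 1 0 := by simp [hA, mul₃]
  have A11 : A 1 1 = p 1 1 := by simp [hA, mul₃]
  have A12 : A 1 2 = 0 := by simp [hA, mul₃, p12]
  have A20 : A 2 0 = 0 := by simp [hA, mul₃, p20]
  have A21 : A 2 1 = 0 := by simp [hA, mul₃, p21]
  have E00 : E 0 0 = q 0 0 := by simp [hE, mul₃]
  have E01 : E 0 1 = q 0 1 := by simp [hE, mul₃]
  have E02 : E 0 2 = 0 := by simp [hE, mul₃, q02]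
  have E10 : E 1 0 = q 1 0 - m * q 0 0 := by simp [hE, mul₃]; ring
  have E11 : E 1 1 = q 1 1 - m * q 0 1 := by simp [hE, mul₃]; ring
  have E12 : E 1 2 = 0 := by simp [hE, mul₃, q02, q12]
  have E20 : E 2 0 = 0 := by simp [hE, mul₃, q20]
  have E21 : E 2 1 = 0 := by simp [hE, mul₃, q21]
  set C : M₃ := (A : M₃) * E - (E : M₃) * A with hC; have C0 : C 0 2 = 0 := by simp [hC, mul₃, A02, A12, E02, E12]
  have C1 : C 1 2 = 0 := by simp [hC, mul₃, A02, A12, E02, E12]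
  have C2 : C 2 2 = 0 := by simp [hC, mul₃, A02, A12, E02, E12]; ring
  have C00 : C 0 0 = A 0 1 * E 1 0 - A 1 0 * E 0 1 := by simp [hC, mul₃, A02, A12, E02, E12]; ring
  have C01 : C 0 1 = E 0 1 * (A 0 0 - A 1 1) + A 0 1 * (E 1 1 - E 0 0) := by simp [hC, mul₃, A02, A12, E02, E12]; ring
  have C10 : C 1 0 = A 1 0 * (E 0 0 - E 1 1) + E 1 0 * (A 1 1 - A 0 0) := by simp [hC, mul₃, A02, A12, E02, E12]; ring
  have C11 : C 1 1 = -(A 0 1 * E 1 0 - A 1 0 * E 0 1) := by simp [hC, mul₃, A02, A12, E02, E12]; ring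
  have hdet : C 0 0 * C 1 1 - C 0 1 * C 1 0 ≠ 0 := by
    obtain ⟨⟨a1, a2, -⟩, ⟨a3, a4, -⟩, -⟩ := nearOne.entries hp
    obtain ⟨⟨b1, b2, -⟩, ⟨b3, b4, -⟩, -⟩ := nearOne.entries hq
    have := commutator_block_bound (k := k) (m := m) (by exact_mod_cast hk1) (by exact_mod_cast hm1)
      a1 a2 a3 a4 b1 b2 b3 b4
    rw [C00, C01, C10, C11, A00, A01, A10, A11, E00, E01, E10, E11]; intro h0; apply this; linear_combination -h0
  -- the integer commutator
  set M : Matrix (Fin 3) (Fin 3) ℤ := c * d - d * c with hM; set M' : M₃ := M.map (Int.castRingHom ℝ) with hM'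
  have hγc : (γ : M₃) = c.map (Int.castRingHom ℝ) := by ext i j; exact hc i j
  have hδd : (δ : M₃) = d.map (Int.castRingHom ℝ) := by ext i j; exact hd i j
  have hMM : M' = (γ : M₃) * δ - (δ : M₃) * γ := by
    rw [hM', hM, hγc, hδd, ← Matrix.map_mul, ← Matrix.map_mul, Matrix.map_sub _ (map_sub _)]
  have hAg : (A : M₃) * g = g * γ := by
    rw [← Matrix.SpecialLinearGroup.coe_mul, ← Matrix.SpecialLinearGroup.coe_mul, hl]; simp
  have hEg : (E : M₃) * g = g * δ := by
    rw [← Matrix.SpecialLinearGroup.coe_mul, ← Matrix.SpecialLinearGroup.coe_mul, hl']; simp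
  have hCg : C * (g : M₃) = g * M' := by
    have h1 : (A : M₃) * E * g = g * (γ * δ) := by rw [Matrix.mul_assoc, hEg, ← Matrix.mul_assoc, hAg, Matrix.mul_assoc]
    have h2 : (E : M₃) * A * g = g * (δ * γ) := by rw [Matrix.mul_assoc, hAg, ← Matrix.mul_assoc, hEg, Matrix.mul_assoc]
    rw [hC, hMM, Matrix.sub_mul, Matrix.mul_sub, h1, h2]
  have hdet0 : M'.det = 0 := by
    have h1 : C.det = 0 := by rw [det_fin_three, C0, C1, C2]; ring
    have h2 := congrArg Matrix.det hCg; rw [Matrix.det_mul, Matrix.det_mul, h1, Matrix.SpecialLinearGroup.det_coe] at h2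
    linarith
  have hMdet : M.det = 0 := by
    have := RingHom.map_det (Int.castRingHom ℝ) M; rw [RingHom.mapMatrix_apply, ← hM', hdet0] at this
    exact Int.cast_eq_zero.1 this
  obtain ⟨v, hv, hMv⟩ := Matrix.exists_mulVec_eq_zero_iff.2 hMdet; refine (hKi _ (hBK hx) g rfl).1 v hv ?_
  set V : Fin 3 → ℝ := fun i => (v i : ℝ)
  have hM'v : M' *ᵥ V = 0 := by
    funext i
    have := congrFun hMv i; simp only [mulVec, dotProduct, Pi.zero_apply] at this ⊢
    have h2 := congrArg (fun z : ℤ => (z : ℝ)) this; push_cast at h2; exact h2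
  have hCv : C *ᵥ ((g : M₃) *ᵥ V) = 0 := by
    rw [Matrix.mulVec_mulVec, hCg, ← Matrix.mulVec_mulVec, hM'v, Matrix.mulVec_zero]
  set y := (g : M₃) *ᵥ V; have y0 := congrFun hCv 0; have y1 := congrFun hCv 1
  simp only [mulVec, dotProduct, Fin.sum_univ_three, Pi.zero_apply, C0, C1, zero_mul, add_zero] at y0 y1
  have : (C 0 0 * C 1 1 - C 0 1 * C 1 0) * y 1 = 0 := by linear_combination C 0 0 * y1 - C 1 0 * y0
  exact (mul_eq_zero.1 this).resolve_left hdet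

/-! ### Large deviations along contracted unipotent orbits -/

/-- The diagonal element `diag(2⁻ᵃ, 2ᵃ, 1)`, which expands `ll` by `4ᵃ`. -/
def di (a : ℕ) : G := dd ((2 : ℝ) ^ a)⁻¹ (by positivity)

lemma di_zero : di 0 = 1 := by apply G_ext_fin <;> simp [di]

lemma di_add (a b : ℕ) : di (a + b) = di a * di b := by rw [di, di, di, dd_mul]; congr 1; rw [pow_add, mul_inv]

lemma di_ll (a : ℕ) (ξ : ℝ) : di a * ll ξ = ll (4 ^ a * ξ) * di a := by
  apply G_ext_fin <;> simp [mul₃, di]; have : (4 : ℝ) ^ a = 2 ^ a * 2 ^ a := by rw [← mul_pow]; norm_num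
  rw [this]; field_simp

lemma continuous_orbit_ll {H : X → ℝ} (hH : Continuous H) (w : X) : Continuous fun ξ => H (ll ξ • w) :=
  hH.comp (continuous_ll.smul continuous_const)

/-- The Birkhoff sums of `H` along the powers of `di J`. -/
def birk (H : X → ℝ) (J m : ℕ) (z : X) : ℝ := ∑ k ∈ Finset.range m, H (di (J * k) • z)

lemma birk_succ (H : X → ℝ) (J m : ℕ) (z : X) : birk H J (m + 1) z = H z + birk H J m (di J • z) := by
  rw [birk, Finset.sum_range_succ', add_comm, birk]; congr 1
  · simp [di_zero]
  · simp only [smul_smul, ← di_add, mul_add, mul_one]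

lemma continuous_birk {H : X → ℝ} (hH : Continuous H) (J m : ℕ) : Continuous (birk H J m) :=
  continuous_finsetSum _ fun _ _ => hH.comp (continuous_const_smul _)

lemma ll_mem_nearOne {x θ : ℝ} (h : |x| ≤ θ) : ll x ∈ nearOne θ := by
  have h0 : 0 ≤ θ := (abs_nonneg _).trans h; intro i j
  fin_cases i <;> fin_cases j <;> simp [h0, h]

lemma exp_integral_le {H : X → ℝ} (hH : Continuous H) {M b s : ℝ} (hM : ∀ x, |H x| ≤ M)
    (hmean : ∀ w, ∫ ξ in (0 : ℝ)..1, H (ll ξ • w) ≤ b) (hs : 0 < s) (hsM : s * M ≤ 1) (w : X) :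
    ∫ ξ in (0 : ℝ)..1, exp (s * H (ll ξ • w)) ≤ exp (s * b + s ^ 2 * M ^ 2) := by
  have hc := continuous_orbit_ll hH w
  have h1 : ∀ ξ, exp (s * H (ll ξ • w)) ≤ 1 + s * H (ll ξ • w) + s ^ 2 * M ^ 2 := fun ξ => by
    have hb : |s * H (ll ξ • w)| ≤ s * M := by rw [abs_mul, abs_of_pos hs]; exact mul_le_mul_of_nonneg_left (hM _) hs.le
    have h2 := (abs_le.1 (Real.abs_exp_sub_one_sub_id_le (hb.trans hsM))).2
    have h3 : (s * H (ll ξ • w)) ^ 2 ≤ (s * M) ^ 2 := sq_le_sq' (abs_le.1 hb).1 (abs_le.1 hb).2; nlinarith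
  have h2 : ∫ ξ in (0 : ℝ)..1, exp (s * H (ll ξ • w)) ≤ ∫ ξ in (0 : ℝ)..1, (1 + s * H (ll ξ • w) + s ^ 2 * M ^ 2) :=
    intervalIntegral.integral_mono_on zero_le_one
      ((Real.continuous_exp.comp (continuous_const.mul hc)).intervalIntegrable _ _)
      (((continuous_const.add (continuous_const.mul hc)).add continuous_const).intervalIntegrable _ _)
      fun ξ _ => h1 ξ
  have h3 : ∫ ξ in (0 : ℝ)..1, (1 + s * H (ll ξ • w) + s ^ 2 * M ^ 2) =
      1 + s * (∫ ξ in (0 : ℝ)..1, H (ll ξ • w)) + s ^ 2 * M ^ 2 := by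
    have c1 : Continuous fun ξ => s * H (ll ξ • w) := continuous_const.mul hc
    have c2 : Continuous fun ξ => 1 + s * H (ll ξ • w) := continuous_const.add c1
    rw [intervalIntegral.integral_add (c2.intervalIntegrable _ _) intervalIntegrable_const,
      intervalIntegral.integral_add intervalIntegrable_const (c1.intervalIntegrable _ _),
      intervalIntegral.integral_const_mul]
    simp
  have h4 := Real.add_one_le_exp (s * b + s ^ 2 * M ^ 2); have h5 := mul_le_mul_of_nonneg_left (hmean w) hs.le; linarith

lemma exp_moment_le {H : X → ℝ} (hH : Continuous H) {M b s : ℝ} (hM : ∀ x, |H x| ≤ M)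
    (hmean : ∀ w, ∫ ξ in (0 : ℝ)..1, H (ll ξ • w) ≤ b) (hs : 0 < s) (hsM : s * M ≤ 1) {J : ℕ}
    (hJ : ∀ ξ, |ξ| ≤ ((4 : ℝ) ^ J)⁻¹ → ∀ x, |H (ll ξ • x) - H x| ≤ b / 4) (m : ℕ) :
    ∀ w, ∫ ξ in (0 : ℝ)..1, exp (s * birk H J m (ll ξ • w)) ≤ exp (s * b / 2 + s * b + s ^ 2 * M ^ 2) ^ m := by
  induction m with
  | zero => intro w; simp [birk]
  | succ m ih =>
    intro w; set ρ := exp (s * b / 2 + s * b + s ^ 2 * M ^ 2) with hρ; set B : ℕ := 4 ^ J with hB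
    have hBpos : (0 : ℝ) < B := by rw [hB]; positivity
    have hBr : (B : ℝ) = 4 ^ J := by rw [hB]; push_cast; rfl
    set E : ℝ → ℝ := fun ξ => exp (s * H (ll ξ • w)); set F : ℝ → ℝ := fun η => exp (s * birk H J m (ll η • di J • w))
    set p : ℕ → ℝ := fun i => i / B with hpdef; have hp : ∀ i : ℕ, B * p i = i := fun i => mul_div_cancel₀ _ hBpos.ne'
    have contE : Continuous E := Real.continuous_exp.comp (continuous_const.mul (continuous_orbit_ll hH w))
    have contF : Continuous fun ξ => F (B * ξ) :=
      (Real.continuous_exp.comp (continuous_const.mul (continuous_orbit_ll (continuous_birk hH J m) _))).comp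
        (continuous_const.mul continuous_id)
    have hsplit : ∀ ξ, exp (s * birk H J (m + 1) (ll ξ • w)) = E ξ * F (B * ξ) := fun ξ => by
      rw [birk_succ, mul_add, exp_add, smul_smul, di_ll, ← smul_smul, ← hBr]
    have adj : ∀ g : ℝ → ℝ, Continuous g → ∫ ξ in (0 : ℝ)..1, g ξ =
        ∑ i ∈ Finset.range B, ∫ ξ in p i..p (i + 1), g ξ := fun g hg => by
      rw [intervalIntegral.sum_integral_adjacent_intervals fun k _ => hg.intervalIntegrable _ _]; simp [p, hBpos.ne']
    simp only [hsplit]; have contEF : Continuous fun ξ => E ξ * F (B * ξ) := contE.mul contF; rw [adj _ contEF]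
    have piece : ∀ i ∈ Finset.range B, ∫ ξ in p i..p (i + 1), E ξ * F (B * ξ) ≤
        exp (s * b / 2) * ρ ^ m * ∫ ξ in p i..p (i + 1), E ξ := by
      intro i _; have hlen : p (i + 1) - p i = (B : ℝ)⁻¹ := by simp only [p]; push_cast; field_simp; ring
      have hle : p i ≤ p (i + 1) := by linarith [inv_pos.2 hBpos]
      set c := H (ll (p i) • w)
      have hclose : ∀ ξ ∈ Icc (p i) (p (i + 1)), |H (ll ξ • w) - c| ≤ b / 4 := by
        intro ξ hξ
        have := hJ (ξ - p i) (by rw [abs_of_nonneg (by linarith [hξ.1]), ← hBr, ← hlen]; linarith [hξ.2]) (ll (p i) • w)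
        rwa [smul_smul, ← ll_add, sub_add_cancel] at this
      have up : ∫ ξ in p i..p (i + 1), E ξ * F (B * ξ) ≤ exp (s * (c + b / 4)) * ((B : ℝ)⁻¹ * ρ ^ m) := by
        have h1 : ∫ ξ in p i..p (i + 1), F (B * ξ) ≤ (B : ℝ)⁻¹ * ρ ^ m := by
          rw [intervalIntegral.integral_comp_mul_left F hBpos.ne', hp, hp, smul_eq_mul]; gcongr
          have h3 := intervalIntegral.integral_comp_add_right (a := 0) (b := 1) F i
          rw [zero_add, show (1 : ℝ) + i = ((i + 1 : ℕ) : ℝ) by push_cast; ring] at h3; rw [← h3]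
          simp only [F, ll_add, mul_smul]; exact ih (ll (i : ℝ) • di J • w)
        refine le_trans ?_ (mul_le_mul_of_nonneg_left h1 (exp_pos _).le); rw [← intervalIntegral.integral_const_mul]
        refine intervalIntegral.integral_mono_on hle (contEF.intervalIntegrable _ _)
          ((continuous_const.mul contF).intervalIntegrable _ _) fun ξ hξ => ?_
        refine mul_le_mul_of_nonneg_right (exp_le_exp.2 ?_) (exp_pos _).le
        gcongr; linarith [(abs_le.1 (hclose ξ hξ)).2]
      have low : exp (s * (c - b / 4)) * (B : ℝ)⁻¹ ≤ ∫ ξ in p i..p (i + 1), E ξ := by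
        have : exp (s * (c - b / 4)) * (B : ℝ)⁻¹ = ∫ ξ in p i..p (i + 1), exp (s * (c - b / 4)) := by
          rw [intervalIntegral.integral_const, hlen, smul_eq_mul, mul_comm]
        rw [this]
        refine intervalIntegral.integral_mono_on hle intervalIntegrable_const
          (contE.intervalIntegrable _ _) fun ξ hξ => exp_le_exp.2 ?_
        gcongr; linarith [(abs_le.1 (hclose ξ hξ)).1]
      refine up.trans ?_; rw [show s * (c + b / 4) = s * b / 2 + s * (c - b / 4) by ring, exp_add]
      calc exp (s * b / 2) * exp (s * (c - b / 4)) * ((B : ℝ)⁻¹ * ρ ^ m)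
          = exp (s * b / 2) * ρ ^ m * (exp (s * (c - b / 4)) * (B : ℝ)⁻¹) := by ring
        _ ≤ _ := by gcongr
    refine (Finset.sum_le_sum piece).trans ?_; rw [← Finset.mul_sum, ← adj _ contE]
    refine (mul_le_mul_of_nonneg_left (exp_integral_le hH hM hmean hs hsM w) (by positivity)).trans_eq ?_
    rw [pow_succ, hρ, add_assoc, exp_add (s * b / 2)]; ring

/-- Large deviations: long Birkhoff sums of a function with small averages along `ll`-segments are
large only for exponentially few parameters. -/
lemma exists_large_deviation {H : X → ℝ} (hH : Continuous H) (hu : UnifCont H) {M b : ℝ}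
    (hM : ∀ x, |H x| ≤ M) (hb : 0 < b) (hbM : b ≤ M)
    (hmean : ∀ w, ∫ ξ in (0 : ℝ)..1, H (ll ξ • w) ≤ b) :
    ∃ J : ℕ, 0 < J ∧ ∃ δ > 0, ∀ (m : ℕ) (w : X), volume {ξ | ξ ∈ 𝕀 ∧ 4 * b * m ≤ birk H J m (ll ξ • w)} ≤
        ofR (exp (-(δ * m))) := by
  obtain ⟨θ, hθ, hθH⟩ := hu (b / 4) (by positivity); have hM0 : 0 < M := hb.trans_le hbM
  obtain ⟨J, hJ⟩ : ∃ J : ℕ, ((4 : ℝ) ^ J)⁻¹ < θ := by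
    obtain ⟨J, hJ⟩ := exists_pow_lt_of_lt_one hθ (show (1 / 4 : ℝ) < 1 by norm_num); exact ⟨J, by simpa using hJ⟩
  set s := b / (2 * M ^ 2) with hs; have hs0 : 0 < s := by positivity
  have hsM : s * M ≤ 1 := by rw [hs, div_mul_eq_mul_div, div_le_one (by positivity)]; nlinarith
  have hs2 : s ^ 2 * M ^ 2 = s * b / 2 := by rw [hs]; field_simp
  refine ⟨J + 1, by omega, s * (2 * b), by positivity, fun m w => ?_⟩
  have hJ' : ∀ ξ, |ξ| ≤ ((4 : ℝ) ^ (J + 1))⁻¹ → ∀ x, |H (ll ξ • x) - H x| ≤ b / 4 := fun ξ hξ x =>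
    hθH _ (ll_mem_nearOne (hξ.trans ((inv_anti₀ (by positivity)
      (pow_le_pow_right₀ (by norm_num) (Nat.le_succ J))).trans hJ.le))) x
  have h1 := exp_moment_le hH hM hmean hs0 hsM hJ' m w
  rw [hs2, show s * b / 2 + s * b + s * b / 2 = s * (2 * b) by ring, ← exp_nat_mul] at h1
  set S : ℝ → ℝ := fun ξ => birk H (J + 1) m (ll ξ • w) with hS
  have cS : Continuous fun ξ => exp (s * S ξ) :=
    Real.continuous_exp.comp (continuous_const.mul (continuous_orbit_ll (continuous_birk hH _ m) w))
  rw [intervalIntegral.integral_of_le zero_le_one, ← integral_Icc_eq_integral_Ioc] at h1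
  have h2 := mul_meas_ge_le_integral_of_nonneg (μ := volume.restrict 𝕀)
    (f := fun ξ => exp (s * S ξ)) (.of_forall fun ξ => (exp_pos _).le)
    (cS.continuousOn.integrableOn_compact isCompact_Icc) (exp (s * (4 * b * m)))
  have hset : {ξ | ξ ∈ 𝕀 ∧ 4 * b * m ≤ birk H (J + 1) m (ll ξ • w)} =
      {ξ | exp (s * (4 * b * m)) ≤ exp (s * S ξ)} ∩ Icc 0 1 := by
    ext ξ; simp only [mem_ofPred_eq, Set.mem_inter_iff, exp_le_exp, mul_le_mul_iff_right₀ hs0, hS]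
    tauto
  rw [hset, ← Measure.restrict_apply' measurableSet_Icc, ← ofReal_measureReal]; refine ofReal_le_ofReal ?_
  have h3 := h2.trans h1; rw [← le_div_iff₀' (exp_pos _), ← Real.exp_sub] at h3; exact h3.trans_eq (by congr 1; ring)

/-- The averages along `ll` of a coboundary, pushed by the diagonal flow, are small. -/
lemma coboundary_mean_le {f : X → ℝ} (hf : Continuous f) {M : ℝ} (hM : ∀ x, |f x| ≤ M) (ζ : ℝ) (j : ℕ)
    (w : X) : |∫ ξ in (0 : ℝ)..1, (f (ll ζ • di j • ll ξ • w) - f (di j • ll ξ • w))| ≤ 2 * M * |ζ| / 4 ^ j := by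
  have hc := continuous_orbit_ll hf (di j • w)
  have e : ∀ ξ, f (ll ζ • di j • ll ξ • w) - f (di j • ll ξ • w) =
      (fun η => f (ll (η + ζ) • di j • w) - f (ll η • di j • w)) (4 ^ j * ξ) := fun ξ => by
    simp only; rw [smul_smul (di j), di_ll, ← smul_smul, add_comm, ll_add, mul_smul]
  simp only [e]; have h4 : (0 : ℝ) < 4 ^ j := by positivity
  rw [intervalIntegral.integral_comp_mul_left (fun η => f (ll (η + ζ) • di j • w) - f (ll η • di j • w)) h4.ne',
    mul_zero, mul_one, smul_eq_mul, abs_mul, abs_inv, abs_of_pos h4, inv_mul_le_iff₀ h4]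
  have c1 : Continuous fun η => f (ll (η + ζ) • di j • w) := hc.comp (continuous_id.add continuous_const)
  rw [intervalIntegral.integral_sub (c1.intervalIntegrable _ _) (hc.intervalIntegrable _ _),
    intervalIntegral.integral_comp_add_right (fun η => f (ll η • di j • w)) ζ, zero_add]
  have h1 := intervalIntegral.integral_add_adjacent_intervals (μ := volume) (hc.intervalIntegrable 0 ζ)
    (hc.intervalIntegrable ζ ((4 : ℝ) ^ j + ζ))
  have h2 := intervalIntegral.integral_add_adjacent_intervals (μ := volume) (hc.intervalIntegrable 0 (4 ^ j))
    (hc.intervalIntegrable ((4 : ℝ) ^ j) (4 ^ j + ζ))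
  have h3 : (∫ η in ζ..(4 : ℝ) ^ j + ζ, f (ll η • di j • w)) - ∫ η in (0 : ℝ)..4 ^ j, f (ll η • di j • w) =
      (∫ η in (4 : ℝ) ^ j..4 ^ j + ζ, f (ll η • di j • w)) - ∫ η in (0 : ℝ)..ζ, f (ll η • di j • w) := by
    linarith
  rw [h3]
  have b : ∀ a b, |∫ η in a..b, f (ll η • di j • w)| ≤ M * |b - a| := fun a b => by
    rw [← Real.norm_eq_abs]; exact intervalIntegral.norm_integral_le_of_norm_le_const fun t _ => hM _
  have b1 := b (4 ^ j) (4 ^ j + ζ); have b2 := b 0 ζ; rw [add_sub_cancel_left] at b1; rw [sub_zero] at b2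
  refine (abs_sub _ _).trans ?_; rw [mul_div_cancel₀ _ h4.ne']; linarith

/-! ### Counting trajectories that stay close -/

/-- The expanded entries of `k` are at most `θ` after `j` steps with expansion rates `q²` and `q`. -/
def CloseAt (q : ℕ) (θ : ℝ) (j : ℕ) (k : G) : Prop :=
  ((q : ℝ) ^ 2) ^ j * |k 0 1| ≤ θ ∧ (q : ℝ) ^ j * |k 0 2| ≤ θ ∧ (q : ℝ) ^ j * |k 2 1| ≤ θ

/-- The diagonal and contracted entries of `k` are within `θ` of those of the identity. -/
def LowClose (θ : ℝ) (k : G) : Prop :=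
  |k 1 0| ≤ θ ∧ |k 2 0| ≤ θ ∧ |k 1 2| ≤ θ ∧ ∀ i, |k i i - 1| ≤ θ

lemma closeAt_succ {q : ℕ} (hq : 1 ≤ q) {θ θ₀ : ℝ} (hθ : 0 < θ) (hqθ₀ : (q : ℝ) ^ 2 * θ₀ ≤ 1 / 64)
    (hqθ : (q : ℝ) ^ 2 * θ ≤ 1 / 64) {j : ℕ} {k k₁ k₂ : G} (hk : k₂ = k * k₁) (l : LowClose θ₀ k)
    (l₁ : LowClose θ₀ k₁) (c : CloseAt q θ j k) (c₁ : CloseAt q θ j k₁)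
    (hA : ((q : ℝ) ^ 2) ^ (j + 1) * |k₂ 0 1 - k₁ 0 1| ≤ θ / 8)
    (hB : (q : ℝ) ^ (j + 1) * |k₂ 0 2 - k₁ 0 2| ≤ θ / 8)
    (hC : (q : ℝ) ^ (j + 1) * |k₂ 2 1 - k₁ 2 1| ≤ θ / 8) : CloseAt q θ (j + 1) k := by
  obtain ⟨l10, l20, l12, ld⟩ := l; obtain ⟨m10, m20, m12, md⟩ := l₁; obtain ⟨c01, c02, c21⟩ := c
  obtain ⟨d01, d02, d21⟩ := c₁; have hq1 : (1 : ℝ) ≤ q := by exact_mod_cast hq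
  have hθ₀ : 0 ≤ θ₀ := (abs_nonneg _).trans l10; have hqq : (q : ℝ) ≤ (q : ℝ) ^ 2 := le_self_pow₀ hq1 two_ne_zero
  have hqθ₀' : (q : ℝ) * θ₀ ≤ 1 / 64 := (mul_le_mul_of_nonneg_right hqq hθ₀).trans hqθ₀
  have hθ₀1 : θ₀ ≤ 1 / 64 := (le_mul_of_one_le_left hθ₀ hq1).trans hqθ₀'; set a := (q : ℝ) ^ j with ha
  have ha0 : 0 < a := by positivity
  have hQ : ((q : ℝ) ^ 2) ^ j = a ^ 2 := by rw [ha, ← pow_mul, ← pow_mul, mul_comm]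
  have ha1 : 1 ≤ a := one_le_pow₀ hq1; rw [pow_succ, hQ] at hA; rw [pow_succ, ← ha] at hB hC; rw [hQ] at c01 d01
  have e01 : k₂ 0 1 = k 0 0 * k₁ 0 1 + k 0 1 * k₁ 1 1 + k 0 2 * k₁ 2 1 := by rw [hk, mul_entry]
  have e02 : k₂ 0 2 = k 0 0 * k₁ 0 2 + k 0 1 * k₁ 1 2 + k 0 2 * k₁ 2 2 := by rw [hk, mul_entry]
  have e21 : k₂ 2 1 = k 2 0 * k₁ 0 1 + k 2 1 * k₁ 1 1 + k 2 2 * k₁ 2 1 := by rw [hk, mul_entry]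
  have hq0 : (0 : ℝ) ≤ q := by linarith
  have mulq : ∀ t : ℝ, a * |t| ≤ θ → a * q * |t| ≤ q * θ := fun t ht => by rw [mul_comm a, mul_assoc]; gcongr
  have weak : ∀ t : ℝ, a ^ 2 * |t| ≤ θ → a * q * |t| ≤ q * θ := fun t ht =>
    mulq t ((mul_le_mul_of_nonneg_right (le_self_pow₀ ha1 two_ne_zero) (abs_nonneg t)).trans ht)
  -- a diagonal entry is at least one half
  have half : ∀ {t d s : ℝ}, |d - 1| ≤ θ₀ → |t * d| ≤ s → |t| ≤ 2 * s := fun {t d s} hd hs => by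
    rw [abs_mul] at hs
    have h1 : 1 / 2 ≤ |d| := by have := (abs_le.1 hd).1; exact le_trans (by linarith) (le_abs_self d)
    linarith [mul_le_mul_of_nonneg_left h1 (abs_nonneg t)]
  have tri : ∀ x y z : ℝ, |x - y - z| ≤ |x| + |y| + |z| := fun x y z =>
    (abs_sub _ _).trans (by linarith [abs_sub x y])
  have prod : ∀ {x y s t : ℝ}, |x| ≤ s → |y| ≤ t → |x * y| ≤ s * t := fun {x y s t} hx hy => by
    rw [abs_mul]; exact mul_le_mul hx hy (abs_nonneg _) ((abs_nonneg _).trans hx)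
  have sc1 : ∀ t : ℝ, |a * q * t| = a * q * |t| := fun t => by rw [abs_mul, abs_of_nonneg (by positivity)]
  have sc2 : ∀ t : ℝ, |a ^ 2 * (q : ℝ) ^ 2 * t| = a ^ 2 * (q : ℝ) ^ 2 * |t| := fun t => by
    rw [abs_mul, abs_of_nonneg (by positivity)]
  rw [← sc2] at hA; rw [← sc1] at hB hC
  have resc : ∀ {x s t : ℝ}, 0 ≤ s → x ≤ t → s * x ≤ s * t := fun hs hx => mul_le_mul_of_nonneg_left hx hs
  have bnd1 : (q : ℝ) * θ * θ₀ ≤ θ / 64 := by linarith [resc hθ.le hqθ₀']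
  have bnd2 : (q : ℝ) ^ 2 * θ * θ₀ ≤ θ / 64 := by linarith [resc hθ.le hqθ₀]
  have bnd3 : (q : ℝ) * θ * (q * θ) ≤ θ / 64 := by linarith [resc hθ.le hqθ]
  have d01' : a ^ 2 * (q : ℝ) ^ 2 * |k₁ 0 1| ≤ (q : ℝ) ^ 2 * θ := by linarith [resc (sq_nonneg (q : ℝ)) d01]
  rw [CloseAt, pow_succ ((q : ℝ) ^ 2) j, pow_succ (q : ℝ) j, hQ, ← ha]; refine ⟨?_, ?_, ?_⟩
  · have id : (a ^ 2 * (q : ℝ) ^ 2 * k 0 1) * k₁ 1 1 = (a ^ 2 * (q : ℝ) ^ 2) * (k₂ 0 1 - k₁ 0 1) -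
        (a ^ 2 * (q : ℝ) ^ 2 * k₁ 0 1) * (k 0 0 - 1) - (a * q * k 0 2) * (a * q * k₁ 2 1) := by
      rw [e01]; ring
    have h1 : |(a ^ 2 * (q : ℝ) ^ 2 * k 0 1) * k₁ 1 1| ≤ θ / 8 + (q : ℝ) ^ 2 * θ * θ₀ + q * θ * (q * θ) := by
      rw [id]; refine (tri _ _ _).trans (add_le_add (add_le_add ?_ ?_) ?_)
      · exact hA
      · exact prod ((sc2 _).trans_le d01') (ld 0)
      · exact prod ((sc1 _).trans_le (mulq _ c02)) ((sc1 _).trans_le (mulq _ d21))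
    have := half (md 1) h1; rw [sc2] at this; linarith
  · have id : (a * q * k 0 2) * k₁ 2 2 = (a * q) * (k₂ 0 2 - k₁ 0 2) -
        (a * q * k₁ 0 2) * (k 0 0 - 1) - (a * q * k 0 1) * k₁ 1 2 := by
      rw [e02]; ring
    have h1 : |(a * q * k 0 2) * k₁ 2 2| ≤ θ / 8 + q * θ * θ₀ + q * θ * θ₀ := by
      rw [id]; refine (tri _ _ _).trans (add_le_add (add_le_add ?_ ?_) ?_)
      · exact hB
      · exact prod ((sc1 _).trans_le (mulq _ d02)) (ld 0)
      · exact prod ((sc1 _).trans_le (weak _ c01)) m12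
    have := half (md 2) h1; rw [sc1] at this; linarith
  · have id : (a * q * k 2 1) * k₁ 1 1 = (a * q) * (k₂ 2 1 - k₁ 2 1) -
        (a * q * k₁ 2 1) * (k 2 2 - 1) - (a * q * k₁ 0 1) * k 2 0 := by
      rw [e21]; ring
    have h1 : |(a * q * k 2 1) * k₁ 1 1| ≤ θ / 8 + q * θ * θ₀ + q * θ * θ₀ := by
      rw [id]; refine (tri _ _ _).trans (add_le_add (add_le_add ?_ ?_) ?_)
      · exact hC
      · exact prod ((sc1 _).trans_le (mulq _ d21)) (ld 2)
      · exact prod ((sc1 _).trans_le (weak _ d01)) l20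
    have := half (md 1) h1; rw [sc1] at this; linarith

lemma abs_sub_le_of_floor_eq {x y θ : ℝ} (hθ : 0 < θ) (h : ⌊8 * x / θ⌋ = ⌊8 * y / θ⌋) : |x - y| ≤ θ / 8 := by
  have h1 := Int.abs_sub_lt_one_of_floor_eq_floor h
  rw [← sub_div, ← mul_sub, abs_div, abs_mul, abs_of_pos hθ, div_lt_one hθ, abs_of_pos (by norm_num : (0:ℝ) < 8)] at h1
  linarith

lemma floor_mem_Icc {x θ : ℝ} {n : ℕ} (hθ : 0 < θ) (h : |x| ≤ n * θ) :
    ⌊8 * x / θ⌋ ∈ Finset.Icc (-(8 * n : ℤ)) (8 * n) := by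
  rw [abs_le] at h; rw [Finset.mem_Icc, Int.le_floor]; constructor
  · rw [le_div_iff₀ hθ]; push_cast; nlinarith [h.1]
  · have : ⌊8 * x / θ⌋ ≤ ⌊((8 * n : ℤ) : ℝ)⌋ := Int.floor_le_floor (by rw [div_le_iff₀ hθ]; push_cast; nlinarith [h.2])
    rwa [Int.floor_intCast] at this

lemma card_Icc_neg (n : ℕ) : (Finset.Icc (-(8 * n : ℤ)) (8 * n)).card = 16 * n + 1 := by rw [Int.card_Icc]; omega

/-- A family of elements can be coded by few words so that equal codes force closeness for `j`
steps; steps in `P`, where the intermediate entries are known to be small, cost less. -/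
lemma exists_code {ι : Type*} (g : ι → G) (S : Set ι) {q : ℕ} (hq : 1 ≤ q) {θ θ₀ : ℝ} (hθ : 0 < θ)
    (hqθ₀ : (q : ℝ) ^ 2 * θ₀ ≤ 1 / 64) (hqθ : (q : ℝ) ^ 2 * θ ≤ 1 / 64) (P : Finset ℕ)
    (hlow : ∀ r ∈ S, ∀ r' ∈ S, LowClose θ₀ (g r' * (g r)⁻¹))
    (h0 : ∀ r ∈ S, ∀ r' ∈ S, CloseAt q θ 0 (g r' * (g r)⁻¹))
    (hP : ∀ i ∈ P, ∀ r ∈ S, ∀ r' ∈ S, CloseAt q θ i (g r' * (g r)⁻¹) →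
      (q : ℝ) ^ (i + 1) * |(g r' * (g r)⁻¹) 0 2| ≤ θ / 16 ∧ (q : ℝ) ^ (i + 1) * |(g r' * (g r)⁻¹) 2 1| ≤ θ / 16)
    (j : ℕ) : ∃ (c : ι → List (ℤ × ℤ × ℤ)) (F : Finset (List (ℤ × ℤ × ℤ))),
      F.card ≤ (16 * q ^ 2 + 1) ^ j * ((16 * q + 1) ^ 2) ^ (Finset.range j \ P).card ∧
      (∀ r ∈ S, c r ∈ F) ∧ ∀ r ∈ S, ∀ r' ∈ S, c r = c r' → CloseAt q θ j (g r' * (g r)⁻¹) := by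
  rcases S.eq_empty_or_nonempty with rfl | ⟨s₀, hs₀⟩
  · exact ⟨fun _ => [], ∅, by simp, by simp, by simp⟩
  induction j with
  | zero => exact ⟨fun _ => [], {[]}, by simp, by simp, fun r hr r' hr' _ => h0 r hr r' hr'⟩
  | succ j ih =>
    obtain ⟨c, F, hF, hcF, hc⟩ := ih; have hq0 : (0 : ℝ) < q := by exact_mod_cast hq
    have hb' : ∀ v : List (ℤ × ℤ × ℤ), ∃ b : ι, ∀ r ∈ S, c r = v → b ∈ S ∧ c b = v := fun v => by
      by_cases h : ∃ r ∈ S, c r = v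
      · obtain ⟨r, hr⟩ := h; exact ⟨r, fun _ _ _ => hr⟩
      · exact ⟨s₀, fun r hr hv => absurd ⟨r, hr, hv⟩ h⟩
    choose b hb using hb'
    set K : ι → G := fun r => g r * (g (b (c r)))⁻¹ with hK
    have hbS : ∀ r ∈ S, b (c r) ∈ S := fun r hr => (hb _ r hr rfl).1
    have hKc : ∀ r ∈ S, CloseAt q θ j (K r) := fun r hr => hc _ (hbS r hr) r hr (hb _ r hr rfl).2
    have step : ∀ r ∈ S, ∀ r' ∈ S, c r = c r' → ((q : ℝ) ^ 2) ^ (j + 1) * |K r' 0 1 - K r 0 1| ≤ θ / 8 →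
        (q : ℝ) ^ (j + 1) * |K r' 0 2 - K r 0 2| ≤ θ / 8 →
        (q : ℝ) ^ (j + 1) * |K r' 2 1 - K r 2 1| ≤ θ / 8 → CloseAt q θ (j + 1) (g r' * (g r)⁻¹) := by
      intro r hr r' hr' hcc h1 h2 h3
      refine closeAt_succ hq hθ hqθ₀ hqθ (k₁ := K r) (k₂ := K r') ?_ (hlow r hr r' hr')
        (hlow _ (hbS r hr) r hr) (hc r hr r' hr' hcc) (hKc r hr) h1 h2 h3
      simp only [hK, hcc]; group
    have eA : ∀ r ∈ S, |((q : ℝ) ^ 2) ^ (j + 1) * K r 0 1| ≤ ((q ^ 2 : ℕ) : ℝ) * θ := fun r hr => by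
      rw [abs_mul, abs_of_nonneg (by positivity), pow_succ', mul_assoc, Nat.cast_pow]; gcongr; exact (hKc r hr).1
    have eB : ∀ {t : ℝ}, (q : ℝ) ^ j * |t| ≤ θ → |(q : ℝ) ^ (j + 1) * t| ≤ (q : ℝ) * θ := fun h => by
      rw [abs_mul, abs_of_nonneg (by positivity), pow_succ', mul_assoc]; gcongr
    have fl : ∀ {x y t : ℝ}, 0 ≤ t → ⌊8 * (t * x) / θ⌋ = ⌊8 * (t * y) / θ⌋ → t * |y - x| ≤ θ / 8 :=
      fun {x y t} ht h => by
        have := abs_sub_le_of_floor_eq hθ h; rwa [← mul_sub, abs_mul, abs_of_nonneg ht, abs_sub_comm] at this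
    set fA : ι → ℤ := fun r => ⌊8 * (((q : ℝ) ^ 2) ^ (j + 1) * K r 0 1) / θ⌋
    set fB : ι → ℤ := fun r => ⌊8 * ((q : ℝ) ^ (j + 1) * K r 0 2) / θ⌋
    set fC : ι → ℤ := fun r => ⌊8 * ((q : ℝ) ^ (j + 1) * K r 2 1) / θ⌋
    set IA := Finset.Icc (-(8 * (q ^ 2 : ℕ) : ℤ)) (8 * (q ^ 2 : ℕ)); set IB := Finset.Icc (-(8 * q : ℤ)) (8 * q)
    have hIA : IA.card = 16 * q ^ 2 + 1 := card_Icc_neg (q ^ 2); have hIB : IB.card = 16 * q + 1 := card_Icc_neg q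
    by_cases hjP : j ∈ P
    · refine ⟨fun r => (fA r, 0, 0) :: c r, (IA ×ˢ F).image fun p => (p.1, 0, 0) :: p.2, ?_, ?_, ?_⟩
      · refine Finset.card_image_le.trans ?_
        rw [Finset.card_product, hIA, Finset.range_add_one, Finset.insert_sdiff_of_mem _ hjP, pow_succ]
        calc (16 * q ^ 2 + 1) * F.card ≤ (16 * q ^ 2 + 1) * _ := Nat.mul_le_mul_left _ hF
          _ = _ := by ring
      · intro r hr
        exact Finset.mem_image.2 ⟨(fA r, c r), Finset.mem_product.2 ⟨floor_mem_Icc hθ (eA r hr), hcF r hr⟩, rfl⟩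
      · intro r hr r' hr' he; simp only [List.cons.injEq, Prod.mk.injEq, and_true] at he
        obtain ⟨b1, b2⟩ := hP j hjP _ (hbS r hr) r hr (hKc r hr)
        obtain ⟨b1', b2'⟩ := hP j hjP _ (hbS r' hr') r' hr' (hKc r' hr')
        have small : ∀ {x y t : ℝ}, 0 ≤ t → t * |x| ≤ θ / 16 → t * |y| ≤ θ / 16 → t * |y - x| ≤ θ / 8 :=
          fun {x y t} ht hx hy => by have := mul_le_mul_of_nonneg_left (abs_sub y x) ht; linarith
        exact step r hr r' hr' he.2 (fl (by positivity) he.1) (small (by positivity) b1 b1')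
          (small (by positivity) b2 b2')
    · refine ⟨fun r => (fA r, fB r, fC r) :: c r, ((IA ×ˢ IB ×ˢ IB) ×ˢ F).image fun p => p.1 :: p.2, ?_, ?_, ?_⟩
      · refine Finset.card_image_le.trans ?_
        rw [Finset.card_product, Finset.card_product, Finset.card_product, hIA, hIB, Finset.range_add_one, Finset.insert_sdiff_of_notMem _ hjP,
          Finset.card_insert_of_notMem (by simp), pow_succ, pow_succ _ (Finset.card _)]
        calc (16 * q ^ 2 + 1) * ((16 * q + 1) * (16 * q + 1)) * F.card
            ≤ (16 * q ^ 2 + 1) * ((16 * q + 1) * (16 * q + 1)) * _ := Nat.mul_le_mul_left _ hF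
          _ = _ := by ring
      · intro r hr
        exact Finset.mem_image.2 ⟨((fA r, fB r, fC r), c r), Finset.mem_product.2
          ⟨Finset.mem_product.2 ⟨floor_mem_Icc hθ (eA r hr), Finset.mem_product.2
            ⟨floor_mem_Icc hθ (eB (hKc r hr).2.1), floor_mem_Icc hθ (eB (hKc r hr).2.2)⟩⟩, hcF r hr⟩, rfl⟩
      · intro r hr r' hr' he; simp only [List.cons.injEq, Prod.mk.injEq] at he
        exact step r hr r' hr' he.2 (fl (by positivity) he.1.1) (fl (by positivity) he.1.2.1)
          (fl (by positivity) he.1.2.2)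

/-! ### Rigidity of close returns to irrational points -/

/-- Near an irrational point, short `uu`-orbit pieces come close only trivially. -/
lemma exists_irrational_radius {K : Set X} (hK : IsCompact K) (hirr : ∀ x ∈ K, IrrationalPt x) :
    ∃ θ > 0, ∀ x ∈ K, ∀ r ∈ 𝕀, ∀ r' ∈ 𝕀, ∀ k ∈ nearOne θ, uu r' • x = k • uu r • x → k = uu (r' - r) := by
  by_contra! hcon
  choose x hx r hr r' hr' k hk he hne using fun n : ℕ => hcon (1 / (n + 1)) (by positivity)
  obtain ⟨C, hC, hKC⟩ := exists_compact_lift hK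
  choose g hgC hgx using fun n => hKC (hx n)
  obtain ⟨⟨g₀, a, b⟩, -, φ, hφ, hlim⟩ := (hC.prod ((isCompact_Icc (a := (0:ℝ)) (b := 1)).prod
    (isCompact_Icc (a := (0:ℝ)) (b := 1)))).tendsto_subseq
    (x := fun n => (g n, r n, r' n)) (fun n => ⟨hgC n, hr n, hr' n⟩)
  have lg : Tendsto (fun n => g (φ n)) atTop (𝓝 g₀) := (continuous_fst.tendsto _).comp hlim
  have la : Tendsto (fun n => r (φ n)) atTop (𝓝 a) := ((continuous_fst.comp continuous_snd).tendsto _).comp hlim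
  have lb : Tendsto (fun n => r' (φ n)) atTop (𝓝 b) := ((continuous_snd.comp continuous_snd).tendsto _).comp hlim
  have lk : Tendsto (fun n => k (φ n)) atTop (𝓝 1) := by
    have : Tendsto k atTop (𝓝 1) := by
      refine tendsto_of_entries fun i j => ?_; rw [tendsto_iff_norm_sub_tendsto_zero]
      exact squeeze_zero (fun n => norm_nonneg _) (fun n => hk n i j) tendsto_one_div_add_atTop_nhds_zero_nat
    exact this.comp hφ.tendsto_atTop
  set c : ℕ → G := fun n => (g n)⁻¹ * ((uu (r' n))⁻¹ * k n * uu (r n)) * g n with hc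
  have hcΓ : ∀ n, c n ∈ Gamma := fun n => by
    have h1 := he n; rw [← hgx n] at h1; simp only [smul_smul] at h1
    change ((uu (r' n) * g n : G) : X) = ((k n * uu (r n) * g n : G) : X) at h1; have h2 := mk_eq_mk.1 h1
    simp only [hc]; convert h2 using 1; group
  set L : G := g₀⁻¹ * ((uu b)⁻¹ * 1 * uu a) * g₀ with hL
  have hcL : Tendsto (fun n => c (φ n)) atTop (𝓝 L) :=
    (lg.inv.mul ((((continuous_uu.tendsto _).comp lb).inv.mul lk).mul ((continuous_uu.tendsto _).comp la))).mul lg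
  have hLΓ : L ∈ Gamma := isClosed_Gamma.mem_of_tendsto hcL (.of_forall fun n => hcΓ _)
  obtain ⟨N, hN, hN1⟩ := exists_compact_mem_nhds L
  have hfin := (finite_inter_Gamma hN).subset (Set.sdiff_subset (t := {L}))
  have hev : ∀ᶠ n in atTop, c (φ n) = L := by
    have h1 := hcL.eventually (hfin.isClosed.isOpen_compl.mem_nhds (show L ∈ _ by simp))
    filter_upwards [h1, hcL.eventually hN1] with n hn hn'
    by_contra hne; exact hn ⟨⟨hn', hcΓ _⟩, hne⟩
  have hLe : uu (a - b) = g₀ * L * g₀⁻¹ := by rw [hL, sub_eq_neg_add, uu_add, uu_neg]; group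
  by_cases hab : a = b
  · obtain ⟨n, hn⟩ := hev.exists; have hL1 : L = 1 := by rw [hL, hab]; group
    rw [hL1] at hn; apply hne (φ n); simp only [hc] at hn
    have h1 : (uu (r' (φ n)))⁻¹ * k (φ n) * uu (r (φ n)) = 1 := by
      simpa [mul_assoc] using congrArg (fun z => g (φ n) * z * (g (φ n))⁻¹) hn
    rw [sub_eq_add_neg, uu_add, uu_neg, eq_mul_inv_iff_mul_eq]; rw [mul_assoc] at h1; exact (inv_mul_eq_one.1 h1).symm
  · have hKcl : (g₀ : X) ∈ K := by
      refine hK.isClosed.mem_of_tendsto ((continuous_mkX.tendsto _).comp lg) (.of_forall fun n => ?_)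
      change ((g (φ n) : G) : X) ∈ K; rw [show ((g (φ n) : G) : X) = x (φ n) from hgx (φ n)]; exact hx _
    refine not_irrationalPt_of_row hLΓ hLe ?_ ?_ (hirr _ hKcl)
    · intro h1; have : (uu (a - b)) 0 1 = (1 : G) 0 1 := by rw [h1]
      simp at this; exact hab (by linarith)
    · intro j
      fin_cases j
      · simp
      · exact (one_apply_eq (1 : Fin 3)).symm
      · simp

/-! ### Conjugation by the diagonal subgroup -/

lemma conj_dd (c : ℝ) (hc : c ≠ 0) (k : G) :
    (dd c hc * k * (dd c hc)⁻¹) 0 0 = k 0 0 ∧ (dd c hc * k * (dd c hc)⁻¹) 0 1 = c ^ 2 * k 0 1 ∧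
    (dd c hc * k * (dd c hc)⁻¹) 0 2 = c * k 0 2 ∧ (dd c hc * k * (dd c hc)⁻¹) 1 0 = (c ^ 2)⁻¹ * k 1 0 ∧
    (dd c hc * k * (dd c hc)⁻¹) 1 1 = k 1 1 ∧ (dd c hc * k * (dd c hc)⁻¹) 1 2 = c⁻¹ * k 1 2 ∧
    (dd c hc * k * (dd c hc)⁻¹) 2 0 = c⁻¹ * k 2 0 ∧ (dd c hc * k * (dd c hc)⁻¹) 2 1 = c * k 2 1 ∧
    (dd c hc * k * (dd c hc)⁻¹) 2 2 = k 2 2 := by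
  have hi : (dd c hc)⁻¹ = dd c⁻¹ (inv_ne_zero hc) := by
    rw [inv_eq_iff_mul_eq_one, dd_mul]; apply G_ext_fin <;> simp [hc]
  rw [hi]; simp only [mul_entry]; refine ⟨?_, ?_, ?_, ?_, ?_, ?_, ?_, ?_, ?_⟩ <;> simp <;> field_simp

lemma di_inv (a : ℕ) : (di a)⁻¹ = dd ((2 : ℝ) ^ a) (by positivity) := by
  rw [inv_eq_iff_mul_eq_one, di, dd_mul]; apply G_ext_fin <;> simp

lemma nearOne_of_entries {θ : ℝ} {k : G} (h01 : |k 0 1| ≤ θ) (h02 : |k 0 2| ≤ θ) (h10 : |k 1 0| ≤ θ)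
    (h12 : |k 1 2| ≤ θ) (h20 : |k 2 0| ≤ θ) (h21 : |k 2 1| ≤ θ) (h00 : |k 0 0 - 1| ≤ θ)
    (h11 : |k 1 1 - 1| ≤ θ) (h22 : |k 2 2 - 1| ≤ θ) : k ∈ nearOne θ := by
  intro i j
  fin_cases i <;> fin_cases j <;> simpa

/-- A correction of `k` by an element of `ll` remains close to the identity under the backward
diagonal flow, provided the contracted transverse entries are small. -/
lemma corrected_mem_nearOne {k : G} {θ θ₀ θ₂ c A : ℝ} (hθ₀ : θ₀ ≤ 1 / 16) (h3 : 3 * θ₀ ≤ θ) (hθ₂ : θ₂ ≤ θ)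
    (hθ₂1 : θ₂ ≤ 1) (hl : LowClose θ₀ k) (hc : 1 ≤ c) (hcA : c ≤ A) (h01 : |k 0 1| ≤ θ₂) (h02 : |k 0 2| ≤ θ₂)
    (h21 : A * |k 2 1| ≤ θ₂) (h12 : A * |k 1 2| ≤ θ₀) (h20 : A * |k 2 0| ≤ θ₀) :
    dd c⁻¹ (by positivity) * (k * ll (-(k 1 0 / k 1 1))) * (dd c⁻¹ (by positivity))⁻¹ ∈ nearOne θ ∧
      |k 1 0 / k 1 1| ≤ 2 * θ₀ := by
  obtain ⟨l10, l20, l12, ld⟩ := hl; set ξ := k 1 0 / k 1 1 with hξ; have hθ₀0 : 0 ≤ θ₀ := (abs_nonneg _).trans l10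
  have hθ₂0 : 0 ≤ θ₂ := (abs_nonneg _).trans h01; have hk11 : 1 / 2 ≤ k 1 1 := by linarith [(abs_le.1 (ld 1)).1]
  have hξb : |ξ| ≤ 2 * θ₀ := by
    rw [hξ, abs_div, abs_of_pos (by linarith : 0 < k 1 1), div_le_iff₀ (by linarith)]
    linarith [mul_le_mul_of_nonneg_left hk11 (by positivity : 0 ≤ 2 * θ₀)]
  refine ⟨?_, hξb⟩; set k' := k * ll (-ξ) with hk'; have e00 : k' 0 0 = k 0 0 - ξ * k 0 1 := by simp [hk', mul₃]; ring
  have e01 : k' 0 1 = k 0 1 := by simp [hk', mul₃]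
  have e02 : k' 0 2 = k 0 2 := by simp [hk', mul₃]
  have e10 : k' 1 0 = 0 := by simp [hk', mul₃, hξ]; rw [mul_div_cancel₀ _ (by linarith)]; ring
  have e11 : k' 1 1 = k 1 1 := by simp [hk', mul₃]
  have e12 : k' 1 2 = k 1 2 := by simp [hk', mul₃]
  have e20 : k' 2 0 = k 2 0 - ξ * k 2 1 := by simp [hk', mul₃]; ring
  have e21 : k' 2 1 = k 2 1 := by simp [hk', mul₃]
  have e22 : k' 2 2 = k 2 2 := by simp [hk', mul₃]
  have hc0 : c ≠ 0 := by linarith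
  obtain ⟨f00, f01, f02, f10, f11, f12, f20, f21, f22⟩ := conj_dd c⁻¹ (inv_ne_zero hc0) k'
  have hci : c⁻¹ ≤ 1 := inv_le_one_of_one_le₀ hc; have hci0 : 0 ≤ c⁻¹ := by positivity
  have hcisq : (c⁻¹) ^ 2 ≤ 1 := pow_le_one₀ hci0 hci
  have sh : ∀ {s t u : ℝ}, 0 ≤ s → s ≤ 1 → |t| ≤ u → |s * t| ≤ u := fun {s t u} h0 h1 ht => by
    rw [abs_mul, abs_of_nonneg h0]; exact (mul_le_of_le_one_left (abs_nonneg _) h1).trans ht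
  have hA : ∀ {t u : ℝ}, A * |t| ≤ u → c * |t| ≤ u := fun {t u} h =>
    (mul_le_mul_of_nonneg_right hcA (abs_nonneg _)).trans h
  have hpr : |ξ * k 0 1| ≤ 2 * θ₀ * 1 := by
    rw [abs_mul]; exact mul_le_mul hξb (h01.trans hθ₂1) (abs_nonneg _) (by positivity)
  refine nearOne_of_entries ?_ ?_ ?_ ?_ ?_ ?_ ?_ ?_ ?_
  · rw [f01, e01]; exact sh (by positivity) hcisq (h01.trans hθ₂)
  · rw [f02, e02]; exact sh hci0 hci (h02.trans hθ₂)
  · rw [f10, e10]; simp; linarith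
  · rw [f12, e12, inv_inv, abs_mul, abs_of_nonneg (by linarith)]; exact (hA h12).trans (by linarith)
  · rw [f20, e20, inv_inv, abs_mul, abs_of_nonneg (by linarith)]; have h1 := hA h20; have h2 := hA h21
    have h3' : |k 2 0 - ξ * k 2 1| ≤ |k 2 0| + |ξ| * |k 2 1| := by rw [← abs_mul]; exact abs_sub _ _
    have h4 := mul_le_mul hξb h2 (by positivity) (by positivity)
    calc c * |k 2 0 - ξ * k 2 1| ≤ c * (|k 2 0| + |ξ| * |k 2 1|) :=
          mul_le_mul_of_nonneg_left h3' (by linarith)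
      _ = c * |k 2 0| + |ξ| * (c * |k 2 1|) := by ring
      _ ≤ θ₀ + 2 * θ₀ * θ₂ := add_le_add h1 h4
      _ ≤ θ := by linarith [mul_le_mul_of_nonneg_left hθ₂1 (by positivity : 0 ≤ 2 * θ₀)]
  · rw [f21, e21]; exact sh hci0 hci (le_trans ((le_mul_of_one_le_left (abs_nonneg _) hc).trans (hA h21)) hθ₂)
  · rw [f00, e00, show k 0 0 - ξ * k 0 1 - 1 = (k 0 0 - 1) - ξ * k 0 1 by ring]; refine (abs_sub _ _).trans ?_
    linarith [ld 0]
  · rw [f11, e11]; linarith [ld 1]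
  · rw [f22, e22]; linarith [ld 2]

/-! ### The measure of a class of close trajectories -/

/-- The point reached from `uu r • x` by the diagonal flow at time `a`. -/
def flowPt (a : ℕ) (x : X) (r : ℝ) : X := (di a)⁻¹ • uu r • x

lemma two_pow_mul (J n : ℕ) : (2 : ℝ) ^ (J * n) = ((2 ^ J : ℕ) : ℝ) ^ n := by push_cast; rw [pow_mul]

/-- The constants used to bound classes of trajectories. -/
structure ClassData (K : Set X) (H : X → ℝ) (b θ₀ θ₂ θ : ℝ) : Prop where
  b_nonneg : 0 ≤ b
  θ_pos : 0 < θ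
  θ_le : θ ≤ 1 / 4
  θ₀_le : θ₀ ≤ 1 / 16
  three_le : 3 * θ₀ ≤ θ
  θ₂_le : θ₂ ≤ θ
  θ₂_pos : 0 < θ₂
  tilt : ∀ x ∈ K, ∀ h ∈ nearOne (max θ₀ θ₂), h • x ∈ K → |h 1 2| ≤ |h 1 0| ∧ |h 2 0| ≤ |h 1 0|
  var : ∀ h ∈ nearOne θ, ∀ x, |H (h • x) - H x| ≤ b / 2
  rigid : ∀ x ∈ K, ∀ r ∈ 𝕀, ∀ r' ∈ 𝕀, ∀ k₁ ∈ nearOne θ, ∀ k₂ ∈ nearOne θ,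
    ∀ k₃ ∈ nearOne θ, uu r' • x = (k₁ * k₂ * k₃⁻¹) • uu r • x → k₁ * k₂ * k₃⁻¹ = uu (r' - r)

lemma class_volume_le {K : Set X} {H : X → ℝ} {b θ₀ θ₂ θ e : ℝ} (D : ClassData K H b θ₀ θ₂ θ)
    {J J₀ n m nf j : ℕ} {x : X} (hx : x ∈ K) {C : Set ℝ} (hC : C ⊆ Icc 0 1) {g : ℝ → G}
    (hy : ∀ r ∈ C, ∀ r' ∈ C, flowPt (J * n) x r' = (g r' * (g r)⁻¹) • flowPt (J * n) x r)
    (hlow : ∀ r ∈ C, ∀ r' ∈ C, LowClose θ₀ (g r' * (g r)⁻¹))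
    (hclose : ∀ r ∈ C, ∀ r' ∈ C, CloseAt (2 ^ J) θ₂ nf (g r' * (g r)⁻¹))
    (hnj : n ≤ j) (hjf : j ≤ nf) (hjK : ∀ r ∈ C, (di (J * j))⁻¹ • flowPt (J * n) x r ∈ K)
    (hm : J₀ * m ≤ J * n) (hbirk : ∀ r ∈ C, 6 * b * m ≤ birk H J₀ m (flowPt (J * n) x r)) (he : 0 ≤ e)
    (hLD : ∀ w : X, volume {ξ | ξ ∈ 𝕀 ∧ 4 * b * m ≤ birk H J₀ m (ll ξ • w)} ≤ ofR e) :
    volume C ≤ ofR (e * (θ₂ / θ) / (((2 ^ J : ℕ) : ℝ) ^ 2) ^ nf) := by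
  rcases C.eq_empty_or_nonempty with rfl | ⟨r₀, hr₀⟩
  · simp
  set q : ℝ := ((2 ^ J : ℕ) : ℝ) with hq; have hq1 : 1 ≤ q := by rw [hq]; exact_mod_cast Nat.one_le_two_pow
  have hq0 : 0 < q := by linarith
  set y := flowPt (J * n) x with hydef; set k : ℝ → G := fun r => g r * (g r₀)⁻¹ with hk
  set ξ : ℝ → ℝ := fun r => k r 1 0 / k r 1 1 with hξ; set w := y r₀
  have hyk : ∀ r ∈ C, y r = k r • w := fun r hr => hy r₀ hr₀ r hr
  have hpow : ∀ i : ℕ, (2 : ℝ) ^ (J * i) = q ^ i := fun i => two_pow_mul J i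
  -- smallness of the contracted transverse entries
  have htilt : ∀ r ∈ C, q ^ n * |k r 1 2| ≤ θ₀ ∧ q ^ n * |k r 2 0| ≤ θ₀ := by
    intro r hr; obtain ⟨l10, l20, l12, ld⟩ := hlow r₀ hr₀ r hr; obtain ⟨c01, c02, c21⟩ := hclose r₀ hr₀ r hr
    have hqj : (1 : ℝ) ≤ q ^ j := one_le_pow₀ hq1; have hqj0 : (0 : ℝ) < q ^ j := by positivity
    obtain ⟨f00, f01, f02, f10, f11, f12, f20, f21, f22⟩ := conj_dd ((2 : ℝ) ^ (J * j)) (by positivity) (k r)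
    rw [← di_inv] at f00 f11 f22; rw [← di_inv, hpow] at f01 f02 f10 f12 f20 f21
    have up : ∀ {t : ℝ}, q ^ nf * |t| ≤ θ₂ → |q ^ j * t| ≤ max θ₀ θ₂ := fun {t} ht => by
      rw [abs_mul, abs_of_pos hqj0]
      exact ((mul_le_mul_of_nonneg_right (pow_le_pow_right₀ hq1 hjf) (abs_nonneg _)).trans ht).trans (le_max_right _ _)
    have dn : ∀ {s t : ℝ}, 1 ≤ s → |t| ≤ θ₀ → |s⁻¹ * t| ≤ max θ₀ θ₂ := fun {s t} hs ht => by
      rw [abs_mul, abs_of_nonneg (by positivity)]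
      exact ((mul_le_of_le_one_left (abs_nonneg _) (inv_le_one_of_one_le₀ hs)).trans ht).trans (le_max_left _ _)
    have hmem : (di (J * j))⁻¹ * k r * ((di (J * j))⁻¹)⁻¹ ∈ nearOne (max θ₀ θ₂) := by
      refine nearOne_of_entries ?_ ?_ ?_ ?_ ?_ ?_ ?_ ?_ ?_
      · rw [f01, abs_mul, abs_of_pos (by positivity), ← pow_mul, mul_comm j 2, pow_mul]
        exact ((mul_le_mul_of_nonneg_right (pow_le_pow_right₀ (one_le_pow₀ hq1) hjf)
          (abs_nonneg _)).trans c01).trans (le_max_right _ _)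
      · rw [f02]; exact up c02
      · rw [f10]; exact dn (one_le_pow₀ hqj) l10
      · rw [f12]; exact dn hqj l12
      · rw [f20]; exact dn hqj l20
      · rw [f21]; exact up c21
      · rw [f00]; exact (ld 0).trans (le_max_left _ _)
      · rw [f11]; exact (ld 1).trans (le_max_left _ _)
      · rw [f22]; exact (ld 2).trans (le_max_left _ _)
    have hh := D.tilt _ (hjK r₀ hr₀) _ hmem (by
      have := hjK r hr; rw [hyk r hr] at this
      simpa [smul_smul, mul_assoc] using this)
    rw [f12, f20, f10] at hh
    have conv : ∀ {t : ℝ}, |(q ^ j)⁻¹ * t| ≤ |((q ^ j) ^ 2)⁻¹ * k r 1 0| → q ^ n * |t| ≤ θ₀ := fun {t} ht => by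
      rw [abs_mul, abs_mul, abs_of_nonneg (show 0 ≤ (q ^ j)⁻¹ by positivity),
        abs_of_nonneg (show 0 ≤ ((q ^ j) ^ 2)⁻¹ by positivity)] at ht
      have h1 : q ^ j * |t| ≤ |k r 1 0| := by
        have := mul_le_mul_of_nonneg_left ht (by positivity : 0 ≤ (q ^ j) ^ 2); field_simp at this; linarith
      exact ((mul_le_mul_of_nonneg_right (pow_le_pow_right₀ hq1 hnj) (abs_nonneg _)).trans h1).trans l10
    exact ⟨conv hh.1, conv hh.2⟩
  have hcorr : ∀ r ∈ C, ∀ a ≤ J * n, di a * (k r * ll (-ξ r)) * (di a)⁻¹ ∈ nearOne θ ∧ |ξ r| ≤ 2 * θ₀ := by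
    intro r hr a ha; obtain ⟨c01, c02, c21⟩ := hclose r₀ hr₀ r hr
    have h1 : ∀ {s t : ℝ}, 1 ≤ s → s * |t| ≤ θ₂ → |t| ≤ θ₂ := fun {s t} hs ht =>
      (le_mul_of_one_le_left (abs_nonneg _) hs).trans ht
    exact corrected_mem_nearOne (c := (2 : ℝ) ^ a) (A := q ^ n) D.θ₀_le D.three_le D.θ₂_le
      (by linarith [D.θ₂_le, D.θ_le]) (hlow r₀ hr₀ r hr) (one_le_pow₀ one_le_two)
      (by rw [← hpow]; exact pow_le_pow_right₀ one_le_two ha)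
      (h1 (one_le_pow₀ (one_le_pow₀ hq1)) c01) (h1 (one_le_pow₀ hq1) c02)
      ((mul_le_mul_of_nonneg_right (pow_le_pow_right₀ hq1 (hnj.trans hjf)) (abs_nonneg _)).trans c21)
      (htilt r hr).1 (htilt r hr).2
  set δ : ℝ := θ / 4 ^ (J * n) with hδ; have hθ := D.θ_pos; have h4 : (0 : ℝ) < 4 ^ (J * n) := by positivity
  have hδ0 : 0 < δ := by positivity
  have hδθ : δ ≤ θ := div_le_self hθ.le (one_le_pow₀ (by norm_num))
  -- the sums along the corrected trajectory
  have hsum : ∀ r ∈ C, ∀ z, |z - ξ r| ≤ δ → 4 * b * m ≤ birk H J₀ m (ll z • w) := by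
    intro r hr z hz
    have hterm : ∀ i ∈ Finset.range m, H (di (J₀ * i) • y r) - b ≤ H (di (J₀ * i) • ll z • w) := by
      intro i hi; have ha : J₀ * i ≤ J * n := (Nat.mul_le_mul_left _ (Finset.mem_range.1 hi).le).trans hm
      have h1 := D.var _ (hcorr r hr _ ha).1 (di (J₀ * i) • ll (ξ r) • w)
      have e1 : (di (J₀ * i) * (k r * ll (-ξ r)) * (di (J₀ * i))⁻¹) • di (J₀ * i) • ll (ξ r) • w =
          di (J₀ * i) • y r := by
        rw [hyk r hr, ll_neg]; simp only [smul_smul]; congr 1; group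
      rw [e1] at h1
      have h2 := D.var (ll (4 ^ (J₀ * i) * (z - ξ r))) (ll_mem_nearOne (by
        rw [abs_mul, abs_of_pos (by positivity)]
        calc (4 : ℝ) ^ (J₀ * i) * |z - ξ r| ≤ 4 ^ (J * n) * δ := by
              gcongr; norm_num
          _ = θ := by rw [hδ]; field_simp)) (di (J₀ * i) • ll (ξ r) • w)
      have e2 : ll (4 ^ (J₀ * i) * (z - ξ r)) • di (J₀ * i) • ll (ξ r) • w = di (J₀ * i) • ll z • w := by
        rw [smul_smul, ← di_ll, mul_smul, smul_smul (ll _), ← ll_add, sub_add_cancel]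
      rw [e2] at h2; have := abs_le.1 h1; have := abs_le.1 h2; linarith
    have h3 := Finset.sum_le_sum hterm
    rw [Finset.sum_sub_distrib, Finset.sum_const, Finset.card_range, nsmul_eq_mul] at h3; have h4' := hbirk r hr
    simp only [birk] at h4' ⊢; have : 0 ≤ b * m := mul_nonneg D.b_nonneg (Nat.cast_nonneg m); linarith
  -- cells
  set cell : ℤ → Set ℝ := fun i => Set.Ico (i * δ) ((i + 1) * δ) with hcell
  have mem_cell : ∀ z i, z ∈ cell i ↔ ⌊z / δ⌋ = i := fun z i => by
    rw [Int.floor_eq_iff, le_div_iff₀ hδ0, div_lt_iff₀ hδ0]; rfl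
  have hfin : ((fun r => ⌊ξ r / δ⌋) '' C).Finite := by
    refine (finite_Icc ⌊-1 / δ⌋ ⌊1 / δ⌋).subset ?_
    rintro - ⟨r, hr, rfl⟩
    have h1 := abs_le.1 (hcorr r hr 0 (Nat.zero_le _)).2; have h2 := D.θ₀_le
    constructor <;> refine Int.floor_le_floor (div_le_div_of_nonneg_right ?_ hδ0.le) <;> linarith
  set I : Finset ℤ := hfin.toFinset with hI
  have hIr : ∀ i ∈ I, ∃ r ∈ C, ⌊ξ r / δ⌋ = i := fun i hi => by rw [hI, Set.Finite.mem_toFinset] at hi; exact hi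
  have hcard : (I.card : ℝ) * δ ≤ e := by
    have hdis : Set.PairwiseDisjoint (I : Set ℤ) cell := by
      intro i _ i' _ hne; rw [Function.onFun, Set.disjoint_left]; intro z hz hz'
      exact hne (((mem_cell z i).1 hz).symm.trans ((mem_cell z i').1 hz'))
    have hvol : volume (⋃ i ∈ I, cell i) = ofR (I.card * δ) := by
      rw [measure_biUnion_finset hdis fun i _ => measurableSet_Ico]
      have : ∀ i ∈ I, volume (cell i) = ofR δ := fun i _ => by rw [hcell, Real.volume_Ico]; congr 1; ring
      rw [Finset.sum_congr rfl this, Finset.sum_const, nsmul_eq_mul, ofReal_mul (Nat.cast_nonneg _), ofReal_natCast]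
    have hsub : (⋃ i ∈ I, cell i) ⊆ (fun z => z + 1 / 2) ⁻¹'
        {ξ | ξ ∈ 𝕀 ∧ 4 * b * m ≤ birk H J₀ m (ll ξ • ll (-(1 / 2)) • w)} := by
      intro z hz; simp only [mem_iUnion] at hz; obtain ⟨i, hi, hzi⟩ := hz; obtain ⟨r, hr, hri⟩ := hIr i hi
      have h1 := Int.abs_sub_lt_one_of_floor_eq_floor (((mem_cell z i).1 hzi).trans hri.symm)
      rw [← sub_div, abs_div, abs_of_pos hδ0, div_lt_one hδ0] at h1
      have h2 := abs_le.1 (hcorr r hr 0 (Nat.zero_le _)).2; have h3 := D.θ₀_le; have h4 := D.θ_le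
      have h5 := abs_lt.1 h1; refine ⟨⟨by linarith, by linarith⟩, ?_⟩; rw [smul_smul, ← ll_add, add_neg_cancel_right]
      exact hsum r hr z h1.le
    have := (measure_mono (μ := volume) hsub).trans_eq (measure_preimage_add_right volume (1 / 2 : ℝ) _)
    rw [hvol] at this; exact (ofReal_le_ofReal_iff he).1 (this.trans (hLD _))
  -- points in the same cell
  set σ : ℝ := θ₂ / ((q ^ 2) ^ n * (q ^ 2) ^ nf) with hσ; have hσ0 : 0 ≤ σ := by have := D.θ₂_pos; positivity
  have h4q : (4 : ℝ) ^ (J * n) = (q ^ 2) ^ n := by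
    rw [show (4 : ℝ) = 2 ^ 2 by norm_num, ← pow_mul, mul_comm 2 (J * n), pow_mul, hpow, ← pow_mul,
      mul_comm n 2, pow_mul]
  have hdiam : ∀ r ∈ C, ∀ r' ∈ C, ⌊ξ r / δ⌋ = ⌊ξ r' / δ⌋ → |r - r'| ≤ σ := by
    intro r hr r' hr' hfl; have h1 := Int.abs_sub_lt_one_of_floor_eq_floor hfl
    rw [← sub_div, abs_div, abs_of_pos hδ0, div_lt_one hδ0] at h1
    have hl : ll (4 ^ (J * n) * (ξ r' - ξ r)) ∈ nearOne θ := ll_mem_nearOne (by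
      rw [abs_mul, abs_of_pos h4, abs_sub_comm]
      calc (4 : ℝ) ^ (J * n) * |ξ r - ξ r'| ≤ 4 ^ (J * n) * δ := by gcongr
        _ = θ := by rw [hδ]; field_simp)
    have eκ : di (J * n) * (k r' * ll (-ξ r')) * (di (J * n))⁻¹ * ll (4 ^ (J * n) * (ξ r' - ξ r)) *
        (di (J * n) * (k r * ll (-ξ r)) * (di (J * n))⁻¹)⁻¹ =
        di (J * n) * (g r' * (g r)⁻¹) * (di (J * n))⁻¹ := by
      have h2 : ll (4 ^ (J * n) * (ξ r' - ξ r)) = di (J * n) * ll (ξ r' - ξ r) * (di (J * n))⁻¹ := by rw [di_ll]; group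
      rw [h2, sub_eq_add_neg, ll_add, ll_neg, ll_neg]; simp only [hk]; group
    have h2 := D.rigid x hx r (hC hr) r' (hC hr') _ (hcorr r' hr' _ le_rfl).1 _ hl _ (hcorr r hr _ le_rfl).1 (by
      rw [eκ]; have h3 := hy r hr r' hr'; simp only [hydef, flowPt] at h3; rw [inv_smul_eq_iff] at h3; rw [h3]
      simp only [smul_smul, mul_assoc])
    rw [eκ] at h2; obtain ⟨-, f01, -⟩ := conj_dd ((2 : ℝ) ^ (J * n))⁻¹ (by positivity) (g r' * (g r)⁻¹)
    change (di (J * n) * (g r' * (g r)⁻¹) * (di (J * n))⁻¹) 0 1 = _ at f01; rw [h2] at f01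
    have f01' : r' - r = (((2 : ℝ) ^ (J * n))⁻¹) ^ 2 * (g r' * (g r)⁻¹) 0 1 := by simpa using f01
    have c01 := (hclose r hr r' hr').1
    rw [abs_sub_comm, f01', abs_mul, abs_of_nonneg (by positivity), hpow, hσ, le_div_iff₀ (by positivity)]
    calc (q ^ n)⁻¹ ^ 2 * |(g r' * (g r)⁻¹) 0 1| * ((q ^ 2) ^ n * (q ^ 2) ^ nf)
        = (q ^ 2) ^ nf * |(g r' * (g r)⁻¹) 0 1| := by rw [← pow_mul q 2 n, mul_comm 2 n, pow_mul q n 2]; field_simp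
      _ ≤ θ₂ := c01
  have hcover : C ⊆ ⋃ i ∈ I, {r | r ∈ C ∧ ⌊ξ r / δ⌋ = i} := fun r hr => by
    simp only [mem_iUnion]; exact ⟨⌊ξ r / δ⌋, by rw [hI, Set.Finite.mem_toFinset]; exact ⟨r, hr, rfl⟩, hr, rfl⟩
  calc volume C ≤ ∑ i ∈ I, volume {r | r ∈ C ∧ ⌊ξ r / δ⌋ = i} :=
        (measure_mono hcover).trans (measure_biUnion_finset_le _ _)
    _ ≤ ∑ i ∈ I, ofR σ := by
        refine Finset.sum_le_sum fun i _ => (Real.volume_le_diam _).trans (Metric.ediam_le ?_)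
        rintro r ⟨hr, hri⟩ r' ⟨hr', hri'⟩
        rw [edist_dist, Real.dist_eq]; exact ofReal_le_ofReal (hdiam r hr r' hr' (hri.trans hri'.symm))
    _ = ofR (I.card * σ) := by rw [Finset.sum_const, nsmul_eq_mul, ofReal_mul (Nat.cast_nonneg _), ofReal_natCast]
    _ ≤ _ := by
        refine ofReal_le_ofReal ?_; have h1 : (I.card : ℝ) ≤ e / δ := by rwa [le_div_iff₀ hδ0]
        refine (mul_le_mul_of_nonneg_right h1 hσ0).trans (le_of_eq ?_); rw [hσ, hδ, h4q]; field_simp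

/-! ### The measure of the good parameters -/

open Classical in
/-- The times at which the trajectory of `z` under the diagonal flow visits `K`. -/
def visits (K : Set X) (J nf : ℕ) (z : X) : Finset ℕ := (Finset.range nf).filter fun i => (di (J * i))⁻¹ • z ∈ K

lemma mem_visits {K : Set X} {J nf : ℕ} {z : X} {i : ℕ} :
    i ∈ visits K J nf z ↔ i ∈ Finset.range nf ∧ (di (J * i))⁻¹ • z ∈ K := by
  classical
  unfold visits; exact Finset.mem_filter

/-- Parameters whose trajectory visits `K` often and has large Birkhoff sums. -/
def goodSet (K : Set X) (H : X → ℝ) (b : ℝ) (J J₀ m nf t : ℕ) : Set X :=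
  {z | z ∈ K ∧ (Finset.range nf \ visits K J nf z).card ≤ t ∧ 6 * b * m ≤ birk H J₀ m z}

lemma exists_late_visit {K : Set X} {J n nf t : ℕ} (hnf : n + t + 1 ≤ nf) {z : X}
    (h : (Finset.range nf \ visits K J nf z).card ≤ t) : ∃ j ∈ visits K J nf z, n ≤ j ∧ j ≤ nf := by
  by_contra! hcon
  have h1 : Finset.Ico n nf ⊆ Finset.range nf \ visits K J nf z := fun j hj => by
    rw [Finset.mem_Ico] at hj
    exact Finset.mem_sdiff.2 ⟨Finset.mem_range.2 hj.2, fun hv => absurd (hcon j hv hj.1) (not_lt.2 hj.2.le)⟩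
  have h2 := Finset.card_le_card h1; rw [Nat.card_Ico] at h2; omega

lemma good_volume_le {K : Set X} {H : X → ℝ} {b θ₀ θ₂ θ e θ' : ℝ} (D : ClassData K H b θ₀ θ₂ θ)
    {J J₀ n m nf t : ℕ} (hθ₀2 : θ₀ ≤ θ₂) (hqθ : ((2 ^ J : ℕ) : ℝ) ^ 2 * θ₂ ≤ 1 / 64)
    (hshear : ∀ x ∈ K, ∀ h : G, h • x ∈ K → |h 1 0| ≤ θ₀ → |h 2 0| ≤ θ₀ → |h 1 2| ≤ θ₀ →
      (∀ i, |h i i - 1| ≤ θ₀) → |h 0 1| ≤ 1 → |h 0 2| ≤ 1 → |h 2 1| ≤ 1 →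
      |h 0 2| ≤ θ₂ / 16 / (2 ^ J : ℕ) ∧ |h 2 1| ≤ θ₂ / 16 / (2 ^ J : ℕ))
    (hdiv : ∀ a ∈ nearOne θ', ∀ b ∈ nearOne θ', a * b⁻¹ ∈ nearOne θ₀) {T : Finset X}
    (hT : K ⊆ ⋃ w ∈ T, (fun g : G => g • w) '' nearOne θ') (hnf : n + t + 1 ≤ nf)
    (hm : J₀ * m ≤ J * n) (he : 0 ≤ e)
    (hLD : ∀ w : X, volume {ξ | ξ ∈ 𝕀 ∧ 4 * b * m ≤ birk H J₀ m (ll ξ • w)} ≤ ofR e) {x : X} (hx : x ∈ K) :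
    volume {r | r ∈ 𝕀 ∧ flowPt (J * n) x r ∈ goodSet K H b J J₀ m nf t} ≤
      ofR (T.card * 2 ^ nf * ((16 * ((2 ^ J : ℕ) : ℝ) ^ 2 + 1) ^ nf * ((16 * ((2 ^ J : ℕ) : ℝ) + 1) ^ 2) ^ t) *
        (e * (θ₂ / θ) / (((2 ^ J : ℕ) : ℝ) ^ 2) ^ nf)) := by
  set q : ℕ := 2 ^ J; have hq1 : 1 ≤ q := Nat.one_le_two_pow; have hqr1 : (1 : ℝ) ≤ q := by exact_mod_cast hq1
  set y := flowPt (J * n) x with hy; set v : ℝ := e * (θ₂ / θ) / ((q : ℝ) ^ 2) ^ nf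
  have hθ := D.θ_pos; have hθ₂ := D.θ₂_pos; have hv0 : 0 ≤ v := by positivity
  set B : ℕ := (16 * q ^ 2 + 1) ^ nf * ((16 * q + 1) ^ 2) ^ t with hB
  set S : X → Finset ℕ → Set ℝ := fun w P => {r | (r ∈ 𝕀 ∧ y r ∈ goodSet K H b J J₀ m nf t) ∧
    (∃ g ∈ nearOne θ', y r = g • w) ∧ visits K J nf (y r) = P}
  have piece : ∀ w P, volume (S w P) ≤ B * ofR v := by
    intro w P
    rcases (S w P).eq_empty_or_nonempty with h0 | ⟨s, hs⟩
    · simp [h0]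
    have hPt : (Finset.range nf \ P).card ≤ t := hs.2.2 ▸ hs.1.2.2.1
    obtain ⟨j, hjP, hnj, hjf⟩ := exists_late_visit hnf hs.1.2.2.1; rw [hs.2.2] at hjP
    have hgex : ∀ r, ∃ g : G, r ∈ S w P → g ∈ nearOne θ' ∧ y r = g • w := fun r => by
      by_cases h : r ∈ S w P
      · obtain ⟨g, hg, hgw⟩ := h.2.1; exact ⟨g, fun _ => ⟨hg, hgw⟩⟩
      · exact ⟨1, fun h' => absurd h' h⟩
    choose g hg using hgex
    have hk : ∀ r ∈ S w P, ∀ r' ∈ S w P, g r' * (g r)⁻¹ ∈ nearOne θ₀ := fun r hr r' hr' =>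
      hdiv _ (hg r' hr').1 _ (hg r hr).1
    have hlow : ∀ r ∈ S w P, ∀ r' ∈ S w P, LowClose θ₀ (g r' * (g r)⁻¹) := fun r hr r' hr' => by
      obtain ⟨-, ⟨a1, -, a3⟩, a2, -⟩ := nearOne.entries (hk r hr r' hr')
      exact ⟨a1, a2, a3, fun i => by simpa using hk r hr r' hr' i i⟩
    have hpair : ∀ r ∈ S w P, ∀ r' ∈ S w P, y r' = (g r' * (g r)⁻¹) • y r := fun r hr r' hr' => by
      rw [(hg r hr).2, (hg r' hr').2, smul_smul, inv_mul_cancel_right]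
    have hvis : ∀ r ∈ S w P, ∀ i ∈ P, (di (J * i))⁻¹ • y r ∈ K := fun r hr i hi => by
      have := hr.2.2 ▸ hi; exact (mem_visits.1 this).2
    obtain ⟨c, F, hF, hcF, hc⟩ := exists_code g (S w P) hq1 hθ₂ (θ₀ := θ₀)
      ((mul_le_mul_of_nonneg_left hθ₀2 (by positivity)).trans hqθ) hqθ P hlow
      (fun r hr r' hr' => by
        obtain ⟨⟨-, a1, a2⟩, -, -, a3, -⟩ := nearOne.entries (hk r hr r' hr'); simp only [CloseAt, pow_zero, one_mul]
        exact ⟨a1.trans hθ₀2, a2.trans hθ₀2, a3.trans hθ₀2⟩)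
      (fun i hi r hr r' hr' hcl => by
        set k := g r' * (g r)⁻¹; obtain ⟨l10, l20, l12, ld⟩ := hlow r hr r' hr'; obtain ⟨c01, c02, c21⟩ := hcl
        obtain ⟨f00, f01, f02, f10, f11, f12, f20, f21, f22⟩ := conj_dd ((2 : ℝ) ^ (J * i)) (by positivity) k
        rw [← di_inv] at f00 f11 f22; rw [← di_inv, two_pow_mul] at f01 f02 f10 f12 f20 f21
        have hqi : (1 : ℝ) ≤ (q : ℝ) ^ i := one_le_pow₀ hqr1; have hθ1 : θ₂ ≤ 1 := by linarith [D.θ₂_le, D.θ_le]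
        have dn : ∀ {s u : ℝ}, 1 ≤ s → |u| ≤ θ₀ → |s⁻¹ * u| ≤ θ₀ := fun {s u} hs hu => by
          rw [abs_mul, abs_of_nonneg (by positivity)]
          exact (mul_le_of_le_one_left (abs_nonneg _) (inv_le_one_of_one_le₀ hs)).trans hu
        have h1 := hshear _ (hvis r hr i hi) ((di (J * i))⁻¹ * k * ((di (J * i))⁻¹)⁻¹) (by
          have := hvis r' hr' i hi; rw [hpair r hr r' hr'] at this
          simpa [smul_smul, mul_assoc] using this)
          (by rw [f10]; exact dn (one_le_pow₀ hqi) l10) (by rw [f20]; exact dn hqi l20)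
          (by rw [f12]; exact dn hqi l12)
          (fun l => by
            fin_cases l
            · change |(((di (J * i))⁻¹ * k * ((di (J * i))⁻¹)⁻¹ : G) 0 0) - 1| ≤ θ₀; rw [f00]; exact ld 0
            · change |(((di (J * i))⁻¹ * k * ((di (J * i))⁻¹)⁻¹ : G) 1 1) - 1| ≤ θ₀; rw [f11]; exact ld 1
            · change |(((di (J * i))⁻¹ * k * ((di (J * i))⁻¹)⁻¹ : G) 2 2) - 1| ≤ θ₀; rw [f22]; exact ld 2)
          (by rw [f01, abs_mul, abs_of_nonneg (by positivity), ← pow_mul, mul_comm i 2, pow_mul]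
              exact c01.trans hθ1)
          (by rw [f02, abs_mul, abs_of_nonneg (by positivity)]; exact c02.trans hθ1)
          (by rw [f21, abs_mul, abs_of_nonneg (by positivity)]; exact c21.trans hθ1)
        rw [f02, f21, abs_mul, abs_mul, abs_of_nonneg (by positivity : (0 : ℝ) ≤ (q : ℝ) ^ i)] at h1
        have h2 := (le_div_iff₀ (by linarith)).1 h1.1; have h3 := (le_div_iff₀ (by linarith)).1 h1.2; rw [pow_succ]
        exact ⟨by linarith, by linarith⟩) nf
    have hFB : F.card ≤ B := hF.trans (Nat.mul_le_mul_left _ (Nat.pow_le_pow_right (by positivity) hPt))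
    have hcov : S w P ⊆ ⋃ u ∈ F, {r | r ∈ S w P ∧ c r = u} := fun r hr => by
      simp only [mem_iUnion]; exact ⟨c r, hcF r hr, hr, rfl⟩
    calc volume (S w P) ≤ ∑ u ∈ F, volume {r | r ∈ S w P ∧ c r = u} :=
          (measure_mono hcov).trans (measure_biUnion_finset_le _ _)
      _ ≤ ∑ u ∈ F, ofR v := Finset.sum_le_sum fun u _ =>
          class_volume_le D hx (fun r hr => hr.1.1.1) (fun r hr r' hr' => hpair r hr.1 r' hr'.1)
            (fun r hr r' hr' => hlow r hr.1 r' hr'.1)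
            (fun r hr r' hr' => hc r hr.1 r' hr'.1 (hr.2.trans hr'.2.symm)) hnj hjf
            (fun r hr => hvis r hr.1 j hjP) hm (fun r hr => hr.1.1.2.2.2) he hLD
      _ = F.card * ofR v := by rw [Finset.sum_const, nsmul_eq_mul]
      _ ≤ B * ofR v := by gcongr
  have hcov : {r | r ∈ 𝕀 ∧ y r ∈ goodSet K H b J J₀ m nf t} ⊆
      ⋃ w ∈ T, ⋃ P ∈ (Finset.range nf).powerset, S w P := fun r hr => by
    obtain ⟨w, hw⟩ := mem_iUnion.1 (hT hr.2.1); obtain ⟨hw, g, hg, hgw⟩ := mem_iUnion.1 hw; simp only [mem_iUnion]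
    exact ⟨w, hw, visits K J nf (y r), Finset.mem_powerset.2 (fun i hi => (mem_visits.1 hi).1), hr,
      ⟨g, hg, hgw.symm⟩, rfl⟩
  calc _ ≤ ∑ w ∈ T, ∑ P ∈ (Finset.range nf).powerset, volume (S w P) :=
        (measure_mono hcov).trans ((measure_biUnion_finset_le _ _).trans
          (Finset.sum_le_sum fun w _ => measure_biUnion_finset_le _ _))
    _ ≤ ∑ w ∈ T, ∑ P ∈ (Finset.range nf).powerset, B * ofR v :=
        Finset.sum_le_sum fun w _ => Finset.sum_le_sum fun P _ => piece w P
    _ = ofR (T.card * 2 ^ nf * B * v) := by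
        rw [Finset.sum_const, Finset.sum_const, Finset.card_powerset, Finset.card_range, nsmul_eq_mul,
          nsmul_eq_mul, ofReal_mul (by positivity), ofReal_mul (by positivity),
          ofReal_mul (by positivity), ofReal_natCast, ofReal_natCast,
          ofReal_pow (by norm_num)]
        push_cast; rw [ofReal_ofNat]; ring
    _ = _ := by rw [hB]; push_cast; rfl

/-! ### The measure of the good set -/

lemma measurableSet_goodSet {K : Set X} (hK : IsCompact K) {H : X → ℝ} (hH : Continuous H) (b : ℝ)
    (J J₀ m nf t : ℕ) : MeasurableSet (goodSet K H b J J₀ m nf t) := by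
  have h1 : MeasurableSet {z | (Finset.range nf \ visits K J nf z).card ≤ t} := by
    have : Measurable fun z => (Finset.range nf \ visits K J nf z) := by
      classical
      refine measurable_to_countable' fun P => ?_
      have e : (fun z => Finset.range nf \ visits K J nf z) ⁻¹' {P} =
          ⋂ i : ℕ, {z | (i ∈ P ↔ (i ∈ Finset.range nf ∧ (di (J * i))⁻¹ • z ∉ K))} := by
        ext z
        simp only [Set.mem_preimage, Set.mem_singleton_iff, Finset.ext_iff, mem_iInter, mem_ofPred_eq,
          mem_visits, Finset.mem_sdiff]
        refine forall_congr' fun i => ?_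
        tauto
      rw [e]; refine MeasurableSet.iInter fun i => ?_
      have hm : MeasurableSet {z : X | (di (J * i))⁻¹ • z ∈ K} := measurable_smulX _ hK.measurableSet
      by_cases hP : i ∈ P <;> by_cases hr : i ∈ Finset.range nf <;> simp only [hP, hr, true_iff, false_iff,
        true_and, false_and, not_not, not_false_eq_true] <;> first | exact hm | exact hm.compl | simp
    exact this (Set.to_countable {P : Finset ℕ | P.card ≤ t}).measurableSet
  exact hK.measurableSet.inter (h1.inter (measurableSet_le measurable_const (continuous_birk hH J₀ m).measurable))

lemma measure_goodSet_ge (hD : ∀ a, di a ∈ stab ν) {K : Set X} (hK : IsCompact K) {H : X → ℝ}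
    (hH : Continuous H) {M b : ℝ} (hM : ∀ x, |H x| ≤ M) (hb : 0 < b) (hmean : ∫ x, H x ∂ν = 8 * b)
    (J J₀ : ℕ) {m nf t R : ℕ} (hm : 0 < m) (ht : 0 < t) (hnf : nf ≤ R * t) :
    2 * b ≤ M * (ν.real (goodSet K H b J J₀ m nf t) + (R + 1) * ν.real Kᶜ) := by
  classical
  set A := goodSet K H b J J₀ m nf t; have hAm : MeasurableSet A := measurableSet_goodSet hK hH b J J₀ m nf t
  have hKm := hK.measurableSet.compl; set χ : X → ℝ := Kᶜ.indicator 1 with hχ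
  have hχ0 : ∀ z, 0 ≤ χ z := fun z => Set.indicator_nonneg (fun _ _ => zero_le_one) z
  have hM0 : 0 ≤ M := (abs_nonneg _).trans (hM x₀)
  set N : X → ℝ := fun z => ∑ i ∈ Finset.range nf, χ ((di (J * i))⁻¹ • z) with hN
  have hN0 : ∀ z, 0 ≤ N z := fun z => Finset.sum_nonneg fun i _ => hχ0 _
  have hcard : ∀ z, N z = ((Finset.range nf \ visits K J nf z).card : ℝ) := fun z => by
    rw [hN, Finset.card_eq_sum_ones, Nat.cast_sum]
    have : Finset.range nf \ visits K J nf z = (Finset.range nf).filter fun i => (di (J * i))⁻¹ • z ∈ Kᶜ := by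
      ext i; simp only [Finset.mem_sdiff, mem_visits, Finset.mem_filter, Set.mem_compl_iff]
      tauto
    rw [this, Finset.sum_filter]; refine Finset.sum_congr rfl fun i _ => ?_
    by_cases h : (di (J * i))⁻¹ • z ∈ Kᶜ
    · rw [if_pos h, hχ, indicator_of_mem h]; simp
    · rw [if_neg h, hχ, indicator_of_notMem h]
  have hpt : ∀ z, birk H J₀ m z ≤ 6 * b * m + M * m * (A.indicator 1 z + χ z + N z / t) := fun z => by
    have hle : birk H J₀ m z ≤ M * m := by
      calc birk H J₀ m z ≤ ∑ i ∈ Finset.range m, M := Finset.sum_le_sum fun i _ => (abs_le.1 (hM _)).2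
        _ = M * m := by simp [mul_comm]
    have hMm : 0 ≤ M * m := by positivity
    have h6 : 0 ≤ 6 * b * m := by positivity
    have hN1 : 0 ≤ N z / t := div_nonneg (hN0 z) (by positivity)
    have hA0 : (0 : ℝ) ≤ A.indicator 1 z := Set.indicator_nonneg (fun _ _ => zero_le_one) z
    have key : 1 ≤ A.indicator (1 : X → ℝ) z + χ z + N z / t ∨ birk H J₀ m z < 6 * b * m := by
      by_cases h1 : z ∈ K
      · by_cases h2 : (Finset.range nf \ visits K J nf z).card ≤ t
        · by_cases h3 : 6 * b * m ≤ birk H J₀ m z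
          · left
            rw [indicator_of_mem (show z ∈ A from ⟨h1, h2, h3⟩)]; have := hχ0 z; simp only [Pi.one_apply]; linarith
          · exact Or.inr (not_le.1 h3)
        · left
          have : 1 ≤ N z / t := by rw [hcard, le_div_iff₀ (by positivity), one_mul]; exact_mod_cast (not_le.1 h2).le
          linarith [hχ0 z]
      · left
        have : χ z = 1 := indicator_of_mem (show z ∈ Kᶜ from h1) _; linarith
    rcases key with h | h
    · nlinarith
    · have : 0 ≤ M * m * (A.indicator 1 z + χ z + N z / t) := mul_nonneg hMm (by linarith [hχ0 z]); linarith
  have iH : ∀ g : G, Integrable (fun z => H (g • z)) ν := fun g =>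
    Integrable.of_bound ((hH.comp (continuous_const_smul g)).aestronglyMeasurable) M
      (.of_forall fun x => by rw [norm_eq_abs]; exact hM _)
  have iχ : Integrable χ ν := (integrable_const (1 : ℝ)).indicator hKm
  have iχg : ∀ g : G, g ∈ stab ν → Integrable (fun z => χ (g • z)) ν := fun g hg =>
    (measurePreserving_of_mem_stab hg).integrable_comp_of_integrable iχ
  have eg : ∀ g : G, g ∈ stab ν → ∀ f : X → ℝ, Integrable f ν → ∫ z, f (g • z) ∂ν = ∫ z, f z ∂ν := fun g hg f hf => by
    have h := (measurePreserving_of_mem_stab hg).map_eq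
    have h2 := integral_map (measurable_smulX g).aemeasurable (f := f) (μ := ν) (by rw [h]; exact hf.1); rw [h] at h2
    exact h2.symm
  have eχ : ∫ z, χ z ∂ν = ν.real Kᶜ := by rw [hχ, integral_indicator_one hKm]
  have hbirk : ∫ z, birk H J₀ m z ∂ν = m * (8 * b) := by
    unfold birk; rw [integral_finsetSum _ fun i _ => iH _]
    have : ∀ i ∈ Finset.range m, ∫ z, H (di (J₀ * i) • z) ∂ν = 8 * b := fun i _ => by
      rw [eg _ (hD _) H (by simpa using iH 1), hmean]
    rw [Finset.sum_congr rfl this]; simp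
  have iN : Integrable N ν := integrable_finsetSum _ fun i _ => iχg _ (inv_mem (hD _))
  have eN : ∫ z, N z ∂ν = nf * ν.real Kᶜ := by
    rw [hN, integral_finsetSum _ fun i _ => iχg _ (inv_mem (hD _))]
    have : ∀ i ∈ Finset.range nf, ∫ z, χ ((di (J * i))⁻¹ • z) ∂ν = ν.real Kᶜ := fun i _ => by
      rw [eg _ (inv_mem (hD _)) χ iχ, eχ]
    rw [Finset.sum_congr rfl this]; simp
  have iA : Integrable (A.indicator (1 : X → ℝ)) ν := (integrable_const (1 : ℝ)).indicator hAm
  have ibirk : Integrable (birk H J₀ m) ν := integrable_finsetSum _ fun i _ => iH _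
  have iB : Integrable (fun z => A.indicator (1 : X → ℝ) z + χ z) ν := iA.add iχ
  have iN' : Integrable (fun z => N z / t) ν := iN.div_const _
  have iS : Integrable (fun z => M * m * (A.indicator (1 : X → ℝ) z + χ z + N z / t)) ν := (iB.add iN').const_mul _
  have h1 := integral_mono ibirk ((integrable_const _).add iS) hpt
  have e2 : ∫ z, (6 * b * m + M * m * (A.indicator 1 z + χ z + N z / t)) ∂ν =
      6 * b * m + M * m * (ν.real A + ν.real Kᶜ + nf * ν.real Kᶜ / t) := by
    rw [integral_add (integrable_const _) iS, integral_const, integral_const_mul, integral_add iB iN', integral_add iA iχ, integral_div, eN, eχ,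
      integral_indicator_one hAm]
    simp
  have h1' : (m : ℝ) * (8 * b) ≤ 6 * b * m + M * m * (ν.real A + ν.real Kᶜ + nf * ν.real Kᶜ / t) := by
    rw [← hbirk, ← e2]; exact h1
  have hmr : (0 : ℝ) < m := by exact_mod_cast hm
  have htr : (0 : ℝ) < t := by exact_mod_cast ht
  have h3 : 2 * b ≤ M * (ν.real A + ν.real Kᶜ + nf * ν.real Kᶜ / t) := by
    have : m * (2 * b) ≤ m * (M * (ν.real A + ν.real Kᶜ + nf * ν.real Kᶜ / t)) := by linarith
    exact le_of_mul_le_mul_left this hmr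
  have h4 : (nf : ℝ) * ν.real Kᶜ / t ≤ R * ν.real Kᶜ := by
    rw [div_le_iff₀ htr]; have : (nf : ℝ) ≤ R * t := by exact_mod_cast hnf
    have := mul_le_mul_of_nonneg_right this (measureReal_nonneg (μ := ν) (s := Kᶜ)); linarith
  refine h3.trans (mul_le_mul_of_nonneg_left (by linarith) hM0)

lemma exists_fibre_ge {p : ℝ → G} (hp : Continuous p) (hst : ∀ r, p r ∈ stab ν) {A K : Set X}
    (hA : MeasurableSet A) (hK : MeasurableSet K) {c : ℝ} (hc : 0 < c) (hAc : c ≤ ν.real A)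
    (hKc : ν.real Kᶜ ≤ c / 3) :
    ∃ x ∈ K, ofR (c / 2) ≤ volume {r | r ∈ 𝕀 ∧ p r • x ∈ A} := by
  by_contra! hcon; have e := lintegral_fibre hp hst hA
  have hb : ∀ x, (volume.restrict 𝕀) {ζ | p ζ • x ∈ A} ≤ ofR (c / 2) + Kᶜ.indicator 1 x := fun x => by
    by_cases hx : x ∈ K
    · refine le_trans ?_ le_self_add
      have hm : MeasurableSet {ζ | p ζ • x ∈ A} := (hp.smul continuous_const).measurable hA
      rw [Measure.restrict_apply hm, Set.inter_comm]; exact (hcon x hx).le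
    · rw [indicator_of_mem (show x ∈ Kᶜ from hx)]; refine le_trans ?_ le_add_self
      refine (measure_mono (Set.subset_univ _)).trans ?_; simp
  have h1 : ν A ≤ ofR (c / 2) + ν Kᶜ := by
    rw [← e]; refine (lintegral_mono hb).trans ?_
    rw [lintegral_add_left measurable_const, lintegral_indicator_one hK.compl]; simp
  rw [← ofReal_measureReal, ← ofReal_measureReal, ← ofReal_add (by positivity) measureReal_nonneg,
    ofReal_le_ofReal_iff (by positivity)] at h1
  linarith

/-- Elementary estimate for the total size of the classes. -/
lemma class_count_bound {q : ℝ} (hq : 1 ≤ q) (R t : ℕ) {s : ℝ}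
    (hs : (34 : ℝ) ^ R * 289 * q ^ 2 * s ≤ 1 / 2) (hs0 : 0 ≤ s) {c d : ℝ} (hc : 0 ≤ c) (hd : 0 ≤ d) :
    c * 2 ^ (R * t) * ((16 * q ^ 2 + 1) ^ (R * t) * ((16 * q + 1) ^ 2) ^ t) * (s ^ t * d / (q ^ 2) ^ (R * t)) ≤
      c * d * (1 / 2) ^ t := by
  have hq0 : 0 < q := by linarith
  have e : c * 2 ^ (R * t) * ((16 * q ^ 2 + 1) ^ (R * t) * ((16 * q + 1) ^ 2) ^ t) * (s ^ t * d / (q ^ 2) ^ (R * t)) =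
      c * d * ((2 * (16 * q ^ 2 + 1) / q ^ 2) ^ R * (16 * q + 1) ^ 2 * s) ^ t := by
    rw [pow_mul, pow_mul, pow_mul, mul_pow _ s, mul_pow, div_pow, div_pow, mul_pow, mul_pow]; ring
  rw [e]; refine mul_le_mul_of_nonneg_left ?_ (by positivity)
  refine pow_le_pow_left₀ (by positivity) (le_trans ?_ hs) _; refine mul_le_mul_of_nonneg_right ?_ hs0
  have h1 : 2 * (16 * q ^ 2 + 1) / q ^ 2 ≤ 34 := by rw [div_le_iff₀ (by positivity)]; nlinarith
  have h2 : (16 * q + 1) ^ 2 ≤ 289 * q ^ 2 := by nlinarith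
  calc (2 * (16 * q ^ 2 + 1) / q ^ 2) ^ R * (16 * q + 1) ^ 2 ≤ 34 ^ R * (289 * q ^ 2) :=
        mul_le_mul (pow_le_pow_left₀ (by positivity) h1 _) h2 (by positivity) (by positivity)
    _ = _ := by ring

lemma exists_class_exponents (J₀ : ℕ) {δ : ℝ} (hδ : 0 < δ) : ∃ R L : ℕ, 0 < R ∧ 0 < L ∧
    (34 : ℝ) ^ (R + 2) * 289 * (((2 ^ (J₀ * L) : ℕ) : ℝ)) ^ 2 * exp (-(δ * (L * R : ℕ))) ≤ 1 / 2 := by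
  obtain ⟨R, hR⟩ := exists_nat_gt ((Real.log 4 * J₀ + 1) / δ)
  have hR1 : Real.log 4 * J₀ + 1 < δ * R := by rw [div_lt_iff₀ hδ] at hR; linarith
  obtain ⟨L, hL⟩ := exists_nat_gt (Real.log (2 * ((34 : ℝ) ^ (R + 2) * 289)))
  have hC : (0 : ℝ) < 2 * ((34 : ℝ) ^ (R + 2) * 289) := by positivity
  refine ⟨R, L, ?_, ?_, ?_⟩
  · rcases Nat.eq_zero_or_pos R with h | h
    · rw [h] at hR1; have : 0 ≤ Real.log 4 * J₀ := mul_nonneg (Real.log_nonneg (by norm_num)) (by positivity)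
      simp at hR1; linarith
    · exact h
  · rcases Nat.eq_zero_or_pos L with h | h
    · rw [h] at hL
      have : 0 ≤ Real.log (2 * ((34 : ℝ) ^ (R + 2) * 289)) := Real.log_nonneg (by
        have : (1 : ℝ) ≤ 34 ^ (R + 2) := one_le_pow₀ (by norm_num)
        linarith)
      simp only [Nat.cast_zero] at hL; linarith
    · exact h
  · have e1 : (((2 ^ (J₀ * L) : ℕ) : ℝ)) ^ 2 = exp (L * (Real.log 4 * J₀)) := by
      push_cast
      rw [← pow_mul, mul_comm (J₀ * L) 2, pow_mul, show (2 : ℝ) ^ 2 = 4 by norm_num,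
        ← exp_log (show (0 : ℝ) < 4 by norm_num), ← exp_nat_mul, Real.log_exp]
      congr 1; push_cast; ring
    have h1 : (((2 ^ (J₀ * L) : ℕ) : ℝ)) ^ 2 * exp (-(δ * (L * R : ℕ))) ≤ exp (-L) := by
      rw [e1, ← exp_add]; refine exp_le_exp.2 ?_; have := mul_le_mul_of_nonneg_left hR1.le (Nat.cast_nonneg (α := ℝ) L)
      push_cast; linarith
    have h2 : 2 * ((34 : ℝ) ^ (R + 2) * 289) ≤ exp L := by rw [← Real.log_le_iff_le_exp hC]; exact hL.le
    have h3 : 2 * ((34 : ℝ) ^ (R + 2) * 289) * exp (-L) ≤ 1 := by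
      rw [exp_neg, ← div_eq_mul_inv]; exact (div_le_one (exp_pos _)).2 h2
    have h4 := mul_le_mul_of_nonneg_left h1 (show (0 : ℝ) ≤ 34 ^ (R + 2) * 289 by positivity); linarith

lemma exists_mul_inv_nearOne {θ : ℝ} (hθ : 0 < θ) :
    ∃ θ' > 0, ∀ a ∈ nearOne θ', ∀ b ∈ nearOne θ', a * b⁻¹ ∈ nearOne θ := by
  have hc : Continuous fun p : G × G => p.1 * p.2⁻¹ := continuous_fst.mul continuous_snd.inv; have := hc.tendsto (1, 1)
  simp only [mul_inv_cancel] at this; have h := this (nearOne_mem_nhds hθ)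
  rw [nhds_prod_eq, Filter.mem_map, Filter.mem_prod_same_iff] at h; obtain ⟨s, hs, h⟩ := h
  obtain ⟨θ', hθ', hsub⟩ := exists_nearOne_subset hs; exact ⟨θ', hθ', fun a ha b hb => @h (a, b) ⟨hsub ha, hsub hb⟩⟩

lemma exists_mul_mul_inv_nearOne {θ : ℝ} (hθ : 0 < θ) :
    ∃ θ' > 0, ∀ a ∈ nearOne θ', ∀ b ∈ nearOne θ', ∀ c ∈ nearOne θ', a * b * c⁻¹ ∈ nearOne θ := by
  obtain ⟨θ₁, hθ₁, h₁⟩ := exists_mul_inv_nearOne hθ; obtain ⟨θ₂, hθ₂, h₂⟩ := exists_mul_inv_nearOne hθ₁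
  obtain ⟨θ₃, hθ₃, h₃⟩ := exists_mul_inv_nearOne hθ₂
  refine ⟨min θ₁ (min θ₂ θ₃), by positivity, fun a ha b hb c hc => h₁ _ ?_ _ (nearOne_mono (min_le_left _ _) hc)⟩
  have ha' := nearOne_mono ((min_le_right _ _).trans (min_le_left _ _)) ha
  have hb' := nearOne_mono ((min_le_right _ _).trans (min_le_right _ _)) hb
  simpa using h₂ a ha' (1 * b⁻¹) (h₃ 1 (one_mem_nearOne hθ₃.le) b hb')

set_option maxHeartbeats 800000 in
/-- Invariance under the lower unipotent subgroup in the block. -/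
theorem ll_mem_stab (hU : ∀ r, uu r ∈ stab ν) (hD : ∀ a (ha : 0 < a), dd a ha.ne' ∈ stab ν)
    (hgen : ∀ᵐ x ∂ν, Generic ν x) (hirr : ∀ᵐ x ∂ν, IrrationalPt x)
    (hH : ∀ p w, nn p w ∈ stab ν → p = 0 ∧ w = 0) (ζ : ℝ) : ll ζ ∈ stab ν := by
  have hdi : ∀ a, di a ∈ stab ν := fun a => hD _ (by positivity); refine mem_stab_of_integral fun f₀ hf₀ hc₀ => ?_
  by_contra hne
  obtain ⟨f, hf, hc, hpos⟩ : ∃ f : X → ℝ, Continuous f ∧ HasCompactSupport f ∧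
      0 < (∫ x, f (ll ζ • x) ∂ν) - ∫ x, f x ∂ν := by
    rcases lt_or_gt_of_ne hne with h | h
    · refine ⟨fun x => - f₀ x, hf₀.neg, hc₀.neg, ?_⟩; rw [integral_neg, integral_neg]; linarith
    · exact ⟨f₀, hf₀, hc₀, sub_pos.2 h⟩
  obtain ⟨M₀, hM₀, hfM⟩ := exists_bound hf hc; set b := ((∫ x, f (ll ζ • x) ∂ν) - ∫ x, f x ∂ν) / 8 with hb
  have hb0 : 0 < b := by positivity
  obtain ⟨j, hj⟩ : ∃ j : ℕ, 2 * M₀ * |ζ| / 4 ^ j ≤ b := by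
    obtain ⟨j, hj⟩ := pow_unbounded_of_one_lt (2 * M₀ * |ζ| / b) (show (1 : ℝ) < 4 by norm_num); refine ⟨j, ?_⟩
    rw [div_lt_iff₀ hb0] at hj; rw [div_le_iff₀ (by positivity)]; linarith
  set H : X → ℝ := fun x => f (ll ζ • di j • x) - f (di j • x) with hHdef
  have hHc : Continuous H := (hf.comp ((continuous_const_smul _).comp (continuous_const_smul _))).sub
    (hf.comp (continuous_const_smul _))
  have hHu : UnifCont H := by
    have u := UnifCont.of_compactSupport hf hc; exact ((u.comp_smul (ll ζ)).comp_smul (di j)).sub (u.comp_smul (di j))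
  have hHM : ∀ x, |H x| ≤ 2 * M₀ := fun x => by
    have h1 := hfM (ll ζ • di j • x); have h2 := hfM (di j • x); rw [abs_le] at h1 h2 ⊢
    exact ⟨by simp only [hHdef]; linarith, by simp only [hHdef]; linarith⟩
  have hmean : ∫ x, H x ∂ν = 8 * b := by
    have i1 := integral_smul_of_mem_stab (hdi j) (fun x => f (ll ζ • x)); have i2 := integral_smul_of_mem_stab (hdi j) f
    rw [hHdef, integral_sub, i1, i2, hb]
    · ring
    · exact integrable_cc ((hf.comp ((continuous_const_smul _).comp (continuous_const_smul _))))
        ((hc.comp_smulX (ll ζ)).comp_smulX (di j))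
    · exact integrable_cc (hf.comp (continuous_const_smul _)) (hc.comp_smulX (di j))
  have hbM : b ≤ 2 * M₀ := by
    have : ∫ x, H x ∂ν ≤ ∫ x, (2 * M₀) ∂ν := integral_mono (Integrable.of_bound hHc.aestronglyMeasurable (2 * M₀)
        (.of_forall fun x => by rw [norm_eq_abs]; exact hHM x)) (integrable_const _)
        fun x => (abs_le.1 (hHM x)).2
    rw [hmean, integral_const] at this; simp at this; linarith
  obtain ⟨J₀, hJ₀, δ, hδ, hLD⟩ := exists_large_deviation hHc hHu hHM hb0 hbM fun w =>
    (le_abs_self _).trans ((coboundary_mean_le hf hfM ζ j w).trans hj)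
  obtain ⟨R, L, hR, hL, hRL⟩ := exists_class_exponents J₀ hδ; set J := J₀ * L with hJ
  set c₁ : ℝ := b / (2 * M₀) with hc₁; have hc₁0 : 0 < c₁ := by positivity
  obtain ⟨K, hK, hKg, hKi, hKν⟩ := exists_compact_unifGeneric hgen hirr (ε := c₁ / (R + 3)) (by positivity)
  have hKν' : ν.real Kᶜ ≤ c₁ / (R + 3) := by rw [measureReal_def]; exact toReal_le_of_le_ofReal (by positivity) hKν
  -- constants
  obtain ⟨θr, hθr, hrig⟩ := exists_irrational_radius hK hKi; obtain ⟨θp, hθp, hprod⟩ := exists_mul_mul_inv_nearOne hθr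
  obtain ⟨θv, hθv, hvar⟩ := hHu (b / 2) (by positivity); obtain ⟨θt, hθt, htilt⟩ := exists_tilt hD hH hKg one_pos
  set θ := min θp (min θv (1 / 4)); have hθ0 : 0 < θ := by positivity
  set q : ℝ := ((2 ^ J : ℕ) : ℝ) with hq; have hq1 : 1 ≤ q := by rw [hq]; exact_mod_cast Nat.one_le_two_pow
  set θ₂ := min θ (min θt (1 / 64 / q ^ 2)); have hθ₂0 : 0 < θ₂ := by positivity
  obtain ⟨θs, hθs, hshear⟩ := exists_shear hU hH hKg hK (η := θ₂ / 16 / q) (by positivity)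
  set θ₀ := min θs (min θt (min (θ / 3) (min (1 / 16) θ₂))); have hθ₀0 : 0 < θ₀ := by positivity
  have le1 : θ₀ ≤ θs := min_le_left _ _; have le2 : θ₀ ≤ θt := (min_le_right _ _).trans (min_le_left _ _)
  have le3 : θ₀ ≤ θ / 3 := (min_le_right _ _).trans ((min_le_right _ _).trans (min_le_left _ _))
  have le4 : θ₀ ≤ 1 / 16 :=
    (min_le_right _ _).trans ((min_le_right _ _).trans ((min_le_right _ _).trans (min_le_left _ _)))
  have le5 : θ₀ ≤ θ₂ :=
    (min_le_right _ _).trans ((min_le_right _ _).trans ((min_le_right _ _).trans (min_le_right _ _)))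
  have le6 : θ₂ ≤ θt := (min_le_right _ _).trans (min_le_left _ _)
  have D : ClassData K H b θ₀ θ₂ θ := {
      b_nonneg := hb0.le
      θ_pos := hθ0
      θ_le := (min_le_right _ _).trans (min_le_right _ _)
      θ₀_le := le4
      three_le := by linarith
      θ₂_le := min_le_left _ _
      θ₂_pos := hθ₂0
      tilt := fun x hx h hh hy => by simpa using htilt x hx h (nearOne_mono (max_le le2 le6) hh) hy
      var := fun h hh x => hvar h (nearOne_mono ((min_le_right _ _).trans (min_le_left _ _)) hh) x
      rigid := fun x hx r hr r' hr' k₁ h₁ k₂ h₂ k₃ h₃ he => hrig x hx r hr r' hr' _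
        (hprod _ (nearOne_mono (min_le_left _ _) h₁) _ (nearOne_mono (min_le_left _ _) h₂) _
          (nearOne_mono (min_le_left _ _) h₃)) he }
  obtain ⟨θ', hθ', hdiv⟩ := exists_mul_inv_nearOne hθ₀0
  obtain ⟨T, hT⟩ : ∃ T : Finset X, K ⊆ ⋃ w ∈ T, (fun g : G => g • w) '' nearOne θ' := by
    obtain ⟨T, -, hT⟩ := hK.elim_nhds_subcover (fun w => (fun g : G => g • w) '' nearOne θ') fun w _ => by
      simpa using (isOpenMap_orbit w).image_mem_nhds (nearOne_mem_nhds hθ')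
    exact ⟨T, hT⟩
  -- the bound for a given length
  have hfinal : ∀ t : ℕ, 0 < t → c₁ / 2 ≤ T.card * (θ₂ / θ) * (1 / 2) ^ t := by
    intro t ht; set n := R * t with hn; set m := L * n with hm; have hm0 : 0 < m := by positivity
    have hnf' : n + t + 1 ≤ (R + 2) * t := by rw [hn]; linarith
    have hmn : J₀ * m ≤ J * n := by rw [hm, hJ, mul_assoc]
    have hg := measure_goodSet_ge hdi hK hHc hHM hb0 hmean J J₀ (m := m) (nf := (R + 2) * t) (t := t) (R := R + 2) hm0 ht le_rfl
    set A := goodSet K H b J J₀ m ((R + 2) * t) t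
    have hAm : MeasurableSet A := measurableSet_goodSet hK hHc b J J₀ m _ t
    have hAc : c₁ ≤ ν.real A := by
      have h2M : 0 < 2 * M₀ := by positivity
      have e1 : 2 * b = 2 * M₀ * (2 * c₁) := by rw [hc₁]; field_simp
      rw [e1] at hg; have := le_of_mul_le_mul_left hg h2M
      have h3 : ((R + 2 : ℕ) + 1 : ℝ) * ν.real Kᶜ ≤ c₁ := by
        have h := (le_div_iff₀ (by positivity : (0 : ℝ) < R + 3)).1 hKν'; push_cast; linarith
      linarith
    have hK3 : ν.real Kᶜ ≤ c₁ / 3 := hKν'.trans (div_le_div_of_nonneg_left hc₁0.le (by norm_num) (by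
      have : (0 : ℝ) ≤ R := Nat.cast_nonneg _
      linarith))
    have hinvA : ν.real ((fun z : X => (di (J * n))⁻¹ • z) ⁻¹' A) = ν.real A := by
      rw [measureReal_def, (measurePreserving_of_mem_stab (inv_mem (hdi (J * n)))).measure_preimage
        hAm.nullMeasurableSet, measureReal_def]
    obtain ⟨x, hx, hvol⟩ := exists_fibre_ge continuous_uu hU (measurable_smulX _ hAm) hK.measurableSet hc₁0
      (hAc.trans_eq hinvA.symm) hK3
    have h1 := good_volume_le D (J := J) (J₀ := J₀) (n := n) (m := m) (nf := (R + 2) * t) (t := t) le5 (by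
        have : θ₂ ≤ 1 / 64 / q ^ 2 := (min_le_right _ _).trans (min_le_right _ _)
        rw [le_div_iff₀ (by positivity)] at this
        linarith)
      (fun x hx h hy a1 a2 a3 a4 => hshear x hx h hy (a1.trans le1) (a2.trans le1) (a3.trans le1)
        fun i => (a4 i).trans le1) hdiv hT hnf' hmn
      (exp_pos (-(δ * m))).le (fun w => hLD m w) hx
    have e2 : exp (-(δ * m)) = exp (-(δ * (L * R : ℕ))) ^ t := by
      rw [← exp_nat_mul]; congr 1; rw [hm, hn]; push_cast; ring
    have hd : 0 ≤ θ₂ / θ := div_nonneg hθ₂0.le hθ0.le; rw [e2] at h1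
    have h2 := hvol.trans (h1.trans (ofReal_le_ofReal
      (class_count_bound hq1 (R + 2) t hRL (exp_pos _).le (Nat.cast_nonneg _) hd)))
    exact (ofReal_le_ofReal_iff (mul_nonneg (mul_nonneg (Nat.cast_nonneg _) hd) (pow_nonneg (by norm_num) _))).1 h2
  have hlim : Tendsto (fun t : ℕ => T.card * (θ₂ / θ) * (1 / 2 : ℝ) ^ t) atTop (𝓝 (T.card * (θ₂ / θ) * 0)) :=
    (_root_.tendsto_pow_atTop_nhds_zero_of_lt_one (by norm_num) (by norm_num)).const_mul _
  have := ge_of_tendsto hlim ((eventually_gt_atTop 0).mono fun t ht => hfinal t ht); rw [mul_zero] at this; linarith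

/-! ### Additional invariance of generic measures -/

lemma ae_map_smul {ν : Measure X} {c : G} {P : X → Prop} :
    (∀ᵐ x ∂(Measure.map (fun x : X => c • x) ν), P x) ↔ ∀ᵐ x ∂ν, P (c • x) := by
  rw [(measurableEmbedding_const_smul c).ae_map_iff]

/-- A generic measure invariant under the upper triangular group of the block has further invariance. -/
lemma exists_nn_mem_stab_of_dd (hU : ∀ r, uu r ∈ stab ν) (hD : ∀ a (ha : 0 < a), dd a ha.ne' ∈ stab ν)
    (hgen : ∀ᵐ x ∂ν, Generic ν x) (hirr : ∀ᵐ x ∂ν, IrrationalPt x) :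
    ∃ p w, (p ≠ 0 ∨ w ≠ 0) ∧ ∀ s, nn (s * p) (s * w) ∈ stab ν := by
  obtain ⟨p, w, hpw, h⟩ : ∃ p w, nn p w ∈ stab ν ∧ (p ≠ 0 ∨ w ≠ 0) := by
    by_contra! hcon; have hH : ∀ p w, nn p w ∈ stab ν → p = 0 ∧ w = 0 := fun p w h => hcon p w h
    exact exists_nn_of_SL2 hU (ll_mem_stab hU hD hgen hirr hH) hD hgen hirr hH
  refine ⟨p, w, h, nn_line_mem_stab hU one_pos fun s hs _ => ?_⟩; rw [← dd_nn s hs.ne']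
  exact mul_mem (mul_mem (hD s hs) hpw) (inv_mem (hD s hs))

/-- A generic `uu`-invariant measure is invariant under a line in the Heisenberg group. -/
theorem exists_nn_line_mem_stab (hU : ∀ r, uu r ∈ stab ν)
    (hgen : ∀ᵐ x ∂ν, Generic ν x) (hirr : ∀ᵐ x ∂ν, IrrationalPt x) :
    ∃ p w, (p ≠ 0 ∨ w ≠ 0) ∧ ∀ s, nn (s * p) (s * w) ∈ stab ν := by
  obtain ⟨K, hK, hKg, hKi, hKν⟩ := exists_compact_unifGeneric hgen hirr (ε := 1 / 2) (by norm_num)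
  have hK0 : ν K ≠ 0 := fun h0 => by
    have := measure_univ_le_add_compl (μ := ν) K; rw [measure_univ, h0, zero_add] at this; have h2 := this.trans hKν
    rw [← ofReal_one, ofReal_le_ofReal_iff (by norm_num)] at h2; norm_num at h2
  obtain ⟨α, β, γ, hα, hne, -, hst⟩ := exists_drift (κ := 0) hKg fun θ hθ => by
    obtain ⟨x, hx, h, hh, hy, h0⟩ := exists_transverse_pair hU hK hK0 hKi hθ; exact ⟨x, hx, h, hh, hy, h0, by simp⟩
  have hα' := abs_le.1 hα
  by_cases h0 : α = 0
  · refine ⟨β, -γ, ?_, nn_line_mem_stab hU one_pos fun s hs hs1 => ?_⟩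
    · simpa [h0] using hne
    · have h1 := hst s hs hs1 (by simp [h0])
      have e : driftElt α β γ s (by simp [h0]) = nn (s * β) (s * -γ) := by
        rw [driftElt_eq]; subst h0; apply G_ext_fin <;> simp [mul₃]
      rwa [e] at h1
  · set c : G := nn (β / α) (-(γ / α)) with hc; set ν' : Measure X := Measure.map (fun x : X => c • x) ν with hν'
    have hcu : ∀ r, c * uu r = uu r * c := fun r => nn_uu _ _ r
    have : IsProbabilityMeasure ν' := Measure.isProbabilityMeasure_map (measurable_smulX c).aemeasurable
    have hU' : ∀ r, uu r ∈ stab ν' := fun r => by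
      have := stab_map (h := c) (hU r); rwa [hcu, mul_inv_cancel_right] at this
    have hD1 : ∀ τ, 0 < τ → τ ≤ 1 → ∀ hne, dd (1 + τ * α) hne ∈ stab ν' := fun τ h1 h2 hne => by
      rw [← driftElt_eq_conj α β γ τ h0 hne]; exact stab_map (mul_mem (hU _) (hst τ h1 h2 hne))
    have hpos : 0 < 1 + α := by linarith
    have hlog : Real.log (1 + α) ≠ 0 := Real.log_ne_zero_of_pos_of_ne_one hpos (by simpa using h0)
    have hD' : ∀ a (ha : 0 < a), dd a ha.ne' ∈ stab ν' := dd_mem_stab hlog fun τ h1 h2 => by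
      have hτ : 0 < (exp (τ * Real.log (1 + α)) - 1) / α ∧ (exp (τ * Real.log (1 + α)) - 1) / α ≤ 1 := by
        rcases lt_or_gt_of_ne h0 with hneg | hp
        · have hl : Real.log (1 + α) < 0 := Real.log_neg hpos (by linarith); refine ⟨div_pos_of_neg_of_neg ?_ hneg, ?_⟩
          · have : exp (τ * Real.log (1 + α)) < 1 := by
              exact (exp_lt_exp.2 (mul_neg_of_pos_of_neg h1 hl)).trans_eq Real.exp_zero
            linarith
          · rw [div_le_one_of_neg hneg]; have : Real.log (1 + α) ≤ τ * Real.log (1 + α) := by nlinarith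
            have := exp_le_exp.2 this; rw [exp_log hpos] at this; linarith
        · have hl : 0 < Real.log (1 + α) := Real.log_pos (by linarith); refine ⟨div_pos ?_ hp, ?_⟩
          · have : 1 < exp (τ * Real.log (1 + α)) := Real.one_lt_exp_iff.2 (mul_pos h1 hl); linarith
          · rw [div_le_one hp]; have : τ * Real.log (1 + α) ≤ Real.log (1 + α) := by nlinarith
            have := exp_le_exp.2 this; rw [exp_log hpos] at this; linarith
      have e : 1 + (exp (τ * Real.log (1 + α)) - 1) / α * α = exp (τ * Real.log (1 + α)) := by
        rw [div_mul_cancel₀ _ h0]; ring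
      simpa only [e] using hD1 _ hτ.1 hτ.2 (by rw [e]; exact (exp_pos _).ne')
    have hgen' : ∀ᵐ x ∂ν', Generic ν' x := by rw [hν', ae_map_smul]; filter_upwards [hgen] with x hx using hx.smul hcu
    have hirr' : ∀ᵐ x ∂ν', IrrationalPt x := by
      rw [hν', ae_map_smul]
      filter_upwards [hirr] with x hx using hx.nn_smul _ _
    obtain ⟨p, w, hpw, hline⟩ := exists_nn_mem_stab_of_dd hU' hD' hgen' hirr'; refine ⟨p, w, hpw, fun s => ?_⟩
    have h1 := stab_map (h := c⁻¹) (hline s)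
    have e1 : Measure.map (fun x : X => c⁻¹ • x) ν' = ν := by
      rw [hν', Measure.map_map (measurable_smulX _) (measurable_smulX _)]
      have : ((fun x : X => c⁻¹ • x) ∘ fun x => c • x) = id := by ext x; simp
      rw [this, Measure.map_id]
    rw [e1, inv_inv] at h1
    have e2 : c⁻¹ * nn (s * p) (s * w) * c = nn (s * p) (s * w) * (uu (s * p * -(γ / α) - β / α * (s * w))) := by
      rw [mul_assoc, inv_mul_eq_iff_eq_mul, hc, ← mul_assoc, nn_mul, nn_mul, mul_assoc (nn _ _) (uu _) (uu _), ← uu_add, add_comm (s * p),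
        add_comm (s * w)]
      congr 2; ring
    rw [e2] at h1; exact ((stab ν).mul_mem_cancel_right (hU _)).1 h1

/-! ### Compactness criterion for lattices -/

/-- The vector of the lattice of `g` with integer coordinates `v`. -/
def lat (g : G) (v : Fin 3 → ℤ) : Fin 3 → ℝ := (g : M₃) *ᵥ fun j => (v j : ℝ)

/-- The vector of the dual lattice of `g` with integer coordinates `w`. -/
def dlat (g : G) (w : Fin 3 → ℤ) : Fin 3 → ℝ := ((g⁻¹ : G) : M₃)ᵀ *ᵥ fun j => (w j : ℝ)

lemma lat_apply (g : G) (v : Fin 3 → ℤ) (i : Fin 3) : lat g v i = g i 0 * v 0 + g i 1 * v 1 + g i 2 * v 2 := by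
  simp [lat, mulVec, dotProduct, Fin.sum_univ_three]

lemma dlat_apply (g : G) (v : Fin 3 → ℤ) (i : Fin 3) : dlat g v i = g⁻¹ 0 i * v 0 + g⁻¹ 1 i * v 1 + g⁻¹ 2 i * v 2 := by
  simp only [dlat, mulVec, dotProduct, Fin.sum_univ_three, Matrix.transpose_apply]

lemma fin3 (j : Fin 3) : j = 0 ∨ j = 1 ∨ j = 2 := by revert j; decide

lemma one_combo (f : Fin 3 → ℝ) (j : Fin 3) : f 0 * (1 : M₃) 0 j + f 1 * (1 : M₃) 1 j + f 2 * (1 : M₃) 2 j = f j := by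
  rcases fin3 j with rfl|rfl|rfl <;> simp

/-- Reduced bases of a three-dimensional lattice are nearly orthogonal. -/
lemma reduced_det_ge {d₁ d₂ d₃ a b c : ℝ} (h0 : 0 ≤ d₁) (h12 : d₁ ≤ d₂) (h23 : d₂ ≤ d₃)
    (hc : 2 * |c| ≤ d₁) (hb : 2 * |b| ≤ d₁) (ha : 2 * |a| ≤ d₂)
    (hs : ∀ σ τ : ℝ, |σ| = 1 → |τ| = 1 → 0 ≤ d₁ + d₂ + 2 * σ * b + 2 * τ * a + 2 * (σ * τ) * c) :
    d₁ * d₂ * d₃ ≤ 4 * (d₁ * d₂ * d₃ + 2 * (a * b * c) - d₁ * a ^ 2 - d₂ * b ^ 2 - d₃ * c ^ 2) := by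
  have e : ∀ x : ℝ, x ^ 2 = |x| ^ 2 := fun x => (sq_abs x).symm; rw [e a, e b, e c]
  have hA := abs_nonneg a; have hB := abs_nonneg b; have hC := abs_nonneg c; have hd2 : 0 ≤ d₂ := h0.trans h12
  have hd3 : 0 ≤ d₃ := hd2.trans h23
  by_cases hpos : 0 ≤ a * b * c
  · have e1 : |a| ^ 2 ≤ d₂ ^ 2 / 4 := by nlinarith
    have e2 : |b| ^ 2 ≤ d₁ ^ 2 / 4 := by nlinarith
    have e3 : |c| ^ 2 ≤ d₁ ^ 2 / 4 := by nlinarith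
    have p : 0 ≤ d₁ * d₂ := mul_nonneg h0 hd2; have f1 := mul_le_mul_of_nonneg_left e1 h0
    have f2 := mul_le_mul_of_nonneg_left e2 hd2; have f3 := mul_le_mul_of_nonneg_left e3 hd3
    have g1 := mul_le_mul_of_nonneg_left h23 p; have g2 := mul_le_mul_of_nonneg_left (h12.trans h23) p
    have g3 := mul_le_mul_of_nonneg_left h12 (mul_nonneg h0 hd3); nlinarith
  · push Not at hpos
    have habc : a * b * c = -(|a| * |b| * |c|) := by rw [← abs_mul, ← abs_mul, abs_of_neg hpos, neg_neg]
    have hne : a ≠ 0 ∧ b ≠ 0 ∧ c ≠ 0 := by refine ⟨?_, ?_, ?_⟩ <;> rintro rfl <;> simp at hpos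
    have hsum : 2 * (|a| + |b| + |c|) ≤ d₁ + d₂ := by
      have key := hs (-(|b| / b)) (-(|a| / a)) (by rw [abs_neg, abs_div, abs_abs, div_self (abs_ne_zero.2 hne.2.1)])
        (by rw [abs_neg, abs_div, abs_abs, div_self (abs_ne_zero.2 hne.1)])
      have k1 : |b| / b * b = |b| := div_mul_cancel₀ _ hne.2.1; have k2 : |a| / a * a = |a| := div_mul_cancel₀ _ hne.1
      have k3 : |b| / b * (|a| / a) * c = -|c| := by
        have : |b| / b * (|a| / a) * c * (a * b * c) = -|c| * (a * b * c) := by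
          have q : |b| / b * (|a| / a) * c * (a * b * c) = |b| * |a| * c ^ 2 := by field_simp [hne.1, hne.2.1]
          rw [q, habc, e c]; ring
        exact mul_right_cancel₀ hpos.ne this
      nlinarith
    rw [habc]
    set A := |a|; set B := |b|; set C := |c|
    have f1 : d₂ * B ^ 2 ≤ d₁ * (d₃ * B / 2) := by
      have : d₂ * B ^ 2 ≤ d₃ * B ^ 2 := mul_le_mul_of_nonneg_right h23 (sq_nonneg _)
      have h2 := mul_le_mul_of_nonneg_left hb (mul_nonneg hd3 hB); nlinarith
    have f2 : d₃ * C ^ 2 ≤ d₁ * (d₃ * C / 2) := by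
      have h2 := mul_le_mul_of_nonneg_left hc (mul_nonneg hd3 hC); nlinarith
    have f3 : 2 * (A * B * C) ≤ d₁ * (A * (B + C) / 2) := by
      have h1 := mul_le_mul_of_nonneg_left hc (mul_nonneg hA hB)
      have h2 := mul_le_mul_of_nonneg_left hb (mul_nonneg hA hC); nlinarith
    have f4 : A ^ 2 + d₃ * B / 2 + d₃ * C / 2 + A * (B + C) / 2 ≤ 3 / 4 * (d₂ * d₃) := by
      have h1 : B + C ≤ d₂ - A := by linarith
      have h2 := mul_le_mul_of_nonneg_right h1 (add_nonneg hd3 hA); have h3 := mul_le_mul_of_nonneg_left h23 hA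
      have h4 : A ^ 2 ≤ d₂ ^ 2 / 4 := by nlinarith
      have h5 := mul_le_mul_of_nonneg_left h23 hd2; nlinarith
    have f5 := mul_le_mul_of_nonneg_left f4 h0; nlinarith

/-- Replacing a column by its sum with an integer combination of the other two. -/
lemma exists_column_op (c : Fin 3) (v : Fin 3 → ℤ) (hv : v c = 0) : ∃ γ ∈ Gamma, ∀ i j : Fin 3,
    γ i j = (1 : M₃) i j + if j = c then (v i : ℝ) else 0 := by
  let E : Matrix (Fin 3) (Fin 3) ℤ := fun i j => (1 : Matrix (Fin 3) (Fin 3) ℤ) i j + if j = c then v i else 0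
  have hE : E.det = 1 := by rw [det_fin_three]; fin_cases c <;> simp at hv <;> simp [E, hv, Matrix.one_apply]
  refine ⟨Matrix.SpecialLinearGroup.map (n := Fin 3) (Int.castRingHom ℝ) ⟨E, hE⟩, ⟨_, rfl⟩, fun i j => ?_⟩
  change ((E i j : ℤ) : ℝ) = _; simp only [E, Int.cast_add, Matrix.one_apply]
  split_ifs <;> simp

lemma exists_reduced (g : G) : ∃ γ ∈ Gamma, ∀ (c : Fin 3) (v : Fin 3 → ℤ), v c = 0 → ∑ i, ((g * γ : G) i c) ^ 2 ≤
      ∑ i, ((g * γ : G) i c + ((g * γ : G) i 0 * v 0 + (g * γ : G) i 1 * v 1 + (g * γ : G) i 2 * v 2)) ^ 2 := by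
  set F : G → ℝ := fun h => ∑ i, ∑ j, (h i j) ^ 2 with hF; set S : Set G := {γ | γ ∈ Gamma ∧ F (g * γ) ≤ F g}
  have hle : ∀ h : G, ∀ i j, (h i j) ^ 2 ≤ F h := fun h i j =>
    (Finset.single_le_sum (f := fun j => (h i j) ^ 2) (fun _ _ => sq_nonneg _) (Finset.mem_univ j)).trans
      (Finset.single_le_sum (f := fun i => ∑ j, (h i j) ^ 2)
        (fun _ _ => Finset.sum_nonneg fun _ _ => sq_nonneg _) (Finset.mem_univ i))
  have hfin : S.Finite := by
    have hC : IsCompact ((fun h : G => g⁻¹ * h) '' {h : G | ∀ i j, |h i j| ≤ Real.sqrt (F g)}) :=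
      (isCompact_bounded _).image (by fun_prop)
    refine (finite_inter_Gamma hC).subset fun γ hγ => ⟨⟨g * γ, fun i j => ?_, by group⟩, hγ.1⟩
    exact Real.abs_le_sqrt ((hle _ i j).trans hγ.2)
  obtain ⟨γ, hγ, hmin⟩ := hfin.exists_minimalFor (fun γ => F (g * γ)) S ⟨1, one_mem _, by simp⟩
  refine ⟨γ, hγ.1, fun c v hv => ?_⟩; obtain ⟨ε, hε, he⟩ := exists_column_op c v hv
  have hFle : F (g * γ) ≤ F (g * (γ * ε)) := by
    by_cases h : F (g * (γ * ε)) ≤ F g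
    · exact (le_total _ _).elim id fun h' => hmin ⟨mul_mem hγ.1 hε, h⟩ h'
    · exact hγ.2.trans (not_le.1 h).le
  rw [← mul_assoc] at hFle; set B := g * γ
  have hcol : ∀ i j, (B * ε : G) i j = B i j + if j = c then (B i 0 * v 0 + B i 1 * v 1 + B i 2 * v 2) else 0 := by
    intro i j; rw [mul_entry, he, he, he]; have h1 := one_combo (fun k => B i k) j
    by_cases hj : j = c
    · simp only [if_pos hj]; linarith
    · simp only [if_neg hj]; linarith
  have hsplit : ∀ h : G, F h = ∑ j, ∑ i, (h i j) ^ 2 := fun h => Finset.sum_comm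
  rw [hsplit, hsplit, ← Finset.add_sum_erase _ _ (Finset.mem_univ c),
    ← Finset.add_sum_erase _ (fun j => ∑ i, ((B * ε : G) i j) ^ 2) (Finset.mem_univ c)] at hFle
  have hrest : ∑ j ∈ Finset.univ.erase c, ∑ i, ((B * ε : G) i j) ^ 2 =
      ∑ j ∈ Finset.univ.erase c, ∑ i, (B i j) ^ 2 := Finset.sum_congr rfl fun j hj => by
    refine Finset.sum_congr rfl fun i _ => ?_; rw [hcol, if_neg (Finset.ne_of_mem_erase hj), add_zero]
  rw [hrest] at hFle; simpa only [hcol, if_true] using le_of_add_le_add_right hFle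

/-- Lattices without short vectors form a relatively compact set. -/
theorem exists_compact_of_no_short_vector {ε : ℝ} (hε : 0 < ε) : ∃ K : Set X, IsCompact K ∧
    ∀ g : G, (∀ v : Fin 3 → ℤ, v ≠ 0 → ε ≤ ‖lat g v‖) → (g : X) ∈ K := by
  set R : ℝ := 2 / ε ^ 2 with hR; refine ⟨_, (isCompact_bounded R).image continuous_mkX, fun g hg => ?_⟩
  obtain ⟨γ, hγ, hred⟩ := exists_reduced g; refine ⟨g * γ, ?_, by rw [mk_eq_mk]; simpa using inv_mem hγ⟩
  obtain ⟨m, hm⟩ := exists_int_matrix hγ; set B := g * γ with hB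
  -- lengths of the columns
  have hlen : ∀ j, ε ^ 2 ≤ ∑ i, (B i j) ^ 2 := fun j => by
    have hcol : ∀ i, B i j = lat g (fun k => m k j) i := fun i => by rw [lat_apply, hB, mul_entry, hm, hm, hm]
    have hne : (fun k => m k j) ≠ 0 := fun h0 => by
      have hd : (γ : M₃).det = 0 := Matrix.det_eq_zero_of_column_eq_zero j fun i => by
          have h1 := hm i j; have h2 : m i j = 0 := congrFun h0 i; rw [h2] at h1; simpa using h1
      rw [γ.2] at hd; norm_num at hd
    have h1 := hg _ hne
    obtain ⟨i, hi⟩ : ∃ i, ε ≤ |B i j| := by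
      by_contra! hcon
      exact absurd h1 (not_le.2 ((pi_norm_lt_iff hε).2 fun i => by rw [norm_eq_abs, ← hcol]; exact hcon i))
    calc ε ^ 2 ≤ |B i j| ^ 2 := pow_le_pow_left₀ hε.le hi 2
      _ = (B i j) ^ 2 := sq_abs _
      _ ≤ _ := Finset.single_le_sum (f := fun i => (B i j) ^ 2) (fun _ _ => sq_nonneg _) (Finset.mem_univ i)
  set D : Fin 3 → Fin 3 → ℝ := fun j k => ∑ i, B i j * B i k with hD
  have hDd : ∀ j, ∑ i, (B i j) ^ 2 = D j j := fun j => by simp only [hD, sq]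
  simp only [hDd] at hlen; have hsymm : ∀ j k, D j k = D k j := fun j k => by simp only [hD, mul_comm]
  have hexp : ∀ j k l : Fin 3, j ≠ k → j ≠ l → k ≠ l → ∀ σ τ : ℤ,
      0 ≤ σ ^ 2 * D k k + τ ^ 2 * D l l + 2 * σ * D j k + 2 * τ * D j l + 2 * (σ * τ) * D k l := by
    intro j k l hjk hjl hkl σ τ
    have := hred j (fun i => if i = k then σ else if i = l then τ else 0) (by simp [hjk, hjl])
    simp only [Fin.sum_univ_three, hD] at this ⊢
    fin_cases j <;> fin_cases k <;> fin_cases l <;> simp at hjk hjl hkl this ⊢ <;> linarith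
  have hdet : D 0 0 * D 1 1 * D 2 2 + 2 * (D 1 2 * D 0 2 * D 0 1) - D 0 0 * D 1 2 ^ 2 - D 1 1 * D 0 2 ^ 2 -
      D 2 2 * D 0 1 ^ 2 = 1 := by
    have h1 : (B : M₃).det ^ 2 = 1 := by rw [B.2]; norm_num
    rw [det_fin_three] at h1; rw [← h1]; simp only [hD, Fin.sum_univ_three]; ring
  have hD0 : ∀ j, 0 ≤ D j j := fun j => (sq_nonneg ε).trans (hlen j)
  have key : ∀ j k l : Fin 3, j ≠ k → j ≠ l → k ≠ l → D j j ≤ D k k → D k k ≤ D l l →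
      D j j * D k k * D l l ≤ 4 * (D j j * D k k * D l l + 2 * (D k l * D j l * D j k) - D j j * D k l ^ 2
        - D k k * D j l ^ 2 - D l l * D j k ^ 2) := by
    intro j k l hjk hjl hkl h1 h2
    have two : ∀ i i' : Fin 3, ∀ i'', i ≠ i' → i ≠ i'' → i' ≠ i'' → 2 * |D i' i| ≤ D i i := by
      intro i i' i'' a1 a2 a3; have p := hexp i' i i'' a1.symm a3 a2 1 0; have q := hexp i' i i'' a1.symm a3 a2 (-1) 0
      push_cast at p q
      rcases abs_cases (D i' i) with h | h <;> linarith
    refine reduced_det_ge (hD0 j) h1 h2 ?_ ?_ ?_ fun σ τ hσ hτ => ?_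
    · have := two j k l hjk hjl hkl; rwa [hsymm k j] at this
    · have := two j l k hjl hjk hkl.symm; rwa [hsymm l j] at this
    · have := two k l j hkl hjk.symm hjl.symm; rwa [hsymm l k] at this
    · have i1 := hexp l j k hjl.symm hkl.symm hjk; rw [hsymm l j, hsymm l k] at i1
      have s1 : σ = 1 ∨ σ = -1 := by rcases abs_cases σ with h | h <;> [left; right] <;> linarith
      have s2 : τ = 1 ∨ τ = -1 := by rcases abs_cases τ with h | h <;> [left; right] <;> linarith
      have j1 := i1 1 1; have j2 := i1 1 (-1); have j3 := i1 (-1) 1; have j4 := i1 (-1) (-1); push_cast at j1 j2 j3 j4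
      rcases s1 with rfl | rfl <;> rcases s2 with rfl | rfl <;> linarith
  have hprod : D 0 0 * D 1 1 * D 2 2 ≤ 4 := by
    have r := hsymm 1 0; have r' := hsymm 2 0; have r'' := hsymm 2 1
    rcases le_total (D 0 0) (D 1 1) with a | a <;> rcases le_total (D 0 0) (D 2 2) with b | b <;>
      rcases le_total (D 1 1) (D 2 2) with c | c
    · have := key 0 1 2 (by decide) (by decide) (by decide) a c; linarith
    · have := key 0 2 1 (by decide) (by decide) (by decide) b c; rw [r''] at this; linarith
    · have := key 0 1 2 (by decide) (by decide) (by decide) a c; linarith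
    · have := key 2 0 1 (by decide) (by decide) (by decide) b a; rw [r', r''] at this; linarith
    · have := key 1 0 2 (by decide) (by decide) (by decide) a b; rw [r] at this; linarith
    · have := key 0 2 1 (by decide) (by decide) (by decide) b c; rw [r''] at this; linarith
    · have := key 1 2 0 (by decide) (by decide) (by decide) c b; rw [r, r', ← r''] at this; rw [← r''] at hdet; linarith
    · have := key 2 1 0 (by decide) (by decide) (by decide) c a; rw [r, r', r''] at this; linarith
  have hbound : ∀ j, D j j ≤ R ^ 2 := by
    intro j
    have hp : ∀ x y z : ℝ, ε ^ 2 ≤ x → ε ^ 2 ≤ y → 0 ≤ z → x * y * z ≤ 4 → z ≤ R ^ 2 := by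
      intro x y z hx hy hz h4; have e0 : 0 < ε ^ 2 := by positivity
      have : ε ^ 2 * ε ^ 2 ≤ x * y := mul_le_mul hx hy e0.le (e0.le.trans hx)
      have h5 := mul_le_mul_of_nonneg_right this hz; rw [hR, div_pow, le_div_iff₀ (by positivity)]; nlinarith
    rcases fin3 j with rfl|rfl|rfl
    · exact hp _ _ _ (hlen 1) (hlen 2) (hD0 0) (by linarith)
    · exact hp _ _ _ (hlen 0) (hlen 2) (hD0 1) (by linarith)
    · exact hp _ _ _ (hlen 0) (hlen 1) (hD0 2) hprod
  intro i j; refine abs_le_of_sq_le_sq (le_trans ?_ (hbound j)) (by positivity); rw [← hDd]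
  exact Finset.single_le_sum (f := fun i => (B i j) ^ 2) (fun _ _ => sq_nonneg _) (Finset.mem_univ i)

lemma exists_inv_entry_bound {C : Set G} (hC : IsCompact C) : ∃ M > 0, ∀ g ∈ C, ∀ i j, |(g⁻¹ : G) i j| ≤ M := by
  have : ∀ i j : Fin 3, ∃ M, ∀ g ∈ C, |(g⁻¹ : G) i j| ≤ M := fun i j => by
    obtain ⟨M, hM⟩ := hC.exists_bound_of_continuousOn ((continuous_entry i j).comp continuous_inv).continuousOn
    exact ⟨M, hM⟩
  choose M hM using this
  refine ⟨1 + ∑ i, ∑ j, |M i j|, by positivity, fun g hg i j => ?_⟩; have h1 := (hM i j g hg).trans (le_abs_self _)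
  have h2 := Finset.single_le_sum (f := fun j => |M i j|) (fun _ _ => abs_nonneg _) (Finset.mem_univ j)
  have h3 := Finset.single_le_sum (f := fun i => ∑ j, |M i j|) (fun _ _ => Finset.sum_nonneg fun _ _ => abs_nonneg _)
    (Finset.mem_univ i)
  linarith

lemma abs_coord_le {h : G} {M : ℝ} (hM : ∀ i j, |(h⁻¹ : G) i j| ≤ M) (u : Fin 3 → ℤ) (i : Fin 3) :
    |(u i : ℝ)| ≤ 3 * M * ‖lat h u‖ := by
  have hinv : (u i : ℝ) = (h⁻¹ : G) i 0 * lat h u 0 + (h⁻¹ : G) i 1 * lat h u 1 + (h⁻¹ : G) i 2 * lat h u 2 := by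
    have q : ∀ j : Fin 3, (h⁻¹ * h : G) i j = (1 : M₃) i j := fun j => by rw [inv_mul_cancel]; rfl
    simp only [mul_entry] at q; simp only [lat_apply]
    have e2 : (u i : ℝ) = (1 : M₃) i 0 * u 0 + (1 : M₃) i 1 * u 1 + (1 : M₃) i 2 * u 2 := by
      rcases fin3 i with rfl|rfl|rfl <;> simp
    rw [e2, ← q 0, ← q 1, ← q 2]; ring
  have ht : ∀ k, |(h⁻¹ : G) i k * lat h u k| ≤ M * ‖lat h u‖ := fun k => by
    rw [abs_mul]; exact mul_le_mul (hM i k) (norm_le_pi_norm (lat h u) k) (abs_nonneg _) ((abs_nonneg _).trans (hM i k))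
  rw [hinv]; have := (abs_add_three _ _ _).trans (add_le_add (add_le_add (ht 0) (ht 1)) (ht 2)); linarith

lemma lat_eq_zero {g : G} {v : Fin 3 → ℤ} (h : lat g v = 0) : v = 0 := by
  have : (fun j => (v j : ℝ)) = 0 := Matrix.eq_zero_of_mulVec_eq_zero (by rw [g.2]; exact one_ne_zero) h
  exact funext fun j => by simpa using congrFun this j

/-- Representatives of the same point define the same lattice. -/
lemma exists_lat_eq {g h : G} (e : h⁻¹ * g ∈ Gamma) {v : Fin 3 → ℤ} (hv : v ≠ 0) : ∃ u ≠ 0, lat g v = lat h u := by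
  obtain ⟨m, hm⟩ := exists_int_matrix e; set u : Fin 3 → ℤ := fun i => m i 0 * v 0 + m i 1 * v 1 + m i 2 * v 2 with hu
  have hgu : lat g v = lat h u := by
    have e : g = h * (h⁻¹ * g) := by group
    ext i; rw [lat_apply, lat_apply]
    conv_lhs => rw [e]
    simp only [mul_entry h, hm, hu]; push_cast; ring
  exact ⟨u, fun h0 => hv (lat_eq_zero (g := g) (by rw [hgu, h0]; ext i; simp [lat_apply])), hgu⟩

/-- Lattices in a compact set have no short vectors. -/
lemma exists_le_norm_lat {K : Set X} (hK : IsCompact K) : ∃ ε > 0, ∀ g : G, (g : X) ∈ K →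
    ∀ v : Fin 3 → ℤ, v ≠ 0 → ε ≤ ‖lat g v‖ := by
  obtain ⟨C, hC, hKC⟩ := exists_compact_lift hK; obtain ⟨M, hM, hCM⟩ := exists_inv_entry_bound hC
  refine ⟨1 / (3 * M), by positivity, fun g hg v hv => ?_⟩; obtain ⟨h, hh, he⟩ := hKC hg
  obtain ⟨u, hu0, hgu⟩ := exists_lat_eq (mk_eq_mk.1 he) hv; obtain ⟨i, hi⟩ := Function.ne_iff.1 hu0
  have h1 : (1 : ℝ) ≤ |(u i : ℝ)| := by exact_mod_cast Int.one_le_abs hi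
  rw [hgu, div_le_iff₀ (by positivity)]; linarith [abs_coord_le (hCM h hh) u i]

/-! ### Covers of sublevel sets by intervals -/

lemma volume_sublevel_le {p q : Fin 3 → ℝ} {a b t ρ ε : ℝ} (ht : t ∈ Icc a b) (hρ : 0 < ρ)
    (hε : 0 ≤ ε) (hερ : 2 * ε ≤ ρ) (h : ρ ≤ ‖p + t • q‖) :
    volume {s | s ∈ Icc a b ∧ ‖p + s • q‖ < ε} ≤ ofR (4 * ε / ρ * (b - a)) := by
  obtain ⟨i, hi⟩ : ∃ i, ρ ≤ |p i + t * q i| := by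
    by_contra! hcon; exact absurd h (not_le.2 ((pi_norm_lt_iff hρ).2 fun i => by simpa using hcon i))
  rcases Set.eq_empty_or_nonempty {s | s ∈ Icc a b ∧ ‖p + s • q‖ < ε} with h0 | ⟨s₀, hs₀, hs₀'⟩
  · rw [h0]; simp
  have hlt : ∀ s, ‖p + s • q‖ < ε → |p i + s * q i| < ε := fun s hs => by
    simpa using (norm_le_pi_norm (p + s • q) i).trans_lt hs
  have h1 := hlt s₀ hs₀'
  have h2 : ρ / 2 ≤ |q i| * (b - a) := by
    have e : p i + t * q i = (p i + s₀ * q i) + q i * (t - s₀) := by ring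
    have h3 : |t - s₀| ≤ b - a := abs_le.2 ⟨by linarith [ht.1, hs₀.2], by linarith [ht.2, hs₀.1]⟩
    have h4 := abs_add_le (p i + s₀ * q i) (q i * (t - s₀)); rw [← e, abs_mul] at h4
    have h5 := mul_le_mul_of_nonneg_left h3 (abs_nonneg (q i)); linarith
  have hq : q i ≠ 0 := fun h0 => by rw [h0] at h2; simp at h2; linarith
  have hq' : 0 < |q i| := abs_pos.2 hq
  have hsub : {s | s ∈ Icc a b ∧ ‖p + s • q‖ < ε} ⊆ Metric.ball (-(p i / q i)) (ε / |q i|) := fun s hs => by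
    have h3 := hlt s hs.2; rw [Metric.mem_ball, Real.dist_eq, lt_div_iff₀ hq', ← abs_mul]
    have e : (s - -(p i / q i)) * q i = p i + s * q i := by field_simp; ring
    rwa [e]
  refine (measure_mono hsub).trans ?_; rw [Real.volume_ball]; refine ofReal_le_ofReal ?_
  rw [mul_div_assoc', div_mul_eq_mul_div, div_le_div_iff₀ hq' hρ]; nlinarith

/-- A finite family of intervals has a subfamily with the same union and multiplicity at most two. -/
lemma exists_cover_mult_two {ι : Type*} (F : Finset ι) (U : ι → Set ℝ) (hU : ∀ i, (U i).OrdConnected) :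
    ∃ S ⊆ F, (∀ i ∈ F, ∀ x ∈ U i, ∃ j ∈ S, x ∈ U j) ∧ ∀ x, ∃ T : Finset ι, T.card ≤ 2 ∧ ∀ i ∈ S, x ∈ U i → i ∈ T := by
  classical
  obtain ⟨S, hS, hmin⟩ : ∃ S, (S ⊆ F ∧ ∀ i ∈ F, ∀ x ∈ U i, ∃ j ∈ S, x ∈ U j) ∧
      ∀ S' : Finset ι, (S' ⊆ F ∧ ∀ i ∈ F, ∀ x ∈ U i, ∃ j ∈ S', x ∈ U j) → S.card ≤ S'.card := by
    have := (F.powerset.filter fun S => ∀ i ∈ F, ∀ x ∈ U i, ∃ j ∈ S, x ∈ U j).exists_min_image Finset.card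
      ⟨F, by simpa using fun i hi x hx => ⟨i, hi, hx⟩⟩
    obtain ⟨S, hS, hmin⟩ := this; simp only [Finset.mem_filter, Finset.mem_powerset] at hS hmin
    exact ⟨S, hS, fun S' hS' => hmin S' hS'⟩
  refine ⟨S, hS.1, hS.2, fun x => ⟨S.filter fun i => x ∈ U i, ?_, fun i hi hx => Finset.mem_filter.2 ⟨hi, hx⟩⟩⟩
  by_contra! hcard; obtain ⟨i, hi, j, hj, k, hk, hij, hik, hjk⟩ := Finset.two_lt_card.1 hcard
  have priv : ∀ i ∈ S, ∃ y ∈ U i, ∀ j ∈ S, j ≠ i → y ∉ U j := by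
    intro i hi; by_contra! hcon
    have := hmin (S.erase i) ⟨(Finset.erase_subset _ _).trans hS.1, fun l hl y hy => by
      obtain ⟨j, hj, hyj⟩ := hS.2 l hl y hy
      by_cases h : j = i
      · obtain ⟨j', hj', hne, hy'⟩ := hcon y (h ▸ hyj); exact ⟨j', Finset.mem_erase.2 ⟨hne, hj'⟩, hy'⟩
      · exact ⟨j, Finset.mem_erase.2 ⟨h, hj⟩, hyj⟩⟩
    have h2 := Finset.card_erase_lt_of_mem hi; omega
  rw [Finset.mem_filter] at hi hj hk; obtain ⟨a, ha, ha'⟩ := priv i hi.1; obtain ⟨b, hb, hb'⟩ := priv j hj.1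
  obtain ⟨c, hc, hc'⟩ := priv k hk.1
  have key : ∀ {l l' : ι} {y z : ℝ}, l ∈ S → l' ∈ S → l ≠ l' → x ∈ U l → x ∈ U l' → y ∈ U l → z ∈ U l' →
      (∀ j ∈ S, j ≠ l → y ∉ U j) → (∀ j ∈ S, j ≠ l' → z ∉ U j) → (x ≤ y → z < x) ∧ (y ≤ x → x < z) := by
    intro l l' y z hl hl' hne h1 h2 hy hz py pz; refine ⟨fun hxy => ?_, fun hyx => ?_⟩
    · by_contra! hxz
      rcases le_total y z with h | h
      · exact py l' hl' hne.symm ((hU l').out h2 hz ⟨hxy, h⟩)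
      · exact pz l hl hne ((hU l).out h1 hy ⟨hxz, h⟩)
    · by_contra! hzx
      rcases le_total y z with h | h
      · exact pz l hl hne ((hU l).out hy h1 ⟨h, hzx⟩)
      · exact py l' hl' hne.symm ((hU l').out hz h2 ⟨h, hyx⟩)
  have k1 := key hi.1 hj.1 hij hi.2 hj.2 ha hb ha' hb'; have k2 := key hi.1 hk.1 hik hi.2 hk.2 ha hc ha' hc'
  have k3 := key hj.1 hk.1 hjk hj.2 hk.2 hb hc hb' hc'
  rcases le_total x a with h | h
  · have := k3.2 (k1.1 h).le; linarith [k2.1 h]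
  · have := k3.1 (k1.2 h).le; linarith [k2.2 h]

lemma sum_volume_le_two {ι : Type*} (S : Finset ι) (U : ι → Set ℝ) (hU : ∀ i, (U i).OrdConnected) {a b : ℝ}
    (hab : ∀ i, U i ⊆ Icc a b) (h : ∀ x, ∃ T : Finset ι, T.card ≤ 2 ∧ ∀ i ∈ S, x ∈ U i → i ∈ T) :
    ∑ i ∈ S, volume (U i) ≤ 2 * ofR (b - a) := by
  classical
  have hm : ∀ i, MeasurableSet (U i) := fun i => (hU i).measurableSet
  have e : ∀ i, volume (U i) = ∫⁻ x, (U i).indicator 1 x := fun i => (lintegral_indicator_one (hm i)).symm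
  simp only [e]; rw [← lintegral_finsetSum _ fun i _ => measurable_one.indicator (hm i)]
  calc ∫⁻ x, ∑ i ∈ S, (U i).indicator 1 x ≤ ∫⁻ x, (Icc a b).indicator (fun _ => 2) x := by
        refine lintegral_mono fun x => ?_
        by_cases hx : x ∈ Icc a b
        · rw [indicator_of_mem hx]; obtain ⟨T, hT, hST⟩ := h x
          calc ∑ i ∈ S, (U i).indicator (1 : ℝ → ℝ≥0∞) x = ∑ i ∈ S.filter (fun i => x ∈ U i), 1 := by
                rw [Finset.sum_filter]; exact Finset.sum_congr rfl fun i _ => by simp [Set.indicator_apply]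
            _ = ((S.filter fun i => x ∈ U i).card : ℝ≥0∞) := by simp
            _ ≤ 2 := by
                have : (S.filter fun i => x ∈ U i).card ≤ 2 := (Finset.card_le_card fun i hi => by
                  rw [Finset.mem_filter] at hi
                  exact hST i hi.1 hi.2).trans hT
                exact_mod_cast this
        · rw [indicator_of_notMem hx]
          refine le_of_eq (Finset.sum_eq_zero fun i _ => indicator_of_notMem (fun h' => hx (hab i h')) _)
    _ = 2 * ofR (b - a) := by
        rw [lintegral_indicator measurableSet_Icc, lintegral_const, Measure.restrict_apply_univ, volume_Icc]

lemma norm_affine_le_max (p q : Fin 3 → ℝ) {c d s M : ℝ} (hc : ‖p + c • q‖ ≤ M) (hd : ‖p + d • q‖ ≤ M)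
    (hs : s ∈ Icc c d) : ‖p + s • q‖ ≤ M := by
  have hM : 0 ≤ M := (norm_nonneg _).trans hc; rw [pi_norm_le_iff_of_nonneg hM] at hc hd ⊢; intro i
  have h1 := hc i; have h2 := hd i; simp only [Pi.add_apply, Pi.smul_apply, smul_eq_mul, norm_eq_abs, abs_le] at h1 h2 ⊢
  rcases le_total 0 (q i) with h | h
  · have := mul_le_mul_of_nonneg_right hs.1 h; have := mul_le_mul_of_nonneg_right hs.2 h
    exact ⟨by linarith, by linarith⟩
  · have := mul_le_mul_of_nonpos_right hs.1 h; have := mul_le_mul_of_nonpos_right hs.2 h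
    exact ⟨by linarith, by linarith⟩

/-- Covering the points where some function of the family is small by intervals which are
maximal for the whole family. -/
lemma exists_interval_cover {ι : Type*} (p q : ι → Fin 3 → ℝ) {a b ρ : ℝ}
    (hfin : {k | ∃ s ∈ Icc a b, ‖p k + s • q k‖ < ρ}.Finite)
    (hsup : ∀ k, ∃ t ∈ Icc a b, ρ ≤ ‖p k + t • q k‖) :
    ∃ (S : Finset ι) (c d : ι → ℝ), (∀ i ∈ S, a ≤ c i ∧ c i ≤ d i ∧ d i ≤ b ∧
      (∀ s ∈ Icc (c i) (d i), ‖p i + s • q i‖ ≤ ρ) ∧ ∀ k, ∃ t ∈ Icc (c i) (d i), ρ ≤ ‖p k + t • q k‖) ∧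
      (∀ k, ∀ s ∈ Icc a b, ‖p k + s • q k‖ < ρ → ∃ i ∈ S, s ∈ Icc (c i) (d i) ∧ ‖p i + s • q i‖ < ρ) ∧
      ∑ i ∈ S, ofR (d i - c i) ≤ 2 * ofR (b - a) := by
  classical
  set U : ι → Set ℝ := fun k => {s | s ∈ Icc a b ∧ ‖p k + s • q k‖ < ρ}
  have hcont : ∀ k, Continuous fun s : ℝ => ‖p k + s • q k‖ := fun k => by fun_prop
  have hord : ∀ k, (U k).OrdConnected := fun k => ⟨fun x hx y hy z hz =>
    ⟨⟨hx.1.1.trans hz.1, hz.2.trans hy.1.2⟩, (norm_affine_le_max _ _ (le_max_left _ _) (le_max_right _ _) hz).trans_lt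
      (max_lt hx.2 hy.2)⟩⟩
  set F : Finset ι := hfin.toFinset with hF
  have hFmem : ∀ k, k ∈ F ↔ (U k).Nonempty := fun k => by rw [hF, Set.Finite.mem_toFinset]; rfl
  set F' := F.filter fun i => ∀ k, U i ⊆ U k → U k ⊆ U i
  have hmax : ∀ k, (U k).Nonempty → ∃ i ∈ F', U k ⊆ U i := by
    intro k hk; obtain ⟨i, hi, hmax⟩ := (F.filter fun i => U k ⊆ U i).exists_maximalFor U ⟨k, by simp [hFmem, hk]⟩
    rw [Finset.mem_filter] at hi; refine ⟨i, Finset.mem_filter.2 ⟨hi.1, fun l hl => ?_⟩, hi.2⟩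
    exact hmax (Finset.mem_filter.2 ⟨(hFmem l).2 (hk.mono (hi.2.trans hl)), hi.2.trans hl⟩) hl
  obtain ⟨S, hSF, hcov, hmult⟩ := exists_cover_mult_two F' U hord
  have hne : ∀ i ∈ S, (U i).Nonempty := fun i hi => (hFmem i).1 (Finset.mem_filter.1 (hSF hi)).1
  have hbb : ∀ i, BddBelow (U i) := fun i => ⟨a, fun s hs => hs.1.1⟩
  have hba : ∀ i, BddAbove (U i) := fun i => ⟨b, fun s hs => hs.1.2⟩
  have hcd : ∀ i, U i ⊆ Icc (sInf (U i)) (sSup (U i)) := fun i s hs => ⟨csInf_le (hbb i) hs, le_csSup (hba i) hs⟩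
  have hclos : ∀ i, closure (U i) ⊆ {s | ‖p i + s • q i‖ ≤ ρ} := fun i =>
    closure_minimal (fun s hs => hs.2.le) (isClosed_le (hcont i) continuous_const)
  have hle : ∀ i ∈ S, sInf (U i) ≤ sSup (U i) := fun i hi => by
    obtain ⟨s, hs⟩ := hne i hi; exact (hcd i hs).1.trans (hcd i hs).2
  refine ⟨S, fun i => sInf (U i), fun i => sSup (U i), fun i hi => ⟨le_csInf (hne i hi) fun s hs => hs.1.1,
    hle i hi, csSup_le (hne i hi) fun s hs => hs.1.2, fun s hs => norm_affine_le_max _ _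
      (hclos i (csInf_mem_closure (hne i hi) (hbb i))) (hclos i (csSup_mem_closure (hne i hi) (hba i))) hs, ?_⟩, ?_, ?_⟩
  · intro k; by_contra! hcon; set c := sInf (U i); set d := sSup (U i)
    have hca : a ≤ c := le_csInf (hne i hi) fun s hs => hs.1.1
    have hdb : d ≤ b := csSup_le (hne i hi) fun s hs => hs.1.2
    have hsubk : Icc c d ⊆ U k := fun s hs => ⟨⟨hca.trans hs.1, hs.2.trans hdb⟩, hcon s hs⟩
    have hki := (Finset.mem_filter.1 (hSF hi)).2 k ((hcd i).trans hsubk); have hUi : Icc c d ⊆ U i := hsubk.trans hki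
    obtain ⟨t, ht, htρ⟩ := hsup i; have htn : t ∉ Icc c d := fun h => absurd (hUi h).2 (not_lt.2 htρ)
    have hop : IsOpen {s : ℝ | ‖p i + s • q i‖ < ρ} := isOpen_lt (hcont i) continuous_const
    rcases lt_or_ge t c with htc | htc
    · have h1 : ∀ᶠ s in 𝓝[<] c, ‖p i + s • q i‖ < ρ ∧ s ∈ Set.Ioo t c :=
        Filter.Eventually.and (nhdsWithin_le_nhds (hop.mem_nhds (hUi ⟨le_rfl, hle i hi⟩).2)) (Ioo_mem_nhdsLT htc)
      obtain ⟨s, hs1, hs2⟩ := h1.exists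
      have : s ∈ U i := ⟨⟨ht.1.trans hs2.1.le, hs2.2.le.trans ((hle i hi).trans hdb)⟩, hs1⟩
      exact absurd (hcd i this).1 (not_le.2 hs2.2)
    · have htd : d < t := not_le.1 fun h => htn ⟨htc, h⟩
      have h1 : ∀ᶠ s in 𝓝[>] d, ‖p i + s • q i‖ < ρ ∧ s ∈ Set.Ioo d t :=
        Filter.Eventually.and (nhdsWithin_le_nhds (hop.mem_nhds (hUi ⟨hle i hi, le_rfl⟩).2)) (Ioo_mem_nhdsGT htd)
      obtain ⟨s, hs1, hs2⟩ := h1.exists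
      have : s ∈ U i := ⟨⟨hca.trans ((hle i hi).trans hs2.1.le), hs2.2.le.trans ht.2⟩, hs1⟩
      exact absurd (hcd i this).2 (not_le.2 hs2.1)
  · intro k s hs hlt; obtain ⟨i, hi, hki⟩ := hmax k ⟨s, hs, hlt⟩; obtain ⟨j, hj, hsj⟩ := hcov i hi s (hki ⟨hs, hlt⟩)
    exact ⟨j, hj, hcd j hsj, hsj.2⟩
  · refine le_trans (Finset.sum_le_sum fun i hi => ?_) (sum_volume_le_two S U hord (fun i s hs => hs.1) hmult)
    rw [← Real.volume_Ioo]; refine measure_mono fun s hs => ?_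
    obtain ⟨x, hx, hxs⟩ := exists_lt_of_csInf_lt (hne i hi) hs.1
    obtain ⟨y, hy, hys⟩ := exists_lt_of_lt_csSup (hne i hi) hs.2; exact (hord i).out hx hy ⟨hxs.le, hys.le⟩

/-- Measure of the points where a family of functions, any two of which are either proportional or
bound a fixed function by their product, has a small member. -/
lemma volume_small_le {ι : Type*} (p q : ι → Fin 3 → ℝ) (p₀ q₀ : Fin 3 → ℝ) {a b ρ ε : ℝ} (hab : a ≤ b)
    (hρ : 0 < ρ) (hρ1 : ρ ≤ 1) (hε : 0 < ε) (hερ : 4 * ε ≤ ρ)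
    (hfin : {k | ∃ s ∈ Icc a b, ‖p k + s • q k‖ < ρ}.Finite)
    (hsup : ∀ k, ∃ t ∈ Icc a b, ρ ≤ ‖p k + t • q k‖) (h₀ : ∃ t ∈ Icc a b, ρ ≤ ‖p₀ + t • q₀‖)
    (hdich : ∀ i k, (∃ l : ℝ, ∀ s : ℝ, ‖p k + s • q k‖ = |l| * ‖p i + s • q i‖) ∨
      ∀ s ∈ Icc a b, ‖p₀ + s • q₀‖ ≤ 2 * (‖p i + s • q i‖ * ‖p k + s • q k‖)) :
    volume {s | s ∈ Icc a b ∧ ∃ k, ‖p k + s • q k‖ < ε} ≤ ofR (16 * ε / ρ * (b - a)) := by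
  obtain ⟨S, c, d, hS, hcov, hsum⟩ := exists_interval_cover p q hfin hsup; obtain ⟨t₀, ht₀, hρ₀⟩ := h₀
  have hsub : {s | s ∈ Icc a b ∧ ∃ k, ‖p k + s • q k‖ < ε} ⊆ {s | s ∈ Icc a b ∧ ‖p₀ + s • q₀‖ < 2 * ε} ∪
        ⋃ i ∈ S, {s | s ∈ Icc (c i) (d i) ∧ ‖p i + s • q i‖ < ε} := by
    rintro s ⟨hs, k, hk⟩
    obtain ⟨i, hi, hsi, hlt⟩ := hcov k s hs (by linarith); obtain ⟨-, -, -, hle, hbig⟩ := hS i hi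
    rcases hdich i k with ⟨l, hl⟩ | h
    · right
      simp only [mem_iUnion]; refine ⟨i, hi, hsi, ?_⟩; obtain ⟨t, ht, hρt⟩ := hbig k; rw [hl] at hρt hk
      have h1 : 1 ≤ |l| := by
        by_contra! hcon
        have h2 : |l| * ‖p i + t • q i‖ ≤ |l| * ρ := mul_le_mul_of_nonneg_left (hle t ht) (abs_nonneg _); nlinarith
      exact (le_mul_of_one_le_left (norm_nonneg _) h1).trans_lt hk
    · left
      refine ⟨hs, (h s hs).trans_lt ?_⟩
      have h1 : ‖p i + s • q i‖ * ‖p k + s • q k‖ ≤ 1 * ‖p k + s • q k‖ :=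
        mul_le_mul_of_nonneg_right (by linarith) (norm_nonneg _)
      linarith
  refine (measure_mono hsub).trans ((measure_union_le _ _).trans ?_)
  have h1 := volume_sublevel_le ht₀ hρ (by positivity) (show 2 * (2 * ε) ≤ ρ by linarith) hρ₀
  have h2 : volume (⋃ i ∈ S, {s | s ∈ Icc (c i) (d i) ∧ ‖p i + s • q i‖ < ε}) ≤
      ofR (4 * ε / ρ) * (2 * ofR (b - a)) := by
    refine (measure_biUnion_finset_le _ _).trans (le_trans (Finset.sum_le_sum fun i hi => ?_)
      ((Finset.mul_sum _ _ _).symm.le.trans (mul_le_mul_right hsum _)))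
    obtain ⟨t, ht, hρt⟩ := (hS i hi).2.2.2.2 i; rw [← ofReal_mul (by positivity)]
    exact volume_sublevel_le ht hρ hε.le (by linarith) hρt
  have hba : 0 ≤ b - a := by linarith
  refine (add_le_add h1 h2).trans (le_of_eq ?_)
  rw [show (2 : ℝ≥0∞) = ofR 2 by simp, ← ofReal_mul (by norm_num),
    ← ofReal_mul (by positivity), ← ofReal_add (by positivity) (by positivity)]
  congr 1; ring

/-! ### Quantitative nondivergence of unipotent orbits -/

/-- The cross product. -/
def cr {R : Type*} [CommRing R] (v w : Fin 3 → R) : Fin 3 → R :=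
  ![v 1 * w 2 - v 2 * w 1, v 2 * w 0 - v 0 * w 2, v 0 * w 1 - v 1 * w 0]

/-- The scalar product of integer vectors. -/
def idot (v w : Fin 3 → ℤ) : ℤ := v 0 * w 0 + v 1 * w 1 + v 2 * w 2

/-- The inverse transpose. -/
def tinv (g : G) : G := ⟨((g⁻¹ : G) : M₃)ᵀ, by rw [Matrix.det_transpose]; exact (g⁻¹).2⟩

lemma dlat_eq (g : G) (w : Fin 3 → ℤ) : dlat g w = lat (tinv g) w := rfl

lemma tinv_tinv (g : G) : tinv (tinv g) = g := by
  refine Subtype.ext ?_; change (((tinv g)⁻¹ : G) : M₃)ᵀ = g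
  rw [Matrix.SpecialLinearGroup.coe_inv, Matrix.adjugate_transpose]; change Matrix.adjugate ((((g⁻¹ : G) : M₃)ᵀ)ᵀ) = g
  rw [Matrix.transpose_transpose, Matrix.SpecialLinearGroup.coe_inv, Matrix.adjugate_adjugate _ (by simp), g.2]; simp

lemma continuous_tinv : Continuous tinv := continuous_of_entries fun i j => (continuous_entry j i).comp continuous_inv

lemma lat_cross (g : G) (v w : Fin 3 → ℤ) : cr (lat g v) (lat g w) = lat (tinv g) (cr v w) := by
  have hinv : ∀ i j : Fin 3, (tinv g) i j = (Matrix.adjugate (g : M₃)) j i := fun i j => rfl; ext i; rw [lat_apply]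
  simp only [hinv, adjugate_fin_three]
  rcases fin3 i with rfl|rfl|rfl <;> simp [cr, lat_apply] <;> ring

lemma norm_cr_le (x y : Fin 3 → ℝ) : ‖cr x y‖ ≤ 2 * (‖x‖ * ‖y‖) := by
  have hx : ∀ i, |x i| ≤ ‖x‖ := fun i => norm_le_pi_norm x i; have hy : ∀ i, |y i| ≤ ‖y‖ := fun i => norm_le_pi_norm y i
  have h : ∀ i j k l, |x i * y j - x k * y l| ≤ 2 * (‖x‖ * ‖y‖) := fun i j k l => by
    have h1 : |x i * y j| ≤ ‖x‖ * ‖y‖ := by rw [abs_mul]; exact mul_le_mul (hx i) (hy j) (abs_nonneg _) (norm_nonneg _)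
    have h2 : |x k * y l| ≤ ‖x‖ * ‖y‖ := by rw [abs_mul]; exact mul_le_mul (hx k) (hy l) (abs_nonneg _) (norm_nonneg _)
    linarith [abs_sub (x i * y j) (x k * y l)]
  refine (pi_norm_le_iff_of_nonneg (by positivity)).2 fun i => ?_
  rcases fin3 i with rfl|rfl|rfl <;> simpa [cr] using h _ _ _ _

lemma exists_smul_of_cr_eq_zero {v w : Fin 3 → ℤ} (hv : v ≠ 0) (h : cr v w = 0) :
    ∃ l : ℝ, ∀ g, lat g w = l • lat g v := by
  have h0 : v 1 * w 2 - v 2 * w 1 = 0 := by simpa [cr] using congrFun h 0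
  have h1 : v 2 * w 0 - v 0 * w 2 = 0 := by simpa [cr] using congrFun h 1
  have h2 : v 0 * w 1 - v 1 * w 0 = 0 := by simpa [cr] using congrFun h 2
  have hp : ∀ j k, v j * w k = v k * w j := fun j k => by
    rcases fin3 j with rfl|rfl|rfl <;> rcases fin3 k with rfl|rfl|rfl <;> linarith
  obtain ⟨j, hj⟩ := Function.ne_iff.1 hv; have hj' : (v j : ℝ) ≠ 0 := by exact_mod_cast hj
  refine ⟨w j / v j, fun g => ?_⟩
  have hk : ∀ k, (w k : ℝ) = w j / v j * v k := fun k => by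
    rw [div_mul_eq_mul_div, eq_div_iff hj']; have := hp j k
    have h' : (v j : ℝ) * w k = v k * w j := by exact_mod_cast this
    linarith
  ext i; rw [Pi.smul_apply, lat_apply, lat_apply, hk 0, hk 1, hk 2, smul_eq_mul]; ring

lemma cr_cr_eq_zero {v w w' : Fin 3 → ℤ} (h : idot w v = 0) (h' : idot w' v = 0) : cr v (cr w w') = 0 := by
  unfold idot at h h'; ext i
  rcases fin3 i with rfl|rfl|rfl <;> simp [cr] <;> grind

lemma idot_cr (v w : Fin 3 → ℤ) : idot (cr v w) v = 0 := by simp [idot, cr]; ring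

lemma idot_le (g : G) (v w : Fin 3 → ℤ) : |(idot w v : ℝ)| ≤ 3 * (‖dlat g w‖ * ‖lat g v‖) := by
  have e : (idot w v : ℝ) = dlat g w 0 * lat g v 0 + dlat g w 1 * lat g v 1 + dlat g w 2 * lat g v 2 := by
    have h1 : dlat g w ⬝ᵥ lat g v = (fun j => (w j : ℝ)) ⬝ᵥ fun j => (v j : ℝ) := by
      rw [dlat, lat, Matrix.mulVec_transpose, ← Matrix.dotProduct_mulVec, Matrix.mulVec_mulVec,
        ← Matrix.SpecialLinearGroup.coe_mul, inv_mul_cancel, Matrix.SpecialLinearGroup.coe_one, Matrix.one_mulVec]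
    simp only [dotProduct, Fin.sum_univ_three] at h1; rw [h1, idot]; push_cast; ring
  have h : ∀ i, |dlat g w i * lat g v i| ≤ ‖dlat g w‖ * ‖lat g v‖ := fun i => by
    rw [abs_mul]
    exact mul_le_mul (norm_le_pi_norm (dlat g w) i) (norm_le_pi_norm (lat g v) i) (abs_nonneg _) (norm_nonneg _)
  rw [e]; have := (abs_add_three _ _ _).trans (add_le_add (add_le_add (h 0) (h 1)) (h 2)); linarith

/-- Curves of lattices all of whose vectors move along lines. -/
def AffineCurve (M : ℝ → G) : Prop := ∃ p q : (Fin 3 → ℤ) → Fin 3 → ℝ, ∀ s v, lat (M s) v = p v + s • q v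

lemma finite_short {M : ℝ → G} (hM : Continuous M) (a b ρ : ℝ) : {v | ∃ s ∈ Icc a b, ‖lat (M s) v‖ < ρ}.Finite := by
  obtain ⟨B, hB, h⟩ := exists_inv_entry_bound (isCompact_Icc.image hM (s := Icc a b))
  obtain ⟨N, hN⟩ := exists_nat_gt (3 * B * ρ)
  refine (finite_Icc (fun _ => -(N : ℤ)) (fun _ : Fin 3 => (N : ℤ))).subset ?_
  rintro v ⟨s, hs, hv⟩
  have hi : ∀ i, |v i| ≤ (N : ℤ) := fun i => by
    have h1 := abs_coord_le (h _ ⟨s, hs, rfl⟩) v i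
    have h2 : 3 * B * ‖lat (M s) v‖ ≤ 3 * B * ρ := mul_le_mul_of_nonneg_left hv.le (by positivity)
    have h3 : |(v i : ℝ)| ≤ N := by linarith
    exact_mod_cast h3
  exact ⟨fun i => (abs_le.1 (hi i)).1, fun i => (abs_le.1 (hi i)).2⟩

lemma volume_short_orthogonal_le {M : ℝ → G} (hMc : Continuous M) (hA : AffineCurve M)
    (hA' : AffineCurve fun s => tinv (M s)) {v : Fin 3 → ℤ} (hv : v ≠ 0) {c d ρ ε : ℝ} (hcd : c ≤ d)
    (hρ : 0 < ρ) (hρ1 : ρ ≤ 1) (hε : 0 < ε) (hερ : 4 * ε ≤ ρ)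
    (hle : ∀ s ∈ Icc c d, ‖lat (M s) v‖ ≤ ρ)
    (hbig : ∀ u, u ≠ 0 → ∃ t ∈ Icc c d, ρ ≤ ‖lat (M t) u‖)
    (hbig' : ∀ w, w ≠ 0 → ∃ t ∈ Icc c d, ρ ≤ ‖lat (tinv (M t)) w‖) :
    volume {s | s ∈ Icc c d ∧ ∃ w, w ≠ 0 ∧ idot w v = 0 ∧ ‖lat (tinv (M s)) w‖ < ε} ≤ ofR (16 * ε / ρ * (d - c)) := by
  obtain ⟨p, q, hpq⟩ := hA; obtain ⟨p', q', hpq'⟩ := hA'; simp only [hpq, hpq'] at hle hbig hbig' ⊢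
  have key := volume_small_le (ι := {w : Fin 3 → ℤ // w ≠ 0 ∧ idot w v = 0}) (fun w => p' w) (fun w => q' w)
    (p v) (q v) hcd hρ hρ1 hε hερ
    (by
      have h1 := finite_short (continuous_tinv.comp hMc) c d ρ
      refine Set.Finite.of_finite_image (f := Subtype.val) (h1.subset ?_) Subtype.val_injective.injOn
      rintro _ ⟨w, ⟨s, hs, hw⟩, rfl⟩
      refine ⟨s, hs, ?_⟩
      rw [Function.comp_apply, hpq']; exact hw)
    (fun w => hbig' w w.2.1) (hbig v hv) (fun w w' => by
      by_cases h0 : cr w.1 w'.1 = 0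
      · left
        obtain ⟨l, hl⟩ := exists_smul_of_cr_eq_zero w.2.1 h0; refine ⟨l, fun s => ?_⟩
        rw [← hpq', ← hpq', hl, norm_smul, norm_eq_abs]
      · right
        intro s hs; obtain ⟨l, hl⟩ := exists_smul_of_cr_eq_zero hv (cr_cr_eq_zero w.2.2 w'.2.2)
        obtain ⟨t, ht, hρt⟩ := hbig _ h0
        have h1 : 1 ≤ |l| := by
          rw [← hpq, hl, norm_smul, norm_eq_abs, hpq] at hρt; by_contra! hcon
          have h2 := mul_le_mul_of_nonneg_left (hle t ht) (abs_nonneg l); nlinarith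
        have h2 : ‖p v + s • q v‖ ≤ ‖lat (M s) (cr w.1 w'.1)‖ := by
          rw [hl, norm_smul, norm_eq_abs, hpq]; exact le_mul_of_one_le_left (norm_nonneg _) h1
        refine h2.trans ?_; have h3 := lat_cross (tinv (M s)) w.1 w'.1; rw [tinv_tinv] at h3; rw [← h3, ← hpq', ← hpq']
        exact norm_cr_le _ _)
  refine (measure_mono ?_).trans key
  rintro s ⟨hs, w, hw0, hwv, hw⟩
  exact ⟨hs, ⟨w, hw0, hwv⟩, hw⟩

lemma AffineCurve.uu (g : G) : AffineCurve fun s => uu s * g := by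
  refine ⟨fun v => lat g v, fun v => ![lat g v 1, 0, 0], fun s v => ?_⟩; ext i; rw [lat_apply]
  simp only [mul_entry, Pi.add_apply, Pi.smul_apply, lat_apply]
  rcases fin3 i with rfl|rfl|rfl <;> simp <;> ring

lemma dlat_uu_mul (s : ℝ) (g : G) (v : Fin 3 → ℤ) : dlat (uu s * g) v = dlat g v + s • ![0, -dlat g v 0, 0] := by
  ext i; rw [dlat_apply]; simp only [_root_.mul_inv_rev, ← uu_neg, mul_entry, Pi.add_apply, Pi.smul_apply, dlat_apply]
  rcases fin3 i with rfl|rfl|rfl <;> simp <;> ring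

lemma AffineCurve.tinv_uu (g : G) : AffineCurve fun s => tinv (_root_.uu s * g) :=
  ⟨fun v => dlat g v, fun v => ![0, -dlat g v 0, 0], fun s v => by rw [← dlat_eq, dlat_uu_mul]⟩

/-- Quantitative nondivergence. -/
theorem volume_short_le (g : G) {a b ρ ε : ℝ} (hρ : 0 < ρ) (hρ1 : ρ ≤ 1) (hε : 0 < ε)
    (hερ : 8 * ε ≤ ρ) (hbig : ∀ v, v ≠ 0 → ∃ t ∈ Icc a b, ρ ≤ ‖lat (uu t * g) v‖)
    (hbig' : ∀ w, w ≠ 0 → ∃ t ∈ Icc a b, ρ ≤ ‖dlat (uu t * g) w‖) :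
    volume {s | s ∈ Icc a b ∧ ∃ v, v ≠ 0 ∧ ‖lat (uu s * g) v‖ < ε} ≤ ofR (72 * ε / ρ * (b - a)) := by
  set M : ℝ → G := fun s => uu s * g with hM; have hMc : Continuous M := continuous_uu.mul continuous_const
  obtain ⟨p, q, hpq⟩ := AffineCurve.uu g; obtain ⟨p', q', hpq'⟩ := AffineCurve.tinv_uu g
  let ι := {v : Fin 3 → ℤ // v ≠ 0} ⊕ {v : Fin 3 → ℤ // v ≠ 0}
  let P : ι → Fin 3 → ℝ := Sum.elim (fun v => p v) fun w => p' w
  let Q : ι → Fin 3 → ℝ := Sum.elim (fun v => q v) fun w => q' w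
  have hl : ∀ v s, ‖P (Sum.inl v) + s • Q (Sum.inl v)‖ = ‖lat (M s) v‖ := fun v s => by rw [hM, hpq]; rfl
  have hr : ∀ v s, ‖P (Sum.inr v) + s • Q (Sum.inr v)‖ = ‖lat (tinv (M s)) v‖ := fun v s => by rw [hM, hpq']; rfl
  have hfin : {k : ι | ∃ s ∈ Icc a b, ‖P k + s • Q k‖ < ρ}.Finite := by
    have h1 := (finite_short hMc a b ρ).preimage (Subtype.val_injective (p := fun v : Fin 3 → ℤ => v ≠ 0)).injOn
    have h2 := (finite_short (continuous_tinv.comp hMc) a b ρ).preimage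
      (Subtype.val_injective (p := fun v : Fin 3 → ℤ => v ≠ 0)).injOn
    refine ((h1.image Sum.inl).union (h2.image Sum.inr)).subset ?_
    rintro (v | v) ⟨s, hs, h⟩
    · exact Or.inl ⟨v, ⟨s, hs, by rwa [← hl]⟩, rfl⟩
    · exact Or.inr ⟨v, ⟨s, hs, by rw [Function.comp_apply, ← hr]; exact h⟩, rfl⟩
  obtain ⟨S, c, d, hS, hcov, hsum⟩ := exists_interval_cover P Q hfin (by
    rintro (v | v)
    · simp only [hl]; exact hbig v v.2
    · simp only [hr]; exact hbig' v v.2)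
  set Bad := {s | s ∈ Icc a b ∧ ∃ v, v ≠ 0 ∧ ‖lat (M s) v‖ < ε}
  have hsub : Bad ⊆ ⋃ i ∈ S, {s | s ∈ Bad ∧ s ∈ Icc (c i) (d i) ∧ ‖P i + s • Q i‖ < ρ} := by
    intro s hs; obtain ⟨v, hv, hlt⟩ := hs.2
    obtain ⟨i, hi, h1, h2⟩ := hcov (Sum.inl ⟨v, hv⟩) s hs.1 (by rw [hl]; linarith); simp only [mem_iUnion]
    exact ⟨i, hi, hs, h1, h2⟩
  have hpiece : ∀ i ∈ S, volume {s | s ∈ Bad ∧ s ∈ Icc (c i) (d i) ∧ ‖P i + s • Q i‖ < ρ} ≤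
      ofR (36 * ε / ρ) * ofR (d i - c i) := by
    intro i hi; obtain ⟨-, hcd, -, hle, hbg⟩ := hS i hi; have hdc : 0 ≤ d i - c i := by linarith
    rw [← ofReal_mul (by positivity)]
    have bl : ∀ u, u ≠ 0 → ∃ t ∈ Icc (c i) (d i), ρ ≤ ‖lat (M t) u‖ := fun u hu => by
      simpa only [hl] using hbg (Sum.inl ⟨u, hu⟩)
    have br : ∀ u, u ≠ 0 → ∃ t ∈ Icc (c i) (d i), ρ ≤ ‖lat (tinv (M t)) u‖ := fun u hu => by
      simpa only [hr] using hbg (Sum.inr ⟨u, hu⟩)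
    rcases i with ⟨v, hv⟩ | ⟨w, hw⟩
    · simp only [hl] at hle ⊢
      have h1 := volume_short_orthogonal_le hMc (AffineCurve.uu g) (AffineCurve.tinv_uu g) hv hcd hρ hρ1
        (ε := 2 * ε) (by positivity) (by linarith) hle bl br
      obtain ⟨t, ht, hρt⟩ := bl v hv; rw [hM, hpq] at hρt; have h2 := volume_sublevel_le ht hρ hε.le (by linarith) hρt
      refine (measure_mono ?_).trans ((measure_union_le _ _).trans ((add_le_add h1 h2).trans (le_of_eq ?_)))
      · rintro s ⟨⟨hs, v', hv', hlt⟩, hsi, hlt'⟩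
        by_cases h0 : cr v v' = 0
        · right
          obtain ⟨l, hlv⟩ := exists_smul_of_cr_eq_zero hv h0; refine ⟨hsi, ?_⟩; rw [← hpq]
          obtain ⟨t', ht', hρt'⟩ := bl v' hv'; rw [hlv, norm_smul, norm_eq_abs] at hlt hρt'
          have h1 : 1 ≤ |l| := by
            by_contra! hcon; have h2 := mul_le_mul_of_nonneg_left (hle t' ht') (abs_nonneg l); nlinarith
          exact (le_mul_of_one_le_left (norm_nonneg _) h1).trans_lt hlt
        · left
          refine ⟨hsi, cr v v', h0, idot_cr v v', ?_⟩; rw [← lat_cross]; refine (norm_cr_le _ _).trans_lt ?_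
          have h3 : ‖lat (M s) v‖ * ‖lat (M s) v'‖ ≤ 1 * ‖lat (M s) v'‖ :=
            mul_le_mul_of_nonneg_right (by linarith) (norm_nonneg _)
          linarith
      · rw [← ofReal_add (by positivity) (by positivity)]; congr 1; ring
    · simp only [hr] at hle ⊢
      have h1 := volume_short_orthogonal_le (M := fun s => tinv (M s)) (continuous_tinv.comp hMc) (AffineCurve.tinv_uu g)
        (by simpa only [tinv_tinv] using AffineCurve.uu g) hw hcd hρ hρ1 hε (by linarith) hle br
        (by simpa only [tinv_tinv] using bl)
      refine (measure_mono ?_).trans (h1.trans (ofReal_le_ofReal ?_))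
      · rintro s ⟨⟨hs, v', hv', hlt⟩, hsi, hlt'⟩
        refine ⟨hsi, v', hv', ?_, by simpa only [tinv_tinv] using hlt⟩; by_contra h0; have h3 := idot_le (M s) v' w
        rw [dlat_eq] at h3
        have h4 : (1 : ℝ) ≤ |(idot w v' : ℝ)| := by
          have : idot w v' ≠ 0 := fun h => h0 (by unfold idot at h ⊢; linarith); exact_mod_cast Int.one_le_abs this
        have h5 : ‖lat (tinv (M s)) w‖ * ‖lat (M s) v'‖ ≤ 1 * ‖lat (M s) v'‖ :=
          mul_le_mul_of_nonneg_right (by linarith) (norm_nonneg _)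
        linarith
      · have : 16 * ε / ρ ≤ 36 * ε / ρ := div_le_div_of_nonneg_right (by linarith) hρ.le
        exact mul_le_mul_of_nonneg_right this hdc
  refine (measure_mono hsub).trans ((measure_biUnion_finset_le _ _).trans ((Finset.sum_le_sum hpiece).trans ?_))
  rw [← Finset.mul_sum]; refine (mul_le_mul_right hsum _).trans (le_of_eq ?_)
  rw [show (2 : ℝ≥0∞) = ofR 2 by simp, ← ofReal_mul (by norm_num), ← ofReal_mul (by positivity)]; congr 1; ring

/-! ### Nondivergence of invariant measures -/

lemma irrationalPt_iff {x : X} : IrrationalPt x ↔ ∀ g : G, (g : X) = x →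
    (∀ v, v ≠ 0 → lat g v 1 ≠ 0) ∧ ∀ v, v ≠ 0 → dlat g v 0 ≠ 0 := by
  simp only [IrrationalPt, lat_apply, dlat_apply, Fin.sum_univ_three]

lemma exists_big_of_irrational {g : G} (h : IrrationalPt (g : X)) : ∀ᶠ R : ℝ in atTop,
    (∀ v, v ≠ 0 → ∃ t ∈ Icc 0 R, 1 ≤ ‖lat (uu t * g) v‖) ∧
    ∀ v, v ≠ 0 → ∃ t ∈ Icc 0 R, 1 ≤ ‖dlat (uu t * g) v‖ := by
  obtain ⟨h1, h2⟩ := irrationalPt_iff.1 h g rfl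
  have key : ∀ σ : G → G, (∀ v, v ≠ 0 → ∃ t ≥ 0, 1 ≤ ‖lat (σ (uu t * g)) v‖) →
      ∀ᶠ R : ℝ in atTop, ∀ v, v ≠ 0 → ∃ t ∈ Icc 0 R, 1 ≤ ‖lat (σ (uu t * g)) v‖ := by
    intro σ hσ; have hfin := finite_short (M := fun _ => σ g) continuous_const 0 0 1
    have h3 : ∀ᶠ R : ℝ in atTop, ∀ v ∈ {v | ∃ s ∈ Icc (0 : ℝ) 0, ‖lat (σ g) v‖ < 1}, v ≠ 0 →
        ∃ t ∈ Icc 0 R, 1 ≤ ‖lat (σ (uu t * g)) v‖ := by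
      rw [hfin.eventually_all]; intro v _
      by_cases hv : v = 0
      · exact .of_forall fun R h => absurd hv h
      obtain ⟨t, ht, h⟩ := hσ v hv
      filter_upwards [eventually_ge_atTop t] with R hR _ using ⟨t, ⟨ht, hR⟩, h⟩
    filter_upwards [h3, eventually_ge_atTop 0] with R hR hR0 v hv
    by_cases hs : ‖lat (σ g) v‖ < 1
    · exact hR v ⟨0, by simp, hs⟩ hv
    · exact ⟨0, ⟨le_rfl, hR0⟩, by rw [uu_zero, one_mul]; exact not_lt.1 hs⟩
  have esc : ∀ p c : ℝ, c ≠ 0 → ∃ t ≥ 0, 1 ≤ |p + t * c| := fun p c hc => by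
    refine ⟨(1 + |p|) / |c|, by positivity, ?_⟩; have h3 := abs_sub_abs_le_abs_add ((1 + |p|) / |c| * c) p
    rw [abs_mul, abs_div, abs_abs, div_mul_cancel₀ _ (abs_ne_zero.2 hc), abs_of_nonneg (by positivity : 0 ≤ 1 + |p|),
      add_comm _ p] at h3
    linarith
  refine (key id fun v hv => ?_).and (key tinv fun v hv => ?_)
  · obtain ⟨t, ht, h⟩ := esc (lat g v 0) (lat g v 1) (h1 v hv); refine ⟨t, ht, h.trans ?_⟩
    have e : lat (uu t * g) v 0 = lat g v 0 + t * lat g v 1 := by simp only [lat_apply, mul_entry]; simp; ring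
    rw [← e]; exact norm_le_pi_norm (lat (uu t * g) v) 0
  · obtain ⟨t, ht, h⟩ := esc (dlat g v 1) (-dlat g v 0) (neg_ne_zero.2 (h2 v hv)); refine ⟨t, ht, h.trans ?_⟩
    have e : dlat (uu t * g) v 1 = dlat g v 1 + t * -dlat g v 0 := by rw [dlat_uu_mul]; simp
    rw [← e]; exact norm_le_pi_norm (dlat (uu t * g) v) 1

/-- Measures invariant under `uu` without mass on rational points are uniformly tight. -/
theorem exists_compact_uniform {δ : ℝ} (hδ : 0 < δ) : ∃ K : Set X, IsCompact K ∧ ∀ ν : Measure X,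
    IsProbabilityMeasure ν → (∀ r, uu r ∈ stab ν) → (∀ᵐ x ∂ν, IrrationalPt x) → ν Kᶜ ≤ ofR δ := by
  set ε : ℝ := min (1 / 8) (δ / 72); have hε0 : 0 < ε := by positivity
  obtain ⟨K, hK, hKε⟩ := exists_compact_of_no_short_vector hε0; refine ⟨K, hK, fun ν _ hU hirr => ?_⟩
  set F : ℕ → X → ℝ≥0∞ := fun n x => (volume.restrict 𝕀) {ζ | uu (n * ζ) • x ∈ Kᶜ} with hF
  have hc : ∀ n : ℕ, Continuous fun ζ : ℝ => uu (n * ζ) := fun n => continuous_uu.comp (continuous_const.mul continuous_id)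
  have hnt : ∀ n, ∫⁻ x, F n x ∂ν = ν Kᶜ := fun n =>
    lintegral_fibre (hc n) (fun ζ => hU _) hK.measurableSet.compl
  have hlim : ∀ᵐ x ∂ν, limsup (fun n => F n x) atTop ≤ ofR δ := by
    filter_upwards [hirr] with x hx
    obtain ⟨g, rfl⟩ := exists_rep x; refine limsup_le_of_le (h := ?_)
    filter_upwards [tendsto_natCast_atTop_atTop.eventually (exists_big_of_irrational hx), eventually_gt_atTop 0] with n hn hn0
    have hn' : (0 : ℝ) < n := by exact_mod_cast hn0
    have h1 := volume_short_le g one_pos le_rfl hε0 (by linarith [min_le_left (1 / 8 : ℝ) (δ / 72)]) hn.1 hn.2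
    have hm : MeasurableSet {ζ : ℝ | uu (n * ζ) • (g : X) ∈ Kᶜ} := by
      have hcg : Continuous fun ζ : ℝ => uu (n * ζ) • (g : X) := (continuous_orbitG (g : X)).comp (hc n)
      exact hcg.measurable hK.measurableSet.compl
    rw [hF]; simp only; rw [Measure.restrict_apply hm]
    have hsub : {ζ : ℝ | uu (n * ζ) • (g : X) ∈ Kᶜ} ∩ Icc 0 1 ⊆ (fun ζ : ℝ => (n : ℝ) * ζ) ⁻¹'
        {s | s ∈ Icc (0 : ℝ) n ∧ ∃ v, v ≠ 0 ∧ ‖lat (uu s * g) v‖ < ε} := by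
      rintro ζ ⟨h2, h3⟩
      refine ⟨⟨by have := h3.1; positivity, by simpa using mul_le_mul_of_nonneg_left h3.2 hn'.le⟩, ?_⟩; by_contra! hcon
      exact h2 (hKε (uu (n * ζ) * g) hcon)
    refine (measure_mono hsub).trans ?_; rw [Real.volume_preimage_mul_left hn'.ne']
    refine (mul_le_mul_right h1 _).trans ?_; rw [← ofReal_mul (by positivity)]; refine ofReal_le_ofReal ?_
    rw [abs_of_pos (by positivity), div_one, sub_zero]; have : (n : ℝ)⁻¹ * (72 * ε * n) = 72 * ε := by field_simp
    rw [this]; linarith [min_le_right (1 / 8 : ℝ) (δ / 72)]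
  have h3 : limsup (fun n => ∫⁻ x, F n x ∂ν) atTop ≤ ∫⁻ x, limsup (fun n => F n x) atTop ∂ν :=
    limsup_lintegral_le (fun _ => 1) (fun n => measurable_fibre (hc n) hK.measurableSet.compl _)
      (fun n => .of_forall fun x => by refine (measure_mono (Set.subset_univ _)).trans ?_; simp) (by simp)
  simp only [hnt, limsup_const] at h3; refine h3.trans ((lintegral_mono_ae hlim).trans ?_); simp

/-! ### Irrationality of almost every point -/

/-- The diagonal element with given entries. -/
def diagG (d : Fin 3 → ℝ) (h : d 0 * d 1 * d 2 = 1) : G :=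
  ⟨diagonal d, by rw [Matrix.det_diagonal, Fin.prod_univ_three, h]⟩

lemma lat_diagG (d : Fin 3 → ℝ) (h : d 0 * d 1 * d 2 = 1) (g : G) (v : Fin 3 → ℤ) (i : Fin 3) :
    lat (diagG d h * g) v i = d i * lat g v i := by
  have e : ∀ j, (diagG d h * g : G) i j = d i * g i j := fun j => by
    rw [Matrix.SpecialLinearGroup.coe_mul]; exact Matrix.diagonal_mul _ _ _ _
  rw [lat_apply, lat_apply, e, e, e]; ring

lemma diagG_ne_zero {d : Fin 3 → ℝ} (h : d 0 * d 1 * d 2 = 1) (i : Fin 3) : d i ≠ 0 := by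
  rcases fin3 i with rfl|rfl|rfl <;> rintro h0 <;> simp [h0] at h

lemma dlat_diagG (d : Fin 3 → ℝ) (h : d 0 * d 1 * d 2 = 1) (g : G) (v : Fin 3 → ℤ) (i : Fin 3) :
    dlat (diagG d h * g) v i = (d i)⁻¹ * dlat g v i := by
  have e : g⁻¹ = (diagG d h * g)⁻¹ * diagG d h := by group
  have e2 : ∀ j, (g⁻¹ : G) j i = (((diagG d h * g)⁻¹ : G) j i) * d i := fun j => by
    conv_lhs => rw [e]
    rw [Matrix.SpecialLinearGroup.coe_mul]; exact Matrix.mul_diagonal _ _ _ _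
  rw [dlat_apply, dlat_apply, e2, e2, e2, inv_mul_eq_div, eq_div_iff (diagG_ne_zero h i)]; ring

lemma IrrationalPt.diagG_smul {d : Fin 3 → ℝ} (h : d 0 * d 1 * d 2 = 1) {x : X} (hx : IrrationalPt x) :
    IrrationalPt (diagG d h • x) := by
  rw [irrationalPt_iff] at hx ⊢; intro g hg; have e : g = diagG d h * ((diagG d h)⁻¹ * g) := by group
  have h1 : (((diagG d h)⁻¹ * g : G) : X) = x := by rw [← smul_mk, hg, inv_smul_smul]
  obtain ⟨a, b⟩ := hx _ h1; rw [e]; refine ⟨fun v hv => ?_, fun v hv => ?_⟩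
  · rw [lat_diagG]; exact mul_ne_zero (diagG_ne_zero h _) (a v hv)
  · rw [dlat_diagG]; exact mul_ne_zero (inv_ne_zero (diagG_ne_zero h _)) (b v hv)

lemma measure_zero_of_scaling {μ : Measure X} [IsProbabilityMeasure μ] {t : G} (ht : t ∈ stab μ) {E : ℕ → Set X}
    (hm : ∀ k, MeasurableSet (E k)) (hanti : Antitone E) (hE : ∀ k x, t • x ∈ E k → x ∈ E (k + 1))
    (h0 : μ (⋂ k, E k) = 0) : μ (E 0) = 0 := by
  have h1 : ∀ k, μ (E 0) ≤ μ (E k) := fun k => by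
    induction k with
    | zero => exact le_rfl
    | succ k ih =>
      refine ih.trans ?_; rw [← (measurePreserving_of_mem_stab ht).measure_preimage (hm k).nullMeasurableSet]
      exact measure_mono fun x hx => hE k x hx
  have h2 := tendsto_measure_iInter_atTop (μ := μ) (fun k => (hm k).nullMeasurableSet) hanti ⟨0, measure_ne_top _ _⟩
  rw [h0] at h2; exact le_antisymm (ge_of_tendsto h2 (.of_forall h1)) bot_le

/-- Points having a representative whose lattice, after applying `σ`, has a nonzero vector in `C`. -/
def latSet (σ : G → G) (C : Set (Fin 3 → ℝ)) : Set X := {x | ∃ g : G, (g : X) = x ∧ ∃ v, v ≠ 0 ∧ lat (σ g) v ∈ C}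

lemma continuous_lat (v : Fin 3 → ℤ) : Continuous fun g : G => lat g v := by
  refine continuous_pi fun i => ?_; simp only [lat_apply]
  exact (((continuous_entry i 0).mul continuous_const).add ((continuous_entry i 1).mul continuous_const)).add
    ((continuous_entry i 2).mul continuous_const)

lemma measurableSet_latSet {σ : G → G} (hσ : Continuous σ) {C : Set (Fin 3 → ℝ)} (hC : IsClosed C) :
    MeasurableSet (latSet σ C) := by
  have e : latSet σ C = ⋃ v : {v : Fin 3 → ℤ // v ≠ 0}, (fun g : G => (g : X)) '' {g | lat (σ g) v ∈ C} := by
    ext x; simp only [latSet, mem_iUnion, Set.mem_image, mem_ofPred_eq]; constructor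
    · rintro ⟨g, hg, v, hv, h⟩; exact ⟨⟨v, hv⟩, g, h, hg⟩
    · rintro ⟨v, g, h, hg⟩; exact ⟨g, hg, v, v.2, h⟩
  rw [e]; exact MeasurableSet.iUnion fun v => measurableSet_image_mk (hC.preimage ((continuous_lat v.1).comp hσ))

lemma latSet_mono {σ : G → G} {C C' : Set (Fin 3 → ℝ)} (h : C ⊆ C') : latSet σ C ⊆ latSet σ C' :=
  fun _ ⟨g, hg, v, hv, hC⟩ => ⟨g, hg, v, hv, h hC⟩

lemma tinv_mem_Gamma {γ : G} (h : γ ∈ Gamma) : tinv γ ∈ Gamma := by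
  obtain ⟨m, rfl⟩ := h
  refine ⟨⟨((m⁻¹ : Matrix.SpecialLinearGroup (Fin 3) ℤ) : Matrix (Fin 3) (Fin 3) ℤ)ᵀ,
    by rw [Matrix.det_transpose]; exact (m⁻¹).2⟩, ?_⟩
  refine G_ext fun i j => ?_
  have e : (Matrix.SpecialLinearGroup.map (n := Fin 3) (Int.castRingHom ℝ) m)⁻¹ =
      Matrix.SpecialLinearGroup.map (n := Fin 3) (Int.castRingHom ℝ) m⁻¹ := (map_inv _ m).symm
  change _ = (((Matrix.SpecialLinearGroup.map (n := Fin 3) (Int.castRingHom ℝ) m)⁻¹ : G) : M₃) j i; rw [e]; rfl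

lemma tinv_mul (g h : G) : tinv (g * h) = tinv g * tinv h := by
  refine Subtype.ext ?_; change (((g * h)⁻¹ : G) : M₃)ᵀ = ((g⁻¹ : G) : M₃)ᵀ * ((h⁻¹ : G) : M₃)ᵀ
  rw [_root_.mul_inv_rev, Matrix.SpecialLinearGroup.coe_mul, Matrix.transpose_mul]

lemma tinv_inv (g : G) : tinv g⁻¹ = (tinv g)⁻¹ := by
  rw [eq_inv_iff_mul_eq_one, ← tinv_mul, inv_mul_cancel]; refine G_ext fun i j => ?_
  change ((1 : G)⁻¹ : G) j i = (1 : M₃) i j; rw [inv_one]; change (1 : M₃) j i = _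
  rw [Matrix.one_apply, Matrix.one_apply]; simp only [eq_comm]

lemma exists_lat_of_mem_latSet {σ : G → G} (hσ : σ = id ∨ σ = tinv) {C : Set (Fin 3 → ℝ)} {g : G}
    (h : (g : X) ∈ latSet σ C) : ∃ v, v ≠ 0 ∧ lat (σ g) v ∈ C := by
  obtain ⟨g', hg', v, hv, hC⟩ := h; have hγ := mk_eq_mk.1 hg'.symm
  have hγ' : (σ g)⁻¹ * σ g' ∈ Gamma := by
    rcases hσ with rfl | rfl
    · exact hγ
    · rw [← tinv_inv, ← tinv_mul]; exact tinv_mem_Gamma hγ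
  obtain ⟨u, hu, e⟩ := exists_lat_eq hγ' hv; exact ⟨u, hu, e ▸ hC⟩

lemma iInter_latSet_eq_empty {σ : G → G} (hσ : σ = id ∨ σ = tinv) {C : ℕ → Set (Fin 3 → ℝ)} {ε : ℕ → ℝ}
    (hε : Tendsto ε atTop (𝓝 0)) (hC : ∀ k, ∀ y ∈ C k, ‖y‖ ≤ ε k) : ⋂ k, latSet σ (C k) = ∅ := by
  rw [Set.eq_empty_iff_forall_notMem]; intro x hx; obtain ⟨g, rfl⟩ := exists_rep x
  obtain ⟨η, hη, h⟩ := exists_le_norm_lat (K := {((σ g : G) : X)}) isCompact_singleton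
  obtain ⟨k, hk⟩ := (hε.eventually (gt_mem_nhds hη)).exists
  obtain ⟨v, hv, hvC⟩ := exists_lat_of_mem_latSet hσ (mem_iInter.1 hx k); linarith [h _ rfl v hv, hC k _ hvC]

lemma gSL_eq (t : ℝ) : ∃ h, gSL t = diagG ![exp (2 * t), exp (-t), exp (-t)] h := ⟨by simp [← exp_add]; ring_nf, rfl⟩

lemma lat_gSL (t : ℝ) (g : G) (v : Fin 3 → ℤ) : lat (gSL t * g) v 0 = exp (2 * t) * lat g v 0 ∧
    lat (gSL t * g) v 1 = exp (-t) * lat g v 1 ∧ lat (gSL t * g) v 2 = exp (-t) * lat g v 2 := by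
  obtain ⟨h, e⟩ := gSL_eq t; rw [e]; exact ⟨lat_diagG _ h g v 0, lat_diagG _ h g v 1, lat_diagG _ h g v 2⟩

lemma dlat_gSL (t : ℝ) (g : G) (v : Fin 3 → ℤ) : dlat (gSL t * g) v 0 = exp (-(2 * t)) * dlat g v 0 ∧
    dlat (gSL t * g) v 1 = exp t * dlat g v 1 ∧ dlat (gSL t * g) v 2 = exp t * dlat g v 2 := by
  obtain ⟨h, e⟩ := gSL_eq t; rw [e]; have e2 : exp t = (exp (-t))⁻¹ := by rw [exp_neg, inv_inv]
  have e3 : exp (-(2 * t)) = (exp (2 * t))⁻¹ := exp_neg _; rw [e2, e3]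
  exact ⟨dlat_diagG _ h g v 0, dlat_diagG _ h g v 1, dlat_diagG _ h g v 2⟩

lemma gSL_smul_rep {t : ℝ} {x : X} {g : G} (h : (g : X) = gSL t • x) :
    (((gSL t)⁻¹ * g : G) : X) = x ∧ g = gSL t * ((gSL t)⁻¹ * g) :=
  ⟨by rw [← smul_mk, h, inv_smul_smul], by group⟩

lemma tendsto_mul_exp_neg (m : ℝ) : Tendsto (fun k : ℕ => m * exp (-k)) atTop (𝓝 0) := by
  have h := (Real.tendsto_exp_neg_atTop_nhds_zero.comp tendsto_natCast_atTop_atTop).const_mul m; rwa [mul_zero] at h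

/-- Almost every point is irrational for a measure invariant under the diagonal flow. -/
theorem ae_irrationalPt {μ : Measure X} [IsProbabilityMeasure μ] (hA : ∀ t, gSL t ∈ stab μ) :
    ∀ᵐ x ∂μ, IrrationalPt x := by
  have hexp : ∀ k : ℕ, exp (-((k + 1 : ℕ) : ℝ)) = exp (-k) * exp (-1) := fun k => by
    rw [← exp_add]; congr 1; push_cast; ring
  have hexp1 : exp (-1) * exp 1 = 1 := by rw [← exp_add]; simp
  have hexpk : ∀ {m : ℝ}, 0 ≤ m → ∀ {j k : ℕ}, j ≤ k → m * exp (-(k : ℝ)) ≤ m * exp (-(j : ℝ)) :=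
    fun hm j k hjk => mul_le_mul_of_nonneg_left (exp_le_exp.2 (neg_le_neg (by exact_mod_cast hjk))) hm
  have hmul : ∀ {x m : ℝ} (k : ℕ), exp 1 * x ≤ m * exp (-k) → x ≤ m * exp (-((k + 1 : ℕ) : ℝ)) := fun {x m} k h => by
    rw [hexp]; have := mul_le_mul_of_nonneg_left h (exp_pos (-1)).le; rw [← mul_assoc, hexp1, one_mul] at this; linarith
  -- rational planes
  have hplane : ∀ m : ℕ, μ (latSet tinv {y | y 0 = 0 ∧ ‖y‖ ≤ m}) = 0 := fun m => by
    have := measure_zero_of_scaling (hA 1) (E := fun k => latSet tinv {y | y 0 = 0 ∧ ‖y‖ ≤ m * exp (-k)})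
      (fun k => measurableSet_latSet continuous_tinv ((isClosed_eq (continuous_apply 0) continuous_const).inter
        (isClosed_le continuous_norm continuous_const)))
      (fun j k hjk => latSet_mono fun y hy => ⟨hy.1, hy.2.trans (hexpk (Nat.cast_nonneg m) hjk)⟩) (fun k x => ?_)
      (by rw [iInter_latSet_eq_empty (Or.inr rfl) (tendsto_mul_exp_neg m) fun k y hy => hy.2]; exact measure_empty)
    · simpa using this
    · rintro ⟨g, hg, v, hv, h0, hn⟩
      obtain ⟨h1, h2⟩ := gSL_smul_rep hg; rw [h2, ← dlat_eq] at h0 hn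
      obtain ⟨d0, d1, d2⟩ := dlat_gSL 1 ((gSL 1)⁻¹ * g) v; rw [d0] at h0
      have h0' := (mul_eq_zero.1 h0).resolve_left (exp_pos _).ne'
      refine ⟨_, h1, v, hv, h0', (pi_norm_le_iff_of_nonneg (by positivity)).2 fun i => ?_⟩; rw [← dlat_eq, norm_eq_abs]
      have hb : ∀ i, |dlat (gSL 1 * ((gSL 1)⁻¹ * g)) v i| ≤ m * exp (-k) := fun i =>
        (norm_le_pi_norm (dlat (gSL 1 * ((gSL 1)⁻¹ * g)) v) i).trans hn
      have b1 := hb 1; have b2 := hb 2; rw [d1, abs_mul, abs_of_pos (exp_pos _)] at b1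
      rw [d2, abs_mul, abs_of_pos (exp_pos _)] at b2
      rcases fin3 i with rfl|rfl|rfl
      · rw [h0', abs_zero]; positivity
      · exact hmul k b1
      · exact hmul k b2
  -- rational vectors on the third axis
  have hline : ∀ m : ℕ, μ (latSet id {y | (y 0 = 0 ∧ y 1 = 0) ∧ ‖y‖ ≤ m}) = 0 := fun m => by
    have := measure_zero_of_scaling (hA (-1)) (E := fun k => latSet id {y | (y 0 = 0 ∧ y 1 = 0) ∧ ‖y‖ ≤ m * exp (-k)})
      (fun k => measurableSet_latSet continuous_id (((isClosed_eq (continuous_apply 0) continuous_const).inter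
        (isClosed_eq (continuous_apply 1) continuous_const)).inter
        (isClosed_le continuous_norm continuous_const)))
      (fun j k hjk => latSet_mono fun y hy => ⟨hy.1, hy.2.trans (hexpk (Nat.cast_nonneg m) hjk)⟩) (fun k x => ?_)
      (by rw [iInter_latSet_eq_empty (Or.inl rfl) (tendsto_mul_exp_neg m) fun k y hy => hy.2]; exact measure_empty)
    · simpa using this
    · rintro ⟨g, hg, v, hv, ⟨h0, h01⟩, hn⟩
      obtain ⟨h1, h2⟩ := gSL_smul_rep hg; rw [id, h2] at h0 h01 hn
      obtain ⟨d0, d1, d2⟩ := lat_gSL (-1) ((gSL (-1))⁻¹ * g) v; rw [d0] at h0; rw [d1] at h01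
      have h0' := (mul_eq_zero.1 h0).resolve_left (exp_pos _).ne'
      have h1' := (mul_eq_zero.1 h01).resolve_left (exp_pos _).ne'
      refine ⟨_, h1, v, hv, ⟨h0', h1'⟩, (pi_norm_le_iff_of_nonneg (by positivity)).2 fun i => ?_⟩; rw [id, norm_eq_abs]
      have b2 : |lat (gSL (-1) * ((gSL (-1))⁻¹ * g)) v 2| ≤ m * exp (-k) :=
        (norm_le_pi_norm (lat (gSL (-1) * ((gSL (-1))⁻¹ * g)) v) 2).trans hn
      rw [d2, abs_mul, abs_of_pos (exp_pos _), neg_neg] at b2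
      rcases fin3 i with rfl|rfl|rfl
      · rw [h0', abs_zero]; positivity
      · rw [h1', abs_zero]; positivity
      · exact hmul k b2
  -- rational vectors in the coordinate plane
  have hvec : ∀ m : ℕ, μ (latSet id {y | y 1 = 0 ∧ |y 0| ≤ m}) = 0 := fun m => by
    have := measure_zero_of_scaling (hA 1) (E := fun k => latSet id {y | y 1 = 0 ∧ |y 0| ≤ m * exp (-k)})
      (fun k => measurableSet_latSet continuous_id ((isClosed_eq (continuous_apply 1) continuous_const).inter
        (isClosed_le (continuous_apply 0).abs continuous_const)))
      (fun j k hjk => latSet_mono fun y hy => ⟨hy.1, hy.2.trans (hexpk (Nat.cast_nonneg m) hjk)⟩) (fun k x => ?_) ?_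
    · simpa using this
    · rintro ⟨g, hg, v, hv, h0, hn⟩
      obtain ⟨h1, h2⟩ := gSL_smul_rep hg; rw [id, h2] at h0 hn; obtain ⟨d0, d1, d2⟩ := lat_gSL 1 ((gSL 1)⁻¹ * g) v
      rw [d1] at h0; refine ⟨_, h1, v, hv, (mul_eq_zero.1 h0).resolve_left (exp_pos _).ne', ?_⟩
      rw [d0, abs_mul, abs_of_pos (exp_pos _)] at hn
      refine hmul k (le_trans (mul_le_mul_of_nonneg_right (exp_le_exp.2 (by norm_num)) (abs_nonneg _)) hn)
    · refine measure_mono_null (t := (⋃ m : ℕ, latSet tinv {y | y 0 = 0 ∧ ‖y‖ ≤ m}) ∪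
        ⋃ m : ℕ, latSet id {y | (y 0 = 0 ∧ y 1 = 0) ∧ ‖y‖ ≤ m}) (fun x hx => ?_)
        (measure_union_null (measure_iUnion_null hplane) (measure_iUnion_null hline))
      obtain ⟨g, rfl⟩ := exists_rep x; by_contra hcon; simp only [Set.mem_union, mem_iUnion, not_or, not_exists] at hcon
      have n1 : ∀ w, w ≠ 0 → dlat g w 0 ≠ 0 := fun w hw h0 => by
        obtain ⟨m, hm⟩ := exists_nat_ge ‖dlat g w‖; exact hcon.1 m ⟨g, rfl, w, hw, h0, hm⟩
      have n2 : ∀ v, v ≠ 0 → lat g v 1 = 0 → lat g v 0 ≠ 0 := fun v hv h1 h0 => by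
        obtain ⟨m, hm⟩ := exists_nat_ge ‖lat g v‖; exact hcon.2 m ⟨g, rfl, v, hv, ⟨h0, h1⟩, hm⟩
      have hex := fun k => exists_lat_of_mem_latSet (Or.inl rfl) (mem_iInter.1 hx k); obtain ⟨v, hv, hv1, -⟩ := hex 0
      have hv0 := n2 v hv hv1; obtain ⟨j, hj⟩ := Function.ne_iff.1 hv
      have hj' : (0 : ℝ) < |(v j : ℝ)| := abs_pos.2 (by exact_mod_cast hj)
      obtain ⟨k, hk⟩ := ((tendsto_mul_exp_neg m).eventually (gt_mem_nhds (div_pos (abs_pos.2 hv0) hj'))).exists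
      obtain ⟨u, hu, hu1, hu0⟩ := hex k; rw [id] at hu1 hu0
      have hcr : cr v u = 0 := by
        by_contra h0; refine n1 _ h0 ?_; rw [dlat_eq, ← lat_cross]; rw [id] at hv1; simp [cr, hv1, hu1]
      obtain ⟨l, hl⟩ := exists_smul_of_cr_eq_zero hv hcr
      have hl0 : (u j : ℝ) = l * v j := by have h1 := hl 1; have h2 := congrFun h1 j; simpa [lat] using h2
      have hlne : l ≠ 0 := fun h0 => hu (lat_eq_zero (g := g) (by rw [hl, h0, zero_smul]))
      have huj : u j ≠ 0 := fun h0 => by rw [h0] at hl0; simp [hlne] at hl0; exact hj hl0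
      have h1 : (1 : ℝ) ≤ |l| * |(v j : ℝ)| := by rw [← abs_mul, ← hl0]; exact_mod_cast Int.one_le_abs huj
      rw [hl, Pi.smul_apply, smul_eq_mul, abs_mul] at hu0; have h2 := hu0.trans_lt hk; rw [lt_div_iff₀ hj'] at h2
      have h3 := mul_le_mul_of_nonneg_right h1 (abs_nonneg (lat g v 0)); linarith
  refine measure_mono_null (t := (⋃ m : ℕ, latSet tinv {y | y 0 = 0 ∧ ‖y‖ ≤ m}) ∪
    ⋃ m : ℕ, latSet id {y | y 1 = 0 ∧ |y 0| ≤ m}) (fun x hx => ?_)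
    (measure_union_null (measure_iUnion_null hplane) (measure_iUnion_null hvec))
  by_contra hcon; refine hx (irrationalPt_iff.2 fun g hg => ⟨fun v hv h1 => hcon ?_, fun w hw h0 => hcon ?_⟩)
  · obtain ⟨m, hm⟩ := exists_nat_ge |lat g v 0|
    exact Or.inr (mem_iUnion.2 ⟨m, g, hg, v, hv, h1, hm⟩)
  · obtain ⟨m, hm⟩ := exists_nat_ge ‖dlat g w‖; exact Or.inl (mem_iUnion.2 ⟨m, g, hg, w, hw, h0, hm⟩)

open Matrix.SpecialLinearGroup (diag2n diag2n_coe)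

/-- The elementary matrix `1 + r E_{ij}` in `G`. -/
abbrev tv {i j : Fin 3} (hij : i ≠ j) (r : ℝ) : G := SpecialLinearGroup.transvection hij r

/-- A subgroup of `G` with the closure property behind the Mautner phenomenon. -/
def IsMautner (S : Subgroup G) : Prop :=
  ∀ (a h b : ℕ → G) (k : G), (∀ n, a n ∈ S) → (∀ n, b n ∈ S) → Tendsto h atTop (𝓝 1) →
    Tendsto (fun n => a n * h n * b n) atTop (𝓝 k) → k ∈ S

lemma transvection_apply {i j : Fin 3} (hij : i ≠ j) (r : ℝ) (k l : Fin 3) :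
    tv hij r k l = (1 : M₃) k l + single i j r k l := rfl

lemma continuous_transvection {i j : Fin 3} (hij : i ≠ j) : Continuous fun r : ℝ => (tv hij r : G) := by
  refine continuous_of_entries fun k l => ?_; simp only [transvection_apply, single_apply]
  split_ifs <;> fun_prop

lemma transvection_conj {i j : Fin 3} (hij : i ≠ j) {a s : ℝ} (ha : a ≠ 0) (hs : s ≠ 0) :
    (tv hij.symm ((a⁻¹ - 1) / s) : G) * tv hij s * tv hij.symm ((a - 1) / s) = diag2n hij a ha * tv hij (s / a) := by
  apply G_ext; intro k l; rw [mul_entry, mul_entry, mul_entry, mul_entry, mul_entry]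
  simp only [transvection_apply, diag2n_coe, single_apply, diagonal_apply, one_apply]
  rcases fin3 i with rfl|rfl|rfl <;> rcases fin3 j with rfl|rfl|rfl <;> first | exact absurd rfl hij | skip
  all_goals rcases fin3 k with rfl|rfl|rfl <;> rcases fin3 l with rfl|rfl|rfl <;> simp
  all_goals field_simp
  all_goals ring

lemma diag2n_conj {i j : Fin 3} (hij : i ≠ j) {a : ℝ} (ha : a ≠ 0) (s : ℝ) :
    (diag2n hij a ha * tv hij s : G) = tv hij (a ^ 2 * s) * diag2n hij a ha := by
  apply G_ext; intro k l; rw [mul_entry, mul_entry]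
  simp only [transvection_apply, diag2n_coe, single_apply, diagonal_apply, one_apply]
  rcases fin3 i with rfl|rfl|rfl <;> rcases fin3 j with rfl|rfl|rfl <;> first | exact absurd rfl hij | skip
  all_goals rcases fin3 k with rfl|rfl|rfl <;> rcases fin3 l with rfl|rfl|rfl <;> simp
  all_goals field_simp

lemma transvection_comm {i j k : Fin 3} (hij : i ≠ j) (hjk : j ≠ k) (hik : i ≠ k) (r : ℝ) : (tv hik r : G) =
      tv hij 1 * tv hjk r * tv hij (-1) * tv hjk (-r) := by
  apply Subtype.ext
  change (1 + single i k r : M₃) =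
    (1 + single i j 1) * (1 + single j k r) * (1 + single i j (-1)) * (1 + single j k (-r))
  simp [mul_add, add_mul, hij.symm, hjk.symm, hik.symm, ← single_neg]
  abel

lemma IsMautner.opposite {S : Subgroup G} (hS : IsMautner S) {i j : Fin 3} (hij : i ≠ j) (h : ∀ r, tv hij.symm r ∈ S) :
    (∀ a (ha : a ≠ 0), diag2n hij a ha ∈ S) ∧ ∀ r, tv hij r ∈ S := by
  have h0 : Tendsto (fun n : ℕ => (1 / ((n : ℝ) + 1))) atTop (𝓝 0) := tendsto_one_div_add_atTop_nhds_zero_nat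
  have hT : ∀ {s : ℕ → ℝ}, Tendsto s atTop (𝓝 0) → Tendsto (fun n => (tv hij (s n) : G)) atTop (𝓝 1) := by
    intro s hs; have := ((continuous_transvection hij).tendsto 0).comp hs
    rwa [tv, SpecialLinearGroup.transvection_coeff_zero] at this
  have hD : ∀ a (ha : a ≠ 0), diag2n hij a ha ∈ S := by
    intro a ha
    refine hS (fun n => tv hij.symm ((a⁻¹ - 1) / (1 / ((n : ℝ) + 1)))) (fun n => tv hij (1 / ((n : ℝ) + 1)))
      (fun n => tv hij.symm ((a - 1) / (1 / ((n : ℝ) + 1)))) _ (fun n => h _) (fun n => h _) (hT h0) ?_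
    have : Tendsto (fun n : ℕ => (diag2n hij a ha : G) * tv hij (1 / ((n : ℝ) + 1) / a)) atTop
        (𝓝 (diag2n hij a ha * 1)) := (hT (by simpa using h0.div_const a)).const_mul _
    rw [mul_one] at this; refine this.congr fun n => (transvection_conj hij ha (by positivity)).symm
  refine ⟨hD, fun r => ?_⟩
  refine hS (fun n => diag2n hij ((2 : ℝ) ^ n) (by positivity)) (fun n => tv hij (r * (1 / 4) ^ n))
    (fun n => (diag2n hij ((2 : ℝ) ^ n) (by positivity))⁻¹) _ (fun n => hD _ _) (fun n => S.inv_mem (hD _ _)) (hT ?_) ?_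
  · simpa using (_root_.tendsto_pow_atTop_nhds_zero_of_lt_one (by norm_num : (0 : ℝ) ≤ 1 / 4) (by norm_num)).const_mul r
  · refine tendsto_const_nhds.congr fun n => ?_; rw [diag2n_conj, mul_inv_cancel_right]; congr 1
    rw [← pow_mul, mul_comm n, pow_mul, mul_left_comm, ← mul_pow]; norm_num

lemma IsMautner.eq_top {S : Subgroup G} (hS : IsMautner S) (h1 : ∀ r, tv (one_ne_zero : (1 : Fin 3) ≠ 0) r ∈ S)
    (h2 : (∀ r, tv (by decide : (2 : Fin 3) ≠ 0) r ∈ S) ∨ ∀ r, tv (by decide : (1 : Fin 3) ≠ 2) r ∈ S) : S = ⊤ := by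
  have comm : ∀ {i j k : Fin 3} (hij : i ≠ j) (hjk : j ≠ k) (hik : i ≠ k),
      (∀ r, tv hij r ∈ S) → (∀ r, tv hjk r ∈ S) → ∀ r, tv hik r ∈ S := by
    intro i j k hij hjk hik a b r; rw [transvection_comm hij hjk hik]
    exact S.mul_mem (S.mul_mem (S.mul_mem (a _) (b _)) (a _)) (b _)
  have h3 := (hS.opposite (zero_ne_one : (0 : Fin 3) ≠ 1) h1).2
  have all : ∀ (i j : Fin 3) (hij : i ≠ j) (r : ℝ), tv hij r ∈ S := by
    have d20 : (2 : Fin 3) ≠ 0 := by decide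
    have d12 : (1 : Fin 3) ≠ 2 := by decide
    have key : (∀ r, tv d20 r ∈ S) ∧ (∀ r, tv d20.symm r ∈ S) ∧ (∀ r, tv d12 r ∈ S) ∧ (∀ r, tv d12.symm r ∈ S) := by
      rcases h2 with h2 | h2
      · have h4 := (hS.opposite d20.symm h2).2; exact ⟨h2, h4, comm _ _ _ h1 h4, comm _ _ _ h2 h3⟩
      · have h4 := (hS.opposite d12.symm h2).2; exact ⟨comm _ _ _ h4 h1, comm _ _ _ h3 h2, h2, h4⟩
    intro i j hij
    rcases fin3 i with rfl|rfl|rfl <;> rcases fin3 j with rfl|rfl|rfl <;> first | exact absurd rfl hij | skip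
    exacts [h3, key.2.1, h1, key.2.2.1, key.1, key.2.2.2]
  refine (Subgroup.eq_top_iff' S).2 fun g => SpecialLinearGroup.diagonal_transvection_induction' (· ∈ S) g
    (fun i j hij c hc => (hS.opposite hij (all _ _ _)).1 c hc) all fun _ _ => S.mul_mem

variable {μX : Measure X} [IsProbabilityMeasure μX] [SMulInvariantMeasure G X μX]

/-- The isotropy group of a vector of `L²(X)`. -/
def fixer (ψ : Lp ℝ 2 μX) : Subgroup G where
  carrier := {g | DomMulAct.mk g • ψ = ψ}
  one_mem' := by simp
  mul_mem' {a b} ha hb := by simp only [mem_ofPred_eq, DomMulAct.mk_mul, mul_smul] at *; rw [ha, hb]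
  inv_mem' {a} ha := by simp only [mem_ofPred_eq, DomMulAct.mk_inv] at *; rw [inv_smul_eq_iff, ha]

instance : Fact ((2 : ℝ≥0∞) ≠ ∞) := ⟨ENNReal.ofNat_ne_top⟩

lemma isMautner_fixer (ψ : Lp ℝ 2 μX) : IsMautner (fixer ψ) := by
  intro a h b k ha hb hh hk
  have hc : Continuous fun g : G => DomMulAct.mk g • ψ :=
    (continuous_id.smul continuous_const : Continuous fun g : Gᵈᵐᵃ => g • ψ).comp DomMulAct.continuous_mk
  have h1 : Tendsto (fun n => dist (DomMulAct.mk (a n * h n * b n) • ψ) ψ) atTop (𝓝 (dist (DomMulAct.mk k • ψ) ψ)) :=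
    ((hc.tendsto k).comp hk).dist tendsto_const_nhds
  have h2 : Tendsto (fun n => dist (DomMulAct.mk (h n) • ψ) ψ) atTop (𝓝 (dist (DomMulAct.mk (1 : G) • ψ) ψ)) :=
    ((hc.tendsto 1).comp hh).dist tendsto_const_nhds
  have e : ∀ n, dist (DomMulAct.mk (a n * h n * b n) • ψ) ψ = dist (DomMulAct.mk (h n) • ψ) ψ := by
    intro n; have h3 : DomMulAct.mk (a n) • ψ = ψ := ha n; have h4 : DomMulAct.mk (b n) • ψ = ψ := hb n
    rw [DomMulAct.mk_mul, DomMulAct.mk_mul, mul_smul, mul_smul, h3]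
    conv_lhs => rw [← h4, DomMulAct.dist_smul_Lp, h4]
  simp only [e] at h1; have := tendsto_nhds_unique h1 h2; rw [DomMulAct.mk_one, one_smul, dist_self] at this
  exact dist_eq_zero.1 this

/-- A right-invariant measure on `G`. -/
def rhaar : Measure G := (Measure.haar : Measure G).inv

instance : Measure.IsMulRightInvariant rhaar := by unfold rhaar; infer_instance
instance : SigmaFinite rhaar := by unfold rhaar; infer_instance
instance : IsFiniteMeasureOnCompacts rhaar := by unfold rhaar; infer_instance
instance : Measure.IsOpenPosMeasure rhaar := by unfold rhaar; infer_instance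

lemma null_orbit_iff {E : Set X} (hE : MeasurableSet E) (x : X) : rhaar {g : G | g • x ∈ E} = 0 ↔ μX E = 0 := by
  have hm : MeasurableSet {p : G × X | p.1 • p.2 ∈ E} := by
    have : Measurable fun p : G × X => p.1 • p.2 := (continuous_smul (M := G) (X := X)).measurable; exact this hE
  have key : ∀ y z : X, rhaar {g : G | g • y ∈ E} = rhaar {g : G | g • z ∈ E} := by
    intro y z; obtain ⟨h, rfl⟩ := MulAction.exists_smul_eq G y z; simp only [smul_smul]
    exact (measure_preimage_mul_right rhaar h {g : G | g • y ∈ E}).symm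
  have h1 : (rhaar.prod μX) {p : G × X | p.1 • p.2 ∈ E} = 0 ↔ μX E = 0 := by
    rw [Measure.prod_apply hm]
    have : ∀ g : G, μX (Prod.mk g ⁻¹' {p : G × X | p.1 • p.2 ∈ E}) = μX E := fun g =>
      measure_preimage_smul_of_nullMeasurableSet hE.nullMeasurableSet g
    simp only [this, lintegral_const, mul_eq_zero, Measure.measure_univ_eq_zero]; exact or_iff_left (NeZero.ne _)
  rw [← h1, Measure.prod_apply_symm hm]
  have : ∀ y : X, rhaar ((fun g => (g, y)) ⁻¹' {p : G × X | p.1 • p.2 ∈ E}) = rhaar {g : G | g • x ∈ E} :=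
    fun y => key y x
  simp only [this, lintegral_const, measure_univ, mul_one]

lemma ae_const_of_fixer {ψ : Lp ℝ 2 μX} (h : fixer ψ = ⊤) : ∃ c : ℝ, ∀ᵐ x ∂μX, ψ x = c := by
  have hψ : Measurable ψ := (Lp.stronglyMeasurable ψ).measurable
  have h1 : ∀ g : G, ∀ᵐ x ∂μX, ψ (g • x) = ψ x := by
    intro g; have hg : DomMulAct.mk g • ψ = ψ := (h ▸ Subgroup.mem_top g : g ∈ fixer ψ)
    have := DomMulAct.smul_Lp_ae_eq (DomMulAct.mk g) ψ; rw [hg] at this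
    filter_upwards [this] with x hx
    exact hx.symm
  have hm : MeasurableSet {p : G × X | ψ (p.1 • p.2) = ψ p.2} :=
    measurableSet_eq_fun (hψ.comp (continuous_smul (M := G) (X := X)).measurable) (hψ.comp measurable_snd)
  have h2 : ∀ᵐ p ∂(rhaar.prod μX), ψ (p.1 • p.2) = ψ p.2 := (Measure.ae_prod_iff_ae_ae hm).2 (.of_forall h1)
  have h3 : ∀ᵐ x ∂μX, ∀ᵐ g ∂rhaar, ψ (g • x) = ψ x := by
    rw [← Measure.prod_swap] at h2; have := (ae_map_iff measurable_swap.aemeasurable hm).1 h2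
    exact Measure.ae_ae_of_ae_prod this
  obtain ⟨x, hx⟩ := h3.exists; refine ⟨ψ x, ?_⟩
  have hE : MeasurableSet {y | ψ y ≠ ψ x} := (measurableSet_eq_fun hψ measurable_const).compl
  exact (null_orbit_iff hE x).1 hx

/-- The powers of `c` contract two of the root groups that generate `G` together with their opposites. -/
def IsMixingElt (c : G) : Prop :=
  (∀ r, Tendsto (fun n : ℕ => c ^ n * tv (one_ne_zero : (1 : Fin 3) ≠ 0) r * (c ^ n)⁻¹) atTop (𝓝 1)) ∧
    ((∀ r, Tendsto (fun n : ℕ => c ^ n * tv (by decide : (2 : Fin 3) ≠ 0) r * (c ^ n)⁻¹) atTop (𝓝 1)) ∨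
      ∀ r, Tendsto (fun n : ℕ => c ^ n * tv (by decide : (1 : Fin 3) ≠ 2) r * (c ^ n)⁻¹) atTop (𝓝 1))

/-- The mixing property of a sequence of powers, on `L²`. -/
theorem tendsto_inner_smul {c : G} (hc : IsMixingElt c) (F φ : Lp ℝ 2 μX) :
    Tendsto (fun n : ℕ => inner ℝ (DomMulAct.mk (c ^ n) • F) φ) atTop (𝓝 ((∫ x, F x ∂μX) * ∫ x, φ x ∂μX)) := by
  obtain ⟨h1, h2⟩ := hc; rw [tendsto_iff_ultrafilter]; intro U hU
  set y : ℕ → WeakDual ℝ (Lp ℝ 2 μX) := fun n =>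
    StrongDual.toWeakDual (InnerProductSpace.toDual ℝ _ (DomMulAct.mk (c ^ n) • F)) with hy
  obtain ⟨ℓ, -, hℓ⟩ := (WeakDual.isCompact_closedBall (0 : StrongDual ℝ (Lp ℝ 2 μX)) ‖F‖).ultrafilter_le_nhds
    (U.map y) (by
      rw [le_principal_iff]; refine Filter.mem_map.2 (univ_mem' fun n => ?_)
      simp [hy, DomMulAct.norm_smul_Lp])
  set ψ : Lp ℝ 2 μX := (InnerProductSpace.toDual ℝ _).symm (WeakDual.toStrongDual ℓ)
  have lim : ∀ φ : Lp ℝ 2 μX, Tendsto (fun n : ℕ => inner ℝ (DomMulAct.mk (c ^ n) • F) φ) U (𝓝 (inner ℝ ψ φ)) := by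
    intro φ; have := ((WeakDual.eval_continuous φ).tendsto ℓ).comp hℓ
    have e : inner ℝ ψ φ = ℓ φ := InnerProductSpace.toDual_symm_apply; rw [e]; exact this
  have fix : ∀ k : G, Tendsto (fun n : ℕ => c ^ n * k * (c ^ n)⁻¹) atTop (𝓝 1) → k ∈ fixer ψ := by
    intro k hk
    have isom : ∀ (g : G) (u v : Lp ℝ 2 μX), inner ℝ (DomMulAct.mk g • u) (DomMulAct.mk g • v) = inner ℝ u v := by
      intro g u v; have n1 := @norm_add_sq_real (Lp ℝ 2 μX) _ _ u v
      have n2 := @norm_add_sq_real (Lp ℝ 2 μX) _ _ (DomMulAct.mk g • u) (DomMulAct.mk g • v)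
      rw [← DomMulAct.smul_Lp_add, DomMulAct.norm_smul_Lp, DomMulAct.norm_smul_Lp, DomMulAct.norm_smul_Lp] at n2
      linarith
    refine ext_inner_right ℝ fun φ => ?_
    refine tendsto_nhds_unique (f := fun n : ℕ => inner ℝ (DomMulAct.mk (c ^ n) • F) (DomMulAct.mk k⁻¹ • φ)) (l := U) ?_ ?_
    · rw [← isom k⁻¹, smul_smul, ← DomMulAct.mk_mul, mul_inv_cancel, DomMulAct.mk_one, one_smul]; exact lim _
    · have hc : Continuous fun g : G => DomMulAct.mk g • F :=
        (continuous_id.smul continuous_const : Continuous fun g : Gᵈᵐᵃ => g • F).comp DomMulAct.continuous_mk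
      have d : Tendsto (fun n => ‖DomMulAct.mk (c ^ n * k * (c ^ n)⁻¹) • F - F‖ * ‖φ‖) U (𝓝 0) := by
        have := (((hc.tendsto 1).comp hk).sub_const F).norm.mul_const ‖φ‖
        simp only [DomMulAct.mk_one, one_smul, sub_self, norm_zero, zero_mul] at this; exact this.mono_left hU
      have := (squeeze_zero_norm (f := fun n => inner ℝ (DomMulAct.mk (c ^ n * k) • F) φ -
        inner ℝ (DomMulAct.mk (c ^ n) • F) φ) (fun n => ?_) d).add (lim φ)
      · rw [zero_add] at this; refine this.congr fun n => ?_
        rw [sub_add_cancel, ← isom k (DomMulAct.mk (c ^ n) • F), smul_smul, smul_smul, ← DomMulAct.mk_mul,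
          ← DomMulAct.mk_mul, inv_mul_cancel, DomMulAct.mk_one, one_smul]
      · rw [← inner_sub_left]
        refine (norm_inner_le_norm _ _).trans (mul_le_mul_of_nonneg_right (le_of_eq ?_) (norm_nonneg _))
        have e : c ^ n * k = (c ^ n * k * (c ^ n)⁻¹) * c ^ n := by group
        conv_lhs => rw [e, DomMulAct.mk_mul, mul_smul, ← DomMulAct.smul_Lp_sub, DomMulAct.norm_smul_Lp]
  obtain ⟨b, hb⟩ := ae_const_of_fixer ((isMautner_fixer ψ).eq_top (fun r => fix _ (h1 r))
    (h2.imp (fun h r => fix _ (h r)) fun h r => fix _ (h r)))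
  have val : ∀ φ : Lp ℝ 2 μX, inner ℝ ψ φ = b * ∫ x, φ x ∂μX := by
    intro φ; rw [L2.inner_def, ← integral_const_mul]; refine integral_congr_ae ?_
    filter_upwards [hb] with x hx
    rw [hx]; simp [mul_comm]
  have hb' : b = ∫ x, F x ∂μX := by
    set one : Lp ℝ 2 μX := (memLp_const (1 : ℝ)).toLp _; have h1 : ∀ᵐ x ∂μX, one x = 1 := MemLp.coeFn_toLp _
    have h2 := lim one; rw [val, integral_congr_ae h1] at h2
    simp only [integral_const, probReal_univ, smul_eq_mul, mul_one] at h2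
    refine tendsto_nhds_unique h2 (tendsto_const_nhds.congr fun n => ?_); rw [L2.inner_def]
    have h3 : ∫ x, F (c ^ n • x) ∂μX = ∫ x, F x ∂μX :=
      (measurePreserving_smul (c ^ n) μX).integral_comp (Homeomorph.smul (c ^ n)).measurableEmbedding _
    rw [← h3]; refine integral_congr_ae ?_
    filter_upwards [h1, DomMulAct.smul_Lp_ae_eq (DomMulAct.mk (c ^ n)) F] with x hx hx'
    rw [hx, hx']; simp
  have := lim φ; rwa [val, hb'] at this
theorem tendsto_integral_smul_of_absolutelyContinuous {c : G} (hc : IsMixingElt c) {f : X → ℝ}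
    (hf : Continuous f) (hs : HasCompactSupport f) {η : Measure X} [IsFiniteMeasure η] (hη : η ≪ μX) :
    Tendsto (fun n : ℕ => ∫ x, f (c ^ n • x) ∂η) atTop (𝓝 ((∫ x, f x ∂μX) * η.real Set.univ)) := by
  obtain ⟨M, hM0, hM⟩ := exists_bound hf hs; set ρ : X → ℝ := fun x => (η.rnDeriv μX x).toReal with hρ
  have hρi : Integrable ρ μX := Measure.integrable_toReal_rnDeriv
  have hdens : ∀ u : X → ℝ, ∫ x, u x ∂η = ∫ x, u x * ρ x ∂μX := fun u => by
    rw [← integral_rnDeriv_smul hη]; simp [hρ, mul_comm]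
  have hηu : η.real Set.univ = ∫ x, ρ x ∂μX := by simpa using hdens fun _ => 1
  rw [Metric.tendsto_atTop]; intro ε hε
  obtain ⟨φ, hφs, hφ, hφc, hφi⟩ := hρi.exists_hasCompactSupport_integral_sub_le
    (show 0 < ε / (4 * (M + 1)) by positivity)
  have L : ∀ u : X → ℝ, Continuous u → HasCompactSupport u → MemLp u 2 μX := fun u h1 h2 =>
    h1.memLp_of_hasCompactSupport h2
  have mix := tendsto_inner_smul hc ((L f hf hs).toLp f) ((L φ hφc hφs).toLp φ)
  rw [integral_congr_ae (L f hf hs).coeFn_toLp, integral_congr_ae (L φ hφc hφs).coeFn_toLp] at mix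
  have e : ∀ n : ℕ, inner ℝ (DomMulAct.mk (c ^ n) • (L f hf hs).toLp f) ((L φ hφc hφs).toLp φ) =
      ∫ x, f (c ^ n • x) * φ x ∂μX := by
    intro n; rw [DomMulAct.mk_smul_toLp, L2.inner_def]; refine integral_congr_ae ?_
    filter_upwards [MemLp.coeFn_toLp ((L f hf hs).comp_measurePreserving (measurePreserving_smul (c ^ n) μX)),
      (L φ hφc hφs).coeFn_toLp] with x h1 h2
    rw [h2]; exact (congrArg (fun y : ℝ => inner ℝ y (φ x)) h1).trans (by simp [mul_comm])
  simp only [e] at mix; rw [Metric.tendsto_atTop] at mix; obtain ⟨N, hN⟩ := mix (ε / 2) (by positivity)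
  have close : ∀ u : X → ℝ, Continuous u → (∀ x, |u x| ≤ M) →
      |∫ x, u x * ρ x ∂μX - ∫ x, u x * φ x ∂μX| ≤ ε / 4 := by
    intro u hu hb
    have hi : ∀ v : X → ℝ, Integrable v μX → Integrable (fun x => u x * v x) μX := fun v hv =>
      hv.bdd_mul hu.aestronglyMeasurable (.of_forall hb)
    rw [← integral_sub (hi _ hρi) (hi _ hφi)]
    calc _ ≤ ∫ x, M * ‖ρ x - φ x‖ ∂μX := by
          rw [← norm_eq_abs]
          refine norm_integral_le_of_norm_le (g := fun x => M * ‖ρ x - φ x‖)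
            ((hρi.sub hφi).norm.const_mul M) (.of_forall fun x => ?_)
          rw [← mul_sub, norm_mul]; exact mul_le_mul_of_nonneg_right (hb x) (norm_nonneg _)
      _ ≤ M * (ε / (4 * (M + 1))) := by rw [integral_const_mul]; exact mul_le_mul_of_nonneg_left hφ hM0.le
      _ ≤ ε / 4 := by rw [← mul_div_assoc, div_le_div_iff₀ (by positivity) (by norm_num)]; nlinarith
  refine ⟨N, fun n hn => ?_⟩
  have c1 := close (fun x => f (c ^ n • x)) (hf.comp (continuous_const_smul _)) fun x => hM _
  have c2 := close (fun _ => ∫ x, f x ∂μX) continuous_const fun _ => by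
    simpa using norm_integral_le_of_norm_le_const (μ := μX) (f := f) (.of_forall hM)
  simp only [integral_const_mul] at c2; have c3 := hN n hn; rw [hdens, hηu]; rw [Real.dist_eq] at c3 ⊢
  rw [abs_le] at c1 c2; rw [abs_lt] at c3 ⊢; constructor <;> linarith

/-! ### Measures invariant under a horospherical group -/

open scoped Pointwise in
lemma exists_smoothing {N : Set G} (hN : N ∈ 𝓝 (1 : G)) : ∃ κ : Measure G, IsProbabilityMeasure κ ∧
    (∀ᵐ g ∂κ, g ∈ N) ∧ κ ≪ rhaar ∧ ∀ ε > 0, ∀ᶠ h : G in 𝓝 1, ∀ F : G → ℝ, Continuous F → (∀ g, |F g| ≤ 1) →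
      |∫ g, F (g * h) ∂κ - ∫ g, F g ∂κ| ≤ ε := by
  obtain ⟨ψ₀, h1, hcs, hsub, h01⟩ := exists_continuousMap_one_of_isCompact_subset_isOpen
    (isCompact_singleton (x := (1 : G))) isOpen_interior
    (Set.singleton_subset_iff.2 (mem_interior_iff_mem_nhds.2 hN))
  have hB : 0 < ∫ g, ψ₀ g ∂rhaar := ψ₀.continuous.integral_pos_of_hasCompactSupport_nonneg_nonzero hcs
    (fun g => (h01 g).1) (x := 1) (by rw [h1 rfl]; simp)
  set ψ : G → ℝ := fun g => (∫ g, ψ₀ g ∂rhaar)⁻¹ * ψ₀ g with hψ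
  have hψc : Continuous ψ := continuous_const.mul ψ₀.continuous
  have hψ0 : ∀ g, 0 ≤ ψ g := fun g => mul_nonneg (inv_nonneg.2 hB.le) (h01 g).1
  have hψs : HasCompactSupport ψ := HasCompactSupport.mul_left hcs
  have hψi : Integrable ψ rhaar := hψc.integrable_of_hasCompactSupport hψs
  have hnt : ∫ g, ψ g ∂rhaar = 1 := by rw [hψ, integral_const_mul, inv_mul_cancel₀ hB.ne']
  set ρ : G → NNReal := fun g => (ψ g).toNNReal with hρ
  have hρm : Measurable ρ := (continuous_real_toNNReal.comp hψc).measurable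
  set κ : Measure G := rhaar.withDensity fun g => (ρ g : ℝ≥0∞) with hκ
  have hκint : ∀ F : G → ℝ, ∫ g, F g ∂κ = ∫ g, ψ g * F g ∂rhaar := fun F => by
    rw [hκ, integral_withDensity_eq_integral_smul hρm]; refine integral_congr_ae (.of_forall fun g => ?_)
    simp [hρ, NNReal.smul_def, hψ0 g]
  have hP : IsProbabilityMeasure κ := by
    refine ⟨?_⟩; rw [hκ, withDensity_apply _ MeasurableSet.univ, Measure.restrict_univ]
    change ∫⁻ g, ofR (ψ g) ∂rhaar = 1; rw [← ofReal_integral_eq_lintegral_ofReal hψi (.of_forall hψ0), hnt, ofReal_one]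
  have hψN : ∀ g, ψ g ≠ 0 → g ∈ N := fun g hg => interior_subset (hsub (subset_tsupport _ (right_ne_zero_of_mul hg)))
  refine ⟨κ, hP, ?_, withDensity_absolutelyContinuous _ _, fun ε hε => ?_⟩
  · rw [hκ, ae_withDensity_iff hρm.coe_nnreal_ennreal]
    refine .of_forall fun g hg => hψN g fun h0 => hg (by simp [hρ, h0])
  · obtain ⟨C, hC, hC1⟩ := exists_compact_mem_nhds (1 : G); obtain ⟨M, hM⟩ := hψc.bounded_above_of_compact_support hψs
    have hK : IsCompact (tsupport ψ * C) := hψs.isCompact.mul hC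
    have hsupp : ∀ h ∈ C, ∀ g, g ∉ tsupport ψ * C → ψ (g * h⁻¹) = 0 := by
      intro h hh g hg; by_contra hne; exact hg ⟨g * h⁻¹, subset_tsupport _ hne, h, hh, by simp⟩
    have hcont : ContinuousAt (fun h : G => ∫ g, ‖ψ (g * h⁻¹) - ψ g‖ ∂rhaar) 1 := by
      refine continuousAt_of_dominated (bound := (tsupport ψ * C).indicator fun _ => M + M) ?_ ?_ ?_ ?_
      · exact .of_forall fun h => (by fun_prop : Continuous fun g => ‖ψ (g * h⁻¹) - ψ g‖).aestronglyMeasurable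
      · filter_upwards [hC1] with h hh
        refine .of_forall fun g => ?_
        by_cases hg : g ∈ tsupport ψ * C
        · rw [indicator_of_mem hg, norm_norm]; exact (norm_sub_le _ _).trans (add_le_add (hM _) (hM _))
        · rw [indicator_of_notMem hg, hsupp h hh g hg, show ψ g = 0 by simpa using hsupp 1 (mem_of_mem_nhds hC1) g hg]
          simp
      · exact (integrable_indicator_iff hK.isClosed.measurableSet).2 (integrableOn_const hK.measure_lt_top.ne)
      · exact .of_forall fun g => (by fun_prop : Continuous fun h : G => ‖ψ (g * h⁻¹) - ψ g‖).continuousAt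
    have hlim := hcont.tendsto; simp only [inv_one, mul_one, sub_self, norm_zero, integral_zero] at hlim
    filter_upwards [hlim.eventually_lt_const hε] with h hh F hF hF1
    have e : ∫ g, ψ g * F (g * h) ∂rhaar = ∫ g, ψ (g * h⁻¹) * F g ∂rhaar := by
      rw [← integral_mul_right_eq_self (fun g => ψ (g * h⁻¹) * F g) h]; simp
    have i0 : Integrable (fun g => ψ (g * h⁻¹)) rhaar := hψi.comp_mul_right h⁻¹
    have ib : ∀ u : G → ℝ, Integrable u rhaar → Integrable (fun g => u g * F g) rhaar := fun u hu =>
      hu.mul_bdd hF.aestronglyMeasurable (.of_forall hF1)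
    rw [hκint, hκint, e, ← integral_sub (ib _ i0) (ib _ hψi), ← norm_eq_abs]
    refine le_trans (norm_integral_le_of_norm_le (g := fun g => ‖ψ (g * h⁻¹) - ψ g‖) (i0.sub hψi).norm
      (.of_forall fun g => ?_)) hh.le
    rw [← sub_mul, norm_mul]; exact mul_le_of_le_one_right (norm_nonneg _) (hF1 g)

variable {μX : Measure X} [IsProbabilityMeasure μX] [SMulInvariantMeasure G X μX]

theorem eq_of_expanding {c : G} (hc : IsMixingElt c)
    (htight : ∀ δ > 0, ∃ K : Set X, IsCompact K ∧ ∀ n : ℕ, ν {x | (c ^ n)⁻¹ • x ∉ K} ≤ ofR δ)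
    (hdec : ∀ θ > 0, ∀ᶠ g in 𝓝 (1 : G), ∀ n : ℕ, ∃ q ∈ nearOne θ, ∃ v ∈ stab ν, c ^ n * g * (c ^ n)⁻¹ = q * v) :
    ν = μX := by
  refine measure_ext_cc fun f hf hs => ?_; obtain ⟨M, hM0, hM⟩ := exists_bound hf hs
  have key : ∀ ε > 0, |∫ x, f x ∂ν - ∫ x, f x ∂μX| ≤ (2 + 3 * M) * ε := by
    intro ε hε; obtain ⟨θ, hθ, hu⟩ := UnifCont.of_compactSupport hf hs ε hε
    obtain ⟨κ, hκP, hκN, hκac, hκeq⟩ := exists_smoothing (hdec θ hθ); obtain ⟨K, hK, hKν⟩ := htight ε hε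
    set Ψ : ℕ → X → ℝ := fun n y => ∫ g, f (c ^ n • g • y) ∂κ with hΨ
    have hfc : ∀ (n : ℕ) (y : X), Continuous fun g : G => f (c ^ n • g • y) := fun n y =>
      hf.comp ((continuous_const_smul (c ^ n)).comp (continuous_orbitG y))
    have hlim : ∀ y, Tendsto (fun n => Ψ n y) atTop (𝓝 (∫ x, f x ∂μX)) := by
      intro y; have hm : Measurable fun g : G => g • y := (continuous_orbitG y).measurable
      have hac : κ.map (fun g => g • y) ≪ μX := by
        refine Measure.AbsolutelyContinuous.mk fun E hE h0 => ?_; rw [Measure.map_apply hm hE]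
        exact hκac ((null_orbit_iff hE y).2 h0)
      have hP : IsProbabilityMeasure (κ.map fun g => g • y) := Measure.isProbabilityMeasure_map hm.aemeasurable
      have := tendsto_integral_smul_of_absolutelyContinuous hc hf hs hac; rw [probReal_univ, mul_one] at this
      refine this.congr fun n => ?_
      exact integral_map hm.aemeasurable (hf.comp (continuous_const_smul (c ^ n))).aestronglyMeasurable
    have hV := hκeq ε hε
    have hcov : ∃ t : Finset X, ∀ y ∈ K, ∃ z ∈ t, ∀ n, |Ψ n y - Ψ n z| ≤ M * ε := by
      obtain ⟨t, -, ht⟩ := hK.elim_nhds_subcover (fun z => (fun h : G => h • z) '' {h | ∀ F : G → ℝ, Continuous F →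
        (∀ g, |F g| ≤ 1) → |∫ g, F (g * h) ∂κ - ∫ g, F g ∂κ| ≤ ε}) fun z _ => by
          have := (isOpenMap_orbit z).image_mem_nhds hV; rwa [one_smul] at this
      refine ⟨t, fun y hy => ?_⟩; obtain ⟨z, hz, h, hh, rfl⟩ := Set.mem_iUnion₂.1 (ht hy); refine ⟨z, hz, fun n => ?_⟩
      have := hh (fun g => M⁻¹ * f (c ^ n • g • z)) (continuous_const.mul (hfc n z)) fun g => by
        rw [abs_mul, abs_of_pos (inv_pos.2 hM0), inv_mul_le_one₀ hM0]; exact hM _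
      rw [integral_const_mul, integral_const_mul, ← mul_sub, abs_mul, abs_of_pos (inv_pos.2 hM0),
        inv_mul_le_iff₀ hM0] at this
      simpa only [hΨ, mul_smul] using this
    obtain ⟨t, ht⟩ := hcov
    have hev : ∀ᶠ n in atTop, ∀ z ∈ t, |Ψ n z - ∫ x, f x ∂μX| ≤ ε := (Filter.eventually_all_finset t).2 fun z _ => by
        filter_upwards [(hlim z).eventually (Metric.closedBall_mem_nhds _ hε)] with n hn
        exact hn
    obtain ⟨n, hn⟩ := hev.exists
    have hΨb : ∀ y, |Ψ n y| ≤ M := fun y => by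
      simpa using norm_integral_le_of_norm_le_const (μ := κ) (f := fun g => f (c ^ n • g • y))
        (.of_forall fun g => hM _)
    have hμb : |∫ x, f x ∂μX| ≤ M := by simpa using norm_integral_le_of_norm_le_const (μ := μX) (f := f) (.of_forall hM)
    set B : Set X := {x | (c ^ n)⁻¹ • x ∉ K}
    have hB : MeasurableSet B := (measurable_smulX (c ^ n)⁻¹ hK.isClosed.measurableSet).compl
    have hpt : ∀ x, |Ψ n ((c ^ n)⁻¹ • x) - ∫ x, f x ∂μX| ≤ (1 + M) * ε + B.indicator (fun _ => 2 * M) x := by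
      intro x
      by_cases hx : x ∈ B
      · rw [indicator_of_mem hx]; have := abs_sub (Ψ n ((c ^ n)⁻¹ • x)) (∫ x, f x ∂μX); nlinarith [hΨb ((c ^ n)⁻¹ • x)]
      · rw [indicator_of_notMem hx]; obtain ⟨z, hz, hzy⟩ := ht ((c ^ n)⁻¹ • x) (not_not.1 hx)
        have := abs_sub_le (Ψ n ((c ^ n)⁻¹ • x)) (Ψ n z) (∫ x, f x ∂μX); nlinarith [hn z hz, hzy n]
    have hjoint : Continuous fun p : X × G => f (c ^ n • p.2 • (c ^ n)⁻¹ • p.1) := by fun_prop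
    have hji : Integrable (fun p : X × G => f (c ^ n • p.2 • (c ^ n)⁻¹ • p.1)) (ν.prod κ) :=
      Integrable.of_bound hjoint.aestronglyMeasurable M (.of_forall fun p => hM _)
    have hΨi : Integrable (fun x => Ψ n ((c ^ n)⁻¹ • x)) ν := hji.integral_prod_left
    have hind : Integrable (B.indicator fun _ => 2 * M) ν := (integrable_const _).indicator hB
    have b1 : |∫ x, Ψ n ((c ^ n)⁻¹ • x) ∂ν - ∫ x, f x ∂μX| ≤ (1 + 3 * M) * ε := by
      have e : ∫ x, Ψ n ((c ^ n)⁻¹ • x) ∂ν - ∫ x, f x ∂μX = ∫ x, (Ψ n ((c ^ n)⁻¹ • x) - ∫ x, f x ∂μX) ∂ν := by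
        rw [integral_sub hΨi (integrable_const _)]; simp
      rw [e]
      have := norm_integral_le_of_norm_le (f := fun x => Ψ n ((c ^ n)⁻¹ • x) - ∫ x, f x ∂μX)
        ((integrable_const ((1 + M) * ε)).add hind) (.of_forall hpt)
      rw [norm_eq_abs] at this; refine this.trans ?_
      rw [integral_add' (integrable_const _) hind, integral_indicator hB]
      have h2 : ν.real B ≤ ε := toReal_le_of_le_ofReal hε.le (hKν n); simp; nlinarith
    have b2 : |∫ x, Ψ n ((c ^ n)⁻¹ • x) ∂ν - ∫ x, f x ∂ν| ≤ ε := by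
      have sw : ∫ x, Ψ n ((c ^ n)⁻¹ • x) ∂ν = ∫ g, ∫ x, f (c ^ n • g • (c ^ n)⁻¹ • x) ∂ν ∂κ :=
        integral_integral_swap hji
      have e : ∫ x, Ψ n ((c ^ n)⁻¹ • x) ∂ν - ∫ x, f x ∂ν =
          ∫ g, (∫ x, f (c ^ n • g • (c ^ n)⁻¹ • x) ∂ν - ∫ x, f x ∂ν) ∂κ := by
        rw [integral_sub hji.integral_prod_right (integrable_const _), sw]; simp
      rw [e]
      have := norm_integral_le_of_norm_le_const (μ := κ) (C := ε)
        (f := fun g => ∫ x, f (c ^ n • g • (c ^ n)⁻¹ • x) ∂ν - ∫ x, f x ∂ν) ?_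
      · simpa using this
      · filter_upwards [hκN] with g hg
        obtain ⟨q, hq, v, hv, e⟩ := hg n
        have e' : ∀ x : X, c ^ n • g • (c ^ n)⁻¹ • x = q • v • x := fun x => by rw [smul_smul, smul_smul, e, mul_smul]
        simp only [e']; rw [← integral_smul_of_mem_stab hv f, ← integral_sub]
        · simpa using norm_integral_le_of_norm_le_const (μ := ν) (f := fun x => f (q • v • x) - f (v • x))
            (.of_forall fun x => hu q hq (v • x))
        · exact Integrable.of_bound (by fun_prop) M (.of_forall fun x => hM _)
        · exact Integrable.of_bound (by fun_prop) M (.of_forall fun x => hM _)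
    rw [abs_le] at *
    constructor <;> nlinarith [b1.1, b1.2, b2.1, b2.2]
  by_contra hne; have hpos := abs_pos.2 (sub_ne_zero.2 hne)
  have := key (|∫ x, f x ∂ν - ∫ x, f x ∂μX| / (2 * (2 + 3 * M))) (by positivity)
  rw [mul_div_assoc', le_div_iff₀ (by positivity)] at this; nlinarith

lemma diagG_pow_conj {d : Fin 3 → ℝ} (h : d 0 * d 1 * d 2 = 1) (n : ℕ) (g : G) (i j : Fin 3) :
    ((diagG d h) ^ n * g * ((diagG d h) ^ n)⁻¹ : G) i j = (d i / d j) ^ n * g i j := by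
  induction n generalizing g with
  | zero => simp
  | succ n ih =>
    have e1 : (diagG d h) ^ (n + 1) * g * ((diagG d h) ^ (n + 1))⁻¹ =
        (diagG d h) ^ n * (diagG d h * g * (diagG d h)⁻¹) * ((diagG d h) ^ n)⁻¹ := by
      rw [pow_succ]; group
    have e2 : (diagG d h * g : G) i j = ((diagG d h * g * (diagG d h)⁻¹) * diagG d h : G) i j := by
      rw [inv_mul_cancel_right]
    have e3 : (diagG d h * g : G) i j = d i * g i j := Matrix.diagonal_mul d g i j
    have e4 : ((diagG d h * g * (diagG d h)⁻¹) * diagG d h : G) i j = (diagG d h * g * (diagG d h)⁻¹ : G) i j * d j :=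
      Matrix.mul_diagonal d ((diagG d h * g * (diagG d h)⁻¹ : G) : M₃) i j
    rw [e3, e4] at e2
    rw [e1, ih, pow_succ, mul_assoc (_ ^ n), div_mul_eq_mul_div (d i), e2, mul_div_cancel_right₀ _ (diagG_ne_zero h j)]

lemma diagG_pow_conj_tv {d : Fin 3 → ℝ} (h : d 0 * d 1 * d 2 = 1) (n : ℕ) {i j : Fin 3} (hij : i ≠ j) (r : ℝ) :
    (diagG d h) ^ n * tv hij r * ((diagG d h) ^ n)⁻¹ = tv hij ((d i / d j) ^ n * r) := by
  refine G_ext fun k l => ?_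
  rw [diagG_pow_conj, transvection_apply, transvection_apply, single_apply, single_apply, one_apply]
  by_cases hkl : k = l
  · subst hkl; have h1 : ¬ (i = k ∧ j = k) := fun h => hij (h.1.trans h.2.symm); simp [h1, div_self (diagG_ne_zero h k)]
  · by_cases h2 : i = k ∧ j = l
    · simp [h2.1, h2.2, hkl]
    · simp [h2, hkl]

lemma tendsto_diagG_pow_conj_tv {d : Fin 3 → ℝ} (h : d 0 * d 1 * d 2 = 1) {i j : Fin 3} (hij : i ≠ j)
    (h0 : 0 ≤ d i / d j) (h1 : d i / d j < 1) (r : ℝ) :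
    Tendsto (fun n : ℕ => (diagG d h) ^ n * tv hij r * ((diagG d h) ^ n)⁻¹) atTop (𝓝 1) := by
  simp only [diagG_pow_conj_tv]
  have := ((continuous_transvection hij).tendsto _).comp
    ((_root_.tendsto_pow_atTop_nhds_zero_of_lt_one h0 h1).mul_const r)
  rwa [zero_mul, tv, SpecialLinearGroup.transvection_coeff_zero] at this

lemma diagG_pow_conj_mem_nearOne {d : Fin 3 → ℝ} (h : d 0 * d 1 * d 2 = 1) (hd : ∀ i, 0 < d i) {q : G} {θ : ℝ}
    (hq : q ∈ nearOne θ) (hq' : ∀ i j, d i ≤ d j ∨ q i j = 0) (n : ℕ) :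
    (diagG d h) ^ n * q * ((diagG d h) ^ n)⁻¹ ∈ nearOne θ := by
  intro i j; have hb := hq i j; rw [diagG_pow_conj]
  by_cases hij : i = j
  · subst hij; rwa [div_self (hd i).ne', one_pow, one_mul]
  · rw [one_apply_ne hij, sub_zero] at hb ⊢
    rcases hq' i j with h1 | h1
    · rw [abs_mul, abs_of_nonneg (pow_nonneg (div_nonneg (hd i).le (hd j).le) n)]
      exact (mul_le_of_le_one_left (abs_nonneg _)
        (pow_le_one₀ (div_nonneg (hd i).le (hd j).le) ((div_le_one (hd j)).2 h1))).trans hb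
    · rwa [h1, mul_zero, abs_zero, ← abs_zero, ← h1]

lemma uu_eq_tv (r : ℝ) : uu r = tv (zero_ne_one : (0 : Fin 3) ≠ 1) r := by apply G_ext_fin <;> simp [transvection_apply]

lemma tight_of_diagG {d : Fin 3 → ℝ} (h : d 0 * d 1 * d 2 = 1)
    (hU : ∀ r, uu r ∈ stab ν) (hirr : ∀ᵐ x ∂ν, IrrationalPt x) {δ : ℝ} (hδ : 0 < δ) :
    ∃ K : Set X, IsCompact K ∧ ∀ n : ℕ, ν {x | ((diagG d h) ^ n)⁻¹ • x ∉ K} ≤ ofR δ := by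
  obtain ⟨K, hK, hKu⟩ := exists_compact_uniform hδ; refine ⟨K, hK, fun n => ?_⟩
  set a : G := ((diagG d h) ^ n)⁻¹ with ha; have hm := measurable_smulX a
  have h1 : IsProbabilityMeasure (ν.map fun x => a • x) := Measure.isProbabilityMeasure_map hm.aemeasurable
  have := hKu (ν.map fun x => a • x) h1 (fun r => ?_) ((ae_map_smul).2 ?_)
  · rwa [Measure.map_apply hm hK.isClosed.measurableSet.compl] at this
  · have e : uu r = a * tv (zero_ne_one : (0 : Fin 3) ≠ 1) ((d 0 / d 1) ^ n * r) * a⁻¹ := by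
      rw [← diagG_pow_conj_tv h, ha, inv_inv, uu_eq_tv]; group
    rw [e, ← uu_eq_tv]; exact stab_map (hU _)
  · filter_upwards [hirr] with x hx
    have : ∀ (m : ℕ) (y : X), IrrationalPt y → IrrationalPt (((diagG d h) ^ m)⁻¹ • y) := by
      intro m
      induction m with
      | zero => simp
      | succ m ih =>
        intro y hy; rw [pow_succ, _root_.mul_inv_rev, mul_smul]
        have hinv : (d 0)⁻¹ * (d 1)⁻¹ * (d 2)⁻¹ = 1 := by rw [← mul_inv, ← mul_inv, h, inv_one]
        have e : (diagG d h)⁻¹ = diagG (fun i => (d i)⁻¹) hinv := by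
          refine inv_eq_of_mul_eq_one_right (Subtype.ext ?_); change diagonal d * diagonal (fun i => (d i)⁻¹) = 1
          rw [Matrix.diagonal_mul_diagonal]; simp [diagG_ne_zero h]
        rw [e]; exact (ih y hy).diagG_smul hinv
    exact this n x hx

lemma eq_of_two_roots {d : Fin 3 → ℝ} (hd : d 0 * d 1 * d 2 = 1) (hpos : ∀ i, 0 < d i) {ν : Measure X}
    [IsProbabilityMeasure ν] (hU : ∀ r, uu r ∈ stab ν) (hirr : ∀ᵐ x ∂ν, IrrationalPt x)
    (hmix : IsMixingElt (diagG d hd)) {i j k l : Fin 3} {hij : i ≠ j} {hkl : k ≠ l}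
    (h1 : ∀ r, tv hij r ∈ stab ν) (h2 : ∀ r, tv hkl r ∈ stab ν) {x z : G → ℝ} (hx : ContinuousAt x 1)
    (hz : ContinuousAt z 1) (hx1 : x 1 = 0) (hz1 : z 1 = 0)
    (hq : ∀ᶠ g in 𝓝 (1 : G), ∀ q : G, q * (tv hij (x g) * tv hkl (z g)) = g → ∀ a b, d a ≤ d b ∨ q a b = 0) :
    ν = μX := by
  refine eq_of_expanding hmix (fun δ hδ => tight_of_diagG hd hU hirr hδ) fun θ hθ => ?_
  have hQ : Tendsto (fun g : G => g * (tv hij (x g) * tv hkl (z g))⁻¹) (𝓝 1) (𝓝 1) := by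
    have c1 : Tendsto (fun g => tv hij (x g)) (𝓝 1) (𝓝 (tv hij (x 1))) :=
      ((continuous_transvection hij).tendsto _).comp hx
    have c2 : Tendsto (fun g => tv hkl (z g)) (𝓝 1) (𝓝 (tv hkl (z 1))) :=
      ((continuous_transvection hkl).tendsto _).comp hz
    simpa [hx1, hz1, tv] using (tendsto_id (α := G) (x := 𝓝 1)).mul (c1.mul c2).inv
  filter_upwards [hQ (nearOne_mem_nhds hθ), hq] with g hg hg' n
  refine ⟨_, diagG_pow_conj_mem_nearOne hd hpos hg (hg' _ (inv_mul_cancel_right _ _)) n,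
    ((diagG d hd) ^ n * tv hij (x g) * ((diagG d hd) ^ n)⁻¹) * ((diagG d hd) ^ n * tv hkl (z g) * ((diagG d hd) ^ n)⁻¹),
    ?_, by group⟩
  rw [diagG_pow_conj_tv, diagG_pow_conj_tv]; exact mul_mem (h1 _) (h2 _)

/-- A measure invariant under one of the two maximal horospherical groups through the root group `uu`,
almost all of whose points are irrational, is the invariant measure. -/
theorem eq_of_horospherical (hU : ∀ r, uu r ∈ stab ν)
    (hirr : ∀ᵐ x ∂ν, IrrationalPt x) (hW : (∀ p, nn p 0 ∈ stab ν) ∨ ∀ w, nn 0 w ∈ stab ν) : ν = μX := by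
  have E : exp (-1) < exp 2 := exp_lt_exp.2 (by norm_num); have E' : exp (-2) < exp 1 := exp_lt_exp.2 (by norm_num)
  have hU' : ∀ r, tv (zero_ne_one : (0 : Fin 3) ≠ 1) r ∈ stab ν := fun r => uu_eq_tv r ▸ hU r
  rcases hW with hW | hW
  · have hd : (![exp 2, exp (-1), exp (-1)] : Fin 3 → ℝ) 0 * (![exp 2, exp (-1), exp (-1)] : Fin 3 → ℝ) 1 *
        (![exp 2, exp (-1), exp (-1)] : Fin 3 → ℝ) 2 = 1 := by
      simp [← exp_add]; norm_num
    have hlt : exp (-1) / exp 2 < 1 := (div_lt_one (exp_pos _)).2 E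
    have c0 : ∀ j : Fin 3, ContinuousAt (fun g : G => g 0 j / g 0 0) 1 := fun j =>
      (continuous_entry 0 j).continuousAt.div (continuous_entry 0 0).continuousAt (by simp)
    refine eq_of_two_roots hd (fun i => by rcases fin3 i with rfl|rfl|rfl <;> simp [exp_pos])
      hU hirr ⟨fun r => tendsto_diagG_pow_conj_tv hd _ (by simp; positivity) (by simpa using hlt) r,
        Or.inl fun r => tendsto_diagG_pow_conj_tv hd _ (by simp; positivity) (by simpa using hlt) r⟩
      hU' (hkl := (by decide : (0 : Fin 3) ≠ 2)) (fun r => ?_) (c0 1) (c0 2) (by simp) (by simp) ?_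
    · have : nn r 0 = tv (by decide : (0 : Fin 3) ≠ 2) r := by apply G_ext_fin <;> simp [transvection_apply]
      exact this ▸ hW r
    · filter_upwards [(continuous_entry 0 0).continuousAt.eventually_ne (show (1 : G) 0 0 ≠ (0 : ℝ) by simp)]
        with g h00 q e
      have e0 := fun j => congrArg (fun k : G => k 0 j) e; simp only [mul_entry, transvection_apply] at e0
      have a0 := e0 0; have a1 := e0 1; have a2 := e0 2; simp at a0 a1 a2; rw [a0] at a1 a2; field_simp at a1 a2
      intro i j
      rcases fin3 i with rfl|rfl|rfl <;> rcases fin3 j with rfl|rfl|rfl <;>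
        first | exact Or.inl le_rfl | exact Or.inl E.le | skip
      · right; linarith
      · right; linarith
  · have hd : (![exp 1, exp (-2), exp 1] : Fin 3 → ℝ) 0 * (![exp 1, exp (-2), exp 1] : Fin 3 → ℝ) 1 *
        (![exp 1, exp (-2), exp 1] : Fin 3 → ℝ) 2 = 1 := by
      simp [← exp_add]; norm_num
    have hlt : exp (-2) / exp 1 < 1 := (div_lt_one (exp_pos _)).2 E'
    have cp : ∀ i j k l : Fin 3, Continuous fun g : G => g i j * g k l := fun i j k l =>
      (continuous_entry i j).mul (continuous_entry k l)
    have cΔ : Continuous fun g : G => g 0 0 * g 2 2 - g 0 2 * g 2 0 := (cp _ _ _ _).sub (cp _ _ _ _)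
    have hx : ContinuousAt (fun g : G => (g 0 1 * g 2 2 - g 0 2 * g 2 1) / (g 0 0 * g 2 2 - g 0 2 * g 2 0)) 1 :=
      ((cp _ _ _ _).sub (cp _ _ _ _)).continuousAt.div cΔ.continuousAt (by simp)
    have hz : ContinuousAt (fun g : G => (g 0 0 * g 2 1 - g 0 1 * g 2 0) / (g 0 0 * g 2 2 - g 0 2 * g 2 0)) 1 :=
      ((cp _ _ _ _).sub (cp _ _ _ _)).continuousAt.div cΔ.continuousAt (by simp)
    refine eq_of_two_roots hd (fun i => by rcases fin3 i with rfl|rfl|rfl <;> simp [exp_pos])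
      hU hirr ⟨fun r => tendsto_diagG_pow_conj_tv hd _ (by simp; positivity) (by simpa using hlt) r,
        Or.inr fun r => tendsto_diagG_pow_conj_tv hd _ (by simp; positivity) (by simpa using hlt) r⟩
      hU' (hkl := (by decide : (2 : Fin 3) ≠ 1)) (fun r => ?_) hx hz (by simp) (by simp) ?_
    · have : nn 0 r = tv (by decide : (2 : Fin 3) ≠ 1) r := by apply G_ext_fin <;> simp [transvection_apply]
      exact this ▸ hW r
    · filter_upwards [cΔ.continuousAt.eventually_ne (show (1 : G) 0 0 * (1 : G) 2 2 - (1 : G) 0 2 * (1 : G) 2 0 ≠ (0 : ℝ)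
        by simp)] with g h00 q e
      have e0 := fun i j => congrArg (fun k : G => k i j) e; simp only [mul_entry, transvection_apply] at e0
      have a00 := e0 0 0; have a02 := e0 0 2; have a01 := e0 0 1; have a20 := e0 2 0; have a22 := e0 2 2
      have a21 := e0 2 1; simp at a00 a02 a01 a20 a22 a21; rw [a00, a02] at a01; rw [a20, a22] at a21
      field_simp at a01 a21; intro i j
      rcases fin3 i with rfl|rfl|rfl <;> rcases fin3 j with rfl|rfl|rfl <;>
        first | exact Or.inl le_rfl | exact Or.inl E'.le | skip
      · right; exact (mul_eq_zero.1 (by linear_combination a01 : q 0 1 * (g 0 0 * g 2 2 - g 0 2 * g 2 0) = 0)).resolve_right h00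
      · right; exact (mul_eq_zero.1 (by linear_combination a21 : q 2 1 * (g 0 0 * g 2 2 - g 0 2 * g 2 0) = 0)).resolve_right h00

/-! ### The pointwise ergodic theorem -/

section Birkhoff

variable {α : Type*} {T : α → α}

/-- The running maximum of the Birkhoff sums, with value `0` at time `0`. -/
def maxSum (T : α → α) (g : α → ℝ) : ℕ → α → ℝ
  | 0 => fun _ => 0
  | n + 1 => fun x => max 0 (g x + maxSum T g n (T x))

lemma maxSum_nonneg (g : α → ℝ) (n : ℕ) (x : α) : 0 ≤ maxSum T g n x := by
  cases n
  exacts [le_rfl, le_max_left _ _]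

lemma maxSum_le_succ (g : α → ℝ) (n : ℕ) (x : α) : maxSum T g n x ≤ maxSum T g (n + 1) x := by
  induction n generalizing x with
  | zero => exact maxSum_nonneg g 1 x
  | succ n ih => exact max_le_max le_rfl (by gcongr; exact ih _)

lemma birkhoffSum_le_maxSum (g : α → ℝ) (n : ℕ) (x : α) : birkhoffSum T g n x ≤ maxSum T g n x := by
  induction n generalizing x with
  | zero => simp [maxSum]
  | succ n ih =>
    rw [birkhoffSum_succ']; exact le_max_of_le_right (by gcongr; exact ih _)

variable [MeasurableSpace α] {μ : Measure α} [IsProbabilityMeasure μ]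

/-- The maximal ergodic theorem. -/
lemma setIntegral_nonneg_of_birkhoffSum (hT : MeasurePreserving T μ μ) {A : Set α} (hA : MeasurableSet A)
    (hTA : T ⁻¹' A = A) {g : α → ℝ} (hg : Measurable g) {C : ℝ} (hC : ∀ x, |g x| ≤ C)
    (h : ∀ x ∈ A, ∃ k, 0 < birkhoffSum T g k x) : 0 ≤ ∫ x in A, g x ∂μ := by
  have hm : ∀ n, Measurable (maxSum T g n) := fun n => by
    induction n with
    | zero => exact measurable_const
    | succ n ih => exact measurable_const.max (hg.add (ih.comp hT.measurable))
  have hb : ∀ n, ∃ D, ∀ x, |maxSum T g n x| ≤ D := fun n => by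
    induction n with
    | zero => exact ⟨0, fun x => by simp [maxSum]⟩
    | succ n ih =>
      obtain ⟨D, hD⟩ := ih; refine ⟨C + D, fun x => ?_⟩; rw [abs_of_nonneg (maxSum_nonneg _ _ _)]
      exact max_le (add_nonneg ((abs_nonneg _).trans (hC x)) ((abs_nonneg _).trans (hD x)))
        (add_le_add ((le_abs_self _).trans (hC _)) ((le_abs_self _).trans (hD _)))
  have hi : ∀ n, Integrable (maxSum T g n) μ := fun n => by
    obtain ⟨D, hD⟩ := hb n; exact Integrable.of_bound (hm n).aestronglyMeasurable D (.of_forall hD)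
  have hgi : Integrable g μ := Integrable.of_bound hg.aestronglyMeasurable C (.of_forall hC)
  set E : ℕ → Set α := fun n => A ∩ {x | 0 < maxSum T g n x}
  have hEm : ∀ n, MeasurableSet (E n) := fun n => hA.inter (measurableSet_lt measurable_const (hm n))
  have hmono : Monotone E := monotone_nat_of_le_succ fun n x hx => ⟨hx.1, lt_of_lt_of_le hx.2 (maxSum_le_succ g n x)⟩
  have hU : ⋃ n, E n = A := by
    refine Set.Subset.antisymm (Set.iUnion_subset fun n => inter_subset_left) fun x hx => ?_; obtain ⟨k, hk⟩ := h x hx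
    exact mem_iUnion.2 ⟨k, hx, hk.trans_le (birkhoffSum_le_maxSum g k x)⟩
  have hlim := tendsto_setIntegral_of_monotone hEm hmono (f := g) (μ := μ) hgi.integrableOn; rw [hU] at hlim
  refine ge_of_tendsto' hlim fun n => ?_
  have hTi : Integrable (fun x => maxSum T g n (T x)) μ := hT.integrable_comp_of_integrable (hi n)
  have h0 : ∫ x in A, (maxSum T g n x - maxSum T g n (T x)) ∂μ = 0 := by
    rw [integral_sub (hi n).integrableOn hTi.integrableOn, sub_eq_zero]; have hr := (hT.restrict_preimage hA).map_eq
    rw [hTA] at hr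
    conv_lhs => rw [← hr]
    exact integral_map hT.measurable.aemeasurable (hm n).aestronglyMeasurable
  calc 0 = ∫ x in A, (maxSum T g n x - maxSum T g n (T x)) ∂μ := h0.symm
    _ ≤ ∫ x in A, (E n).indicator g x ∂μ := by
        refine setIntegral_mono_on ((hi n).sub hTi).integrableOn (hgi.indicator (hEm n)).integrableOn hA fun x hx => ?_
        by_cases hxE : x ∈ E n
        · rw [indicator_of_mem hxE]; have h2 : 0 < maxSum T g n x := hxE.2
          cases n with
          | zero => exact absurd h2 (lt_irrefl _)
          | succ n =>
            have h3 : maxSum T g (n + 1) x = g x + maxSum T g n (T x) :=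
              max_eq_right ((lt_max_iff.1 h2).resolve_left (lt_irrefl _)).le
            linarith [maxSum_le_succ (T := T) g n (T x)]
        · rw [indicator_of_notMem hxE]; have h2 : maxSum T g n x ≤ 0 := not_lt.1 fun h => hxE ⟨hx, h⟩
          linarith [maxSum_nonneg (T := T) g n (T x)]
    _ = ∫ x in E n, g x ∂μ := by rw [setIntegral_indicator (hEm n), Set.inter_eq_self_of_subset_right inter_subset_left]

/-- The pointwise ergodic theorem for bounded functions. -/
theorem ae_tendsto_birkhoff (hT : MeasurePreserving T μ μ) {g : α → ℝ} (hg : Measurable g) {C : ℝ}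
    (hC : ∀ x, |g x| ≤ C) : ∀ᵐ x ∂μ, ∃ l, Tendsto (fun n : ℕ => (n : ℝ)⁻¹ * birkhoffSum T g n x) atTop (𝓝 l) := by
  set a : ℕ → α → ℝ := fun n x => (n : ℝ)⁻¹ * birkhoffSum T g n x with ha
  have hs : ∀ (n : ℕ) (c : ℝ) (x : α), birkhoffSum T (fun y => g y - c) n x = birkhoffSum T g n x - n * c := by
    intro n c x; simp [birkhoffSum, Finset.sum_sub_distrib]
  have hs' : ∀ (n : ℕ) (c : ℝ) (x : α), birkhoffSum T (fun y => c - g y) n x = n * c - birkhoffSum T g n x := by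
    intro n c x; simp [birkhoffSum, Finset.sum_sub_distrib]
  have ham : ∀ n, Measurable (a n) := fun n => by
    simp only [ha, birkhoffSum]
    exact (Finset.measurable_sum _ fun k _ => hg.comp (hT.measurable.iterate k)).const_mul _
  have hab : ∀ n x, |a n x| ≤ C := by
    intro n x
    have h1 : |birkhoffSum T g n x| ≤ n * C := by
      refine (Finset.abs_sum_le_sum_abs _ _).trans ((Finset.sum_le_sum fun k _ => hC _).trans ?_); simp
    rcases Nat.eq_zero_or_pos n with rfl | hn
    · simpa [ha] using (abs_nonneg _).trans (hC x)
    · have hn' : (0 : ℝ) < n := by exact_mod_cast hn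
      rw [ha, abs_mul, abs_of_pos (inv_pos.2 hn'), inv_mul_le_iff₀ hn']; exact h1
  have hdiff : ∀ x, Tendsto (fun n => a n (T x) - a n x) atTop (𝓝 0) := by
    intro x
    have h1 : Tendsto (fun n : ℕ => (n : ℝ)⁻¹ * (2 * C)) atTop (𝓝 0) := by
      simpa using tendsto_inv_atTop_nhds_zero_nat.mul_const (2 * C)
    refine squeeze_zero_norm (fun n => ?_) h1
    rw [ha, ← mul_sub, birkhoffSum_apply_sub_birkhoffSum, norm_mul, norm_of_nonneg (by positivity)]; gcongr
    exact (abs_sub _ _).trans (by linarith [hC (T^[n] x), hC x])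
  set B : ℚ → ℚ → Set α := fun p q => {x | (∃ r : ℚ, r < p ∧ ∃ᶠ n in atTop, a n x < r) ∧
    ∃ r : ℚ, q < r ∧ ∃ᶠ n in atTop, (r : ℝ) < a n x} with hB
  have hBm : ∀ p q, MeasurableSet (B p q) := by
    intro p q
    have e : B p q = (⋃ r : ℚ, ⋃ _ : r < p, ⋂ N : ℕ, ⋃ n : ℕ, ⋃ _ : N ≤ n, {x | a n x < r}) ∩
        ⋃ r : ℚ, ⋃ _ : q < r, ⋂ N : ℕ, ⋃ n : ℕ, ⋃ _ : N ≤ n, {x | (r : ℝ) < a n x} := by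
      ext x; simp [hB, frequently_atTop]
    rw [e]
    exact (MeasurableSet.iUnion fun r => MeasurableSet.iUnion fun _ => MeasurableSet.iInter fun N =>
      MeasurableSet.iUnion fun n => MeasurableSet.iUnion fun _ => measurableSet_lt (ham n) measurable_const).inter
      (MeasurableSet.iUnion fun r => MeasurableSet.iUnion fun _ => MeasurableSet.iInter fun N =>
      MeasurableSet.iUnion fun n => MeasurableSet.iUnion fun _ => measurableSet_lt measurable_const (ham n))
  have tr : ∀ u v : ℕ → ℝ, Tendsto (fun n => u n - v n) atTop (𝓝 0) → ∀ p q : ℚ,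
      ((∃ r : ℚ, r < p ∧ ∃ᶠ n in atTop, u n < r) ∧ ∃ r : ℚ, q < r ∧ ∃ᶠ n in atTop, (r : ℝ) < u n) →
      (∃ r : ℚ, r < p ∧ ∃ᶠ n in atTop, v n < r) ∧ ∃ r : ℚ, q < r ∧ ∃ᶠ n in atTop, (r : ℝ) < v n := by
    rintro u v h p q ⟨⟨r, hr, h1⟩, r', hr', h2⟩
    obtain ⟨s, hs1, hs2⟩ := exists_between hr; obtain ⟨s', hs1', hs2'⟩ := exists_between hr'
    have e1 : (0 : ℝ) < s - r := sub_pos.2 (by exact_mod_cast hs1)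
    have e2 : (0 : ℝ) < r' - s' := sub_pos.2 (by exact_mod_cast hs2'); refine ⟨⟨s, hs2, ?_⟩, s', hs1', ?_⟩
    · refine (h1.and_eventually (h.eventually (lt_mem_nhds (neg_lt_zero.2 e1)))).mono fun n hn => ?_
      linarith [hn.1, hn.2]
    · refine (h2.and_eventually (h.eventually (gt_mem_nhds e2))).mono fun n hn => ?_; linarith [hn.1, hn.2]
  have hinv : ∀ p q, T ⁻¹' B p q = B p q := by
    intro p q; ext x; refine ⟨fun hx => tr _ _ (hdiff x) p q hx, fun hx => tr _ _ ?_ p q hx⟩; simpa using (hdiff x).neg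
  have hgi : Integrable g μ := Integrable.of_bound hg.aestronglyMeasurable C (.of_forall hC)
  have hnull : ∀ p q : ℚ, p < q → μ (B p q) = 0 := by
    intro p q hpq
    have I1 : 0 ≤ ∫ x in B p q, (g x - q) ∂μ := by
      refine setIntegral_nonneg_of_birkhoffSum hT (hBm p q) (hinv p q) (hg.sub_const _) (C := C + |(q : ℝ)|)
        (fun x => (abs_sub _ _).trans (by linarith [hC x])) ?_
      rintro x ⟨-, r, hr, h2⟩
      obtain ⟨n, hn, hn0⟩ := (h2.and_eventually (eventually_gt_atTop 0)).exists
      have hn' : (0 : ℝ) < n := by exact_mod_cast hn0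
      refine ⟨n, ?_⟩; rw [hs, sub_pos, ← lt_inv_mul_iff₀ hn']; exact lt_trans (by exact_mod_cast hr) hn
    have I2 : 0 ≤ ∫ x in B p q, ((p : ℝ) - g x) ∂μ := by
      refine setIntegral_nonneg_of_birkhoffSum hT (hBm p q) (hinv p q) (hg.const_sub _) (C := C + |(p : ℝ)|)
        (fun x => (abs_sub _ _).trans (by linarith [hC x])) ?_
      rintro x ⟨⟨r, hr, h2⟩, -⟩
      obtain ⟨n, hn, hn0⟩ := (h2.and_eventually (eventually_gt_atTop 0)).exists
      have hn' : (0 : ℝ) < n := by exact_mod_cast hn0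
      refine ⟨n, ?_⟩; rw [hs', sub_pos, ← inv_mul_lt_iff₀ hn']; exact lt_trans hn (by exact_mod_cast hr)
    rw [integral_sub hgi.integrableOn (integrable_const _), setIntegral_const] at I1
    rw [integral_sub (integrable_const _) hgi.integrableOn, setIntegral_const] at I2; simp only [smul_eq_mul] at I1 I2
    have hpq' : (p : ℝ) < q := by exact_mod_cast hpq
    have : μ.real (B p q) = 0 := by have := measureReal_nonneg (μ := μ) (s := B p q); nlinarith
    exact (measureReal_eq_zero_iff).1 this
  have hall : ∀ᵐ x ∂μ, ∀ p q : ℚ, p < q → x ∉ B p q := by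
    rw [ae_all_iff]; intro p; rw [ae_all_iff]; intro q
    by_cases hpq : p < q
    · filter_upwards [measure_eq_zero_iff_ae_notMem.1 (hnull p q hpq)] with x hx _ using hx
    · exact .of_forall fun x h => absurd h hpq
  filter_upwards [hall] with x hx
  refine tendsto_of_no_upcrossings Rat.denseRange_cast ?_ ?_ ?_
  · rintro _ ⟨r, rfl⟩ _ ⟨r', rfl⟩ hrr ⟨h1, h2⟩
    have hrr' : r < r' := by exact_mod_cast hrr
    obtain ⟨p, hp1, hp2⟩ := exists_between hrr'; obtain ⟨q, hq1, hq2⟩ := exists_between hp2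
    exact hx p q hq1 ⟨⟨r, hp1, h1⟩, r', hq2, h2⟩
  · exact isBoundedUnder_of ⟨C, fun n => (abs_le.1 (hab n x)).2⟩
  · exact isBoundedUnder_of ⟨-C, fun n => (abs_le.1 (hab n x)).1⟩

end Birkhoff

/-! ### Decomposition into measures with generic points -/

lemma integral_orbitAvg (hU : ∀ r, uu r ∈ stab ν) {f : X → ℝ}
    (hf : Continuous f) (hc : HasCompactSupport f) {N : ℕ} (hN : 0 < N) :
    ∫ x, orbitAvg f N x ∂ν = ∫ x, f x ∂ν := by
  obtain ⟨M, -, hM⟩ := exists_bound hf hc; have hN' : (N : ℝ) ≠ 0 := by positivity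
  simp only [orbitAvg, integral_const_mul, intervalIntegral.integral_of_le (Nat.cast_nonneg N)]
  rw [integral_integral_swap]
  · simp only [fun r => integral_smul_of_mem_stab (hU r) f]; simp [hN']
  · refine Integrable.of_bound (Continuous.aestronglyMeasurable ?_) M (.of_forall fun p => hM _)
    exact hf.comp ((continuous_uu.comp continuous_snd).smul continuous_fst)

lemma ae_tendsto_orbitAvg {μ : Measure X} [IsProbabilityMeasure μ] (hU : ∀ r, uu r ∈ stab μ) {f : X → ℝ}
    (hf : Continuous f) (hc : HasCompactSupport f) :
    ∀ᵐ x ∂μ, ∃ l, Tendsto (fun N => orbitAvg f N x) atTop (𝓝 l) := by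
  obtain ⟨M, -, hM⟩ := exists_bound hf hc
  have hb : ∀ x, |orbitAvg f 1 x| ≤ M := fun x => by
    simpa [orbitAvg] using intervalIntegral.norm_integral_le_of_norm_le_const (a := 0) (b := 1) (C := M)
      (f := fun r => f (uu r • x)) (fun t _ => hM _)
  filter_upwards [ae_tendsto_birkhoff (measurePreserving_of_mem_stab (hU 1)) (continuous_orbitAvg hf 1).measurable hb]
    with x ⟨l, hl⟩
  refine ⟨l, hl.congr fun n => ?_⟩; rw [orbitAvg, birkhoffSum]; congr 1
  have key : ∀ k : ℕ, orbitAvg f 1 ((fun y => uu 1 • y)^[k] x) = ∫ r in (k : ℝ)..((k + 1 : ℕ) : ℝ), f (uu r • x) := by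
    intro k; have e : (fun y : X => uu 1 • y)^[k] x = uu (k : ℝ) • x := by rw [smul_iterate_apply, uu_nat]
    have := intervalIntegral.integral_comp_add_right (a := 0) (b := 1) (fun r => f (uu r • x)) (k : ℝ); rw [e, orbitAvg]
    simp only [Nat.cast_one, inv_one, one_mul, smul_smul, ← uu_add, this]; push_cast; rw [zero_add, add_comm]
  simp only [key]
  rw [intervalIntegral.sum_integral_adjacent_intervals (a := fun k : ℕ => (k : ℝ))
    fun k _ => (continuous_orbit hf x).intervalIntegrable _ _]
  simp

lemma mem_stab_of_rat {p : ℝ → G} (hp : Continuous p) (h : ∀ q : ℚ, p q ∈ stab ν) (s : ℝ) : p s ∈ stab ν := by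
  refine mem_stab_of_integral fun f hf hc => ?_; obtain ⟨M, -, hM⟩ := exists_bound hf hc
  have c1 : Continuous fun s => ∫ x, f (p s • x) ∂ν :=
    continuous_of_dominated (fun s => (hf.comp (continuous_const_smul _)).aestronglyMeasurable)
      (fun s => .of_forall fun x => hM _) (integrable_const M)
      (.of_forall fun x => hf.comp ((continuous_orbitG x).comp hp))
  exact congrFun (Rat.denseRange_cast.equalizer c1 continuous_const
    (funext fun q => integral_smul_of_mem_stab (h q) f)) s

open scoped ProbabilityTheory in
theorem exists_decomposition {μ : Measure X} [IsProbabilityMeasure μ] (hU : ∀ r, uu r ∈ stab μ) {P : X → Prop}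
    (hP : ∀ᵐ x ∂μ, P x) : ∃ m : X → Measure X, (∀ z, IsProbabilityMeasure (m z)) ∧
      (∀ f : X → ℝ, Continuous f → Measurable fun z => ∫ x, f x ∂(m z)) ∧
      (∀ f : X → ℝ, Continuous f → HasCompactSupport f → ∫ x, f x ∂μ = ∫ z, ∫ x, f x ∂(m z) ∂μ) ∧
      ∀ᵐ z ∂μ, (∀ r, uu r ∈ stab (m z)) ∧ (∀ᵐ x ∂(m z), Generic (m z) x) ∧ (∀ᵐ x ∂(m z), P x) ∧ Generic (m z) z := by
  obtain ⟨S, hS, hd⟩ := exists_dense_cc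
  have hΩ := fun i => measurable_limit_of_tendsto_metrizable_ae
    (fun N => (continuous_orbitAvg (hS i).1 N).aemeasurable) (ae_tendsto_orbitAvg hU (hS i).1 (hS i).2)
  choose ω hωm hω using hΩ
  set Ω : X → ℕ → ℝ := fun x i => ω i x; have hΩm : Measurable Ω := measurable_pi_iff.2 hωm
  have hpm : Measurable fun x => (Ω x, x) := hΩm.prodMk measurable_id
  set ρ : Measure ((ℕ → ℝ) × X) := μ.map fun x => (Ω x, x) with hρ
  have : IsProbabilityMeasure ρ := Measure.isProbabilityMeasure_map hpm.aemeasurable; have : Nonempty X := ⟨x₀⟩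
  have hfst : ρ.fst = μ.map Ω := by rw [hρ, Measure.fst, Measure.map_map measurable_fst hpm]; rfl
  have hsnd : ρ.map Prod.snd = μ := by rw [hρ, Measure.map_map measurable_snd hpm]; exact Measure.map_id
  set κ := ρ.condKernel; have hdis : ρ.fst ⊗ₘ κ = ρ := ρ.disintegrate κ
  have toμ : ∀ {Q : (ℕ → ℝ) → Prop}, (∀ᵐ w ∂ρ.fst, Q w) → ∀ᵐ z ∂μ, Q (Ω z) := fun h => by
    rw [hfst] at h; exact ae_of_ae_map hΩm.aemeasurable h
  have fib : ∀ {Q : X → Prop}, (∀ᵐ x ∂μ, Q x) → ∀ᵐ w ∂ρ.fst, ∀ᵐ x ∂κ w, Q x := fun {Q} h => by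
    rw [← hsnd] at h; have := ae_of_ae_map measurable_snd.aemeasurable h; rw [← hdis] at this
    exact Measure.ae_ae_of_ae_compProd this
  have hconv : ∀ᵐ x ∂μ, ∀ i, Tendsto (fun N => orbitAvg (S i) N x) atTop (𝓝 (Ω x i)) := ae_all_iff.2 hω
  have hΩinv : ∀ r, ∀ᵐ x ∂μ, Ω (uu r • x) = Ω x := by
    intro r
    filter_upwards [hconv, (measurePreserving_of_mem_stab (hU r)).quasiMeasurePreserving.ae hconv] with x h1 h2
    funext i
    obtain ⟨M, hM0, hM⟩ := exists_bound (hS i).1 (hS i).2; refine tendsto_nhds_unique (h2 i) ?_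
    have hz : Tendsto (fun N => orbitAvg (S i) N (uu r • x) - orbitAvg (S i) N x) atTop (𝓝 0) := by
      have h0 : Tendsto (fun n : ℕ => (n : ℝ)⁻¹ * (2 * M * |r|)) atTop (𝓝 0) := by
        simpa using tendsto_inv_atTop_nhds_zero_nat.mul_const (2 * M * |r|)
      refine squeeze_zero_norm (fun N => ?_) h0
      have hi : ∀ a b : ℝ, IntervalIntegrable (fun s => S i (uu s • x)) volume a b := fun a b =>
        (continuous_orbit (hS i).1 x).intervalIntegrable _ _
      have e := intervalIntegral.integral_comp_add_right (a := 0) (b := (N : ℝ)) (fun s => S i (uu s • x)) r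
      simp only [orbitAvg, smul_smul, ← uu_add, e, ← mul_sub, norm_mul, norm_inv, Real.norm_natCast]; gcongr
      rw [intervalIntegral.integral_interval_sub_interval_comm' (hi _ _) (hi _ _) (hi _ _)]
      have b1 := intervalIntegral.norm_integral_le_of_norm_le_const (a := (N : ℝ)) (b := N + r) (C := M)
        (f := fun s => S i (uu s • x)) fun t _ => hM _
      have b2 := intervalIntegral.norm_integral_le_of_norm_le_const (a := (0 : ℝ)) (b := 0 + r) (C := M)
        (f := fun s => S i (uu s • x)) fun t _ => hM _
      simp only [add_sub_cancel_left] at b1 b2; exact (norm_sub_le _ _).trans (by linarith)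
    simpa using hz.add (h1 i)
  have hinv : ∀ r, ∀ᵐ w ∂ρ.fst, uu r ∈ stab (κ w) := by
    intro r; have hm := measurable_smulX (uu r)
    have e : ρ = ρ.fst ⊗ₘ (κ.map fun x => uu r • x) := by
      rw [Measure.compProd_map hm, hdis, hρ, Measure.map_map (measurable_id.prodMap hm) hpm]
      conv_lhs => rw [← mem_stab.1 (hU r), Measure.map_map hpm hm]
      refine Measure.map_congr ?_
      filter_upwards [hΩinv r] with x hx
      exact Prod.ext hx rfl
    filter_upwards [ProbabilityTheory.eq_condKernel_of_measure_eq_compProd _ e] with w hw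
    rwa [ProbabilityTheory.Kernel.map_apply _ hm] at hw
  have hdiag : ∀ᵐ w ∂ρ.fst, ∀ᵐ x ∂κ w, Ω x = w := by
    have : ∀ᵐ p ∂ρ, Ω p.2 = p.1 := by
      exact (ae_map_iff hpm.aemeasurable (measurableSet_eq_fun (hΩm.comp measurable_snd) measurable_fst)).2
        (.of_forall fun x => rfl)
    rw [← hdis] at this; exact Measure.ae_ae_of_ae_compProd this
  have gen : ∀ (ν : Measure X) [IsProbabilityMeasure ν] (x : X),
      (∀ i, Tendsto (fun N => orbitAvg (S i) N x) atTop (𝓝 (∫ y, S i y ∂ν))) → Generic ν x := fun ν _ x h =>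
    (UnifGeneric.of_dense (K := {x}) hS hd fun i => tendstoUniformlyOn_singleton_iff_tendsto.2 (h i)).generic rfl
  have hgood : ∀ᵐ w ∂ρ.fst, (∀ r, uu r ∈ stab (κ w)) ∧ (∀ᵐ x ∂κ w, Generic (κ w) x) ∧ ∀ i, w i = ∫ x, S i x ∂κ w := by
    filter_upwards [ae_all_iff.2 fun q : ℚ => hinv q, hdiag, fib hconv] with w h1 h2 h3
    have hu := mem_stab_of_rat continuous_uu h1
    have hc : ∀ᵐ x ∂κ w, ∀ i, Tendsto (fun N => orbitAvg (S i) N x) atTop (𝓝 (w i)) := by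
      filter_upwards [h2, h3] with x hx hx' i
      rw [← hx]; exact hx' i
    have hw : ∀ i, w i = ∫ x, S i x ∂κ w := by
      intro i; obtain ⟨M, hM0, hM⟩ := exists_bound (hS i).1 (hS i).2
      have h0 : ∀ N x, |orbitAvg (S i) N x| ≤ M := fun N x => by
        simpa [orbitAvg] using abs_orbitAvg_sub_le (hS i).1 continuous_const hM0.le (g := fun _ => 0) (by simpa using hM) N x
      have lim := tendsto_integral_of_dominated_convergence (μ := κ w) (fun _ => M)
        (fun N => (continuous_orbitAvg (hS i).1 N).aestronglyMeasurable) (integrable_const M)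
        (fun N => .of_forall fun x => h0 N x) (hc.mono fun x hx => hx i)
      simp only [integral_const, probReal_univ, one_smul] at lim
      refine tendsto_nhds_unique lim (tendsto_const_nhds.congr' ?_)
      filter_upwards [eventually_gt_atTop 0] with N hN
      exact (integral_orbitAvg hu (hS i).1 (hS i).2 hN).symm
    refine ⟨hu, ?_, hw⟩
    filter_upwards [hc] with x hx
    exact gen _ x fun i => hw i ▸ hx i
  refine ⟨fun z => κ (Ω z), fun z => inferInstance, fun f hf => ?_, fun f hf hc => ?_, ?_⟩
  · exact (StronglyMeasurable.integral_kernel (κ := κ) hf.stronglyMeasurable).measurable.comp hΩm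
  · have hi : Integrable (fun p : (ℕ → ℝ) × X => f p.2) ρ := by
      obtain ⟨M, -, hM⟩ := exists_bound hf hc
      exact Integrable.of_bound (hf.measurable.comp measurable_snd).aestronglyMeasurable M (.of_forall fun p => hM _)
    have e1 : ∫ x, f x ∂μ = ∫ p, f p.2 ∂ρ := by
      conv_lhs => rw [← hsnd]
      exact integral_map measurable_snd.aemeasurable hf.aestronglyMeasurable
    rw [e1]
    conv_lhs => rw [← hdis]
    rw [Measure.integral_compProd (by rwa [hdis]), hfst]
    exact integral_map hΩm.aemeasurable (StronglyMeasurable.integral_kernel hf.stronglyMeasurable).aestronglyMeasurable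
  · filter_upwards [toμ hgood, toμ (fib hP), hconv] with z h1 h2 h3
    exact ⟨h1.1, h1.2.1, h2, gen _ z fun i => h1.2.2 i ▸ h3 i⟩

/-! ### Measures invariant under `gSL` and `uu` -/

lemma mem_stab_of_dense {S : ℕ → X → ℝ} (hS : ∀ i, Continuous (S i) ∧ HasCompactSupport (S i))
    (hd : ∀ f : X → ℝ, Continuous f → HasCompactSupport f → ∀ ε > 0, ∃ i, ∀ x, |f x - S i x| ≤ ε) {g : G}
    (h : ∀ i, ∫ x, S i (g • x) ∂ν = ∫ x, S i x ∂ν) : g ∈ stab ν := by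
  refine mem_stab_of_integral fun f hf hc => eq_of_forall_dist_le fun ε hε => ?_
  obtain ⟨i, hi⟩ := hd f hf hc (ε / 2) (by positivity)
  have hI : ∀ k : G, ∀ {u : X → ℝ}, Continuous u → HasCompactSupport u → Integrable (fun x => u (k • x)) ν :=
    fun k u hu hc => integrable_cc (hu.comp (continuous_const_smul k)) (hc.comp_smulX k)
  have b1 := abs_integral_sub_le (ν := ν) (hI g hf hc) (hI g (hS i).1 (hS i).2) fun x => hi (g • x)
  have b2 := abs_integral_sub_le (ν := ν) (integrable_cc hf hc) (integrable_cc (hS i).1 (hS i).2) hi; rw [h i] at b1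
  rw [Real.dist_eq]
  rw [abs_le] at *
  constructor <;> linarith [b1.1, b1.2, b2.1, b2.2]

lemma continuous_nn : Continuous fun q : ℝ × ℝ => nn q.1 q.2 := by
  refine continuous_of_entries fun i j => ?_
  rcases fin3 i with rfl|rfl|rfl <;> rcases fin3 j with rfl|rfl|rfl <;> simp <;> fun_prop

/-- A diagonal element contracting `uu` by the factor `2`. -/
def halving : G := gSL (-(Real.log 2 / 3))

lemma halving_pow_conj (n : ℕ) (h : G) (i j : Fin 3) : (halving ^ n * h * (halving ^ n)⁻¹ : G) i j =
    (if i = 0 then if j = 0 then 1 else 1 / 2 else if j = 0 then 2 else 1) ^ n * h i j := by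
  obtain ⟨hd, e⟩ := gSL_eq (-(Real.log 2 / 3)); rw [halving, e, diagG_pow_conj]; congr 2
  have h1 : exp (2 * -(Real.log 2 / 3)) / exp (- -(Real.log 2 / 3)) = 1 / 2 := by
    rw [← Real.exp_sub, show 2 * -(Real.log 2 / 3) - - -(Real.log 2 / 3) = -Real.log 2 by ring, exp_neg,
      exp_log two_pos, one_div]
  have h2 : exp (- -(Real.log 2 / 3)) / exp (2 * -(Real.log 2 / 3)) = 2 := by rw [← inv_div, h1]; norm_num
  rcases fin3 i with rfl|rfl|rfl <;> rcases fin3 j with rfl|rfl|rfl <;> simp [-neg_neg, -mul_neg, h1, h2]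

lemma halving_nn (n : ℕ) (p w : ℝ) : halving ^ n * nn p w * (halving ^ n)⁻¹ = nn ((1 / 2) ^ n * p) w := by
  apply G_ext_fin <;> rw [halving_pow_conj] <;> simp

lemma halving_uu (r : ℝ) : uu r * halving = halving * uu (2 * r) := by
  have : halving ^ 1 * uu (2 * r) * (halving ^ 1)⁻¹ = uu r := by apply G_ext_fin <;> rw [halving_pow_conj] <;> simp
  rw [← this]; group

lemma Generic.halving_smul {ν : Measure X} {x : X} (h : Generic ν x) :
    Generic (ν.map fun y => halving • y) (halving • x) := by
  intro f hf hc; rw [integral_map (measurable_smulX _).aemeasurable hf.aestronglyMeasurable]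
  refine ((h _ (hf.comp (continuous_const_smul halving)) (hc.comp_smulX halving)).comp
    (tendsto_id.const_mul_atTop' (two_pos : (0 : ℕ) < 2))).congr fun N => ?_
  have := intervalIntegral.integral_comp_mul_left (a := 0) (b := (N : ℝ)) (fun r => f (halving • uu r • x)) two_ne_zero
  simp only [Function.comp, id, orbitAvg, smul_smul, halving_uu] at this ⊢; rw [this]; push_cast; simp [mul_comm]; ring

variable {μX : Measure X} [IsProbabilityMeasure μX] [SMulInvariantMeasure G X μX]

theorem eq_of_gSL_uu {μ : Measure X} [IsProbabilityMeasure μ] (hA : ∀ t, gSL t ∈ stab μ) (hU : ∀ r, uu r ∈ stab μ) :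
    μ = μX := by
  obtain ⟨m, hmP, hmm, hμm, hgood⟩ := exists_decomposition hU (ae_irrationalPt hA)
  obtain ⟨S, hS, hd⟩ := exists_dense_cc; have hX : ∀ g : G, g ∈ stab μX := fun g => (measurePreserving_smul g μX).map_eq
  have hpow : ∀ n : ℕ, halving ^ n ∈ stab μ := fun n => pow_mem (hA _) n
  have horb : ∀ᵐ z ∂μ, ∀ n : ℕ, (∀ r, uu r ∈ stab (m (halving ^ n • z))) ∧
      (∀ᵐ x ∂(m (halving ^ n • z)), Generic (m (halving ^ n • z)) x) ∧
      (∀ᵐ x ∂(m (halving ^ n • z)), IrrationalPt x) ∧ Generic (m (halving ^ n • z)) (halving ^ n • z) :=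
    ae_all_iff.2 fun n => (measurePreserving_of_mem_stab (hpow n)).quasiMeasurePreserving.ae hgood
  set F : ℕ → ℝ → X → ℝ := fun i s z => |∫ x, S i (nn 0 s • x) ∂(m z) - ∫ x, S i x ∂(m z)| with hF
  have hFm : ∀ i s, Measurable (F i s) := fun i s =>
    ((hmm _ ((hS i).1.comp (continuous_const_smul _))).sub (hmm _ (hS i).1)).abs
  have hlim : ∀ᵐ z ∂μ, ∀ i s, Tendsto (fun n : ℕ => F i s (halving ^ n • z)) atTop (𝓝 0) := by
    filter_upwards [horb] with z hz i s
    have hmn : ∀ n : ℕ, m (halving ^ n • z) = (m z).map fun y => halving ^ n • y := by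
      intro n
      induction n with
      | zero => simp
      | succ n ih =>
        have h1 := (hz n).2.2.2.halving_smul
        rw [smul_smul, ← pow_succ', ih, Measure.map_map (measurable_smulX _) (measurable_smulX _)] at h1
        have e : (fun y : X => halving • y) ∘ (fun y => halving ^ n • y) = fun y => halving ^ (n + 1) • y := by
          funext y; simp [smul_smul, pow_succ']
        rw [e] at h1
        have := Measure.isProbabilityMeasure_map (μ := m z) (measurable_smulX (halving ^ (n + 1))).aemeasurable
        exact measure_ext_cc fun f hf hc => tendsto_nhds_unique ((hz (n + 1)).2.2.2 f hf hc) (h1 f hf hc)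
    obtain ⟨hz1, hz2, hz3, -⟩ := hz 0; simp only [pow_zero, one_smul] at hz1 hz2 hz3
    obtain ⟨p, w, hpw, hline⟩ := exists_nn_line_mem_stab hz1 hz2 hz3
    by_cases hw : w = 0
    · subst hw; have hp : p ≠ 0 := hpw.resolve_right (not_not.2 rfl)
      have hz0 : m z = μX := eq_of_horospherical hz1 hz3 (Or.inl fun q => by
        have := hline (q / p)
        rwa [mul_zero, div_mul_cancel₀ _ hp] at this)
      refine tendsto_const_nhds.congr fun n => ?_; rw [hF]; simp only
      rw [hmn, hz0, show μX.map (fun y => halving ^ n • y) = μX from hX _, integral_smul_of_mem_stab (hX _), sub_self,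
        abs_zero]
    · rw [Metric.tendsto_atTop]; intro ε hε
      obtain ⟨θ, hθ, hu⟩ := UnifCont.of_compactSupport (hS i).1 (hS i).2 (ε / 2) (by positivity)
      have hq : Tendsto (fun n : ℕ => nn 0 s * (nn ((1 / 2) ^ n * (s / w * p)) s)⁻¹) atTop (𝓝 1) := by
        have h0 : Tendsto (fun n : ℕ => ((1 / 2 : ℝ) ^ n * (s / w * p), s)) atTop (𝓝 (0 * (s / w * p), s)) :=
          ((_root_.tendsto_pow_atTop_nhds_zero_of_lt_one (by norm_num) (by norm_num)).mul_const _).prodMk_nhds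
            tendsto_const_nhds
        have := (((continuous_nn.tendsto _).comp h0).inv).const_mul (nn 0 s); rwa [zero_mul, mul_inv_cancel] at this
      obtain ⟨N, hN⟩ := eventually_atTop.1 (hq (nearOne_mem_nhds hθ)); refine ⟨N, fun n hn => ?_⟩
      have hst : nn ((1 / 2) ^ n * (s / w * p)) s ∈ stab (m (halving ^ n • z)) := by
        have := stab_map (h := halving ^ n) (hline (s / w)); rwa [halving_nn, ← hmn, div_mul_cancel₀ _ hw] at this
      set q := nn 0 s * (nn ((1 / 2) ^ n * (s / w * p)) s)⁻¹ with hqd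
      have e : ∫ x, S i (nn 0 s • x) ∂(m (halving ^ n • z)) = ∫ x, S i (q • x) ∂(m (halving ^ n • z)) := by
        rw [← integral_smul_of_mem_stab hst fun x => S i (q • x)]; simp [hqd, smul_smul]
      have b := abs_integral_sub_le (ν := m (halving ^ n • z)) (f := fun x => S i (q • x))
        (integrable_cc ((hS i).1.comp (continuous_const_smul q)) ((hS i).2.comp_smulX q))
        (integrable_cc (hS i).1 (hS i).2) (hu q (hN n hn))
      rw [Real.dist_eq, sub_zero, hF]; simp only; rw [abs_abs, e]; linarith
  have hzero : ∀ i s, ∀ᵐ z ∂μ, F i s z = 0 := by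
    intro i s; obtain ⟨M, hM0, hM⟩ := exists_bound (hS i).1 (hS i).2
    have hFb : ∀ z, ‖F i s z‖ ≤ 2 * M := by
      intro z
      have b : ∀ k : G, |∫ x, S i (k • x) ∂(m z)| ≤ M := fun k => by
        simpa using norm_integral_le_of_norm_le_const (μ := m z) (f := fun x => S i (k • x))
          (.of_forall fun x => hM (k • x))
      have b1 := b (nn 0 s); have b2 := b 1; simp only [one_smul] at b2; rw [hF, norm_eq_abs, abs_abs]
      exact (abs_sub _ _).trans (by linarith)
    have hnt : Integrable (F i s) μ := Integrable.of_bound (hFm i s).aestronglyMeasurable _ (.of_forall hFb)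
    have lim := tendsto_integral_of_dominated_convergence (μ := μ) (fun _ => 2 * M)
      (F := fun (n : ℕ) z => F i s (halving ^ n • z)) (f := fun _ => 0)
      (fun n => ((hFm i s).comp (measurable_smulX _)).aestronglyMeasurable) (integrable_const _)
      (fun n => .of_forall fun z => hFb _) (hlim.mono fun z hz => hz i s)
    simp only [fun n : ℕ => integral_smul_of_mem_stab (hpow n) (F i s), integral_zero] at lim
    have h0 := tendsto_nhds_unique tendsto_const_nhds lim
    exact (integral_eq_zero_iff_of_nonneg (fun z => abs_nonneg _) hnt).1 h0
  have hall : ∀ᵐ z ∂μ, ∀ i, ∀ q : ℚ, F i q z = 0 := ae_all_iff.2 fun i => ae_all_iff.2 fun q => hzero i q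
  have hmz : ∀ᵐ z ∂μ, m z = μX := by
    filter_upwards [hall, hgood] with z h1 h2
    refine eq_of_horospherical h2.1 h2.2.2.1 (Or.inr (mem_stab_of_rat (p := fun w => nn 0 w)
      (continuous_nn.comp (by fun_prop : Continuous fun w : ℝ => ((0 : ℝ), w))) fun q => ?_))
    exact mem_stab_of_dense hS hd fun i => sub_eq_zero.1 (abs_eq_zero.1 (h1 i q))
  refine measure_ext_cc fun f hf hc => ?_
  rw [hμm f hf hc, integral_congr_ae (hmz.mono fun z hz => by rw [hz] : _ =ᵐ[μ] fun _ => ∫ x, f x ∂μX)]; simp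

/-! ### The averages -/

/-- The points `g_t φ(s) x₀`. -/
def orbitPt (a b : ℝ) (p : ℝ × ℝ) : X := gSL p.1 • phiSL a b p.2 • x₀

/-- The normalized Lebesgue measure on `(0, T]`. -/
def timeM (T : ℝ) : Measure ℝ := (ofR T)⁻¹ • volume.restrict (Ioc (0 : ℝ) T)

/-- The normalized Lebesgue measure on `[s₁, s₂]`. -/
def spaceM (s₁ s₂ : ℝ) : Measure ℝ := (volume (Icc s₁ s₂))⁻¹ • volume.restrict (Icc s₁ s₂)

lemma isProbabilityMeasure_timeM {T : ℝ} (hT : 0 < T) : IsProbabilityMeasure (timeM T) := ⟨by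
  simp [timeM, ENNReal.inv_mul_cancel, hT]⟩

lemma isProbabilityMeasure_spaceM {s₁ s₂ : ℝ} (h : s₁ < s₂) : IsProbabilityMeasure (spaceM s₁ s₂) := ⟨by
  simp [spaceM, ENNReal.inv_mul_cancel, h]⟩

lemma continuous_gSL : Continuous gSL := by
  refine continuous_of_entries fun i j => ?_
  rcases fin3 i with rfl|rfl|rfl <;> rcases fin3 j with rfl|rfl|rfl <;> simp [gSL] <;> fun_prop

lemma continuous_phiSL (a b : ℝ) : Continuous (phiSL a b) := by
  refine continuous_of_entries fun i j => ?_
  rcases fin3 i with rfl|rfl|rfl <;> rcases fin3 j with rfl|rfl|rfl <;> simp [phiSL] <;> fun_prop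

lemma continuous_orbitPt (a b : ℝ) : Continuous (orbitPt a b) :=
  (continuous_gSL.comp continuous_fst).smul ((continuous_orbitG x₀).comp ((continuous_phiSL a b).comp continuous_snd))

variable {a b s₁ s₂ : ℝ}

lemma avgMeasure_eq (h : s₁ < s₂) (T : ℝ) :
    avgMeasure a b s₁ s₂ T = ((timeM T).prod (spaceM s₁ s₂)).map (orbitPt a b) := by
  have := isProbabilityMeasure_spaceM h; have hm := (continuous_orbitPt a b).measurable
  have e : ∀ (t : ℝ) {E : Set X}, MeasurableSet E →
      gtLambda a b s₁ s₂ t E = spaceM s₁ s₂ (Prod.mk t ⁻¹' (orbitPt a b ⁻¹' E)) := by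
    intro t E hE
    have h1 : Measurable fun s => phiSL a b s • x₀ := ((continuous_orbitG x₀).comp (continuous_phiSL a b)).measurable
    rw [gtLambda, lambdaAB, Measure.map_map (measurable_smulX _) h1, Measure.map_apply ((measurable_smulX _).comp h1) hE]
    rfl
  ext E hE; rw [Measure.map_apply hm hE, Measure.prod_apply (hm hE), avgMeasure, Measure.bind_apply hE]
  · exact lintegral_congr fun t => e t hE
  · refine (Measure.measurable_of_measurable_coe _ fun E hE => ?_).aemeasurable; simp only [fun t => e t hE]
    exact measurable_measure_prodMk_left (hm hE)

lemma isProbabilityMeasure_avgMeasure (h : s₁ < s₂) {T : ℝ} (hT : 0 < T) :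
    IsProbabilityMeasure (avgMeasure a b s₁ s₂ T) := by
  have := isProbabilityMeasure_spaceM h; have := isProbabilityMeasure_timeM hT; rw [avgMeasure_eq h]
  exact Measure.isProbabilityMeasure_map (continuous_orbitPt a b).measurable.aemeasurable

lemma avgMeasure_apply (h : s₁ < s₂) (T : ℝ) {E : Set X} (hE : MeasurableSet E) :
    avgMeasure a b s₁ s₂ T E = ∫⁻ t, spaceM s₁ s₂ {s | orbitPt a b (t, s) ∈ E} ∂(timeM T) := by
  have := isProbabilityMeasure_spaceM h; have hm := (continuous_orbitPt a b).measurable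
  rw [avgMeasure_eq h, Measure.map_apply hm hE, Measure.prod_apply (hm hE)]; rfl

lemma ae_timeM (T : ℝ) : ∀ᵐ t ∂(timeM T), t ∈ Ioc 0 T := Measure.ae_smul_measure (ae_restrict_mem measurableSet_Ioc) _

lemma ae_spaceM (s₁ s₂ : ℝ) : ∀ᵐ s ∂(spaceM s₁ s₂), s ∈ Icc s₁ s₂ :=
  Measure.ae_smul_measure (ae_restrict_mem measurableSet_Icc) _

/-- Mass can only escape as `T → ∞`. -/
lemma no_escape_of_eventually (h : s₁ < s₂)
    (H : ∀ c < (1 : ℝ≥0∞), ∃ K : Set X, IsCompact K ∧ ∀ᶠ T in atTop, c < avgMeasure a b s₁ s₂ T K)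
    (ε : ℝ≥0∞) (hε : 0 < ε) : ∃ K : Set X, IsCompact K ∧ ∀ T : ℝ, 0 < T → 1 - ε < avgMeasure a b s₁ s₂ T K := by
  have hc : 1 - ε < 1 := ENNReal.sub_lt_self one_ne_top one_ne_zero hε.ne'; obtain ⟨K, hK, hev⟩ := H _ hc
  obtain ⟨T₀, hT₀⟩ := eventually_atTop.1 hev
  have hK' : IsCompact (orbitPt a b '' (Icc 0 T₀ ×ˢ Icc s₁ s₂)) :=
    (isCompact_Icc.prod isCompact_Icc).image (continuous_orbitPt a b)
  refine ⟨K ∪ orbitPt a b '' (Icc 0 T₀ ×ˢ Icc s₁ s₂), hK.union hK', fun T hT => ?_⟩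
  rcases le_total T₀ T with h1 | h1
  · exact (hT₀ T h1).trans_le (measure_mono Set.subset_union_left)
  · refine lt_of_lt_of_le hc ?_; have := isProbabilityMeasure_spaceM h; have := isProbabilityMeasure_timeM hT
    rw [avgMeasure_apply h T (hK.union hK').isClosed.measurableSet]
    calc (1 : ℝ≥0∞) = ∫⁻ _, 1 ∂(timeM T) := by simp
      _ ≤ _ := lintegral_mono_ae ?_
    filter_upwards [ae_timeM T] with t ht
    rw [← measure_univ (μ := spaceM s₁ s₂)]; refine measure_mono_ae ?_
    filter_upwards [ae_spaceM s₁ s₂] with s hs _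
    exact Or.inr ⟨(t, s), ⟨⟨ht.1.le, ht.2.trans h1⟩, hs⟩, rfl⟩

theorem no_escape_of_equidistribution (h : s₁ < s₂) {μX : Measure X} [IsProbabilityMeasure μX]
    (H : ∀ f : C(X, ℝ), HasCompactSupport f →
      Tendsto (fun T => ∫ x, f x ∂(avgMeasure a b s₁ s₂ T)) atTop (𝓝 (∫ x, f x ∂μX))) :
    ∀ ε : ℝ≥0∞, 0 < ε → ∃ K : Set X, IsCompact K ∧ ∀ T : ℝ, 0 < T → 1 - ε < avgMeasure a b s₁ s₂ T K := by
  refine no_escape_of_eventually h fun c hc => ?_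
  obtain ⟨K, -, hK, hcK⟩ := isOpen_univ.exists_lt_isCompact (μ := μX) (by rwa [measure_univ] : c < μX Set.univ)
  obtain ⟨f, hf1, hfc, -, hf01⟩ := exists_continuousMap_one_of_isCompact_subset_isOpen hK isOpen_univ (Set.subset_univ K)
  have ind : ∀ (ν : Measure X) [IsProbabilityMeasure ν] (E : Set X), MeasurableSet E → ∫ x, E.indicator 1 x ∂ν = ν.real E :=
    fun ν _ E hE => integral_indicator_one hE
  have hnt : ∀ (ν : Measure X) [IsProbabilityMeasure ν] (E : Set X), MeasurableSet E →
      Integrable (E.indicator (1 : X → ℝ)) ν := fun ν _ E hE => (integrable_const (1 : ℝ)).indicator hE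
  have h1 : c.toReal < ∫ x, f x ∂μX := by
    refine lt_of_lt_of_le ((toReal_lt_toReal hc.ne_top (measure_ne_top _ _)).2 hcK) ?_
    rw [← measureReal_def, ← ind μX K hK.isClosed.measurableSet]
    refine integral_mono (hnt _ _ hK.isClosed.measurableSet) (integrable_cc f.continuous hfc) fun x => ?_
    by_cases hx : x ∈ K
    · simp [hx, hf1 hx]
    · simpa [hx] using (hf01 x).1
  refine ⟨tsupport f, hfc, ?_⟩
  filter_upwards [(H f hfc).eventually_const_lt h1, eventually_gt_atTop 0] with T hT hT0
  have := isProbabilityMeasure_avgMeasure (a := a) (b := b) h hT0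
  rw [← toReal_lt_toReal hc.ne_top (measure_ne_top _ _)]; refine hT.trans_le ?_
  rw [← measureReal_def, ← ind _ _ (isClosed_tsupport f).measurableSet]
  refine integral_mono (integrable_cc f.continuous hfc) (hnt _ _ (isClosed_tsupport f).measurableSet) fun x => ?_
  by_cases hx : x ∈ tsupport f
  · simpa [hx] using (hf01 x).2
  · simp [hx, image_eq_zero_of_notMem_tsupport hx]

lemma exists_large_solution (hW : W2' a b) : ∃ ε > (0 : ℝ), ∀ Q : ℝ, ∃ p₁ p₂ q : ℤ, Q ≤ q ∧ 1 ≤ q ∧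
    |(q : ℝ) * b + p₁| ≤ (q : ℝ) ^ (-(2 + ε) : ℝ) ∧ |(q : ℝ) * a + p₂| ≤ (q : ℝ) ^ (-(2 + ε) : ℝ) := by
  obtain ⟨ε, hε, hinf⟩ := hW; refine ⟨ε, hε, fun Q => ?_⟩; by_contra hcon; push Not at hcon
  have bd : ∀ (c : ℝ) (p q : ℤ), 0 < q → (q : ℝ) < Q → |(q : ℝ) * c + p| ≤ (q : ℝ) ^ (-(2 + ε) : ℝ) →
      |(p : ℝ)| ≤ Q * |c| + 1 := by
    intro c p q hq hqQ hp; have hq1 : (1 : ℝ) ≤ q := by exact_mod_cast hq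
    have h1 : (q : ℝ) ^ (-(2 + ε) : ℝ) ≤ 1 := Real.rpow_le_one_of_one_le_of_nonpos hq1 (by linarith)
    have h2 : |(p : ℝ)| ≤ |(q : ℝ) * c + p| + |(q : ℝ) * c| := by
      have := abs_sub ((q : ℝ) * c + p) (q * c); rwa [add_sub_cancel_left] at this
    rw [abs_mul, abs_of_pos (by linarith : (0 : ℝ) < q)] at h2; have := mul_le_mul_of_nonneg_right hqQ.le (abs_nonneg c)
    linarith
  refine hinf (((finite_Icc (-⌈Q * |b| + 1⌉) ⌈Q * |b| + 1⌉).prod ((finite_Icc (-⌈Q * |a| + 1⌉)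
    ⌈Q * |a| + 1⌉).prod (finite_Icc 0 ⌈Q⌉))).subset ?_)
  rintro ⟨p₁, p₂, q⟩ ⟨hq, h1, h2⟩
  simp only at hq h1 h2
  have hqQ : (q : ℝ) < Q := by by_contra h3; exact absurd h2 (not_le.2 (hcon p₁ p₂ q (not_lt.1 h3) hq h1))
  have c1 := abs_le.1 ((bd b p₁ q hq hqQ h1).trans (Int.le_ceil _))
  have c2 := abs_le.1 ((bd a p₂ q hq hqQ h2).trans (Int.le_ceil _))
  exact ⟨⟨by exact_mod_cast c1.1, by exact_mod_cast c1.2⟩, ⟨by exact_mod_cast c2.1, by exact_mod_cast c2.2⟩,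
    hq.le, by exact_mod_cast hqQ.le.trans (Int.le_ceil Q)⟩

lemma lat_phiSL (s : ℝ) (v : Fin 3 → ℤ) : lat (phiSL a b s) v 0 = v 0 + s * v 1 + (a * s + b) * v 2 ∧
    lat (phiSL a b s) v 1 = v 1 ∧ lat (phiSL a b s) v 2 = v 2 := by
  refine ⟨?_, ?_, ?_⟩ <;> rw [lat_apply] <;> simp [phiSL]

theorem not_W2'_of_no_escape (h : s₁ < s₂) (H : ∀ ε : ℝ≥0∞, 0 < ε → ∃ K : Set X, IsCompact K ∧
    ∀ T : ℝ, 0 < T → 1 - ε < avgMeasure a b s₁ s₂ T K) : ¬ W2' a b := by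
  intro hW; obtain ⟨ε, hε, hsol⟩ := exists_large_solution hW
  obtain ⟨K, hK, hKT⟩ := H (ofR (ε / 8 / (1 + ε / 4))) (ofReal_pos.2 (by positivity))
  obtain ⟨ρ, hρ, hKρ⟩ := exists_le_norm_lat hK
  set C : ℝ := 2 + |a| + |s₁| + |s₂|
  have hC0 : 0 < C := by positivity
  obtain ⟨Q, hQ⟩ := eventually_atTop.1 (((tendsto_rpow_neg_atTop (show 0 < ε / 8 by positivity)).const_mul C).eventually_lt_const
    (by rwa [mul_zero] : C * 0 < ρ))
  obtain ⟨p₁, p₂, q, hqQ, hq1, hb, ha⟩ := hsol (max Q 2); have hq : (2 : ℝ) ≤ q := (le_max_right _ _).trans hqQ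
  have hq0 : (0 : ℝ) < q := by linarith
  have hlog : 0 < Real.log q := Real.log_pos (by linarith); have hsmall := hQ q ((le_max_left _ _).trans hqQ)
  set T : ℝ := (1 + ε / 4) * Real.log q with hT; have hT0 : 0 < T := by positivity
  set J : Set ℝ := Ioc ((1 + ε / 8) * Real.log q) T with hJ
  have hbad : ∀ t ∈ J, ∀ s ∈ Icc s₁ s₂, orbitPt a b (t, s) ∉ K := by
    rintro t ⟨ht1, ht2⟩ s hs hmem
    have hv : (![p₁, p₂, q] : Fin 3 → ℤ) ≠ 0 := fun h0 => by have := congrFun h0 2; simp at this; omega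
    have hs' : |s| ≤ |s₁| + |s₂| := by
      rw [abs_le]; constructor <;> linarith [hs.1, hs.2, neg_abs_le s₁, le_abs_self s₂, abs_nonneg s₁, abs_nonneg s₂]
    have hx : orbitPt a b (t, s) = ((gSL t * phiSL a b s : G) : X) := by rw [orbitPt, x₀, smul_mk, smul_mk, mul_one]
    have := hKρ _ (hx ▸ hmem) _ hv
    refine absurd this (not_le.2 (lt_of_le_of_lt ((pi_norm_le_iff_of_nonneg (by positivity)).2 fun i => ?_) hsmall))
    obtain ⟨l0, l1, l2⟩ := lat_gSL t (phiSL a b s) ![p₁, p₂, q]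
    obtain ⟨k0, k1, k2⟩ := lat_phiSL (a := a) (b := b) s ![p₁, p₂, q]
    have ex : ∀ y : ℝ, (q : ℝ) ^ y = exp (Real.log q * y) := fun y => Real.rpow_def_of_pos hq0 y
    have e1 : exp (-t) * q ≤ (q : ℝ) ^ (-(ε / 8)) := by
      rw [ex]; nth_rw 1 [← exp_log hq0]; rw [← exp_add]; exact exp_le_exp.2 (by linarith)
    have e2 : exp (2 * t) * (q : ℝ) ^ (-(2 + ε) : ℝ) ≤ (q : ℝ) ^ (-(ε / 8)) := by
      rw [ex, ex, ← exp_add]; refine exp_le_exp.2 ?_; have : 0 < Real.log q * ε := by positivity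
      nlinarith
    have hP := Real.rpow_nonneg hq0.le (-(ε / 8))
    have hle1 : (q : ℝ) ^ (-(2 + ε) : ℝ) ≤ 1 := Real.rpow_le_one_of_one_le_of_nonpos (by linarith) (by linarith)
    rcases fin3 i with rfl|rfl|rfl
    · rw [l0, k0, norm_mul, norm_of_nonneg (exp_pos _).le, norm_eq_abs]
      have e3 : |((![p₁, p₂, q] : Fin 3 → ℤ) 0 : ℝ) + s * ((![p₁, p₂, q] : Fin 3 → ℤ) 1 : ℝ) +
          (a * s + b) * ((![p₁, p₂, q] : Fin 3 → ℤ) 2 : ℝ)| ≤ C * (q : ℝ) ^ (-(2 + ε) : ℝ) := by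
        simp only [cons_val]; have : (p₁ : ℝ) + s * p₂ + (a * s + b) * q = (q * b + p₁) + s * (q * a + p₂) := by ring
        rw [this]; refine (abs_add_le _ _).trans ?_; rw [abs_mul]
        have := mul_le_mul hs' ha (abs_nonneg _) (by positivity)
        nlinarith [abs_nonneg a, abs_nonneg s₁, abs_nonneg s₂, (abs_nonneg _).trans ha]
      calc _ ≤ exp (2 * t) * (C * (q : ℝ) ^ (-(2 + ε) : ℝ)) := by gcongr
        _ = C * (exp (2 * t) * (q : ℝ) ^ (-(2 + ε) : ℝ)) := by ring
        _ ≤ _ := by gcongr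
    · rw [l1, k1, norm_mul, norm_of_nonneg (exp_pos _).le, norm_eq_abs]
      have e3 : |((![p₁, p₂, q] : Fin 3 → ℤ) 1 : ℝ)| ≤ C * q := by
        simp only [cons_val]; have := abs_sub ((q : ℝ) * a + p₂) (q * a)
        rw [add_sub_cancel_left, abs_mul, abs_of_pos hq0] at this
        nlinarith [abs_nonneg a, abs_nonneg s₁, abs_nonneg s₂]
      calc _ ≤ exp (-t) * (C * q) := by gcongr
        _ = C * (exp (-t) * q) := by ring
        _ ≤ _ := by gcongr
    · rw [l2, k2, norm_mul, norm_of_nonneg (exp_pos _).le, norm_eq_abs]; simp only [cons_val, abs_of_pos hq0]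
      refine e1.trans (le_mul_of_one_le_left hP ?_); linarith [abs_nonneg a, abs_nonneg s₁, abs_nonneg s₂]
  have := isProbabilityMeasure_spaceM h; have := isProbabilityMeasure_avgMeasure (a := a) (b := b) h hT0
  have hJT : timeM T J = ofR (ε / 8 / (1 + ε / 4)) := by
    have hsub : J ∩ Ioc 0 T = J := Set.inter_eq_self_of_subset_left fun t ht => ⟨lt_trans (by positivity) ht.1, ht.2⟩
    rw [timeM, Measure.smul_apply, Measure.restrict_apply measurableSet_Ioc, hsub, hJ, Real.volume_Ioc, smul_eq_mul,
      ← ofReal_inv_of_pos hT0, ← ofReal_mul (by positivity)]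
    congr 1; rw [hT]; field_simp; ring
  have hlow : timeM T J ≤ avgMeasure a b s₁ s₂ T Kᶜ := by
    rw [avgMeasure_apply h T hK.isClosed.measurableSet.compl, ← setLIntegral_one]
    refine (setLIntegral_mono' measurableSet_Ioc fun t ht => ?_).trans (setLIntegral_le_lintegral _ _)
    rw [← measure_univ (μ := spaceM s₁ s₂)]; refine measure_mono_ae ?_
    filter_upwards [ae_spaceM s₁ s₂] with s hs _ using hbad t ht s hs
  refine absurd (hKT T hT0) (not_lt.2 ?_)
  rw [← hJT, ← compl_compl K, prob_compl_eq_one_sub hK.isClosed.measurableSet.compl]; exact tsub_le_tsub_left hlow 1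

/-- The integer vector `(p₁, p₂, q)` witnesses that `g_t` moves the curve into the cusp. -/
def CuspVec (a b t : ℝ) (x : ℤ × ℤ × ℤ) : Prop :=
  0 < x.2.2 ∧ (x.2.2 : ℝ) < 1 / 2 * exp t ∧ |(x.2.2 : ℝ) * b + x.1| < 1 / 2 * exp (-(2 * t)) ∧
    |(x.2.2 : ℝ) * a + x.2.1| < 1 / 2 * exp (-(2 * t))

/-- The times at which a whole translate of the curve is in the cusp. -/
def cuspTimes (a b : ℝ) : Set ℝ := {t | ∃ x, CuspVec a b t x}

variable {a b s₁ s₂ : ℝ}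

lemma measurableSet_cuspTimes : MeasurableSet (cuspTimes a b) := by
  have : cuspTimes a b = ⋃ x, {t | CuspVec a b t x} := by ext; simp [cuspTimes]
  rw [this]; refine MeasurableSet.iUnion fun x => ?_; simp only [CuspVec]
  measurability

lemma CuspVec.lt {t : ℝ} {x : ℤ × ℤ × ℤ} (h : CuspVec a b t x) : Real.log x.2.2 < t := by
  rw [Real.log_lt_iff_lt_exp (by exact_mod_cast h.1)]; linarith [h.2.1, exp_pos t]

lemma eventually_lt_of_not_W2' (hW : ¬ W2' a b) {δ : ℝ} (hδ : 0 < δ) :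
    ∀ᶠ t in atTop, ∀ x, CuspVec a b t x → t < (1 + δ / 2) * Real.log x.2.2 := by
  set S := {x : ℤ × ℤ × ℤ | 0 < x.2.2 ∧
    |(x.2.2 : ℝ) * b + (x.1 : ℝ)| ≤ (x.2.2 : ℝ) ^ (-(2 + δ) : ℝ) ∧
    |(x.2.2 : ℝ) * a + (x.2.1 : ℝ)| ≤ (x.2.2 : ℝ) ^ (-(2 + δ) : ℝ)} with hS
  have hfin : S.Finite := by by_contra hinf; exact hW ⟨δ, hδ, hinf⟩
  have hev : ∀ x ∈ S, ∀ᶠ t in atTop, ¬ CuspVec a b t x := by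
    rintro ⟨p₁, p₂, q⟩ ⟨hq, -, -⟩
    simp only at hq
    have hl : Tendsto (fun t : ℝ => 1 / 2 * exp (-(2 * t))) atTop (𝓝 0) := by
      simpa using (Real.tendsto_exp_neg_atTop_nhds_zero.comp (tendsto_id.const_mul_atTop (two_pos : (0 : ℝ) < 2))).const_mul (1 / 2 : ℝ)
    by_cases h0 : (q : ℝ) * b + p₁ = 0 ∧ (q : ℝ) * a + p₂ = 0
    · refine absurd hfin (Set.infinite_of_injective_forall_mem (f := fun n : ℕ => ((n + 1 : ℤ) * p₁, (n + 1 : ℤ) * p₂, (n + 1 : ℤ) * q))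
        (fun m n hmn => ?_) fun n => ?_)
      · simpa using mul_right_cancel₀ hq.ne' (congrArg (fun x => x.2.2) hmn)
      · have hq' : (0 : ℤ) < (n + 1 : ℤ) * q := by positivity
        have hr : (0 : ℝ) ≤ (((n + 1 : ℤ) * q : ℤ) : ℝ) := by exact_mod_cast hq'.le
        refine ⟨hq', ?_, ?_⟩ <;> simp only
        · rw [show ((((n + 1 : ℤ) * q : ℤ) : ℝ) * b + (((n + 1 : ℤ) * p₁ : ℤ) : ℝ)) = (n + 1) * (q * b + p₁) by push_cast; ring,
            h0.1, mul_zero, abs_zero]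
          positivity
        · rw [show ((((n + 1 : ℤ) * q : ℤ) : ℝ) * a + (((n + 1 : ℤ) * p₂ : ℤ) : ℝ)) = (n + 1) * (q * a + p₂) by push_cast; ring,
            h0.2, mul_zero, abs_zero]
          positivity
    · rcases not_and_or.1 h0 with h0 | h0
      · filter_upwards [hl.eventually_lt_const (abs_pos.2 h0)] with t ht hc using absurd hc.2.2.1 ht.not_gt
      · filter_upwards [hl.eventually_lt_const (abs_pos.2 h0)] with t ht hc using absurd hc.2.2.2 ht.not_gt
  filter_upwards [hfin.eventually_all.2 hev] with t ht x hx
  by_contra hlt; have hq : (0 : ℝ) < x.2.2 := by exact_mod_cast hx.1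
  have hle : 1 / 2 * exp (-(2 * t)) ≤ (x.2.2 : ℝ) ^ (-(2 + δ) : ℝ) := by
    have : exp (-(2 * t)) ≤ (x.2.2 : ℝ) ^ (-(2 + δ) : ℝ) := by
      rw [Real.rpow_def_of_pos hq]; exact exp_le_exp.2 (by linarith)
    linarith [exp_pos (-(2 * t))]
  exact ht x ⟨hx.1, hx.2.2.1.le.trans hle, hx.2.2.2.le.trans hle⟩ hx

lemma mul_eq_mul_of_near {c t t' : ℝ} {p q p' q' : ℤ} (h1 : t ≤ 2 * t') (h2 : t' ≤ 2 * t) (hq : 0 < q) (hq' : 0 < q')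
    (hqt : (q : ℝ) < 1 / 2 * exp t) (hqt' : (q' : ℝ) < 1 / 2 * exp t')
    (hp : |(q : ℝ) * c + p| < 1 / 2 * exp (-(2 * t))) (hp' : |(q' : ℝ) * c + p'| < 1 / 2 * exp (-(2 * t'))) :
    q * p' = q' * p := by
  have key : ∀ {t t' y : ℝ} {q : ℤ}, t ≤ 2 * t' → 0 < q → (q : ℝ) < 1 / 2 * exp t →
      |y| < 1 / 2 * exp (-(2 * t')) → |q * y| < 1 / 2 := by
    intro t t' y q h hq hqt hy; have hq0 : (0 : ℝ) < q := by exact_mod_cast hq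
    have h1 : exp t * exp (-(2 * t')) ≤ 1 := by rw [← exp_add]; exact Real.exp_le_one_iff.2 (by linarith)
    rw [abs_mul, abs_of_pos hq0]; have := mul_lt_mul'' hqt hy hq0.le (abs_nonneg y); linarith
  have k1 := abs_lt.1 (key h1 hq hqt hp'); have k2 := abs_lt.1 (key h2 hq' hqt' hp)
  have e : ((q * p' - q' * p : ℤ) : ℝ) = q * (q' * c + p') - q' * (q * c + p) := by push_cast; ring
  have : |q * p' - q' * p| < 1 := by
    have : |((q * p' - q' * p : ℤ) : ℝ)| < 1 := by rw [e, abs_lt]; constructor <;> linarith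
    exact_mod_cast this
  linarith [Int.abs_lt_one_iff.1 this]

lemma CuspVec.of_le {t t' : ℝ} {x x' : ℤ × ℤ × ℤ} (hx : CuspVec a b t x) (hx' : CuspVec a b t' x')
    (h1 : t ≤ 2 * t') (h2 : t' ≤ 2 * t) (hle : x'.2.2 ≤ x.2.2) : CuspVec a b t x' := by
  have hle' : (x'.2.2 : ℝ) ≤ x.2.2 := by exact_mod_cast hle
  have hq : (0 : ℝ) < x.2.2 := by exact_mod_cast hx.1
  have hq' : (0 : ℝ) < x'.2.2 := by exact_mod_cast hx'.1
  have key : ∀ {c : ℝ} {p p' : ℤ}, x.2.2 * p' = x'.2.2 * p → |(x.2.2 : ℝ) * c + p| < 1 / 2 * exp (-(2 * t)) →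
      |(x'.2.2 : ℝ) * c + p'| < 1 / 2 * exp (-(2 * t)) := by
    intro c p p' he h; refine lt_of_le_of_lt ?_ h; have he' : (x.2.2 : ℝ) * p' = x'.2.2 * p := by exact_mod_cast he
    have : (x.2.2 : ℝ) * (x'.2.2 * c + p') = x'.2.2 * (x.2.2 * c + p) := by linear_combination he'
    have := congrArg abs this; rw [abs_mul, abs_mul, abs_of_pos hq, abs_of_pos hq'] at this
    refine le_of_mul_le_mul_left ?_ hq; rw [this]; gcongr
  exact ⟨hx'.1, hle'.trans_lt hx.2.1,
    key (mul_eq_mul_of_near h1 h2 hx.1 hx'.1 hx.2.1 hx'.2.1 hx.2.2.1 hx'.2.2.1) hx.2.2.1,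
    key (mul_eq_mul_of_near h1 h2 hx.1 hx'.1 hx.2.1 hx'.2.1 hx.2.2.2 hx'.2.2.2) hx.2.2.2⟩

lemma volume_cuspTimes_window {τ δ : ℝ} (hδ : 0 < δ)
    (h : ∀ t, τ ≤ t → ∀ x, CuspVec a b t x → t < (1 + δ / 2) * Real.log x.2.2) :
    volume (cuspTimes a b ∩ Ioc τ (2 * τ)) ≤ ofR (δ * τ) := by
  by_cases hne : ∃ n : ℕ, ∃ t ∈ Ioc τ (2 * τ), ∃ x, CuspVec a b t x ∧ x.2.2.toNat = n
  · classical
    obtain ⟨t', ht', x', hx', hn⟩ := Nat.find_spec hne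
    have hsub : cuspTimes a b ∩ Ioc τ (2 * τ) ⊆ Icc (Real.log x'.2.2) (Real.log x'.2.2 + δ * τ) := by
      rintro t ⟨⟨x, hx⟩, ht⟩
      have hmin := Nat.find_min' hne ⟨t, ht, x, hx, rfl⟩
      have hle : x'.2.2 ≤ x.2.2 := by have := hx.1; have := hx'.1; omega
      have hc := hx.of_le hx' (by linarith [ht.1, ht.2, ht'.1, ht'.2]) (by linarith [ht.1, ht.2, ht'.1, ht'.2]) hle
      refine ⟨hc.lt.le, ?_⟩; have h1 := h t ht.1.le x' hc; have h2 : Real.log x'.2.2 ≤ 2 * τ := hc.lt.le.trans ht.2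
      nlinarith
    refine (measure_mono hsub).trans ?_; rw [volume_Icc, add_sub_cancel_left]
  · have : cuspTimes a b ∩ Ioc τ (2 * τ) = ∅ := by
      rw [Set.eq_empty_iff_forall_notMem]
      rintro t ⟨⟨x, hx⟩, ht⟩
      exact hne ⟨_, t, ht, x, hx, rfl⟩
    simp [this]

lemma volume_cuspTimes_le (hW : ¬ W2' a b) {δ : ℝ} (hδ : 0 < δ) :
    ∃ t₁ > 0, ∀ T, t₁ ≤ T → volume (cuspTimes a b ∩ Ioc 0 T) ≤ ofR (t₁ + 2 * δ * T) := by
  obtain ⟨t₀, ht₀⟩ := eventually_atTop.1 (eventually_lt_of_not_W2' hW hδ); set t₁ := max t₀ 1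
  have h1 : 0 < t₁ := lt_max_of_lt_right one_pos
  have hpow : ∀ n : ℕ, volume (cuspTimes a b ∩ Ioc 0 (2 ^ n * t₁)) ≤ ofR (t₁ + δ * (2 ^ n * t₁)) := by
    intro n
    induction n with
    | zero =>
      refine (measure_mono Set.inter_subset_right).trans ?_; rw [Real.volume_Ioc]; refine ofReal_le_ofReal ?_
      have : 0 < δ * t₁ := by positivity
      simp only [pow_zero, one_mul]; linarith
    | succ n ih =>
      have hle : t₁ ≤ 2 ^ n * t₁ := le_mul_of_one_le_left h1.le (one_le_pow₀ one_le_two)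
      have hsub : cuspTimes a b ∩ Ioc 0 (2 ^ (n + 1) * t₁) ⊆ (cuspTimes a b ∩ Ioc 0 (2 ^ n * t₁)) ∪
          (cuspTimes a b ∩ Ioc (2 ^ n * t₁) (2 * (2 ^ n * t₁))) := by
        rintro t ⟨ht, ht0, ht1⟩
        rcases le_or_gt t (2 ^ n * t₁) with h2 | h2
        · exact Or.inl ⟨ht, ht0, h2⟩
        · exact Or.inr ⟨ht, h2, by rwa [pow_succ', mul_assoc] at ht1⟩
      refine (measure_mono hsub).trans ((measure_union_le _ _).trans ((add_le_add ih (volume_cuspTimes_window hδ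
        fun t ht => ht₀ t ((le_max_left _ _).trans (hle.trans ht)))).trans ?_))
      rw [← ofReal_add (by positivity) (by positivity)]; exact ofReal_le_ofReal (le_of_eq (by ring))
  refine ⟨t₁, h1, fun T hT => ?_⟩; obtain ⟨n, hn, hn'⟩ := exists_nat_pow_near ((one_le_div h1).2 hT) one_lt_two
  rw [le_div_iff₀ h1] at hn; rw [div_lt_iff₀ h1] at hn'
  refine (measure_mono (Set.inter_subset_inter_right _ (Set.Ioc_subset_Ioc_right hn'.le))).trans ((hpow _).trans
    (ofReal_le_ofReal ?_))
  rw [pow_succ]; nlinarith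

/-! ### Tightness of the averages -/

/-- The unipotent matrix with last column `(b, a, 1)`. -/
def kb (a b : ℝ) : G := ⟨!![1, 0, b; 0, 1, a; 0, 0, 1], by simp [det_fin_three]⟩

lemma kb_inv (a b : ℝ) : (kb a b)⁻¹ = kb (-a) (-b) := by
  refine inv_eq_of_mul_eq_one_right (G_ext_fin ?_ ?_ ?_ ?_ ?_ ?_ ?_ ?_ ?_) <;> rw [mul_entry] <;> simp [kb]

lemma kb_mul_gSL (a t : ℝ) : kb a 0 * gSL t = gSL t * kb a 0 := by
  apply G_ext_fin <;> rw [mul_entry, mul_entry] <;> simp [kb, gSL, mul_comm]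

lemma kb_mul_gSL_mul_phiSL (a b s t : ℝ) :
    kb a 0 * (gSL t * phiSL a b s) = uu (exp (3 * t) * s) * (gSL t * kb a b) := by
  have e : exp (2 * t) = exp (3 * t) * exp (-t) := by rw [← exp_add]; ring_nf
  apply G_ext_fin <;> simp only [mul_entry] <;> simp [kb, gSL, phiSL, uu, e] <;> ring

variable {a b s₁ s₂ : ℝ}

lemma lat_uu_gSL_kb (s t : ℝ) (v : Fin 3 → ℤ) : lat (uu (exp (3 * t) * s) * (gSL t * kb a b)) v 0 =
      exp (2 * t) * ((v 2 * b + v 0) + s * (v 2 * a + v 1)) ∧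
    lat (uu (exp (3 * t) * s) * (gSL t * kb a b)) v 2 = exp (-t) * v 2 := by
  have e : exp (2 * t) = exp (3 * t) * exp (-t) := by rw [← exp_add]; ring_nf
  constructor <;> rw [lat_apply] <;> simp only [mul_entry] <;> simp [kb, gSL, uu, e]; ring

lemma dlat_uu_gSL_kb (s t : ℝ) (v : Fin 3 → ℤ) :
    dlat (uu (exp (3 * t) * s) * (gSL t * kb a b)) v 1 = exp t * (v 1 - s * v 0) ∧
    dlat (uu (exp (3 * t) * s) * (gSL t * kb a b)) v 2 = exp t * (v 2 - b * v 0 - a * v 1) := by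
  have e : exp t = exp (3 * t) * exp (-(2 * t)) := by rw [← exp_add]; ring_nf
  obtain ⟨h0, h1, h2⟩ := dlat_gSL t (kb a b) v
  have k0 : dlat (kb a b) v 0 = v 0 := by rw [dlat_apply, kb_inv]; simp [kb]
  have k1 : dlat (kb a b) v 1 = v 1 := by rw [dlat_apply, kb_inv]; simp [kb]
  have k2 : dlat (kb a b) v 2 = v 2 - b * v 0 - a * v 1 := by rw [dlat_apply, kb_inv]; simp [kb]; ring
  rw [dlat_uu_mul]; simp only [Pi.add_apply, Pi.smul_apply, h0, h1, h2, k0, k1, k2]; constructor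
  · rw [e]; simp; ring
  · simp

lemma Int.eq_zero_of_abs_cast_lt {n : ℤ} (h : |(n : ℝ)| < 1) : n = 0 := Int.abs_lt_one_iff.1 (by exact_mod_cast h)

/-- A lower bound for the sup over the curve of the length of lattice vectors, away from the cusp times. -/
def curveRadius (s₁ s₂ : ℝ) : ℝ := (s₂ - s₁) / (2 * (s₂ - s₁ + 2 + 2 * |s₁|))

lemma curveRadius_spec (h : s₁ < s₂) : 0 < curveRadius s₁ s₂ ∧ curveRadius s₁ s₂ ≤ 1 / 2 ∧
    2 * curveRadius s₁ s₂ ≤ (s₂ - s₁) / 2 ∧ curveRadius s₁ s₂ * (s₂ - s₁ + 2 * |s₁|) ≤ (s₂ - s₁) / 2 := by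
  have hD : 0 < s₂ - s₁ := sub_pos.2 h; have h1 := abs_nonneg s₁
  have hE : 0 < 2 * (s₂ - s₁ + 2 + 2 * |s₁|) := by positivity
  have e : curveRadius s₁ s₂ * (2 * (s₂ - s₁ + 2 + 2 * |s₁|)) = s₂ - s₁ := div_mul_cancel₀ _ hE.ne'
  have hp : 0 < curveRadius s₁ s₂ := div_pos hD hE
  refine ⟨hp, ?_, ?_, ?_⟩ <;> nlinarith [mul_pos hp hD, mul_nonneg hp.le h1]

lemma le_lat_of_notMem_cuspTimes (h : s₁ < s₂) {t : ℝ} (ht : 0 ≤ t) (hc : t ∉ cuspTimes a b) {v : Fin 3 → ℤ} (hv : v ≠ 0) :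
    ∃ s ∈ Icc s₁ s₂, curveRadius s₁ s₂ ≤ ‖lat (uu (exp (3 * t) * s) * (gSL t * kb a b)) v‖ := by
  obtain ⟨hρ, hρ1, hρ2, hρ3⟩ := curveRadius_spec h; set ρ := curveRadius s₁ s₂; by_contra! hcon
  have hD : 0 < s₂ - s₁ := sub_pos.2 h; set α : ℝ := v 2 * b + v 0; set β : ℝ := v 2 * a + v 1
  have E : 0 < exp (2 * t) := exp_pos _
  have bd : ∀ s ∈ Icc s₁ s₂, |α + s * β| < ρ * exp (-(2 * t)) := by
    intro s hs; have := (norm_le_pi_norm _ 0).trans_lt (hcon s hs)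
    rw [(lat_uu_gSL_kb s t v).1, norm_eq_abs, abs_mul, abs_of_pos E] at this
    rwa [exp_neg, ← div_eq_mul_inv, lt_div_iff₀ E, mul_comm]
  have hq : |(v 2 : ℝ)| < 1 / 2 * exp t := by
    have := (norm_le_pi_norm _ 2).trans_lt (hcon s₁ ⟨le_rfl, h.le⟩)
    rw [(lat_uu_gSL_kb s₁ t v).2, norm_eq_abs, abs_mul, abs_of_pos (exp_pos _), exp_neg,
      inv_mul_lt_iff₀ (exp_pos _)] at this
    nlinarith [exp_pos t]
  have b1 := abs_lt.1 (bd s₁ ⟨le_rfl, h.le⟩); have b2 := abs_lt.1 (bd s₂ ⟨h.le, le_rfl⟩); set E' := exp (-(2 * t))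
  have hE' : 0 < E' := exp_pos _
  have hβ' : (s₂ - s₁) * |β| < 2 * ρ * E' := by rw [← abs_of_pos hD, ← abs_mul, abs_lt]; constructor <;> linarith
  have hβ : |β| < 1 / 2 * E' := by refine lt_of_mul_lt_mul_left (hβ'.trans_le ?_) hD.le; nlinarith
  have hα : |α| < 1 / 2 * E' := by
    refine lt_of_mul_lt_mul_left ?_ hD.le
    have h1 : |α| ≤ |α + s₁ * β| + |s₁| * |β| := by
      have := abs_sub (α + s₁ * β) (s₁ * β); rwa [add_sub_cancel_right, abs_mul] at this
    have h2 := bd s₁ ⟨le_rfl, h.le⟩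
    calc (s₂ - s₁) * |α| ≤ (s₂ - s₁) * |α + s₁ * β| + |s₁| * ((s₂ - s₁) * |β|) := by nlinarith
      _ < (s₂ - s₁) * (ρ * E') + |s₁| * (2 * ρ * E') := by
        have := mul_le_mul_of_nonneg_left hβ'.le (abs_nonneg s₁); have := mul_lt_mul_of_pos_left h2 hD; linarith
      _ = ρ * (s₂ - s₁ + 2 * |s₁|) * E' := by ring
      _ ≤ (s₂ - s₁) / 2 * E' := by gcongr
      _ = _ := by ring
  rcases lt_trichotomy (v 2) 0 with h0 | h0 | h0
  · refine hc ⟨(-v 0, -v 1, -v 2), neg_pos.2 h0, ?_, ?_, ?_⟩ <;> push_cast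
    · exact (neg_le_abs _).trans_lt hq
    · rwa [show -(v 2 : ℝ) * b + -(v 0 : ℝ) = -α by simp only [α]; ring, abs_neg]
    · rwa [show -(v 2 : ℝ) * a + -(v 1 : ℝ) = -β by simp only [β]; ring, abs_neg]
  · have hE1 : E' ≤ 1 := Real.exp_le_one_iff.2 (by linarith)
    simp only [α, β, h0, Int.cast_zero, zero_mul, zero_add] at hα hβ
    have h00 := Int.eq_zero_of_abs_cast_lt (by linarith : |(v 0 : ℝ)| < 1)
    have h01 := Int.eq_zero_of_abs_cast_lt (by linarith : |(v 1 : ℝ)| < 1); refine hv (funext fun i => ?_)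
    rcases fin3 i with rfl|rfl|rfl <;> assumption
  · exact hc ⟨(v 0, v 1, v 2), h0, (le_abs_self _).trans_lt hq, hα, hβ⟩

lemma le_dlat_curve (h : s₁ < s₂) {t : ℝ} (ht : 0 ≤ t) {v : Fin 3 → ℤ} (hv : v ≠ 0) :
    ∃ s ∈ Icc s₁ s₂, curveRadius s₁ s₂ ≤ ‖dlat (uu (exp (3 * t) * s) * (gSL t * kb a b)) v‖ := by
  obtain ⟨hρ, hρ1, hρ2, -⟩ := curveRadius_spec h; by_contra! hcon; have hD : 0 < s₂ - s₁ := sub_pos.2 h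
  have hE : 1 ≤ exp t := Real.one_le_exp ht
  have cancel : ∀ y : ℝ, ‖exp t * y‖ < curveRadius s₁ s₂ → |y| < curveRadius s₁ s₂ := fun y hy => by
    rw [norm_mul, norm_of_nonneg (by positivity)] at hy; exact (le_mul_of_one_le_left (abs_nonneg y) hE).trans_lt hy
  have m1 : s₁ ∈ Icc s₁ s₂ := ⟨le_rfl, h.le⟩; have b1 := (norm_le_pi_norm _ 1).trans_lt (hcon s₁ m1)
  have b2 := (norm_le_pi_norm _ 1).trans_lt (hcon s₂ ⟨h.le, le_rfl⟩)
  have b3 := (norm_le_pi_norm _ 2).trans_lt (hcon s₁ m1); rw [(dlat_uu_gSL_kb _ t v).1] at b1 b2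
  rw [(dlat_uu_gSL_kb _ t v).2] at b3; replace b1 := cancel _ b1; replace b2 := cancel _ b2; replace b3 := cancel _ b3
  have h0 : v 0 = 0 := by
    refine Int.eq_zero_of_abs_cast_lt ?_; rw [abs_lt] at b1 b2 ⊢
    constructor <;> refine lt_of_mul_lt_mul_left ?_ hD.le <;> linarith
  simp only [h0, Int.cast_zero, mul_zero, sub_zero] at b1 b3
  have h1 := Int.eq_zero_of_abs_cast_lt (by linarith : |(v 1 : ℝ)| < 1)
  simp only [h1, Int.cast_zero, mul_zero, sub_zero] at b3
  have h2 := Int.eq_zero_of_abs_cast_lt (by linarith : |(v 2 : ℝ)| < 1); refine hv (funext fun i => ?_)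
  rcases fin3 i with rfl|rfl|rfl <;> assumption

lemma spaceM_short_le (h : s₁ < s₂) {t ε : ℝ} (ht : 0 ≤ t) (hc : t ∉ cuspTimes a b) (hε : 0 < ε)
    (hε' : 8 * ε ≤ curveRadius s₁ s₂) :
    spaceM s₁ s₂ {s | ∃ v, v ≠ 0 ∧ ‖lat (uu (exp (3 * t) * s) * (gSL t * kb a b)) v‖ < ε} ≤
      ofR (72 * ε / curveRadius s₁ s₂) := by
  obtain ⟨hρ, hρ1, -, -⟩ := curveRadius_spec h; have hD : 0 < s₂ - s₁ := sub_pos.2 h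
  have E : 0 < exp (3 * t) := exp_pos _
  have mem : ∀ {s}, s ∈ Icc s₁ s₂ → exp (3 * t) * s ∈ Icc (exp (3 * t) * s₁) (exp (3 * t) * s₂) :=
    fun hs => ⟨mul_le_mul_of_nonneg_left hs.1 E.le, mul_le_mul_of_nonneg_left hs.2 E.le⟩
  have key := volume_short_le (gSL t * kb a b) hρ (by linarith) hε hε'
    (fun v hv => let ⟨s, hs, h1⟩ := le_lat_of_notMem_cuspTimes h ht hc hv; ⟨_, mem hs, h1⟩)
    (fun v hv => let ⟨s, hs, h1⟩ := le_dlat_curve h ht hv; ⟨_, mem hs, h1⟩)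
  rw [spaceM, Measure.smul_apply, Measure.restrict_apply' measurableSet_Icc, smul_eq_mul, volume_Icc]
  set B := {s | s ∈ Icc (exp (3 * t) * s₁) (exp (3 * t) * s₂) ∧ ∃ v, v ≠ 0 ∧ ‖lat (uu s * (gSL t * kb a b)) v‖ < ε}
  refine (mul_le_mul_right (measure_mono (t := (fun s => exp (3 * t) * s) ⁻¹' B) fun s hs => ⟨mem hs.2, hs.1⟩) _).trans ?_
  rw [Real.volume_preimage_mul_left E.ne', abs_of_pos (inv_pos.2 E)]
  refine (mul_le_mul_right (mul_le_mul_right key _) _).trans ?_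
  rw [← ofReal_inv_of_pos hD, ← ofReal_mul (by positivity), ← ofReal_mul (by positivity)]
  refine ofReal_le_ofReal (le_of_eq ?_); field_simp

theorem no_escape_of_not_W2' (h : s₁ < s₂) (hW : ¬ W2' a b) (ε : ℝ≥0∞) (hε : 0 < ε) : ∃ K : Set X, IsCompact K ∧
    ∀ T : ℝ, 0 < T → 1 - ε < avgMeasure a b s₁ s₂ T K := by
  refine no_escape_of_eventually h (fun c hc => ?_) ε hε; obtain ⟨hρ, hρ1, -, -⟩ := curveRadius_spec h
  obtain ⟨η, hη, hη1, hηc⟩ : ∃ η : ℝ, 0 < η ∧ η < 1 ∧ c < ofR (1 - η) := by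
    obtain ⟨d, hcd, hd1⟩ := exists_between hc; refine ⟨(1 - d.toReal) / 2, ?_, ?_, ?_⟩
    all_goals
      have hd : d.toReal < 1 := by simpa using (toReal_lt_toReal hd1.ne_top one_ne_top).2 hd1
      have hd0 := d.toReal_nonneg
    · linarith
    · linarith
    · refine hcd.trans ((ENNReal.lt_ofReal_iff_toReal_lt hd1.ne_top).2 (by linarith))
  set r : ℝ := η * curveRadius s₁ s₂ / 288 with hr; have hr0 : 0 < r := by positivity
  obtain ⟨K', hK', hK'r⟩ := exists_compact_of_no_short_vector hr0
  obtain ⟨t₁, ht₁, hvol⟩ := volume_cuspTimes_le hW (show 0 < η / 8 by positivity)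
  refine ⟨(fun x => (kb a 0)⁻¹ • x) '' K', hK'.image (continuous_const_smul _), ?_⟩
  have hKm := (hK'.image (continuous_const_smul (kb a 0)⁻¹)).isClosed.measurableSet
  set K := (fun x : X => (kb a 0)⁻¹ • x) '' K'
  filter_upwards [eventually_ge_atTop t₁, eventually_gt_atTop (4 * t₁ / η)] with T hT hT'
  have hT0 : 0 < T := ht₁.trans_le hT; have := isProbabilityMeasure_spaceM h; have := isProbabilityMeasure_timeM hT0
  have := isProbabilityMeasure_avgMeasure (a := a) (b := b) h hT0
  have hle : avgMeasure a b s₁ s₂ T Kᶜ ≤ ofR (3 / 4 * η) := by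
    rw [avgMeasure_apply h T hKm.compl]
    calc _ ≤ ∫⁻ t, (cuspTimes a b).indicator 1 t + ofR (η / 4) ∂(timeM T) := by
          refine lintegral_mono_ae ?_
          filter_upwards [ae_timeM T] with t ht
          by_cases hc : t ∈ cuspTimes a b
          · rw [indicator_of_mem hc]; exact prob_le_one.trans le_self_add
          · rw [indicator_of_notMem hc, zero_add]
            refine (measure_mono ?_).trans ((spaceM_short_le h ht.1.le hc hr0 ?_).trans (ofReal_le_ofReal (le_of_eq ?_)))
            · intro s hs; by_contra hs'; refine hs ⟨_, hK'r _ fun v hv => not_lt.1 fun hlt => hs' ⟨v, hv, hlt⟩, ?_⟩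
              dsimp only; rw [← kb_mul_gSL_mul_phiSL, ← smul_mk, inv_smul_smul, orbitPt, x₀, smul_mk, smul_mk, mul_one]
            · rw [hr]; nlinarith
            · rw [hr]; field_simp; norm_num
      _ = timeM T (cuspTimes a b) + ofR (η / 4) := by
          rw [lintegral_add_right _ measurable_const, lintegral_indicator_one measurableSet_cuspTimes, lintegral_const,
            measure_univ, mul_one]
      _ ≤ ofR (η / 2) + ofR (η / 4) := by
          gcongr; rw [timeM, Measure.smul_apply, Measure.restrict_apply' measurableSet_Ioc, smul_eq_mul]
          refine (mul_le_mul_right (hvol T hT) _).trans ?_; rw [← ofReal_inv_of_pos hT0, ← ofReal_mul (by positivity)]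
          refine ofReal_le_ofReal ?_; rw [div_lt_iff₀ hη] at hT'; rw [inv_mul_le_iff₀ hT0]; linarith
      _ = _ := by rw [← ofReal_add (by positivity) (by positivity)]; congr 1; ring
  rw [← compl_compl K, prob_compl_eq_one_sub hKm.compl]; refine hηc.trans_le ?_; rw [ofReal_sub _ hη.le, ofReal_one]
  exact tsub_le_tsub_left (hle.trans (ofReal_le_ofReal (by linarith))) 1

/-! ### Limits of the averages -/

variable {a b s₁ s₂ : ℝ}

lemma abs_integral_shift_sub_le {φ : ℝ → ℝ} (hφ : Continuous φ) {M : ℝ} (hM : ∀ u, |φ u| ≤ M) (x y c : ℝ) :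
    |(∫ u in x..y, φ (u + c)) - ∫ u in x..y, φ u| ≤ 2 * M * |c| := by
  have hi := fun p q => hφ.intervalIntegrable (μ := volume) p q
  rw [intervalIntegral.integral_comp_add_right, intervalIntegral.integral_interval_sub_interval_comm (hi _ _) (hi _ _) (hi _ _)]
  have h1 := intervalIntegral.norm_integral_le_of_norm_le_const (a := x + c) (b := x) (f := φ) (fun u _ => hM u)
  have h2 := intervalIntegral.norm_integral_le_of_norm_le_const (a := y + c) (b := y) (f := φ) (fun u _ => hM u)
  rw [sub_add_cancel_left, abs_neg, norm_eq_abs] at h1 h2; exact (abs_sub _ _).trans (by linarith)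

lemma integral_spaceM (h : s₁ < s₂) (φ : ℝ → ℝ) : ∫ s, φ s ∂(spaceM s₁ s₂) = (s₂ - s₁)⁻¹ * ∫ s in s₁..s₂, φ s := by
  rw [spaceM, integral_smul_measure, volume_Icc, toReal_inv, toReal_ofReal (sub_pos.2 h).le,
    intervalIntegral.integral_of_le h.le, integral_Icc_eq_integral_Ioc, smul_eq_mul]

lemma integral_avgMeasure (h : s₁ < s₂) {T : ℝ} (hT : 0 < T) {f : X → ℝ} (hf : Continuous f) {M : ℝ} (hM : ∀ x, |f x| ≤ M) :
    ∫ x, f x ∂(avgMeasure a b s₁ s₂ T) = T⁻¹ * ∫ t in 0..T, ∫ s, f (orbitPt a b (t, s)) ∂(spaceM s₁ s₂) := by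
  have := isProbabilityMeasure_spaceM h; have := isProbabilityMeasure_timeM hT; have hc := continuous_orbitPt a b
  rw [avgMeasure_eq h, integral_map hc.aemeasurable hf.aestronglyMeasurable, integral_prod (fun p => f (orbitPt a b p))
    (.of_bound (hf.comp hc).aestronglyMeasurable M (ae_of_all _ fun _ => hM _)), timeM, integral_smul_measure,
    toReal_inv, toReal_ofReal hT.le, intervalIntegral.integral_of_le hT.le, smul_eq_mul]

lemma continuous_integral_spaceM (h : s₁ < s₂) {F : ℝ × ℝ → ℝ} (hF : Continuous F) :
    Continuous fun t => ∫ s, F (t, s) ∂(spaceM s₁ s₂) := by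
  simp only [integral_spaceM h]
  exact continuous_const.mul (intervalIntegral.continuous_parametric_intervalIntegral_of_continuous' (f := fun t s => F (t, s)) hF _ _)

lemma gSL_smul_orbitPt (t₀ t s : ℝ) : gSL t₀ • orbitPt a b (t, s) = orbitPt a b (t + t₀, s) := by
  rw [orbitPt, smul_smul, orbitPt]; congr 1; apply G_ext_fin <;> rw [mul_entry] <;> simp [gSL, ← exp_add]; ring

lemma phiSL_smul_orbitPt (r t s : ℝ) : phiSL a 0 r • orbitPt a b (t, s) = orbitPt a b (t, s + exp (-(3 * t)) * r) := by
  have e : exp (-t) = exp (2 * t) * exp (-(3 * t)) := by rw [← exp_add]; ring_nf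
  simp only [orbitPt, smul_smul]; congr 1; apply G_ext_fin <;> simp only [mul_entry] <;> simp [gSL, phiSL, e] <;> ring

/-- The averages of a bounded continuous function are asymptotically invariant under translation by `g`. -/
def AsympInv (a b s₁ s₂ : ℝ) (g : G) : Prop := ∀ f : X → ℝ, Continuous f → ∀ M, (∀ x, |f x| ≤ M) →
  Tendsto (fun T => (∫ x, f (g • x) ∂(avgMeasure a b s₁ s₂ T)) - ∫ x, f x ∂(avgMeasure a b s₁ s₂ T)) atTop (𝓝 0)

lemma asympInv_of_bound {g : G} (H : ∀ f : X → ℝ, Continuous f → ∀ M, (∀ x, |f x| ≤ M) → ∃ C, ∀ T, 0 < T →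
    |(∫ x, f (g • x) ∂(avgMeasure a b s₁ s₂ T)) - ∫ x, f x ∂(avgMeasure a b s₁ s₂ T)| ≤ T⁻¹ * C) : AsympInv a b s₁ s₂ g := by
  intro f hf M hM; obtain ⟨C, hC⟩ := H f hf M hM
  have hl : Tendsto (fun T : ℝ => T⁻¹ * C) atTop (𝓝 0) := by simpa using tendsto_inv_atTop_zero.mul_const C
  refine squeeze_zero_norm' ?_ hl
  filter_upwards [eventually_gt_atTop 0] with T hT using hC T hT

lemma asympInv_gSL (h : s₁ < s₂) (t₀ : ℝ) : AsympInv a b s₁ s₂ (gSL t₀) := by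
  refine asympInv_of_bound fun f hf M hM => ⟨2 * M * |t₀|, fun T hT => ?_⟩; have := isProbabilityMeasure_spaceM h
  have hc := continuous_orbitPt a b
  rw [integral_avgMeasure h hT (f := fun x => f (gSL t₀ • x)) (hf.comp (continuous_const_smul _)) fun x => hM _,
    integral_avgMeasure h hT hf hM, ← mul_sub, abs_mul, abs_of_pos (inv_pos.2 hT)]
  simp only [gSL_smul_orbitPt]
  refine mul_le_mul_of_nonneg_left (abs_integral_shift_sub_le (φ := fun t => ∫ s, f (orbitPt a b (t, s)) ∂(spaceM s₁ s₂))
    (continuous_integral_spaceM h (hf.comp hc)) (fun t => ?_) 0 T t₀) (inv_nonneg.2 hT.le)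
  simpa using norm_integral_le_of_norm_le_const (μ := spaceM s₁ s₂) (f := fun s => f (orbitPt a b (t, s)))
    (ae_of_all _ fun _ => hM _)

lemma asympInv_phiSL (h : s₁ < s₂) (r : ℝ) : AsympInv a b s₁ s₂ (phiSL a 0 r) := by
  refine asympInv_of_bound fun f hf M hM => ⟨(s₂ - s₁)⁻¹ * (2 * M * |r|), fun T hT => ?_⟩
  have hM0 : 0 ≤ M := (abs_nonneg _).trans (hM x₀); have hD := inv_pos.2 (sub_pos.2 h)
  have hc := continuous_orbitPt a b
  have hc' : Continuous fun p : ℝ × ℝ => (p.1, p.2 + exp (-(3 * p.1)) * r) := by fun_prop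
  rw [integral_avgMeasure h hT (f := fun x => f (phiSL a 0 r • x)) (hf.comp (continuous_const_smul _)) fun x => hM _,
    integral_avgMeasure h hT hf hM, ← mul_sub, abs_mul, abs_of_pos (inv_pos.2 hT)]
  simp only [phiSL_smul_orbitPt]; refine mul_le_mul_of_nonneg_left ?_ (inv_nonneg.2 hT.le)
  rw [← intervalIntegral.integral_sub
    ((continuous_integral_spaceM h (F := fun p => f (orbitPt a b (p.1, _))) (hf.comp (hc.comp hc'))).intervalIntegrable _ _)
    ((continuous_integral_spaceM h (F := fun p => f (orbitPt a b p)) (hf.comp hc)).intervalIntegrable _ _)]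
  have hexp : ∫ t in 0..T, exp (-t) ≤ 1 := by
    rw [intervalIntegral.integral_comp_neg (fun x => exp x), integral_exp]; simp [(exp_pos _).le]
  have hg : Continuous fun t : ℝ => (s₂ - s₁)⁻¹ * (2 * M * |r|) * exp (-t) := by fun_prop
  rw [← norm_eq_abs]
  refine (intervalIntegral.norm_integral_le_of_norm_le hT.le (ae_of_all _ fun t ht => ?_)
    (hg.intervalIntegrable (μ := volume) _ _)).trans ?_
  · rw [integral_spaceM h, integral_spaceM h, ← mul_sub, norm_mul, norm_of_nonneg hD.le, mul_assoc]
    refine mul_le_mul_of_nonneg_left ?_ hD.le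
    refine (abs_integral_shift_sub_le (φ := fun s => f (orbitPt a b (t, s))) (hf.comp (hc.comp (by fun_prop)))
      (fun _ => hM _) s₁ s₂ (exp (-(3 * t)) * r)).trans ?_
    rw [abs_mul, abs_of_pos (exp_pos _)]; have : exp (-(3 * t)) ≤ exp (-t) := exp_le_exp.2 (by linarith [ht.1])
    have := mul_le_mul_of_nonneg_left this (by positivity : 0 ≤ 2 * M * |r|); linarith
  · rw [intervalIntegral.integral_const_mul]; exact mul_le_of_le_one_right (by positivity) hexp

lemma uu_eq_conj (r : ℝ) : kb a 0 * phiSL a 0 r * (kb a 0)⁻¹ = uu r := by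
  rw [kb_inv]; apply G_ext_fin <;> simp only [mul_entry] <;> simp [kb, phiSL, uu, mul_comm]

lemma eq_of_gSL_phiSL {μX : Measure X} [IsProbabilityMeasure μX] [SMulInvariantMeasure G X μX] {μ : Measure X}
    [IsProbabilityMeasure μ] (hA : ∀ t, gSL t ∈ stab μ) (hU : ∀ r, phiSL a 0 r ∈ stab μ) : μ = μX := by
  have hm := measurable_smulX (kb a 0)
  have : IsProbabilityMeasure (μ.map fun x => kb a 0 • x) := Measure.isProbabilityMeasure_map hm.aemeasurable
  have hA' : ∀ t, gSL t ∈ stab (μ.map fun x => kb a 0 • x) := fun t => by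
    have := stab_map (h := kb a 0) (hA t); rwa [kb_mul_gSL, mul_inv_cancel_right] at this
  have e := eq_of_gSL_uu (μX := μX) hA' fun r => uu_eq_conj (a := a) r ▸ stab_map (hU r)
  have e' := congrArg (Measure.map fun x => (kb a 0)⁻¹ • x) e
  rw [Measure.map_map (measurable_smulX _) hm, (measurePreserving_smul (kb a 0)⁻¹ μX).map_eq] at e'
  simpa [Function.comp_def] using e'

theorem equidistribution_of_no_escape (h : s₁ < s₂) {μX : Measure X} [IsProbabilityMeasure μX] [SMulInvariantMeasure G X μX]
    (H : ∀ ε : ℝ≥0∞, 0 < ε → ∃ K : Set X, IsCompact K ∧ ∀ T : ℝ, 0 < T → 1 - ε < avgMeasure a b s₁ s₂ T K)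
    (f : C(X, ℝ)) (hfc : HasCompactSupport f) :
    Tendsto (fun T => ∫ x, f x ∂(avgMeasure a b s₁ s₂ T)) atTop (𝓝 (∫ x, f x ∂μX)) := by
  rw [tendsto_iff_ultrafilter]; intro U hU
  set P : ℝ → ProbabilityMeasure X := fun T => ⟨avgMeasure a b s₁ s₂ (max T 1),
    isProbabilityMeasure_avgMeasure h (lt_max_of_lt_right one_pos)⟩ with hP
  have hPe : ∀ᶠ T in (U : Filter ℝ), (P T : Measure X) = avgMeasure a b s₁ s₂ T := by
    filter_upwards [hU (eventually_ge_atTop 1)] with T hT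
    simp [hP, max_eq_left hT]
  have htight : IsTightMeasureSet {x : Measure X | ∃ μ ∈ Set.range P, (μ : Measure X) = x} := by
    rw [isTightMeasureSet_iff_exists_isCompact_measure_compl_le]; intro ε hε; obtain ⟨K, hK, hKT⟩ := H ε hε
    refine ⟨K, hK, ?_⟩
    rintro _ ⟨_, ⟨T, rfl⟩, rfl⟩
    rw [prob_compl_eq_one_sub hK.isClosed.measurableSet, tsub_le_iff_tsub_le]
    exact (hKT _ (lt_max_of_lt_right one_pos)).le
  obtain ⟨μ, -, hμ⟩ := (isCompact_closure_of_isTightMeasureSet htight).ultrafilter_le_nhds (U.map P)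
    (le_principal_iff.2 (mem_map.2 (Filter.Eventually.of_forall fun T => subset_closure ⟨T, rfl⟩)))
  have hlim : ∀ f : X → ℝ, Continuous f → ∀ M, (∀ x, |f x| ≤ M) →
      Tendsto (fun T => ∫ x, f x ∂(avgMeasure a b s₁ s₂ T)) U (𝓝 (∫ x, f x ∂(μ : Measure X))) := fun f hf M hM =>
    (ProbabilityMeasure.tendsto_iff_forall_integral_tendsto.1 hμ (.ofNormedAddCommGroup f hf M hM)).congr'
      (hPe.mono fun T hT => by rw [hT]; rfl)
  have hstab : ∀ g, AsympInv a b s₁ s₂ g → g ∈ stab (μ : Measure X) := by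
    refine fun g hg => mem_stab_of_integral fun f hf hfc => ?_; obtain ⟨M, -, hM⟩ := exists_bound hf hfc
    have h1 := (hlim (fun x => f (g • x)) (hf.comp (continuous_const_smul _)) M fun x => hM _).sub (hlim f hf M hM)
    exact sub_eq_zero.1 (tendsto_nhds_unique h1 ((hg f hf M hM).mono_left hU))
  obtain ⟨M, -, hM⟩ := exists_bound f.continuous hfc
  rw [← eq_of_gSL_phiSL (μX := μX) (μ := μ) (fun t => hstab _ (asympInv_gSL h t)) fun r => hstab _ (asympInv_phiSL h r)]
  exact hlim f f.continuous M hM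

/-- **Theorem (equidistribution of averages).**
Assuming `μ_X` is a `G`-invariant Borel probability measure on `X`, the following are
equivalent: (1) the averages `A_T` get equidistributed in `X` as `T → ∞`;
(2) the family `{A_T}_{T>0}` has no escape of mass; (3) `(a,b) ∉ W₂′`. -/
theorem averages_equidistribution_tfae (a b s₁ s₂ : ℝ) (h : s₁ < s₂)
    (μX : Measure X) [IsProbabilityMeasure μX]
    (hinv : ∀ g : G, Measure.map (fun x => g • x) μX = μX) :
    List.TFAE
      [ (∀ f : C(X, ℝ), HasCompactSupport f →
          Tendsto (fun T => ∫ x, f x ∂(avgMeasure a b s₁ s₂ T)) atTop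
            (𝓝 (∫ x, f x ∂μX))),
        (∀ ε : ℝ≥0∞, 0 < ε → ∃ K : Set X, IsCompact K ∧
          ∀ T : ℝ, 0 < T → 1 - ε < avgMeasure a b s₁ s₂ T K),
        ¬ W2' a b ] := by
  have : SMulInvariantMeasure G X μX := ⟨fun g E hE => by
    rw [← Measure.map_apply (measurable_smulX g) hE, hinv]⟩
  tfae_have 1 → 2 := no_escape_of_equidistribution h
  tfae_have 2 → 1 := equidistribution_of_no_escape h
  tfae_have 2 → 3 := not_W2'_of_no_escape h
  tfae_have 3 → 2 := no_escape_of_not_W2' h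
  tfae_finish
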